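/- (Almost conservation law) Fix s ∈ (1/2, 1), a cutoff η as in the definition of I_N, and ε > 0. Then there exist δ > 0, N₀ ≥ 1 and C > 0 such that: for every N ≥ N₀, every T > 0, and every smooth decaying solution φ of the cubic defocusing NLS on [0,T] × ℝ³, if ‖φ‖_{L⁴_{x,t}([0,T]×ℝ³)} ≤ δ and E(I_N φ(0,·)) ≤ 1, then for all t ∈ [0,T], | E(I_N φ(t,·)) − E(I_N φ(0,·)) | ≤ C N^{−1+ε}. -/

import Mathlib

open MeasureTheory Real Complex Filter
open scoped FourierTransform ContDiff ENNReal

noncomputable section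

abbrev E3 := EuclideanSpace ℝ (Fin 3)

/-- the `i`-th standard basis vector of `ℝ³`. -/
def e3 (i : Fin 3) : E3 := EuclideanSpace.single i (1 : ℝ)

/-- the `i`-th spatial partial derivative. -/
def pd (g : E3 → ℂ) (i : Fin 3) (x : E3) : ℂ := fderiv ℝ g x (e3 i)

/-- the (spatial) Laplacian. -/
def lap (g : E3 → ℂ) (x : E3) : ℂ := ∑ i : Fin 3, fderiv ℝ (fun y => pd g i y) x (e3 i)

/-- the antiderivative `F(z) = ∫₀^z f(s) ds` of `f`. -/
def Fa (f : ℝ → ℝ) (z : ℝ) : ℝ := ∫ s in (0:ℝ)..z, f s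

/-- `u` is a smooth decaying solution of the gNLS `i ∂ₜ u + α Δ u = μ f(|u|²) u`
on `[0,T] × ℝ³`: it is jointly smooth, every time derivative slice is a Schwartz
function of `x`, and the equation holds pointwise on `[0,T] × ℝ³`. -/
structure IsSolution (α μ : ℝ) (f : ℝ → ℝ) (T : ℝ) (u : ℝ → E3 → ℂ) : Prop where
  smooth : ContDiff ℝ ∞ (fun p : ℝ × E3 => u p.1 p.2)
  schwartz : ∀ (k : ℕ) (t : ℝ), ∃ g : SchwartzMap E3 ℂ,
      ∀ x, iteratedDeriv k (fun s => u s x) t = g x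
  eqn : ∀ t ∈ Set.Icc (0:ℝ) T, ∀ x : E3,
      Complex.I * deriv (fun s => u s x) t + (α : ℂ) * lap (u t) x
        = ((μ * f (Complex.normSq (u t x)) : ℝ) : ℂ) * u t x

/-- the `i`-th component of the mass current `Im (conj u ∇u)`. -/
def massCur (g : E3 → ℂ) (i : Fin 3) (x : E3) : ℝ := ((starRingEnd ℂ) (g x) * pd g i x).im

/-- the Morawetz action centered at `y`. -/
def morAction (g : E3 → ℂ) (y : E3) : ℝ :=
  ∫ x : E3, ∑ i : Fin 3, massCur g i x * ((x i - y i) / ‖x - y‖)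

/-- `|∇̸_y g(x)|²`, the squared norm of the angular part of the gradient. -/
def angGradSq (g : E3 → ℂ) (y x : E3) : ℝ :=
  ∑ i : Fin 3, Complex.normSq (pd g i x -
    (((x i - y i) / ‖x - y‖ : ℝ) : ℂ) *
      ∑ j : Fin 3, (((x j - y j) / ‖x - y‖ : ℝ) : ℂ) * pd g j x)

/-- squared homogeneous Sobolev norm `‖g‖²_{Ḣ^σ}`. -/
def sobSq (σ : ℝ) (g : E3 → ℂ) : ℝ := ∫ ξ : E3, ‖ξ‖ ^ (2 * σ) * ‖𝓕 g ξ‖ ^ 2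


/-- `η` is an admissible cutoff for the smoothing operator `I_N` at regularity `s`:
a smooth nonincreasing function on `[0,∞)` with values in `(0,1]`, equal to `1` for
`r ≤ 1` and to `r^{s−1}` for `r ≥ 2`. -/
def IsCutoff (s : ℝ) (η : ℝ → ℝ) : Prop :=
  ContDiff ℝ ∞ η ∧ AntitoneOn η (Set.Ici 0) ∧ (∀ r ≥ (0:ℝ), 0 < η r ∧ η r ≤ 1) ∧
    (∀ r ≤ (1:ℝ), η r = 1) ∧ (∀ r ≥ (2:ℝ), η r = r ^ (s - 1))

/-- the smoothing operator `I_N`, a Fourier multiplier with symbol `η(|ξ|/N)`. -/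
def Iop (η : ℝ → ℝ) (N : ℝ) (g : E3 → ℂ) : E3 → ℂ :=
  fun x => 𝓕⁻ (fun ξ : E3 => (η (‖ξ‖ / N) : ℂ) * 𝓕 g ξ) x

/-- the Littlewood–Paley type projection `P_M`, a Fourier multiplier with symbol `ψ(ξ/M)`. -/
def PM (ψ : E3 → ℝ) (M : ℝ) (g : E3 → ℂ) : E3 → ℂ :=
  fun x => 𝓕⁻ (fun ξ : E3 => (ψ (M⁻¹ • ξ) : ℂ) * 𝓕 g ξ) x

/-- pointwise norm `|∇g(x)|` of the spatial gradient. -/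
def gradNorm (g : E3 → ℂ) (x : E3) : ℝ := Real.sqrt (∑ i : Fin 3, Complex.normSq (pd g i x))

/-- `(q,r)` is a Schrödinger admissible pair for `ℝ^{3+1}`: `q, r ≥ 2` and
`1/q + 3/(2r) = 3/4`. -/
def SAdmissible (q r : ℝ≥0∞) : Prop := 2 ≤ q ∧ 2 ≤ r ∧ 1 / q + 3 / (2 * r) = 3 / 4

/-- the mixed spacetime norm `‖G‖_{L^q_t L^r_x([0,T] × ℝ³)}` (of a scalar function). -/
def LqLr (q r : ℝ≥0∞) (T : ℝ) (G : ℝ → E3 → ℝ) : ℝ≥0∞ :=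
  eLpNorm (fun t => (eLpNorm (G t) r volume).toReal) q (volume.restrict (Set.Icc (0:ℝ) T))

/-- `Z = sup_{(q,r) admissible} ‖∇ I_N φ‖_{L^q_t L^r_x([0,T] × ℝ³)}`. -/
def Znorm (η : ℝ → ℝ) (N T : ℝ) (φ : ℝ → E3 → ℂ) : ℝ≥0∞ :=
  ⨆ (q : ℝ≥0∞) (r : ℝ≥0∞) (_ : SAdmissible q r),
    LqLr q r T (fun t x => gradNorm (Iop η N (φ t)) x)

/-- the modified energy `E(w) = ∫ (1/2)|∇w|² + (1/4)|w|⁴ dx`. -/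
def energyE (w : E3 → ℂ) : ℝ :=
  ∫ x : E3, (1/2) * (∑ i : Fin 3, Complex.normSq (pd w i x)) + (1/4) * ‖w x‖ ^ 4

/-- squared inhomogeneous Sobolev norm `‖g‖²_{H^s}`. -/
def inhomSobSq (s : ℝ) (g : E3 → ℂ) : ℝ :=
  ∫ ξ : E3, (1 + ‖ξ‖ ^ 2) ^ s * ‖𝓕 g ξ‖ ^ 2

open Set (Icc Ioc Ioi Ioo Ici Iic uIcc uIoc)
open ENNReal renaming ofReal → eR
open ENNReal (ofReal_le_ofReal rpow_ne_top_of_nonneg mul_rpow_of_nonneg rpow_add_of_nonneg ofReal_rpow_of_pos ofReal_rpow_of_nonneg)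
open Filter.Eventually renaming of_forall → evt
local notation "cj" => starRingEnd ℂ
local notation "EC" => (E3 → ℂ)
local notation "nmm" => (by norm_num)
local notation "psv" => (by positivity)

/-- the `L^p` norm of a nonnegative function. -/
def Np {α : Type*} [MeasurableSpace α] (p : ℝ) (μ : Measure α) (F : α → ENNReal) : ENNReal :=
  (∫⁻ a, F a ^ p ∂μ) ^ (1 / p)

section NpBasic
variable {α : Type*} [MeasurableSpace α] {μ : Measure α}

lemma Np_mono {p : ℝ} (hp : 0 < p) {F G : α → ENNReal} (h : ∀ x, F x ≤ G x) :
    Np p μ F ≤ Np p μ G := by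
  unfold Np
  have : 0 ≤ 1 / p := by positivity
  gcongr
  exact h _

lemma Np_mono_ae {p : ℝ} (hp : 0 < p) {F G : α → ENNReal} (h : ∀ᵐ x ∂μ, F x ≤ G x) :
    Np p μ F ≤ Np p μ G := by
  unfold Np
  have h1 : 0 ≤ 1 / p := by positivity
  refine ENNReal.rpow_le_rpow (lintegral_mono_ae ?_) h1
  filter_upwards [h] with x hx
  gcongr

lemma Np_congr_ae {p : ℝ} {F G : α → ENNReal} (h : ∀ᵐ x ∂μ, F x = G x) :
    Np p μ F = Np p μ G := by
  unfold Np
  congr 1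
  refine lintegral_congr_ae ?_
  filter_upwards [h] with x hx
  rw [hx]

lemma Np_rpow {p : ℝ} (hp : 0 < p) (F : α → ENNReal) : Np p μ F ^ p = ∫⁻ a, F a ^ p ∂μ := by
  unfold Np
  rw [← ENNReal.rpow_mul, one_div, inv_mul_cancel₀ hp.ne', ENNReal.rpow_one]

lemma Np_const_mul {p : ℝ} (hp : 0 < p) {c : ENNReal} (hc : c ≠ ⊤) (F : α → ENNReal) :
    Np p μ (fun x => c * F x) = c * Np p μ F := by
  unfold Np
  simp_rw [mul_rpow_of_nonneg _ _ hp.le]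
  rw [lintegral_const_mul' _ _ (rpow_ne_top_of_nonneg hp.le hc),
    mul_rpow_of_nonneg _ _ psv, ← ENNReal.rpow_mul, mul_one_div_cancel hp.ne',
    ENNReal.rpow_one]

lemma Np_add_le {p : ℝ} (hp : 1 ≤ p) {F G : α → ENNReal} (hF : AEMeasurable F μ)
    (hG : AEMeasurable G μ) : Np p μ (fun x => F x + G x) ≤ Np p μ F + Np p μ G :=
  ENNReal.lintegral_Lp_add_le hF hG hp

lemma Np_mul_le {p q r : ℝ} (hp : 0 < p) (hq : 0 < q) (h : 1 / r = 1 / p + 1 / q)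
    {F G : α → ENNReal} (hF : AEMeasurable F μ) (hG : AEMeasurable G μ) :
    Np r μ (fun x => F x * G x) ≤ Np p μ F * Np q μ G := by
  have hr : 0 < r := by
    have : 0 < 1 / r := by rw [h]; positivity
    exact one_div_pos.mp this
  have hrp : r < p := by
    apply (one_div_lt_one_div hp hr).mp
    rw [h]; have : 0 < 1 / q := by positivity
    linarith
  exact ENNReal.lintegral_Lp_mul_le_Lq_mul_Lr hr hrp h μ hF hG

lemma Np_mul3_le {p q r l : ℝ} (hp : 0 < p) (hq : 0 < q) (hl : 0 < l)
    (h : 1 / r = 1 / p + 1 / q + 1 / l)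
    {F G H : α → ENNReal} (hF : AEMeasurable F μ) (hG : AEMeasurable G μ) (hH : AEMeasurable H μ) :
    Np r μ (fun x => F x * G x * H x) ≤ Np p μ F * Np q μ G * Np l μ H := by
  have hm : 0 < (1 / p + 1 / q)⁻¹ := by positivity
  calc _ ≤ Np (1 / p + 1 / q)⁻¹ μ (fun x => F x * G x) * Np l μ H :=
        Np_mul_le hm hl (by rw [h]; simp) (hF.mul hG) hH
    _ ≤ _ := by
        gcongr
        exact Np_mul_le hp hq (by simp) hF hG

lemma Np_pow_comp {p θ : ℝ} (hp : 0 < p) (hθ : 0 < θ) (F : α → ENNReal) :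
    Np p μ (fun x => F x ^ θ) = Np (p * θ) μ F ^ θ := by
  unfold Np
  simp_rw [← ENNReal.rpow_mul]
  rw [mul_comm θ p]
  congr 1
  field_simp

/-- log-convexity of `L^p` norms -/
lemma Np_interp {p q r θ : ℝ} (hp : 0 < p) (hq : 0 < q) (hθ : 0 < θ) (hθ1 : θ < 1)
    (h : 1 / r = θ / p + (1 - θ) / q) {F : α → ENNReal} (hF : AEMeasurable F μ) :
    Np r μ F ≤ Np p μ F ^ θ * Np q μ F ^ (1 - θ) := by
  have h1 : 0 < 1 - θ := by linarith
  have e : F = fun x => F x ^ θ * F x ^ (1 - θ) := by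
    funext x
    rw [← rpow_add_of_nonneg _ _ hθ.le h1.le]; simp
  conv_lhs => rw [e]
  calc _ ≤ Np (p / θ) μ (fun x => F x ^ θ) * Np (q / (1 - θ)) μ (fun x => F x ^ (1 - θ)) := by
        refine Np_mul_le psv psv ?_ (hF.pow_const _) (hF.pow_const _)
        rw [h]; simp
    _ = _ := by
        rw [Np_pow_comp psv hθ, Np_pow_comp psv h1,
          div_mul_cancel₀ _ hθ.ne', div_mul_cancel₀ _ h1.ne']

end NpBasic

/-- Minkowski's integral inequality -/
lemma minkowski {α β : Type*} [MeasurableSpace α] [MeasurableSpace β] {μ : Measure α}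
    {ν : Measure β} [SFinite μ] [SigmaFinite ν] {p : ℝ} (hp : 1 ≤ p) {F : α → β → ENNReal}
    (hF : Measurable (Function.uncurry F)) :
    Np p μ (fun x => ∫⁻ z, F x z ∂ν) ≤ ∫⁻ z, Np p μ (fun x => F x z) ∂ν := by
  rcases hp.eq_or_lt with rfl | hp1
  · unfold Np
    simp only [ENNReal.rpow_one, one_div, inv_one]
    rw [lintegral_lintegral_swap]
    exact hF.aemeasurable
  have hp0 : 0 < p := by linarith
  by_cases htop : ∫⁻ z, Np p μ (fun x => F x z) ∂ν = ⊤
  · rw [htop]; exact le_top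
  have hmeas : Measurable (fun z => Np p μ (fun x => F x z)) := by
    unfold Np
    refine Measurable.pow_const ?_ _
    exact Measurable.lintegral_prod_left (f := fun x z => F x z ^ p) (hF.pow_const p)
  refine ENNReal.le_of_forall_pos_le_add fun ε hε _ => ?_
  obtain ⟨h, hpos, hm, hlt⟩ := exists_pos_lintegral_lt_of_sigmaFinite ν
    (ε := (ε : ENNReal)) psv
  set a : β → ENNReal := fun z => Np p μ (fun x => F x z) + h z with ha
  have hma : Measurable a := hmeas.add hm.coe_nnreal_ennreal
  have hA : ∫⁻ z, a z ∂ν ≤ ∫⁻ z, Np p μ (fun x => F x z) ∂ν + ε := by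
    rw [ha, lintegral_add_left hmeas]
    gcongr
  have hAt : ∫⁻ z, a z ∂ν ≠ ⊤ := ne_top_of_le_ne_top (by simp [htop]) hA
  have ha0 : ∀ z, a z ≠ 0 := fun z => by simp [ha, (hpos z).ne']
  have hat : ∀ᵐ z ∂ν, a z ≠ ⊤ := by
    filter_upwards [ae_lt_top hma hAt] with z hz using hz.ne
  refine le_trans ?_ hA
  set q : ℝ := p / (p - 1) with hq
  have hpq : p.HolderConjugate q := by
    rw [Real.holderConjugate_iff]
    refine ⟨hp1, ?_⟩
    rw [hq]; field_simp; ring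
  have hq0 : 0 < q := hpq.symm.pos
  have key : ∀ x, (∫⁻ z, F x z ∂ν) ^ p ≤
      (∫⁻ z, a z ∂ν) ^ (p - 1) * ∫⁻ z, F x z ^ p * a z ^ (1 - p) ∂ν := by
    intro x
    have e1 : ∫⁻ z, F x z ∂ν =
        ∫⁻ z, ((fun z => F x z * a z ^ (-(1 / q))) * (fun z => a z ^ (1 / q))) z ∂ν := by
      refine lintegral_congr_ae ?_
      filter_upwards [hat] with z hz
      simp only [Pi.mul_apply]
      rw [mul_assoc, ← ENNReal.rpow_add _ _ (ha0 z) hz]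
      simp
    have hFx : Measurable (F x) := hF.comp measurable_prodMk_left
    have e2 := ENNReal.lintegral_mul_le_Lp_mul_Lq ν hpq
      (f := fun z => F x z * a z ^ (-(1 / q))) (g := fun z => a z ^ (1 / q))
      ((hFx.mul (hma.pow_const _)).aemeasurable) (hma.pow_const _).aemeasurable
    rw [← e1] at e2
    calc (∫⁻ z, F x z ∂ν) ^ p ≤ _ := ENNReal.rpow_le_rpow e2 hp0.le
      _ = _ := by
        rw [mul_rpow_of_nonneg _ _ hp0.le, ← ENNReal.rpow_mul, ← ENNReal.rpow_mul,
          one_div_mul_cancel hp0.ne', ENNReal.rpow_one, mul_comm]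
        have e3 : 1 / q * p = p - 1 := by rw [hq]; field_simp
        congr 1
        · rw [e3]
          congr 1
          refine lintegral_congr fun z => ?_
          rw [← ENNReal.rpow_mul, one_div_mul_cancel hq0.ne', ENNReal.rpow_one]
        · refine lintegral_congr fun z => ?_
          rw [mul_rpow_of_nonneg _ _ hp0.le, ← ENNReal.rpow_mul]
          congr 2
          rw [neg_mul, e3]; ring
  have key2 : ∫⁻ x, (∫⁻ z, F x z ∂ν) ^ p ∂μ ≤ (∫⁻ z, a z ∂ν) ^ p := by
    calc _ ≤ ∫⁻ x, (∫⁻ z, a z ∂ν) ^ (p - 1) * ∫⁻ z, F x z ^ p * a z ^ (1 - p) ∂ν ∂μ :=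
          lintegral_mono key
      _ = (∫⁻ z, a z ∂ν) ^ (p - 1) * ∫⁻ x, ∫⁻ z, F x z ^ p * a z ^ (1 - p) ∂ν ∂μ := by
          rw [lintegral_const_mul' _ _ (rpow_ne_top_of_nonneg (by linarith) hAt)]
      _ = (∫⁻ z, a z ∂ν) ^ (p - 1) * ∫⁻ z, ∫⁻ x, F x z ^ p * a z ^ (1 - p) ∂μ ∂ν := by
          rw [lintegral_lintegral_swap]
          exact ((hF.pow_const p).mul ((hma.pow_const (1 - p)).comp measurable_snd)).aemeasurable
      _ ≤ (∫⁻ z, a z ∂ν) ^ (p - 1) * ∫⁻ z, a z ∂ν := by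
          gcongr 1
          refine lintegral_mono_ae ?_
          filter_upwards [hat] with z hz
          have hFz : Measurable (fun x => F x z) := hF.comp measurable_prodMk_right
          rw [lintegral_mul_const _ (hFz.pow_const p), ← Np_rpow hp0]
          calc _ ≤ a z ^ p * a z ^ (1 - p) := by
                gcongr
                simp [ha]
            _ = a z := by
                rw [← ENNReal.rpow_add _ _ (ha0 z) hz]; simp
      _ = _ := by
          conv_lhs => rw [← ENNReal.rpow_one (∫⁻ z, a z ∂ν), ← ENNReal.rpow_mul, one_mul]
          rw [← rpow_add_of_nonneg _ _ (by linarith) nmm]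
          simp
  unfold Np
  calc _ ≤ ((∫⁻ z, a z ∂ν) ^ p) ^ (1 / p) := ENNReal.rpow_le_rpow key2 psv
    _ = _ := by rw [← ENNReal.rpow_mul, mul_one_div_cancel hp0.ne', ENNReal.rpow_one]

/-- Young's convolution inequality -/
lemma young {p q r : ℝ} (hp : 1 ≤ p) (hr : 1 ≤ r) (hq : 0 < q) (h : 1 + 1 / q = 1 / p + 1 / r)
    {K F : E3 → ENNReal} (hK : Measurable K) (hF : Measurable F)
    (hKt : Np r volume K ≠ ⊤) (hFt : Np p volume F ≠ ⊤) :
    Np q volume (fun x => ∫⁻ y, K y * F (x - y)) ≤ Np r volume K * Np p volume F := by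
  have hp0 : 0 < p := by linarith
  have hr0 : 0 < r := by linarith
  have hp1 : 0 ≤ 1 - 1 / p := by
    rw [sub_nonneg, div_le_one hp0]; exact hp
  have hr1 : 0 ≤ 1 - 1 / r := by
    rw [sub_nonneg, div_le_one hr0]; exact hr
  have hq1 : 0 ≤ 1 / q := by positivity
  set A := ∫⁻ y, K y ^ r with hA
  set B := ∫⁻ y, F y ^ p with hB
  have hAt : A ≠ ⊤ := by
    rw [hA, ← Np_rpow hr0]; exact rpow_ne_top_of_nonneg hr0.le hKt
  have hBt : B ≠ ⊤ := by
    rw [hB, ← Np_rpow hp0]; exact rpow_ne_top_of_nonneg hp0.le hFt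
  have key : ∀ x, ∫⁻ y, K y * F (x - y) ≤
      (∫⁻ y, K y ^ r * F (x - y) ^ p) ^ (1 / q) * A ^ (1 - 1 / p) * B ^ (1 - 1 / r) := by
    intro x
    have hFx : Measurable (fun y => F (x - y)) := hF.comp (measurable_const.sub measurable_id)
    have := ENNReal.lintegral_prod_norm_pow_le (μ := (volume : Measure E3)) (Finset.univ : Finset (Fin 3))
      (f := ![fun y => K y ^ r * F (x - y) ^ p, fun y => K y ^ r, fun y => F (x - y) ^ p])
      (p := ![1 / q, 1 - 1 / p, 1 - 1 / r]) (by
        intro i _; fin_cases i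
        · exact ((hK.pow_const r).mul (hFx.pow_const p)).aemeasurable
        · exact (hK.pow_const r).aemeasurable
        · exact (hFx.pow_const p).aemeasurable) (by
        rw [Fin.sum_univ_three]; simp only [Matrix.cons_val]
        linarith) (by
        intro i _; fin_cases i
        · exact hq1
        · exact hp1
        · exact hr1)
    simp only [Fin.prod_univ_three, Matrix.cons_val] at this
    have eB : ∫⁻ y, F (x - y) ^ p = B := by
      rw [hB]; exact lintegral_sub_left_eq_self (fun y => F y ^ p) x
    rw [eB] at this
    refine le_trans (le_of_eq ?_) this
    refine lintegral_congr fun y => ?_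
    rw [mul_rpow_of_nonneg _ _ hq1]
    simp only [← ENNReal.rpow_mul]
    have t1 : K y = K y ^ (r * (1 / q)) * K y ^ (r * (1 - 1 / p)) := by
      rw [← rpow_add_of_nonneg _ _ psv psv, ← mul_add,
        show 1 / q + (1 - 1 / p) = 1 / r by linarith, mul_one_div_cancel hr0.ne', ENNReal.rpow_one]
    have t2 : F (x - y) = F (x - y) ^ (p * (1 / q)) * F (x - y) ^ (p * (1 - 1 / r)) := by
      rw [← rpow_add_of_nonneg _ _ psv psv, ← mul_add,
        show 1 / q + (1 - 1 / r) = 1 / p by linarith, mul_one_div_cancel hp0.ne', ENNReal.rpow_one]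
    conv_lhs => rw [t1, t2]
    ring
  have key2 : ∫⁻ x, (∫⁻ y, K y * F (x - y)) ^ q ≤ A ^ (q / r) * B ^ (q / p) := by
    calc _ ≤ ∫⁻ x, (A ^ (1 - 1 / p) * B ^ (1 - 1 / r)) ^ q * (∫⁻ y, K y ^ r * F (x - y) ^ p) := by
          refine lintegral_mono fun x => ?_
          refine (ENNReal.rpow_le_rpow (key x) hq.le).trans (le_of_eq ?_)
          rw [mul_assoc, mul_rpow_of_nonneg _ _ hq.le, ← ENNReal.rpow_mul,
            one_div_mul_cancel hq.ne', ENNReal.rpow_one, mul_comm]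
      _ = (A ^ (1 - 1 / p) * B ^ (1 - 1 / r)) ^ q * (A * B) := by
          rw [lintegral_const_mul']
          · congr 1
            rw [lintegral_lintegral_swap]
            · have : ∀ y, ∫⁻ x, K y ^ r * F (x - y) ^ p = K y ^ r * B := by
                intro y
                have hm : Measurable (fun x : E3 => F (x - y) ^ p) :=
                  (hF.comp (measurable_id.sub_const y)).pow_const p
                rw [lintegral_const_mul _ hm]
                congr 1
                exact lintegral_sub_right_eq_self (fun y => F y ^ p) y
              simp_rw [this]
              rw [lintegral_mul_const _ (hK.pow_const r)]
            · exact (((hK.comp measurable_snd).pow_const r).mul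
                ((hF.comp (measurable_fst.sub measurable_snd)).pow_const p)).aemeasurable
          · exact rpow_ne_top_of_nonneg hq.le (ENNReal.mul_ne_top
              (rpow_ne_top_of_nonneg hp1 hAt) (rpow_ne_top_of_nonneg hr1 hBt))
      _ = _ := by
          rw [mul_rpow_of_nonneg _ _ hq.le, ← ENNReal.rpow_mul, ← ENNReal.rpow_mul]
          have a1 : A ^ ((1 - 1 / p) * q) * A = A ^ (q / r) := by
            nth_rewrite 2 [← ENNReal.rpow_one A]
            rw [← rpow_add_of_nonneg _ _ psv nmm]
            congr 1
            rw [show 1 - 1 / p = 1 / r - 1 / q by linarith]; field_simp; ring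
          have a2 : B ^ ((1 - 1 / r) * q) * B = B ^ (q / p) := by
            nth_rewrite 2 [← ENNReal.rpow_one B]
            rw [← rpow_add_of_nonneg _ _ psv nmm]
            congr 1
            rw [show 1 - 1 / r = 1 / p - 1 / q by linarith]; field_simp; ring
          rw [← a1, ← a2]; ring
  unfold Np
  refine (ENNReal.rpow_le_rpow key2 psv).trans (le_of_eq ?_)
  rw [mul_rpow_of_nonneg _ _ psv, ← ENNReal.rpow_mul, ← ENNReal.rpow_mul]
  congr 2
  · field_simp
  · field_simp

/-- the kernel `|t|^{-2/3}` -/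
def k23 (t : ℝ) : ENNReal := eR (|t| ^ (-(2/3) : ℝ))

lemma measurable_k23 : Measurable k23 := by unfold k23; fun_prop

lemma k23_neg (t : ℝ) : k23 (-t) = k23 t := by simp [k23]

lemma lintegral_rpow_Ioc (a : ℝ) (ha : 0 ≤ a) (r : ℝ) (hr : -1 < r) :
    ∫⁻ t in Ioc 0 a, eR (t ^ r) = eR (a ^ (r + 1) / (r + 1)) := by
  rw [← ofReal_integral_eq_lintegral_ofReal]
  · rw [← intervalIntegral.integral_of_le ha, integral_rpow (Or.inl hr)]
    rw [Real.zero_rpow (by linarith), sub_zero]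
  · have := (intervalIntegral.intervalIntegrable_rpow' (a := 0) (b := a) hr)
    rwa [intervalIntegrable_iff_integrableOn_Ioc_of_le ha] at this
  · filter_upwards [ae_restrict_mem measurableSet_Ioc] with t ht
    exact Real.rpow_nonneg ht.1.le _

lemma k23_near (R : ℝ) (hR : 0 ≤ R) : ∫⁻ t in Icc (-R) R, k23 t ≤ eR (6 * R ^ (1/3 : ℝ)) := by
  have h1 : ∫⁻ t in Ioc 0 R, k23 t = eR (3 * R ^ (1/3 : ℝ)) := by
    rw [show (3 * R ^ (1/3 : ℝ)) = R ^ (-(2/3) + 1 : ℝ) / (-(2/3) + 1) by norm_num; ring,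
      ← lintegral_rpow_Ioc R hR _ nmm]
    refine setLIntegral_congr_fun measurableSet_Ioc fun t ht => ?_
    simp only [k23]; rw [abs_of_pos ht.1]
  have h2 : ∫⁻ t in Set.Ico (-R) 0, k23 t = eR (3 * R ^ (1/3 : ℝ)) := by
    rw [← h1, ← lintegral_indicator measurableSet_Ico, ← lintegral_indicator measurableSet_Ioc,
      ← lintegral_neg_eq_self]
    congr 1; funext t
    simp only [Set.indicator, Set.mem_Ico, Set.mem_Ioc, k23_neg]
    congr 1
    apply propext; constructor <;> rintro ⟨a, b⟩ <;> constructor <;> linarith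
  have hsub : Icc (-R) R ⊆ (Set.Ico (-R) 0 ∪ {0}) ∪ Ioc 0 R := by
    intro t ht
    rcases lt_trichotomy t 0 with h | h | h
    · left; left; exact ⟨ht.1, h⟩
    · left; right; exact h
    · right; exact ⟨h, ht.2⟩
  calc _ ≤ ∫⁻ t in (Set.Ico (-R) 0 ∪ {0}) ∪ Ioc 0 R, k23 t := lintegral_mono_set hsub
    _ ≤ (∫⁻ t in (Set.Ico (-R) 0 ∪ {0}), k23 t) + ∫⁻ t in Ioc 0 R, k23 t := lintegral_union_le _ _ _
    _ ≤ ((∫⁻ t in Set.Ico (-R) 0, k23 t) + ∫⁻ t in {0}, k23 t) + ∫⁻ t in Ioc 0 R, k23 t := by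
        gcongr; exact lintegral_union_le _ _ _
    _ = _ := by
        rw [h1, h2, Measure.restrict_singleton]
        simp only [volume_singleton, zero_smul, lintegral_zero_measure, add_zero]
        rw [← ENNReal.ofReal_add psv psv]
        congr 1; ring

lemma k23_set (A : Set ℝ) (hA : MeasurableSet A) (t : ℝ) :
    ∫⁻ s in A, k23 (t - s) ≤ 7 * volume A ^ (1/3 : ℝ) := by
  by_cases htop : volume A = ⊤
  · rw [htop]; simp
  by_cases h0 : volume A = 0
  · rw [setLIntegral_measure_zero _ _ h0]; simp
  set R := (volume A).toReal with hRdef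
  have hR : 0 < R := ENNReal.toReal_pos h0 htop
  have hAR : volume A = eR R := (ENNReal.ofReal_toReal htop).symm
  set J : Set ℝ := {s | t - s ∈ Icc (-R) R}
  have hJ : MeasurableSet J := (measurable_const.sub measurable_id) measurableSet_Icc
  have h1 : ∫⁻ s in J, k23 (t - s) ≤ eR (6 * R ^ (1/3 : ℝ)) := by
    refine le_trans (le_of_eq ?_) (k23_near R hR.le)
    rw [← lintegral_indicator hJ, ← lintegral_indicator measurableSet_Icc,
      ← lintegral_sub_left_eq_self ((Icc (-R) R).indicator k23) t]
    rfl
  have h2 : ∫⁻ s in A \ J, k23 (t - s) ≤ eR (R ^ (1/3 : ℝ)) := by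
    calc _ ≤ ∫⁻ s in A \ J, eR (R ^ (-(2/3) : ℝ)) := by
          refine setLIntegral_mono' (hA.diff hJ) fun s hs => ?_
          unfold k23
          refine ofReal_le_ofReal ?_
          have : R ≤ |t - s| := by
            by_contra hc
            exact hs.2 ⟨(abs_le.mp (not_le.mp hc).le).1, (abs_le.mp (not_le.mp hc).le).2⟩
          exact Real.rpow_le_rpow_of_nonpos hR this nmm
      _ ≤ eR (R ^ (-(2/3) : ℝ)) * eR R := by
          rw [setLIntegral_const, ← hAR]
          gcongr; exact Set.sdiff_subset
      _ = _ := by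
          rw [← ENNReal.ofReal_mul psv]
          congr 1
          nth_rewrite 2 [← Real.rpow_one R]
          rw [← Real.rpow_add hR]; norm_num
  have hsub : A ⊆ J ∪ (A \ J) := by
    intro x hx; by_cases h : x ∈ J
    · exact Or.inl h
    · exact Or.inr ⟨hx, h⟩
  calc _ ≤ ∫⁻ s in J ∪ (A \ J), k23 (t - s) := lintegral_mono_set hsub
    _ ≤ _ := lintegral_union_le _ _ _
    _ ≤ _ := add_le_add h1 h2
    _ = _ := by
        rw [← ENNReal.ofReal_add psv psv, hAR,
          ofReal_rpow_of_pos hR, show (7 : ENNReal) = eR 7 by norm_num,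
          ← ENNReal.ofReal_mul nmm]
        congr 1; ring

lemma k23_sets (A B : Set ℝ) (hA : MeasurableSet A) (hB : MeasurableSet B) :
    ∫⁻ t, ∫⁻ s, A.indicator 1 t * k23 (t - s) * B.indicator 1 s ≤
      7 * (volume A * volume B ^ (1/3 : ℝ)) := by
  calc _ ≤ ∫⁻ t, A.indicator 1 t * (7 * volume B ^ (1/3 : ℝ)) := by
        refine lintegral_mono fun t => ?_
        simp_rw [mul_assoc]
        rw [lintegral_const_mul' _ _ (by by_cases h : t ∈ A <;> simp [h])]
        gcongr
        refine le_trans (le_of_eq ?_) (k23_set B hB t)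
        rw [← lintegral_indicator hB]
        congr 1; funext s
        by_cases h : s ∈ B <;> simp [h]
    _ = _ := by
        rw [lintegral_mul_const _ (measurable_one.indicator hA), lintegral_indicator_one hA]
        ring

lemma layer (x : ℝ) : eR x =
    ∫⁻ a in Ioi (0:ℝ), (Ioi a).indicator (1 : ℝ → ENNReal) x := by
  have : ∀ a : ℝ, (Ioi a).indicator (1 : ℝ → ENNReal) x = (Set.Iio x).indicator 1 a := by
    intro a; simp [Set.indicator]
  rw [lintegral_congr this, lintegral_indicator_one measurableSet_Iio, Measure.restrict_apply measurableSet_Iio,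
    Set.inter_comm, Set.Ioi_inter_Iio, Real.volume_Ioo, sub_zero]

lemma hls_half (u v : ℝ → ENNReal) (hu : Measurable u) (hv : Measurable v)
    (hU : ∫⁻ a in Ioi (0:ℝ), u a * eR (a ^ (1/2 : ℝ)) ≤ 1)
    (hV : ∫⁻ a in Ioi (0:ℝ), v a * eR (a ^ (1/2 : ℝ)) ≤ 1) :
    ∫⁻ a in Ioi (0:ℝ), u a * ∫⁻ b in Ioc 0 a, v b ^ (1/3 : ℝ) ≤ 2 := by
  have key : ∀ a : ℝ, 0 < a → ∫⁻ b in Ioc 0 a, v b ^ (1/3 : ℝ) ≤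
      2 * eR (a ^ (1/2 : ℝ)) := by
    intro a ha
    have hpq : (3:ℝ).HolderConjugate (3/2) := by
      rw [Real.holderConjugate_iff]; norm_num
    have := ENNReal.lintegral_mul_le_Lp_mul_Lq (volume.restrict (Ioc 0 a)) hpq
      (f := fun b => v b ^ (1/3 : ℝ) * eR (b ^ (1/6 : ℝ)))
      (g := fun b => eR (b ^ (-(1/6) : ℝ)))
      (by fun_prop) (by fun_prop)
    have e0 : ∫⁻ b in Ioc 0 a, v b ^ (1/3 : ℝ) = ∫⁻ b in Ioc 0 a,
        ((fun b => v b ^ (1/3 : ℝ) * eR (b ^ (1/6 : ℝ))) *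
          (fun b => eR (b ^ (-(1/6) : ℝ)))) b := by
      refine setLIntegral_congr_fun measurableSet_Ioc fun b hb => ?_
      simp only [Pi.mul_apply]
      rw [mul_assoc, ← ENNReal.ofReal_mul (Real.rpow_nonneg hb.1.le _), ← Real.rpow_add hb.1]
      simp
    have e1 : ∫⁻ b in Ioc 0 a, (v b ^ (1/3 : ℝ) * eR (b ^ (1/6 : ℝ))) ^ (3:ℝ) ≤ 1 := by
      calc _ = ∫⁻ b in Ioc 0 a, v b * eR (b ^ (1/2 : ℝ)) := by
            refine setLIntegral_congr_fun measurableSet_Ioc fun b hb => ?_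
            rw [mul_rpow_of_nonneg _ _ nmm, ← ENNReal.rpow_mul,
              ofReal_rpow_of_pos (Real.rpow_pos_of_pos hb.1 _), ← Real.rpow_mul hb.1.le]
            norm_num
        _ ≤ _ := (lintegral_mono_set Set.Ioc_subset_Ioi_self).trans hV
    have e2 : ∫⁻ b in Ioc 0 a, (eR (b ^ (-(1/6) : ℝ))) ^ (3/2 : ℝ) =
        eR (a ^ (3/4 : ℝ) / (3/4)) := by
      rw [show (a ^ (3/4 : ℝ) / (3/4)) = a ^ (-(1/4) + 1 : ℝ) / (-(1/4) + 1) by norm_num,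
        ← lintegral_rpow_Ioc a ha.le _ nmm]
      refine setLIntegral_congr_fun measurableSet_Ioc fun b hb => ?_
      rw [ofReal_rpow_of_pos (Real.rpow_pos_of_pos hb.1 _), ← Real.rpow_mul hb.1.le]
      norm_num
    rw [← e0, e2] at this
    refine this.trans ?_
    calc _ ≤ 1 * eR (a ^ (3/4 : ℝ) / (3/4)) ^ (1 / (3/2) : ℝ) := by
          gcongr
          calc _ ≤ (1 : ENNReal) ^ (1/3 : ℝ) := ENNReal.rpow_le_rpow e1 nmm
            _ = 1 := by simp
      _ ≤ _ := by
          rw [one_mul, ofReal_rpow_of_pos psv,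
            show (2 : ENNReal) = eR 2 by norm_num, ← ENNReal.ofReal_mul nmm]
          refine ofReal_le_ofReal ?_
          rw [Real.div_rpow psv nmm, ← Real.rpow_mul ha.le,
            div_eq_inv_mul, show (3/4 * (1 / (3/2)) : ℝ) = 1/2 by norm_num]
          gcongr
          rw [← Real.inv_rpow nmm]
          calc ((3/4 : ℝ)⁻¹) ^ (1 / (3/2) : ℝ) ≤ (2:ℝ) ^ (1 / (3/2) : ℝ) := by gcongr; norm_num
            _ ≤ 2 ^ (1:ℝ) := by gcongr <;> norm_num
            _ = 2 := by norm_num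
  calc _ ≤ ∫⁻ a in Ioi (0:ℝ), 2 * (u a * eR (a ^ (1/2 : ℝ))) := by
        refine setLIntegral_mono' measurableSet_Ioi fun a ha => ?_
        rw [mul_left_comm]
        gcongr
        exact key a ha
    _ ≤ 2 * 1 := by
        rw [lintegral_const_mul' _ _ nmm]
        gcongr
    _ = 2 := by norm_num

lemma hls_norm (f g : ℝ → ℝ) (hf : Measurable f) (hg : Measurable g) (hf0 : ∀ t, 0 ≤ f t)
    (hg0 : ∀ t, 0 ≤ g t) (hF : ∫⁻ t, eR (f t ^ (3/2 : ℝ)) ≤ 1)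
    (hG : ∫⁻ t, eR (g t ^ (3/2 : ℝ)) ≤ 1) :
    ∫⁻ t, ∫⁻ s, eR (f t) * k23 (t - s) * eR (g s) ≤ 28 := by
  set u : ℝ → ENNReal := fun a => volume {t | a < f t} with hu
  set v : ℝ → ENNReal := fun a => volume {t | a < g t} with hv
  have hum : Measurable u := by
    refine Antitone.measurable fun a b hab => measure_mono fun t ht => lt_of_le_of_lt hab ht
  have hvm : Measurable v := by
    refine Antitone.measurable fun a b hab => measure_mono fun t ht => lt_of_le_of_lt hab ht
  have hU : ∫⁻ a in Ioi (0:ℝ), u a * eR (a ^ (1/2 : ℝ)) ≤ 1 := by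
    have := lintegral_rpow_eq_lintegral_meas_lt_mul volume (evt hf0) hf.aemeasurable
      (p := 3/2) nmm
    rw [this] at hF
    norm_num at hF
    norm_num
    refine le_trans ?_ hF
    conv_lhs => rw [← one_mul (lintegral _ _)]
    gcongr
    rw [show (1:ENNReal) = eR 1 by simp]
    exact ofReal_le_ofReal nmm
  have hV : ∫⁻ a in Ioi (0:ℝ), v a * eR (a ^ (1/2 : ℝ)) ≤ 1 := by
    have := lintegral_rpow_eq_lintegral_meas_lt_mul volume (evt hg0) hg.aemeasurable
      (p := 3/2) nmm
    rw [this] at hG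
    norm_num at hG
    norm_num
    refine le_trans ?_ hG
    conv_lhs => rw [← one_mul (lintegral _ _)]
    gcongr
    rw [show (1:ENNReal) = eR 1 by simp]
    exact ofReal_le_ofReal nmm
  have mf : ∀ a : ℝ, MeasurableSet {t | a < f t} := fun a => measurableSet_lt measurable_const hf
  have mg : ∀ a : ℝ, MeasurableSet {t | a < g t} := fun a => measurableSet_lt measurable_const hg
  -- the form for level sets
  set Q : ℝ → ℝ → ENNReal := fun a b => ∫⁻ t, ∫⁻ s, {t | a < f t}.indicator 1 t * k23 (t - s) *
    {t | b < g t}.indicator 1 s with hQ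
  have Q1 : ∀ a b, Q a b ≤ 7 * (u a * v b ^ (1/3 : ℝ)) := fun a b => k23_sets _ _ (mf a) (mg b)
  have Q2 : ∀ a b, Q a b ≤ 7 * (v b * u a ^ (1/3 : ℝ)) := by
    intro a b
    refine le_trans (le_of_eq ?_) (k23_sets _ _ (mg b) (mf a))
    rw [hQ]
    simp only
    rw [lintegral_lintegral_swap]
    · congr 1; funext s; congr 1; funext t
      rw [← k23_neg, neg_sub]; ring
    · refine Measurable.aemeasurable ?_
      refine Measurable.mul (Measurable.mul ?_ ?_) ?_
      · exact (measurable_one.indicator (mf a)).comp measurable_fst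
      · exact measurable_k23.comp (measurable_fst.sub measurable_snd)
      · exact (measurable_one.indicator (mg b)).comp measurable_snd
  have hid : ∀ x a : ℝ, (Ioi a).indicator (1 : ℝ → ENNReal) x = if a < x then 1 else 0 := by
    intro x a; simp [Set.indicator]
  have mi : Measurable (fun p : ℝ × ℝ => if p.1 < p.2 then (1 : ENNReal) else 0) :=
    Measurable.ite (measurableSet_lt measurable_fst measurable_snd) measurable_const measurable_const
  have hmain : ∫⁻ t, ∫⁻ s, eR (f t) * k23 (t - s) * eR (g s) =
      ∫⁻ a in Ioi (0:ℝ), ∫⁻ b in Ioi (0:ℝ), Q a b := by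
    have s1 : ∀ t s, eR (f t) * k23 (t - s) * eR (g s) =
        ∫⁻ a in Ioi (0:ℝ), ∫⁻ b in Ioi (0:ℝ), (if a < f t then (1:ENNReal) else 0) * k23 (t - s) *
          (if b < g s then (1:ENNReal) else 0) := by
      intro t s
      simp_rw [layer (f t), layer (g s), hid]
      have : ∀ a : ℝ, ∫⁻ b in Ioi (0:ℝ), (if a < f t then (1:ENNReal) else 0) * k23 (t - s) *
          (if b < g s then (1:ENNReal) else 0) = (if a < f t then (1:ENNReal) else 0) * (k23 (t - s) *
          ∫⁻ b in Ioi (0:ℝ), (if b < g s then (1:ENNReal) else 0)) := by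
        intro a
        have hm : Measurable (fun b : ℝ => if b < g s then (1:ENNReal) else 0) :=
          mi.comp (measurable_id.prodMk measurable_const)
        rw [lintegral_const_mul _ hm, mul_assoc]
      simp_rw [this]
      have hm : Measurable (fun a : ℝ => if a < f t then (1:ENNReal) else 0) :=
        mi.comp (measurable_id.prodMk measurable_const)
      rw [lintegral_mul_const _ hm, mul_assoc]
    simp_rw [s1]
    have hm4 : Measurable (fun q : (ℝ × ℝ) × (ℝ × ℝ) =>
        (if q.2.1 < f q.1.1 then (1:ENNReal) else 0) * k23 (q.1.1 - q.1.2) *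
          (if q.2.2 < g q.1.2 then (1:ENNReal) else 0)) := by
      refine Measurable.mul (Measurable.mul ?_ ?_) ?_
      · exact mi.comp ((measurable_fst.comp measurable_snd).prodMk
          (hf.comp (measurable_fst.comp measurable_fst)))
      · exact measurable_k23.comp ((measurable_fst.comp measurable_fst).sub
          (measurable_snd.comp measurable_fst))
      · exact mi.comp ((measurable_snd.comp measurable_snd).prodMk
          (hg.comp (measurable_snd.comp measurable_fst)))
    calc _ = ∫⁻ p : ℝ × ℝ, ∫⁻ q, (if q.1 < f p.1 then (1:ENNReal) else 0) * k23 (p.1 - p.2) *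
          (if q.2 < g p.2 then (1:ENNReal) else 0)
          ∂((volume.restrict (Ioi (0:ℝ))).prod (volume.restrict (Ioi (0:ℝ)))) ∂(volume.prod volume) := by
          rw [lintegral_prod]
          · congr 1; funext t; congr 1; funext s
            rw [lintegral_prod]
            exact (hm4.comp (measurable_prodMk_left (x := (t, s)))).aemeasurable
          · exact (Measurable.lintegral_prod_right hm4).aemeasurable
      _ = _ := by
          rw [lintegral_lintegral_swap hm4.aemeasurable, lintegral_prod]
          · congr 1; funext a; congr 1; funext b
            rw [lintegral_prod]
            · simp only [hQ, Set.indicator]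
              rfl
            · exact (hm4.comp (measurable_prodMk_right (y := (a, b)))).aemeasurable
          · exact (Measurable.lintegral_prod_left hm4).aemeasurable
  rw [hmain]
  have msr : ∀ a : ℝ, MeasurableSet {b : ℝ | b ≤ a} := fun a => measurableSet_Iic
  have pw : ∀ a b : ℝ, Q a b ≤ 7 * ((Iic a).indicator (fun b => u a * v b ^ (1/3 : ℝ)) b) +
      7 * ((Iic b).indicator (fun a => v b * u a ^ (1/3 : ℝ)) a) := by
    intro a b
    rcases le_total b a with h | h
    · refine le_add_right ?_
      rw [Set.indicator_of_mem (show b ∈ Iic a from h)]; exact Q1 a b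
    · refine le_add_left ?_
      rw [Set.indicator_of_mem (show a ∈ Iic b from h)]; exact Q2 a b
  have mA : Measurable (fun p : ℝ × ℝ => (Iic p.1).indicator (fun b => u p.1 * v b ^ (1/3 : ℝ)) p.2) := by
    simp only [Set.indicator, Set.mem_Iic]
    refine Measurable.ite (measurableSet_le measurable_snd measurable_fst) ?_ measurable_const
    exact (hum.comp measurable_fst).mul ((hvm.comp measurable_snd).pow_const _)
  have mB : Measurable (fun p : ℝ × ℝ => (Iic p.1).indicator (fun b => v p.1 * u b ^ (1/3 : ℝ)) p.2) := by
    simp only [Set.indicator, Set.mem_Iic]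
    refine Measurable.ite (measurableSet_le measurable_snd measurable_fst) ?_ measurable_const
    exact (hvm.comp measurable_fst).mul ((hum.comp measurable_snd).pow_const _)
  have half : ∀ (u v : ℝ → ENNReal) (a : ℝ), Measurable v →
      ∫⁻ b in Ioi (0:ℝ), (Iic a).indicator (fun b => u a * v b ^ (1/3 : ℝ)) b =
      u a * ∫⁻ b in Ioc 0 a, v b ^ (1/3 : ℝ) := by
    intro u v a hv
    rw [lintegral_indicator measurableSet_Iic, Measure.restrict_restrict measurableSet_Iic,
      Set.inter_comm, Set.Ioi_inter_Iic, lintegral_const_mul _ (hv.pow_const _)]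
  calc _ ≤ ∫⁻ a in Ioi (0:ℝ), ∫⁻ b in Ioi (0:ℝ),
        (7 * ((Iic a).indicator (fun b => u a * v b ^ (1/3 : ℝ)) b) +
      7 * ((Iic b).indicator (fun a => v b * u a ^ (1/3 : ℝ)) a)) :=
        lintegral_mono fun a => lintegral_mono fun b => pw a b
    _ = 7 * (∫⁻ a in Ioi (0:ℝ), u a * ∫⁻ b in Ioc 0 a, v b ^ (1/3 : ℝ)) +
        7 * (∫⁻ b in Ioi (0:ℝ), v b * ∫⁻ a in Ioc 0 b, u a ^ (1/3 : ℝ)) := by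
        have : ∀ a : ℝ, ∫⁻ b in Ioi (0:ℝ),
          (7 * ((Iic a).indicator (fun b => u a * v b ^ (1/3 : ℝ)) b) +
          7 * ((Iic b).indicator (fun a => v b * u a ^ (1/3 : ℝ)) a)) =
          7 * (u a * ∫⁻ b in Ioc 0 a, v b ^ (1/3 : ℝ)) + 7 * ∫⁻ b in Ioi (0:ℝ),
          ((Iic b).indicator (fun a => v b * u a ^ (1/3 : ℝ)) a) := by
          intro a
          rw [lintegral_add_left, lintegral_const_mul' _ _ nmm,
            lintegral_const_mul' _ _ nmm, half u v a hvm]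
          exact (mA.comp (measurable_prodMk_left (x := a))).const_mul _
        simp_rw [this]
        have mm : Measurable (fun a : ℝ => u a * ∫⁻ b in Ioc 0 a, v b ^ (1/3 : ℝ)) := by
          have := mA.lintegral_prod_right' (ν := volume.restrict (Ioi (0:ℝ)))
          have e : (fun a : ℝ => u a * ∫⁻ b in Ioc 0 a, v b ^ (1/3 : ℝ)) = _ :=
            funext fun a => (half u v a hvm).symm
          rw [e]; exact this
        rw [lintegral_add_left (mm.const_mul _), lintegral_const_mul' _ _ nmm,
            lintegral_const_mul' _ _ nmm, lintegral_lintegral_swap]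
        · congr 2
          refine lintegral_congr fun b => ?_
          exact half v u b hum
        · exact (mB.comp measurable_swap).aemeasurable
    _ ≤ 7 * 2 + 7 * 2 := by
        gcongr
        · exact hls_half u v hum hvm hU hV
        · exact hls_half v u hvm hum hV hU
    _ = 28 := by norm_num

/-- one-dimensional Hardy-Littlewood-Sobolev inequality -/
lemma hls (f g : ℝ → ENNReal) (hf : Measurable f) (hg : Measurable g) (hft : ∀ t, f t ≠ ⊤)
    (hgt : ∀ t, g t ≠ ⊤) (hF : Np (3/2) volume f ≠ ⊤) (hG : Np (3/2) volume g ≠ ⊤) :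
    ∫⁻ t, ∫⁻ s, f t * k23 (t - s) * g s ≤ 28 * Np (3/2) volume f * Np (3/2) volume g := by
  set P := Np (3/2) volume f with hP
  set Q := Np (3/2) volume g with hQ
  have zero : ∀ h : ℝ → ENNReal, Measurable h → Np (3/2) volume h = 0 → ∀ᵐ t, h t = 0 := by
    intro h hh h0
    unfold Np at h0
    rw [ENNReal.rpow_eq_zero_iff_of_pos nmm, lintegral_eq_zero_iff (hh.pow_const _)] at h0
    filter_upwards [h0] with t ht
    rcases (ENNReal.rpow_eq_zero_iff).mp ht with h | h
    · exact h.1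
    · linarith [h.2]
  by_cases hP0 : P = 0
  · have : ∫⁻ t, ∫⁻ s, f t * k23 (t - s) * g s = ∫⁻ _ : ℝ, 0 := by
      refine lintegral_congr_ae ?_
      filter_upwards [zero f hf hP0] with t ht
      simp [ht]
    simp [this]
  by_cases hQ0 : Q = 0
  · have : ∀ t, ∫⁻ s, f t * k23 (t - s) * g s = ∫⁻ _ : ℝ, 0 := by
      intro t
      refine lintegral_congr_ae ?_
      filter_upwards [zero g hg hQ0] with t ht
      simp [ht]
    simp [this]
  have nrm : ∀ (h : ℝ → ENNReal) (_ : ∀ t, h t ≠ ⊤) (h0 : Np (3/2) volume h ≠ 0)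
      (h1 : Np (3/2) volume h ≠ ⊤),
      ∫⁻ t, eR ((h t / Np (3/2) volume h).toReal ^ (3/2 : ℝ)) ≤ 1 := by
    intro h hm h0 h1
    have : ∀ t, eR ((h t / Np (3/2) volume h).toReal ^ (3/2 : ℝ)) =
        (Np (3/2) volume h ^ (3/2:ℝ))⁻¹ * h t ^ (3/2 : ℝ) := by
      intro t
      rw [ENNReal.toReal_rpow, ENNReal.ofReal_toReal, ENNReal.div_rpow_of_nonneg _ _ nmm,
        ENNReal.div_eq_inv_mul]
      exact rpow_ne_top_of_nonneg nmm (ENNReal.div_ne_top (hm t) h0)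
    simp_rw [this]
    rw [lintegral_const_mul', ← Np_rpow nmm]
    · exact ENNReal.inv_mul_le_one _
    · rw [ENNReal.inv_ne_top]
      exact (ENNReal.rpow_pos (pos_iff_ne_zero.mpr h0) h1).ne'
  have := hls_norm (fun t => (f t / P).toReal) (fun t => (g t / Q).toReal)
    (hf.div_const _).ennreal_toReal (hg.div_const _).ennreal_toReal (fun _ => ENNReal.toReal_nonneg)
    (fun _ => ENNReal.toReal_nonneg) (nrm f hft hP0 hF) (nrm g hgt hQ0 hG)
  have e : ∀ t s, f t * k23 (t - s) * g s = P * Q * (eR (f t / P).toReal * k23 (t - s) *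
      eR (g s / Q).toReal) := by
    intro t s
    rw [ENNReal.ofReal_toReal (ENNReal.div_ne_top (hft t) hP0),
      ENNReal.ofReal_toReal (ENNReal.div_ne_top (hgt s) hQ0)]
    calc f t * k23 (t - s) * g s = (P * (f t / P)) * k23 (t - s) * (Q * (g s / Q)) := by
          rw [ENNReal.mul_div_cancel hP0 hF, ENNReal.mul_div_cancel hQ0 hG]
      _ = _ := by ring
  simp_rw [e]
  have hPQ : P * Q ≠ ⊤ := ENNReal.mul_ne_top hF hG
  simp_rw [lintegral_const_mul' _ _ hPQ]
  calc _ ≤ P * Q * 28 := by gcongr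
    _ = _ := by ring

lemma fourier_flip {f g : EC} (hf : Integrable f) (hg : Integrable g) :
    ∫ ξ, 𝓕 f ξ * g ξ = ∫ x, f x * 𝓕 g x := by
  have := VectorFourier.integral_fourierIntegral_smul_eq_flip (μ := volume) (ν := volume)
    (L := innerₗ E3) Real.continuous_fourierChar continuous_inner hf hg
  rw [flip_innerₗ] at this
  exact this

lemma fourierInv_flip {f g : EC} (hf : Integrable f) (hg : Integrable g) :
    ∫ ξ, 𝓕⁻ f ξ * g ξ = ∫ x, f x * 𝓕⁻ g x := by
  have h1 : ∀ ξ, 𝓕⁻ f ξ = 𝓕 (fun x => f (-x)) ξ := fun ξ => by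
    rw [fourierInv_eq_fourier_comp_neg]
  have h2 : ∀ ξ, 𝓕⁻ g ξ = 𝓕 g (-ξ) := fun ξ => by rw [fourierInv_eq_fourier_neg]
  simp_rw [h1, h2]
  rw [fourier_flip hf.comp_neg hg, ← integral_neg_eq_self]
  simp

lemma continuous_fourier {f : EC} (hf : Integrable f) : Continuous (𝓕 f) :=
  VectorFourier.fourierIntegral_continuous Real.continuous_fourierChar
    (by exact continuous_inner) hf

lemma continuous_fourierInv {f : EC} (hf : Integrable f) : Continuous (𝓕⁻ f) := by
  have h2 : 𝓕⁻ f = fun ξ => 𝓕 f (-ξ) := by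
    ext ξ; rw [fourierInv_eq_fourier_neg]
  rw [h2]
  exact (continuous_fourier hf).comp continuous_neg

lemma norm_fourier_le (f : EC) (ξ : E3) : ‖𝓕 f ξ‖ ≤ ∫ x, ‖f x‖ :=
  VectorFourier.norm_fourierIntegral_le_integral_norm _ _ _ _ _

lemma norm_fourierInv_le (f : EC) (ξ : E3) : ‖𝓕⁻ f ξ‖ ≤ ∫ x, ‖f x‖ := by
  rw [fourierInv_eq_fourier_neg]
  exact norm_fourier_le _ _

/-- Gaussian with complex width. -/
def gau (b : ℂ) (ξ : E3) : ℂ := cexp (-b * (‖ξ‖ : ℂ) ^ 2)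

lemma gau_integrable {b : ℂ} (hb : 0 < b.re) : Integrable (gau b) := by
  have := GaussianFourier.integrable_cexp_neg_mul_sq_norm_add hb 0 (0 : E3)
  unfold gau
  simpa using this

lemma gau_continuous (b : ℂ) : Continuous (gau b) := by
  unfold gau; fun_prop

lemma norm_gau (b : ℂ) (ξ : E3) : ‖gau b ξ‖ = rexp (-b.re * ‖ξ‖ ^ 2) := by
  unfold gau
  rw [Complex.norm_exp]
  congr 1
  have : (-b * (‖ξ‖ : ℂ) ^ 2) = -b * ((‖ξ‖ ^ 2 : ℝ) : ℂ) := by push_cast; ring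
  rw [this, Complex.mul_re, Complex.ofReal_re, Complex.ofReal_im]
  simp

lemma gau_norm_le_one {b : ℂ} (hb : 0 ≤ b.re) (ξ : E3) : ‖gau b ξ‖ ≤ 1 := by
  rw [norm_gau]
  apply Real.exp_le_one_iff.mpr
  nlinarith [sq_nonneg ‖ξ‖]

lemma gau_rep {b : ℂ} (hb : 0 < b.re) {f h : EC} (hf : Integrable f) (hh : Integrable h) :
    ∫ ξ, gau b ξ * 𝓕 f ξ * 𝓕⁻ h ξ = ∫ x, f x * ∫ y, h y * 𝓕 (gau b) (x - y) := by
  have hH : Integrable (fun ξ => gau b ξ * 𝓕⁻ h ξ) := by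
    refine (gau_integrable hb).mul_bdd (c := ∫ x, ‖h x‖)
      (continuous_fourierInv hh).aestronglyMeasurable ?_
    exact evt (norm_fourierInv_le h)
  have e1 : ∫ ξ, gau b ξ * 𝓕 f ξ * 𝓕⁻ h ξ = ∫ ξ, 𝓕 f ξ * (gau b ξ * 𝓕⁻ h ξ) := by
    congr 1; ext ξ; ring
  rw [e1, fourier_flip hf hH]
  congr 1; ext x; congr 1
  rw [Real.fourier_eq]
  have hG : Integrable (fun ξ => (𝐞 (-inner ℝ ξ x) : ℂ) * gau b ξ) := by
    have := (Real.fourierIntegral_convergent_iff (f := gau b) x).2 (gau_integrable hb)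
    simpa [Circle.smul_def] using this
  have e2 : ∫ ξ, 𝐞 (-inner ℝ ξ x) • (gau b ξ * 𝓕⁻ h ξ)
      = ∫ ξ, 𝓕⁻ h ξ * ((𝐞 (-inner ℝ ξ x) : ℂ) * gau b ξ) := by
    congr 1; ext ξ; rw [Circle.smul_def, smul_eq_mul]; ring
  rw [e2, fourierInv_flip hh hG]
  congr 1; ext y; congr 1
  rw [Real.fourierInv_eq, Real.fourier_eq]
  congr 1; ext ξ
  rw [Circle.smul_def, Circle.smul_def, smul_eq_mul, smul_eq_mul, ← mul_assoc]
  congr 1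
  rw [← Circle.coe_mul, ← AddChar.map_add_eq_mul, inner_sub_right]
  congr 3; ring

lemma fourier_gau {b : ℂ} (hb : 0 < b.re) (w : E3) :
    𝓕 (gau b) w = (π / b) ^ ((3/2 : ℝ) : ℂ) * cexp (-π ^ 2 * (‖w‖ : ℂ) ^ 2 / b) := by
  have := fourier_gaussian_innerProductSpace hb w
  simp only [finrank_euclideanSpace, Fintype.card_fin] at this
  unfold gau
  rw [this]; norm_num

lemma norm_fourier_gau {b : ℂ} (hb : 0 < b.re) (w : E3) :
    ‖𝓕 (gau b) w‖ ≤ (π / ‖b‖) ^ (3/2 : ℝ) := by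
  rw [fourier_gau hb, norm_mul, Complex.norm_cpow_real, norm_div, Complex.norm_real,
    Real.norm_of_nonneg pi_pos.le]
  refine mul_le_of_le_one_right psv ?_
  rw [Complex.norm_exp]
  apply Real.exp_le_one_iff.mpr
  have : (-π ^ 2 * (‖w‖ : ℂ) ^ 2 / b) = ((-(π ^ 2 * ‖w‖ ^ 2) : ℝ) : ℂ) * b⁻¹ := by
    push_cast; rw [div_eq_mul_inv]; ring
  rw [this, Complex.re_ofReal_mul, Complex.inv_re]
  have : 0 ≤ b.re / normSq b := div_nonneg hb.le (normSq_nonneg _)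
  nlinarith [mul_nonneg (sq_nonneg π) (sq_nonneg ‖w‖)]

lemma lintegral_fourier_gau {ε : ℝ} (hε : 0 < ε) : ∫⁻ w, ‖𝓕 (gau (ε:ℂ)) w‖ₑ = 1 := by
  have hb : 0 < ((ε:ℂ)).re := by simpa
  have e : ∀ w : E3, ‖𝓕 (gau (ε:ℂ)) w‖ = (π / ε) ^ (3/2 : ℝ) * rexp (-(π^2/ε) * ‖w‖^2) := by
    intro w
    rw [fourier_gau hb, norm_mul, Complex.norm_cpow_real, norm_div, Complex.norm_real,
      Real.norm_of_nonneg pi_pos.le, Complex.norm_real, Real.norm_of_nonneg hε.le]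
    congr 1
    have : (-(π:ℂ) ^ 2 * (‖w‖ : ℂ) ^ 2 / (ε:ℂ)) = ((-(π^2/ε) * ‖w‖^2 : ℝ) : ℂ) := by
      push_cast; field_simp
    rw [this, Complex.norm_exp, Complex.ofReal_re]
  have hi : Integrable (fun w : E3 => rexp (-(π^2/ε) * ‖w‖^2)) := by
    have := (gau_integrable (b := ((π^2/ε : ℝ):ℂ)) (by rw [Complex.ofReal_re]; positivity)).norm
    refine this.congr (evt fun w => ?_)
    simp only [norm_gau, Complex.ofReal_re]
  have : ∫⁻ w, ‖𝓕 (gau (ε:ℂ)) w‖ₑ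
      = ∫⁻ w : E3, eR ((π / ε) ^ (3/2 : ℝ) * rexp (-(π^2/ε) * ‖w‖^2)) := by
    refine lintegral_congr fun w => ?_
    rw [← e w, ofReal_norm]
  rw [this, ← ofReal_integral_eq_lintegral_ofReal (hi.const_mul _)
    (evt fun w => by positivity), integral_const_mul,
    GaussianFourier.integral_rexp_neg_mul_sq_norm psv]
  simp only [finrank_euclideanSpace, Fintype.card_fin]
  rw [Nat.cast_ofNat, ← Real.mul_rpow psv psv]
  have : π / ε * (π / (π^2/ε)) = 1 := by field_simp
  rw [this]; simp

/-- spatial Lebesgue norm of a complex function. -/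
def nL (p : ℝ) (f : EC) : ENNReal := Np p volume (fun x => ‖f x‖ₑ)

lemma fourierInv_conj (f : EC) (ξ : E3) :
    𝓕⁻ (fun x => cj (f x)) ξ = cj (𝓕 f ξ) := by
  rw [Real.fourierInv_eq, Real.fourier_eq, ← integral_conj]
  congr 1; ext x
  rw [Circle.smul_def, Circle.smul_def, smul_eq_mul, smul_eq_mul, map_mul, ← Circle.coe_inv_eq_conj]
  congr 2
  rw [← AddChar.map_neg_eq_inv, neg_neg]

lemma nL_two_sq (f : EC) : nL 2 f ^ 2 = ∫⁻ x, ‖f x‖ₑ ^ 2 := by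
  have := Np_rpow (μ := volume) (p := 2) nmm (fun x : E3 => ‖f x‖ₑ)
  rw [← ENNReal.rpow_natCast, nL]; push_cast
  rw [this]; simp

lemma nL_conj (p : ℝ) (f : EC) : nL p (fun x => cj (f x)) = nL p f := by
  unfold nL; congr 1; ext x; rw [RCLike.enorm_conj]

lemma gau_quad_le {ε : ℝ} (hε : 0 < ε) {f : EC} (hm : Measurable f) :
    ∫⁻ x, ‖f x‖ₑ * ∫⁻ y, ‖f y‖ₑ * ‖𝓕 (gau (ε:ℂ)) (x - y)‖ₑ ≤ nL 2 f ^ 2 := by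
  by_cases htop : nL 2 f = ⊤
  · rw [htop]; simp
  have hb : 0 < ((ε:ℂ)).re := by simpa
  have hc : Continuous (𝓕 (gau (ε:ℂ))) := continuous_fourier (gau_integrable hb)
  have hmE : Measurable (fun x => ‖f x‖ₑ) := hm.enorm
  have hmK : Measurable (fun x => ‖𝓕 (gau (ε:ℂ)) x‖ₑ) := hc.measurable.enorm
  have e : ∀ x, ∫⁻ y, ‖f y‖ₑ * ‖𝓕 (gau (ε:ℂ)) (x - y)‖ₑ
      = ∫⁻ y, ‖𝓕 (gau (ε:ℂ)) y‖ₑ * ‖f (x - y)‖ₑ := by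
    intro x
    rw [← lintegral_sub_left_eq_self _ x]
    refine lintegral_congr fun y => ?_
    rw [sub_sub_cancel, mul_comm]
  simp_rw [e]
  have h1 : Np 1 volume (fun x => ‖𝓕 (gau (ε:ℂ)) x‖ₑ) = 1 := by
    unfold Np; simp [lintegral_fourier_gau hε]
  have hY := young (p := 2) (r := 1) (q := 2) nmm nmm nmm
    nmm hmK hmE (by rw [h1]; simp) htop
  rw [h1, one_mul] at hY
  have hH := Np_mul_le (μ := (volume : Measure E3)) (p := 2) (q := 2) (r := 1) nmm
    nmm nmm hmE.aemeasurable
    (G := fun x => ∫⁻ y, ‖𝓕 (gau (ε:ℂ)) y‖ₑ * ‖f (x - y)‖ₑ) (by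
      apply Measurable.aemeasurable
      apply Measurable.lintegral_prod_right' (f := fun p : E3 × E3 => ‖𝓕 (gau (ε:ℂ)) p.2‖ₑ * ‖f (p.1 - p.2)‖ₑ)
      exact (hmK.comp measurable_snd).mul (hmE.comp (measurable_fst.sub measurable_snd)))
  have h2 : Np 1 volume (fun x => ‖f x‖ₑ * ∫⁻ y, ‖𝓕 (gau (ε:ℂ)) y‖ₑ * ‖f (x - y)‖ₑ)
    = ∫⁻ x, ‖f x‖ₑ * ∫⁻ y, ‖𝓕 (gau (ε:ℂ)) y‖ₑ * ‖f (x - y)‖ₑ := by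
    unfold Np; simp
  rw [h2] at hH
  refine hH.trans ?_
  rw [sq]
  unfold nL
  gcongr

lemma fourier_L2 {f : EC} (hm : Measurable f) (hf : Integrable f) :
    ∫⁻ ξ, ‖𝓕 f ξ‖ₑ ^ 2 ≤ nL 2 f ^ 2 := by
  have key : ∀ ε : ℝ, 0 < ε → ∫⁻ ξ, ‖gau (ε:ℂ) ξ‖ₑ * ‖𝓕 f ξ‖ₑ ^ 2 ≤ nL 2 f ^ 2 := by
    intro ε hε
    have hb : 0 < ((ε:ℂ)).re := by simpa
    have hfc : Integrable (fun x => cj (f x)) := by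
      have := hf.norm
      refine (integrable_norm_iff ?_).1 (this.congr (evt fun x => by simp))
      exact (Complex.continuous_conj.measurable.comp hm).aestronglyMeasurable
    have hrep := gau_rep hb hf hfc
    have hInt : Integrable (fun ξ => gau (ε:ℂ) ξ * 𝓕 f ξ * 𝓕⁻ (fun x => cj (f x)) ξ) := by
      refine ((gau_integrable hb).mul_bdd (c := ∫ x, ‖f x‖)
        (continuous_fourier hf).aestronglyMeasurable
        (evt (norm_fourier_le f))).mul_bdd
        (continuous_fourierInv hfc).aestronglyMeasurable
        (evt (norm_fourierInv_le _))
    have e1 : ∀ ξ, gau (ε:ℂ) ξ * 𝓕 f ξ * 𝓕⁻ (fun x => cj (f x)) ξ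
        = ((rexp (-ε * ‖ξ‖^2) * ‖𝓕 f ξ‖^2 : ℝ) : ℂ) := by
      intro ξ
      rw [fourierInv_conj, mul_assoc, Complex.mul_conj, Complex.normSq_eq_norm_sq]
      unfold gau; push_cast; rfl
    have e2 : ∫⁻ ξ, ‖gau (ε:ℂ) ξ‖ₑ * ‖𝓕 f ξ‖ₑ ^ 2 = ‖∫ ξ, gau (ε:ℂ) ξ * 𝓕 f ξ * 𝓕⁻ (fun x => cj (f x)) ξ‖ₑ := by
      simp_rw [e1] at hInt ⊢
      rw [integral_complex_ofReal, ← ofReal_norm (_ : ℂ), Complex.norm_real, Real.norm_of_nonneg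
        (integral_nonneg fun ξ => by positivity), ofReal_integral_eq_lintegral_ofReal
          (by simpa only [RCLike.re_eq_complex_re, Complex.ofReal_re] using hInt.re) (evt fun ξ => by positivity)]
      refine lintegral_congr fun ξ => ?_
      rw [ENNReal.ofReal_mul psv, ENNReal.ofReal_pow psv, ofReal_norm,
        ← ofReal_norm (gau _ _), norm_gau]
      simp
    rw [e2, hrep]
    refine (enorm_integral_le_lintegral_enorm _).trans ?_
    refine le_trans (lintegral_mono fun x => ?_) (gau_quad_le hε hm)
    rw [enorm_mul]
    gcongr
    refine (enorm_integral_le_lintegral_enorm _).trans ?_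
    refine lintegral_mono fun y => ?_
    rw [enorm_mul, RCLike.enorm_conj]
  have hlim : ∀ ξ, Tendsto (fun n : ℕ => ‖gau ((1/((n:ℝ)+1) : ℝ):ℂ) ξ‖ₑ * ‖𝓕 f ξ‖ₑ ^ 2) atTop
      (nhds (‖𝓕 f ξ‖ₑ ^ 2)) := by
    intro ξ
    have h1 : Tendsto (fun n : ℕ => ‖gau ((1/((n:ℝ)+1) : ℝ):ℂ) ξ‖ₑ) atTop (nhds 1) := by
      have : Tendsto (fun n : ℕ => gau ((1/((n:ℝ)+1) : ℝ):ℂ) ξ) atTop (nhds (gau ((0:ℝ):ℂ) ξ)) := by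
        have hc : Continuous (fun r : ℝ => gau (r:ℂ) ξ) := by unfold gau; fun_prop
        exact (hc.tendsto 0).comp tendsto_one_div_add_atTop_nhds_zero_nat
      have h0 : gau ((0:ℝ):ℂ) ξ = 1 := by simp [gau]
      rw [h0] at this
      have := this.enorm
      simpa using this
    have := ENNReal.Tendsto.mul_const (b := ‖𝓕 f ξ‖ₑ ^ 2) h1 (Or.inl one_ne_zero)
    simpa using this
  calc ∫⁻ ξ, ‖𝓕 f ξ‖ₑ ^ 2
      = ∫⁻ ξ, liminf (fun n : ℕ => ‖gau ((1/((n:ℝ)+1) : ℝ):ℂ) ξ‖ₑ * ‖𝓕 f ξ‖ₑ ^ 2) atTop := by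
        refine lintegral_congr fun ξ => ?_
        exact (hlim ξ).liminf_eq.symm
    _ ≤ liminf (fun n : ℕ => ∫⁻ ξ, ‖gau ((1/((n:ℝ)+1) : ℝ):ℂ) ξ‖ₑ * ‖𝓕 f ξ‖ₑ ^ 2) atTop := by
        apply lintegral_liminf_le
        intro n
        exact (gau_continuous _).measurable.enorm.mul
          ((continuous_fourier hf).measurable.enorm.pow_const _)
    _ ≤ nL 2 f ^ 2 := by
        refine liminf_le_of_frequently_le' (Frequently.of_forall fun n => ?_)
        exact key _ psv

lemma fourierInv_L2 {f : EC} (hm : Measurable f) (hf : Integrable f) :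
    ∫⁻ ξ, ‖𝓕⁻ f ξ‖ₑ ^ 2 ≤ nL 2 f ^ 2 := by
  have h2 : ∀ ξ, ‖𝓕⁻ f ξ‖ₑ = ‖𝓕 f (-ξ)‖ₑ := fun ξ => by
    rw [fourierInv_eq_fourier_neg]
  simp_rw [h2]
  rw [lintegral_neg_eq_self (fun ξ => ‖𝓕 f ξ‖ₑ ^ 2)]
  exact fourier_L2 hm hf

/-- the bilinear form of the free Schrodinger propagator. -/
def Af (τ : ℝ) (f h : EC) : ℂ :=
  ∫ ξ, gau (4 * π ^ 2 * τ * I) ξ * 𝓕 f ξ * 𝓕⁻ h ξ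

/-- measurable, integrable and square integrable. -/
structure Good (f : EC) : Prop where
  meas : Measurable f
  int : Integrable f
  two : Integrable (fun x => ‖f x‖ ^ 2)

lemma Good.nL2 {f : EC} (hf : Good f) : nL 2 f ^ 2 = eR (∫ x, ‖f x‖ ^ 2) := by
  rw [nL_two_sq, ofReal_integral_eq_lintegral_ofReal hf.two
    (evt fun x => by positivity)]
  refine lintegral_congr fun x => ?_
  rw [ENNReal.ofReal_pow (norm_nonneg _), ofReal_norm]

lemma Good.nL2_ne_top {f : EC} (hf : Good f) : nL 2 f ≠ ⊤ := by
  intro h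
  have := hf.nL2
  rw [h] at this
  simp at this

lemma sqint_mul {F G : EC} (hFm : Continuous F) (hGm : Continuous G) {a b : ENNReal}
    (hF : ∫⁻ ξ, ‖F ξ‖ₑ ^ 2 ≤ a ^ 2) (hG : ∫⁻ ξ, ‖G ξ‖ₑ ^ 2 ≤ b ^ 2) :
    ∫⁻ ξ, ‖F ξ * G ξ‖ₑ ≤ a * b := by
  have h := Np_mul_le (μ := (volume : Measure E3)) (p := 2) (q := 2) (r := 1) nmm
    nmm nmm (F := fun ξ => ‖F ξ‖ₑ) (G := fun ξ => ‖G ξ‖ₑ)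
    hFm.measurable.enorm.aemeasurable hGm.measurable.enorm.aemeasurable
  have e1 : Np 1 volume (fun ξ => ‖F ξ‖ₑ * ‖G ξ‖ₑ) = ∫⁻ ξ, ‖F ξ * G ξ‖ₑ := by
    unfold Np; simp [enorm_mul]
  rw [e1] at h
  refine h.trans ?_
  have aux : ∀ (H : EC) (c : ENNReal), ∫⁻ ξ, ‖H ξ‖ₑ ^ 2 ≤ c ^ 2 →
      Np 2 volume (fun ξ => ‖H ξ‖ₑ) ≤ c := by
    intro H c hc
    rw [← nL_two_sq] at hc
    exact (ENNReal.pow_right_strictMono (by norm_num : (2:ℕ) ≠ 0)).le_iff_le.1 hc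
  gcongr
  · exact aux _ _ hF
  · exact aux _ _ hG

lemma Good.prod_le {f h : EC} (hf : Good f) (hh : Good h) :
    ∫⁻ ξ, ‖𝓕 f ξ * 𝓕⁻ h ξ‖ₑ ≤ nL 2 f * nL 2 h :=
  sqint_mul (continuous_fourier hf.int) (continuous_fourierInv hh.int)
    (fourier_L2 hf.meas hf.int) (fourierInv_L2 hh.meas hh.int)

lemma Good.prod_int {f h : EC} (hf : Good f) (hh : Good h) :
    Integrable (fun ξ => 𝓕 f ξ * 𝓕⁻ h ξ) := by
  refine ⟨((continuous_fourier hf.int).mul (continuous_fourierInv hh.int)).aestronglyMeasurable, ?_⟩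
  refine (hf.prod_le hh).trans_lt ?_
  exact ENNReal.mul_lt_top hf.nL2_ne_top.lt_top hh.nL2_ne_top.lt_top

lemma Good.Af_int {f h : EC} (hf : Good f) (hh : Good h) {b : ℂ} (hb : 0 ≤ b.re) :
    Integrable (fun ξ => gau b ξ * 𝓕 f ξ * 𝓕⁻ h ξ) := by
  simp_rw [mul_assoc]
  exact (hf.prod_int hh).bdd_mul (c := 1) (gau_continuous _).aestronglyMeasurable
    (evt (gau_norm_le_one hb))

lemma re_b (τ : ℝ) : (4 * (π:ℂ) ^ 2 * τ * I).re = 0 := by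
  have : (4 * (π:ℂ) ^ 2 * τ * I) = ((4 * π ^ 2 * τ : ℝ) : ℂ) * I := by push_cast; ring
  rw [this, Complex.re_ofReal_mul]; simp

lemma im_b (τ : ℝ) : (4 * (π:ℂ) ^ 2 * τ * I).im = 4 * π ^ 2 * τ := by
  have : (4 * (π:ℂ) ^ 2 * τ * I) = ((4 * π ^ 2 * τ : ℝ) : ℂ) * I := by push_cast; ring
  rw [this, Complex.im_ofReal_mul]; simp

lemma Good.Af_L2 {f h : EC} (hf : Good f) (hh : Good h) (τ : ℝ) :
    ‖Af τ f h‖ₑ ≤ nL 2 f * nL 2 h := by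
  refine (enorm_integral_le_lintegral_enorm _).trans (le_trans ?_ (hf.prod_le hh))
  refine lintegral_mono fun ξ => ?_
  rw [mul_assoc, enorm_mul]
  refine mul_le_of_le_one_left psv ?_
  have := gau_norm_le_one (b := 4 * π ^ 2 * τ * I) (by rw [re_b]) ξ
  rw [← ofReal_norm]
  simpa using ofReal_le_ofReal this

lemma Good.Af_L2' {f h : EC} (hf : Good f) (hh : Good h) (τ : ℝ) :
    ‖Af τ f h‖ ≤ (∫ x, ‖f x‖ ^ 2) ^ (1/2 : ℝ) * (∫ x, ‖h x‖ ^ 2) ^ (1/2 : ℝ) := by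
  have e : ∀ {f : EC}, Good f → nL 2 f = eR ((∫ x, ‖f x‖ ^ 2) ^ (1/2 : ℝ)) := by
    intro f hf
    rw [← ofReal_rpow_of_nonneg (integral_nonneg fun x => by positivity) nmm,
      ← hf.nL2, ← ENNReal.rpow_natCast, ← ENNReal.rpow_mul]
    norm_num
  have := hf.Af_L2 hh τ
  rw [e hf, e hh, ← ENNReal.ofReal_mul psv, ← ofReal_norm,
    ENNReal.ofReal_le_ofReal_iff psv] at this
  exact this

lemma Good.Af_L1 {f h : EC} (hf : Good f) (hh : Good h) {τ : ℝ} (hτ : τ ≠ 0) :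
    ‖Af τ f h‖ ≤ |τ| ^ (-(3/2) : ℝ) * (∫ x, ‖f x‖) * (∫ x, ‖h x‖) := by
  have hbre : ∀ n : ℕ, 0 < ((((1/((n:ℝ)+1) : ℝ)) : ℂ) + 4 * (π:ℂ) ^ 2 * τ * I).re := by
    intro n
    rw [Complex.add_re, re_b, Complex.ofReal_re, add_zero]; positivity
  have hlim : Tendsto (fun n : ℕ => ∫ ξ, gau ((((1/((n:ℝ)+1) : ℝ)) : ℂ) + 4 * π ^ 2 * τ * I) ξ
      * 𝓕 f ξ * 𝓕⁻ h ξ) atTop (nhds (Af τ f h)) := by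
    unfold Af
    refine tendsto_integral_of_dominated_convergence (fun ξ => ‖𝓕 f ξ * 𝓕⁻ h ξ‖) ?_
      (hf.prod_int hh).norm ?_ ?_
    · intro n
      exact (hf.Af_int hh (hbre n).le).aestronglyMeasurable
    · intro n
      refine evt fun ξ => ?_
      rw [mul_assoc, norm_mul]
      exact mul_le_of_le_one_left psv (gau_norm_le_one (hbre n).le ξ)
    · refine evt fun ξ => ?_
      refine Tendsto.mul_const _ (Tendsto.mul_const _ ?_)
      have hc : Continuous (fun r : ℝ => gau ((r:ℂ) + 4 * π ^ 2 * τ * I) ξ) := by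
        unfold gau; fun_prop
      have := (hc.tendsto 0).comp (tendsto_one_div_add_atTop_nhds_zero_nat (𝕜 := ℝ))
      simpa [Function.comp_def] using this
  refine le_of_tendsto hlim.norm (evt fun n => ?_)
  rw [gau_rep (hbre n) hf.int hh.int]
  set b := ((((1/((n:ℝ)+1) : ℝ)) : ℂ) + 4 * (π:ℂ) ^ 2 * τ * I) with hb
  have hKb : ∀ w, ‖𝓕 (gau b) w‖ ≤ |τ| ^ (-(3/2) : ℝ) := by
    intro w
    refine (norm_fourier_gau (hbre n) w).trans ?_
    have h1 : 4 * π ^ 2 * |τ| ≤ ‖b‖ := by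
      have := Complex.abs_im_le_norm b
      rw [hb, Complex.add_im, im_b, Complex.ofReal_im, zero_add, abs_mul,
        abs_of_pos (by positivity : 0 < 4 * π^2)] at this
      exact this
    have ht : 0 < |τ| := abs_pos.2 hτ
    have h2 : π / ‖b‖ ≤ |τ|⁻¹ := by
      rw [div_le_iff₀ (lt_of_lt_of_le psv h1)]
      calc π ≤ |τ|⁻¹ * (4 * π^2 * |τ|) := by
            field_simp
            nlinarith [pi_gt_three]
        _ ≤ _ := by gcongr
    rw [Real.rpow_neg ht.le, ← Real.inv_rpow ht.le]
    gcongr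
  calc ‖∫ x, f x * ∫ y, h y * 𝓕 (gau b) (x - y)‖
      ≤ ∫ x, ‖f x‖ * (|τ| ^ (-(3/2) : ℝ) * ∫ y, ‖h y‖) := by
        refine norm_integral_le_of_norm_le (hf.int.norm.mul_const _) (evt fun x => ?_)
        rw [norm_mul]
        gcongr
        rw [← integral_const_mul]
        refine norm_integral_le_of_norm_le (hh.int.norm.const_mul _) (evt fun y => ?_)
        rw [norm_mul, mul_comm]
        gcongr
        exact hKb _
    _ = _ := by rw [integral_mul_const]; ring

/-- the analytic family of Riesz-Thorin. -/
def rtφ (p : ℝ) (z c : ℂ) : ℂ :=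
  if c = 0 then 0 else (c / ‖c‖) * cexp (Real.log ‖c‖ * (p * (1 - z / 2)))

lemma rtφ_norm {p : ℝ} (hp : 0 < p) (z c : ℂ) (hz : z.re ≤ 1) :
    ‖rtφ p z c‖ = ‖c‖ ^ (p * (1 - z.re / 2)) := by
  unfold rtφ
  by_cases hc : c = 0
  · rw [if_pos hc, hc, norm_zero, Real.zero_rpow]
    have : 0 < 1 - z.re / 2 := by linarith
    positivity
  · rw [if_neg hc, norm_mul, norm_div, Complex.norm_real, norm_norm,
      div_self (norm_ne_zero_iff.2 hc), one_mul, Complex.norm_exp, Complex.re_ofReal_mul,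
      Complex.re_ofReal_mul, Real.rpow_def_of_pos (norm_pos_iff.2 hc)]
    congr 2
    have : (z / 2).re = z.re / 2 := by simp
    rw [Complex.sub_re, this, Complex.one_re]

lemma rtφ_diff (p : ℝ) (c : ℂ) : Differentiable ℂ (fun z => rtφ p z c) := by
  unfold rtφ
  by_cases hc : c = 0
  · simp [hc]
  · simp only [hc, if_false]; fun_prop

lemma rtφ_self {p : ℝ} {θ : ℝ} (h : p * (1 - θ / 2) = 1) (c : ℂ) : rtφ p θ c = c := by
  unfold rtφ
  by_cases hc : c = 0
  · simp [hc]
  · rw [if_neg hc]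
    have h' : ((p:ℂ) * (1 - (θ:ℂ) / 2)) = 1 := by exact_mod_cast h
    rw [h', mul_one, ← Complex.ofReal_exp, Real.exp_log (norm_pos_iff.2 hc)]
    have : ((‖c‖ : ℝ) : ℂ) ≠ 0 := by simpa using hc
    field_simp

lemma Good.of_simple {f : SimpleFunc E3 ℂ} (hf : Integrable f) : Good f where
  meas := f.measurable
  int := hf
  two := by
    have h1 := SimpleFunc.integrable_iff_finMeasSupp.1 hf
    have : Integrable (f.map (fun c => ‖c‖^2)) :=
      SimpleFunc.integrable_iff_finMeasSupp.2 (h1.map (by simp))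
    exact this

lemma Good.sum {ι : Type*} (S : Finset ι) (a : ι → ℂ) (F : ι → EC)
    (hF : ∀ i ∈ S, Integrable (F i)) (ξ : E3) :
    𝓕 (fun x => ∑ i ∈ S, a i * F i x) ξ = ∑ i ∈ S, a i * 𝓕 (F i) ξ := by
  rw [Real.fourier_eq]
  simp_rw [Finset.smul_sum, Circle.smul_def, smul_eq_mul]
  rw [integral_finsetSum]
  · refine Finset.sum_congr rfl fun i _ => ?_
    rw [Real.fourier_eq, ← integral_const_mul]
    congr 1; ext x; rw [Circle.smul_def, smul_eq_mul]; ring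
  · intro i hi
    have := ((Real.fourierIntegral_convergent_iff (f := F i) ξ).2 (hF i hi)).const_mul (a i)
    refine this.congr (evt fun x => ?_)
    simp only [Circle.smul_def, smul_eq_mul]; ring

lemma Good.sumInv {ι : Type*} (S : Finset ι) (a : ι → ℂ) (F : ι → EC)
    (hF : ∀ i ∈ S, Integrable (F i)) (ξ : E3) :
    𝓕⁻ (fun x => ∑ i ∈ S, a i * F i x) ξ = ∑ i ∈ S, a i * 𝓕⁻ (F i) ξ := by
  simp_rw [fourierInv_eq_fourier_neg]
  exact Good.sum S a F hF (-ξ)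

lemma Af_sum {ι κ : Type*} (S : Finset ι) (R : Finset κ) (a : ι → ℂ) (b : κ → ℂ)
    (F : ι → EC) (H : κ → EC) (hF : ∀ i ∈ S, Good (F i)) (hH : ∀ i ∈ R, Good (H i)) (τ : ℝ) :
    Af τ (fun x => ∑ i ∈ S, a i * F i x) (fun x => ∑ j ∈ R, b j * H j x)
      = ∑ i ∈ S, ∑ j ∈ R, a i * b j * Af τ (F i) (H j) := by
  unfold Af
  simp_rw [Good.sum S a F (fun i hi => (hF i hi).int), Good.sumInv R b H (fun i hi => (hH i hi).int)]
  simp_rw [Finset.mul_sum, Finset.sum_mul]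
  have hInt : ∀ i ∈ S, ∀ j ∈ R, Integrable (fun ξ => gau (4 * π ^ 2 * τ * I) ξ * (a i * 𝓕 (F i) ξ) *
      (b j * 𝓕⁻ (H j) ξ)) := by
    intro i hi j hj
    have := ((hF i hi).Af_int (hH j hj) (b := 4 * π ^ 2 * τ * I) (re_b τ).ge).const_mul (a i * b j)
    refine this.congr (evt fun x => ?_)
    dsimp only; ring
  rw [integral_finsetSum]
  · rw [Finset.sum_comm]
    refine Finset.sum_congr rfl fun j hj => ?_
    rw [integral_finsetSum _ (fun i hi => hInt i hi j hj)]
    refine Finset.sum_congr rfl fun i hi => ?_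
    rw [← integral_const_mul]
    congr 1; ext ξ; ring
  · intro j hj
    exact integrable_finsetSum _ (fun i hi => hInt i hi j hj)

/-- indicator pieces of a simple function. -/
def pc (f : SimpleFunc E3 ℂ) (c : ℂ) (x : E3) : ℂ := Set.indicator (f ⁻¹' {c}) (fun _ => 1) x

lemma pc_good {f : SimpleFunc E3 ℂ} (hf : Integrable f) {c : ℂ} (hc : c ≠ 0) : Good (pc f c) := by
  have h1 := (SimpleFunc.integrable_iff.1 hf) c hc
  refine ⟨?_, ?_, ?_⟩
  · exact measurable_const.indicator (f.measurableSet_preimage {c})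
  · exact (integrable_indicator_iff (f.measurableSet_preimage {c})).2
      (integrableOn_const h1.ne)
  · have : (fun x => ‖pc f c x‖ ^ 2) = Set.indicator (f ⁻¹' {c}) (fun _ => (1:ℝ)) := by
      ext x; unfold pc; by_cases hx : x ∈ f ⁻¹' {c} <;> simp [hx]
    rw [this]
    exact (integrable_indicator_iff (f.measurableSet_preimage {c})).2
      (integrableOn_const h1.ne)

lemma map_eq_sum (f : SimpleFunc E3 ℂ) {φ : ℂ → ℂ} (h0 : φ 0 = 0) (x : E3) :
    f.map φ x = ∑ c ∈ f.range.filter (· ≠ 0), φ c * pc f c x := by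
  rw [SimpleFunc.map_apply]
  by_cases hx : f x = 0
  · rw [hx, h0, Finset.sum_eq_zero]
    intro c hc
    have : pc f c x = 0 := by
      unfold pc
      rw [Set.indicator_of_notMem]
      simp only [Set.mem_preimage, Set.mem_singleton_iff, hx]
      exact fun h => (Finset.mem_filter.1 hc).2 h.symm
    rw [this, mul_zero]
  · rw [Finset.sum_eq_single (f x)]
    · simp [pc]
    · intro c _ hc
      have : pc f c x = 0 := by
        unfold pc
        rw [Set.indicator_of_notMem]
        simp only [Set.mem_preimage, Set.mem_singleton_iff]
        exact fun h => hc h.symm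
      rw [this, mul_zero]
    · intro h
      exact absurd (Finset.mem_filter.2 ⟨SimpleFunc.mem_range_self f x, hx⟩) h

lemma rt_simple {f h : SimpleFunc E3 ℂ} (hf : Integrable f) (hh : Integrable h) {τ : ℝ}
    (hτ : τ ≠ 0) {p θ : ℝ} (hp : 0 < p) (hθ0 : 0 ≤ θ) (hθ1 : θ ≤ 1) (hpθ : p * (1 - θ / 2) = 1) :
    ‖Af τ f h‖ ≤ (|τ| ^ (-(3/2) : ℝ)) ^ (1 - θ) * (∫ x, ‖f x‖ ^ p) ^ (1 / p)
      * (∫ x, ‖h x‖ ^ p) ^ (1 / p) := by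
  set P := ∫ x, ‖f x‖ ^ p with hP
  set Q := ∫ x, ‖h x‖ ^ p with hQ
  have hP0 : 0 ≤ P := integral_nonneg fun x => by positivity
  have hQ0 : 0 ≤ Q := integral_nonneg fun x => by positivity
  have φ0 : ∀ z, rtφ p z 0 = 0 := fun z => by simp [rtφ]
  have gmap : ∀ {f : SimpleFunc E3 ℂ}, Integrable f → ∀ z, Good (f.map (rtφ p z)) := by
    intro f hf z
    exact Good.of_simple (SimpleFunc.integrable_iff_finMeasSupp.2
      ((SimpleFunc.integrable_iff_finMeasSupp.1 hf).map (φ0 z)))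
  set Sf := f.range.filter (· ≠ 0)
  set Sh := h.range.filter (· ≠ 0)
  let F : ℂ → ℂ := fun z => Af τ (f.map (rtφ p z)) (h.map (rtφ p z))
  have hFeq : ∀ z, F z = ∑ c ∈ Sf, ∑ d ∈ Sh, rtφ p z c * rtφ p z d * Af τ (pc f c) (pc h d) := by
    intro z
    have e1 : ⇑(f.map (rtφ p z)) = fun x => ∑ c ∈ Sf, rtφ p z c * pc f c x := by
      ext x; exact map_eq_sum f (φ0 z) x
    have e2 : ⇑(h.map (rtφ p z)) = fun x => ∑ c ∈ Sh, rtφ p z c * pc h c x := by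
      ext x; exact map_eq_sum h (φ0 z) x
    change Af τ _ _ = _
    rw [e1, e2]
    exact Af_sum Sf Sh _ _ _ _ (fun c hc => pc_good hf (Finset.mem_filter.1 hc).2)
      (fun c hc => pc_good hh (Finset.mem_filter.1 hc).2) τ
  have hdiff : Differentiable ℂ F := by
    have : F = fun z => ∑ c ∈ Sf, ∑ d ∈ Sh, rtφ p z c * rtφ p z d * Af τ (pc f c) (pc h d) :=
      funext hFeq
    rw [this]
    refine Differentiable.fun_sum fun c _ => Differentiable.fun_sum fun d _ => ?_
    exact ((rtφ_diff p c).mul (rtφ_diff p d)).mul_const _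
  have hbdd : BddAbove (norm ∘ F '' Complex.HadamardThreeLines.verticalClosedStrip 0 1) := by
    refine ⟨∑ c ∈ Sf, ∑ d ∈ Sh, (1 + ‖c‖ ^ p) * (1 + ‖d‖ ^ p) * ‖Af τ (pc f c) (pc h d)‖, ?_⟩
    rintro _ ⟨z, hz, rfl⟩
    have hz' : 0 ≤ z.re ∧ z.re ≤ 1 := hz
    have hb : ∀ c : ℂ, ‖rtφ p z c‖ ≤ 1 + ‖c‖ ^ p := by
      intro c
      rw [rtφ_norm hp z c hz'.2]
      rcases le_total ‖c‖ 1 with h1 | h1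
      · have : ‖c‖ ^ (p * (1 - z.re / 2)) ≤ 1 := Real.rpow_le_one (norm_nonneg _) h1 (by
          have : 0 ≤ 1 - z.re / 2 := by linarith
          positivity)
        have : 0 ≤ ‖c‖ ^ p := by positivity
        linarith
      · have : ‖c‖ ^ (p * (1 - z.re / 2)) ≤ ‖c‖ ^ p := Real.rpow_le_rpow_of_exponent_le h1 (by
          nlinarith)
        linarith
    simp only [Function.comp_apply]
    rw [hFeq]
    refine (norm_sum_le _ _).trans (Finset.sum_le_sum fun c _ => (norm_sum_le _ _).trans
      (Finset.sum_le_sum fun d _ => ?_))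
    rw [norm_mul, norm_mul]
    gcongr
    · exact hb c
    · exact hb d
  have h0 : ∀ z ∈ re ⁻¹' {0}, ‖F z‖ ≤ |τ| ^ (-(3/2) : ℝ) * P * Q := by
    intro z hz
    have hz' : z.re = 0 := hz
    refine ((gmap hf z).Af_L1 (gmap hh z) hτ).trans (le_of_eq ?_)
    simp only [SimpleFunc.map_apply]
    simp_rw [rtφ_norm hp z _ (by rw [hz']; norm_num), hz']
    norm_num [hP, hQ]
  have h1 : ∀ z ∈ re ⁻¹' {1}, ‖F z‖ ≤ P ^ (1/2:ℝ) * Q ^ (1/2:ℝ) := by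
    intro z hz
    have hz' : z.re = 1 := hz
    refine ((gmap hf z).Af_L2' (gmap hh z) τ).trans (le_of_eq ?_)
    simp only [SimpleFunc.map_apply]
    have : ∀ c : ℂ, ‖rtφ p z c‖ ^ 2 = ‖c‖ ^ p := by
      intro c
      rw [rtφ_norm hp z _ (by rw [hz']), hz', ← Real.rpow_natCast, ← Real.rpow_mul (norm_nonneg _)]
      congr 1; push_cast; ring
    simp_rw [this]
    rfl
  have hmain := Complex.HadamardThreeLines.norm_le_interp_of_mem_verticalClosedStrip₀₁' F
    (z := (θ:ℂ)) (by constructor <;> simpa) hdiff.diffContOnCl hbdd h0 h1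
  have hFθ : F θ = Af τ f h := by
    have : ∀ f : SimpleFunc E3 ℂ, ⇑(f.map (rtφ p θ)) = f := by
      intro f; ext x; rw [SimpleFunc.map_apply, rtφ_self hpθ]
    change Af τ _ _ = _
    rw [this, this]
  rw [hFθ, Complex.ofReal_re] at hmain
  refine hmain.trans (le_of_eq ?_)
  have hexp : 1 / p = (1 - θ) + 1/2 * θ := by
    rw [div_eq_iff hp.ne']; linarith
  have hτ' : 0 ≤ |τ| ^ (-(3/2) : ℝ) := by positivity
  rw [Real.mul_rpow psv hQ0, Real.mul_rpow hτ' hP0, Real.mul_rpow psv psv,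
    ← Real.rpow_mul hP0, ← Real.rpow_mul hQ0, hexp, Real.rpow_add' hP0 (by rw [← hexp]; positivity),
    Real.rpow_add' hQ0 (by rw [← hexp]; positivity)]
  ring

lemma eLpNorm_eq_nL {p : ℝ} (hp : 0 < p) (f : EC) :
    eLpNorm f (eR p) volume = nL p f := by
  rw [eLpNorm_eq_lintegral_rpow_enorm_toReal (by simpa using hp) ENNReal.ofReal_ne_top]
  rw [ENNReal.toReal_ofReal hp.le]
  rfl

lemma eLpNorm_two_eq_nL (f : EC) : eLpNorm f 2 volume = nL 2 f := by
  have := eLpNorm_eq_nL (p := 2) nmm f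
  rwa [ENNReal.ofReal_ofNat] at this

lemma fourier_sub {f g : EC} (hf : Integrable f) (hg : Integrable g) (ξ : E3) :
    𝓕 (fun x => f x - g x) ξ = 𝓕 f ξ - 𝓕 g ξ := by
  rw [Real.fourier_eq, Real.fourier_eq, Real.fourier_eq, ← integral_sub
    ((Real.fourierIntegral_convergent_iff (f := f) ξ).2 hf)
    ((Real.fourierIntegral_convergent_iff (f := g) ξ).2 hg)]
  congr 1; ext x; rw [smul_sub]

lemma fourierInv_sub {f g : EC} (hf : Integrable f) (hg : Integrable g) (ξ : E3) :
    𝓕⁻ (fun x => f x - g x) ξ = 𝓕⁻ f ξ - 𝓕⁻ g ξ := by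
  simp_rw [fourierInv_eq_fourier_neg]
  exact fourier_sub hf hg _

lemma Good.of_le {f g : EC} (hf : Good f) (hm : Measurable g) {c : ℝ} 
    (h : ∀ x, ‖g x‖ ≤ c * ‖f x‖) : Good g where
  meas := hm
  int := (hf.int.norm.const_mul c).mono' hm.aestronglyMeasurable (evt h)
  two := by
    refine (hf.two.const_mul (c^2)).mono' (hm.norm.pow_const 2).aestronglyMeasurable
      (evt fun x => ?_)
    rw [Real.norm_of_nonneg psv, ← mul_pow]
    have := h x
    gcongr

lemma Good.sub {f g : EC} (hf : Good f) (hg : Good g) : Good (fun x => f x - g x) where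
  meas := hf.meas.sub hg.meas
  int := hf.int.sub hg.int
  two := by
    refine ((hf.two.const_mul 2).add (hg.two.const_mul 2)).mono'
      ((hf.meas.sub hg.meas).norm.pow_const 2).aestronglyMeasurable
      (evt fun x => ?_)
    rw [Real.norm_of_nonneg psv]
    simp only [Pi.add_apply]
    have := norm_sub_le (f x) (g x)
    nlinarith [norm_nonneg (f x - g x), sq_nonneg (‖f x‖ - ‖g x‖)]

lemma Good.Af_sub_left {f g h : EC} (hf : Good f) (hg : Good g) (hh : Good h) (τ : ℝ) :
    Af τ (fun x => f x - g x) h = Af τ f h - Af τ g h := by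
  unfold Af
  rw [← integral_sub (hf.Af_int hh (re_b τ).ge) (hg.Af_int hh (re_b τ).ge)]
  congr 1; ext ξ; rw [fourier_sub hf.int hg.int]; ring

lemma Good.Af_sub_right {f g h : EC} (hf : Good f) (hg : Good g) (hh : Good h) (τ : ℝ) :
    Af τ h (fun x => f x - g x) = Af τ h f - Af τ h g := by
  unfold Af
  rw [← integral_sub (hh.Af_int hf (re_b τ).ge) (hh.Af_int hg (re_b τ).ge)]
  congr 1; ext ξ; rw [fourierInv_sub hf.int hg.int]; ring

lemma rt_simple' {f h : SimpleFunc E3 ℂ} (hf : Integrable f) (hh : Integrable h) {τ : ℝ}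
    (hτ : τ ≠ 0) : ‖Af τ f h‖ₑ ≤ k23 τ * nL (18/13) f * nL (18/13) h := by
  have h1 := rt_simple hf hh hτ (p := 18/13) (θ := 5/9) nmm nmm nmm
    nmm
  have e : ∀ {f : SimpleFunc E3 ℂ}, Integrable f →
      nL (18/13) f = eR ((∫ x, ‖f x‖ ^ (18/13:ℝ)) ^ (1 / (18/13) : ℝ)) := by
    intro f hf
    have hi : Integrable (f.map (fun c => ‖c‖^(18/13:ℝ))) :=
      SimpleFunc.integrable_iff_finMeasSupp.2 ((SimpleFunc.integrable_iff_finMeasSupp.1 hf).map (by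
        rw [norm_zero]; exact Real.zero_rpow nmm))
    have hi' : Integrable (fun x => ‖f x‖^(18/13:ℝ)) := hi
    rw [← ofReal_rpow_of_nonneg (integral_nonneg fun x => by positivity) nmm,
      ofReal_integral_eq_lintegral_ofReal hi' (evt fun x => by positivity)]
    unfold nL Np
    congr 1
    refine lintegral_congr fun x => ?_
    rw [← ofReal_rpow_of_nonneg (norm_nonneg _) nmm, ofReal_norm]
  have ht : (|τ| ^ (-(3/2) : ℝ)) ^ (1 - 5/9 : ℝ) = |τ| ^ (-(2/3) : ℝ) := by
    rw [← Real.rpow_mul (abs_nonneg _)]; norm_num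
  rw [ht] at h1
  rw [e hf, e hh, k23, ← ENNReal.ofReal_mul psv, ← ENNReal.ofReal_mul psv,
    ← ofReal_norm]
  exact ofReal_le_ofReal h1

lemma Good.Af_disp {f h : EC} (hf : Good f) (hh : Good h) {τ : ℝ} (hτ : τ ≠ 0) :
    ‖Af τ f h‖ₑ ≤ 4 * k23 τ * nL (18/13) f * nL (18/13) h := by
  have key : ∀ {f : EC}, Good f → ∃ F : ℕ → SimpleFunc E3 ℂ, (∀ n, Good (F n)) ∧
      (∀ n x, ‖F n x‖ ≤ 2 * ‖f x‖) ∧ Tendsto (fun n => nL 2 (fun x => f x - F n x)) atTop (nhds 0) := by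
    intro f hf
    refine ⟨fun n => SimpleFunc.approxOn f hf.meas (Set.range f ∪ {0}) 0 (by simp) n, ?_, ?_, ?_⟩
    · intro n
      refine hf.of_le (SimpleFunc.measurable _) (c := 2) fun x => ?_
      rw [two_mul]
      exact SimpleFunc.norm_approxOn_zero_le hf.meas (by simp) x n
    · intro n x
      rw [two_mul]
      exact SimpleFunc.norm_approxOn_zero_le hf.meas (by simp) x n
    · have hlt : eLpNorm f 2 volume < ⊤ := by
        rw [eLpNorm_two_eq_nL]
        exact hf.nL2_ne_top.lt_top
      have := SimpleFunc.tendsto_approxOn_range_Lp_eLpNorm (p := 2) (by simp) hf.meas hlt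
      refine this.congr fun n => ?_
      rw [eLpNorm_sub_comm, eLpNorm_two_eq_nL]
      rfl
  obtain ⟨F, hF, hFb, hFl⟩ := key hf
  obtain ⟨H, hH, hHb, hHl⟩ := key hh
  have bd : ∀ {f g : EC} {p : ℝ}, 0 < p → (∀ x, ‖g x‖ ≤ 2 * ‖f x‖) → nL p g ≤ 2 * nL p f := by
    intro f g p hp hb
    unfold nL
    rw [← Np_const_mul hp (by simp)]
    refine Np_mono hp fun x => ?_
    have := ofReal_le_ofReal (hb x)
    rw [ENNReal.ofReal_mul nmm, ofReal_norm, ofReal_norm] at this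
    simpa using this
  have hlim : Tendsto (fun n => 4 * k23 τ * nL (18/13) f * nL (18/13) h +
      (nL 2 (fun x => f x - F n x) * nL 2 h + 2 * nL 2 f * nL 2 (fun x => h x - H n x))) atTop
      (nhds (4 * k23 τ * nL (18/13) f * nL (18/13) h + (0 * nL 2 h + 2 * nL 2 f * 0))) := by
    refine Tendsto.const_add _ (Tendsto.add ?_ ?_)
    · exact ENNReal.Tendsto.mul_const hFl (Or.inr hh.nL2_ne_top)
    · exact ENNReal.Tendsto.const_mul hHl (Or.inr (ENNReal.mul_ne_top (by simp) hf.nL2_ne_top))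
  rw [zero_mul, mul_zero, add_zero, add_zero] at hlim
  refine ge_of_tendsto hlim (evt fun n => ?_)
  have e : Af τ f h = Af τ (F n) (H n) + (Af τ (fun x => f x - F n x) h +
      Af τ (F n) (fun x => h x - H n x)) := by
    rw [hf.Af_sub_left (hF n) hh, hh.Af_sub_right (hH n) (hF n)]; ring
  rw [e]
  refine (enorm_add_le _ _).trans (add_le_add ?_ ((enorm_add_le _ _).trans (add_le_add ?_ ?_)))
  · refine (rt_simple' (hF n).int (hH n).int hτ).trans ?_
    calc _ ≤ k23 τ * (2 * nL (18/13) f) * (2 * nL (18/13) h) := by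
          gcongr
          · exact bd nmm (hFb n)
          · exact bd nmm (hHb n)
      _ = _ := by ring
  · exact (hf.sub (hF n)).Af_L2 hh τ
  · refine ((hF n).Af_L2 (hh.sub (hH n)) τ).trans ?_
    gcongr
    exact bd nmm (hFb n)

lemma measurable_fourier_param {f : ℝ → EC} (hf : Measurable (Function.uncurry f)) :
    Measurable (Function.uncurry fun t ξ => 𝓕 (f t) ξ) := by
  simp_rw [Real.fourier_eq]
  apply StronglyMeasurable.measurable
  have : StronglyMeasurable (fun q : (ℝ × E3) × E3 => 𝐞 (-inner ℝ q.2 q.1.2) • f q.1.1 q.2) := by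
    apply Measurable.stronglyMeasurable
    simp_rw [Circle.smul_def, smul_eq_mul]
    refine Measurable.mul ?_ (hf.comp (measurable_fst.fst.prodMk measurable_snd))
    have : Continuous (fun q : (ℝ × E3) × E3 => ((𝐞 (-inner ℝ q.2 q.1.2) : Circle) : ℂ)) := by
      have := Real.continuous_fourierChar
      fun_prop
    exact this.measurable
  exact this.integral_prod_right

lemma measurable_fourierInv_param {f : ℝ → EC} (hf : Measurable (Function.uncurry f)) :
    Measurable (Function.uncurry fun t ξ => 𝓕⁻ (f t) ξ) := by
  have h : (Function.uncurry fun t ξ => 𝓕⁻ (f t) ξ)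
      = (Function.uncurry fun t ξ => 𝓕 (f t) ξ) ∘ (fun q => (q.1, -q.2)) := by
    ext q; simp [Function.uncurry, fourierInv_eq_fourier_neg]
  rw [h]
  exact (measurable_fourier_param hf).comp (measurable_fst.prodMk measurable_snd.neg)

lemma measurable_nL_param {f : ℝ → EC} (hf : Measurable (Function.uncurry f)) (p : ℝ) :
    Measurable (fun t => nL p (f t)) := by
  unfold nL Np
  refine Measurable.pow_const ?_ _
  apply Measurable.lintegral_prod_right' (f := fun q : ℝ × E3 => ‖f q.1 q.2‖ₑ ^ p)
  exact hf.enorm.pow_const _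

lemma hls_restrict {a b : ℝ} {f g : ℝ → ENNReal} (hf : Measurable f) (hg : Measurable g)
    (hft : ∀ t ∈ Icc a b, f t ≠ ⊤) (hgt : ∀ t ∈ Icc a b, g t ≠ ⊤)
    (hF : Np (3/2) (volume.restrict (Icc a b)) f ≠ ⊤)
    (hG : Np (3/2) (volume.restrict (Icc a b)) g ≠ ⊤) :
    ∫⁻ t in Icc a b, ∫⁻ s in Icc a b, f t * k23 (t - s) * g s ≤
      28 * Np (3/2) (volume.restrict (Icc a b)) f
        * Np (3/2) (volume.restrict (Icc a b)) g := by
  have hI : MeasurableSet (Icc a b) := measurableSet_Icc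
  have e : ∀ {f : ℝ → ENNReal}, Np (3/2) volume ((Icc a b).indicator f)
      = Np (3/2) (volume.restrict (Icc a b)) f := by
    intro f
    unfold Np
    congr 1
    rw [← lintegral_indicator hI]
    refine lintegral_congr fun t => ?_
    by_cases ht : t ∈ Icc a b
    · simp [ht]
    · simp only [ht, Set.indicator_of_notMem, not_false_eq_true]
      exact ENNReal.zero_rpow_of_pos nmm
  have ht : ∀ {f : ℝ → ENNReal}, (∀ t ∈ Icc a b, f t ≠ ⊤) → ∀ t, (Icc a b).indicator f t ≠ ⊤ := by
    intro f hf t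
    by_cases ht : t ∈ Icc a b
    · rw [Set.indicator_of_mem ht]; exact hf t ht
    · rw [Set.indicator_of_notMem ht]; simp
  have := hls _ _ (hf.indicator hI) (hg.indicator hI) (ht hft) (ht hgt) (by rwa [e]) (by rwa [e])
  rw [e, e] at this
  refine le_trans (le_of_eq ?_) this
  rw [← lintegral_indicator hI]
  refine lintegral_congr fun t => ?_
  by_cases ht : t ∈ Icc a b
  · simp only [ht, Set.indicator_of_mem]
    rw [← lintegral_indicator hI]
    refine lintegral_congr fun s => ?_
    by_cases hs : s ∈ Icc a b <;> simp [hs]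
  · simp [ht]

lemma Good.nL_ne_top {f : EC} (hf : Good f) {p : ℝ} (hp : 1 < p) (hp2 : p < 2) : nL p f ≠ ⊤ := by
  have h1 : nL 1 f ≠ ⊤ := by
    unfold nL Np
    simpa using hf.int.2.ne
  have := Np_interp (μ := (volume : Measure E3)) (p := 1) (q := 2) (r := p) (θ := 2 / p - 1) nmm
    nmm (by rw [sub_pos, lt_div_iff₀ (by linarith)]; linarith)
    (by rw [sub_lt_iff_lt_add, div_lt_iff₀ (by linarith)]; linarith) (by field_simp; ring)
    (F := fun x => ‖f x‖ₑ) hf.meas.enorm.aemeasurable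
  refine ne_top_of_le_ne_top ?_ this
  refine ENNReal.mul_ne_top ?_ ?_
  · exact rpow_ne_top_of_nonneg (by
      rw [sub_nonneg, le_div_iff₀ (by linarith)]; linarith) h1
  · exact rpow_ne_top_of_nonneg (by
      rw [sub_nonneg, sub_le_iff_le_add, div_le_iff₀ (by linarith)]; linarith) hf.nL2_ne_top

/-- the dual function. -/
def dualG (Φ : EC) (x : E3) : ℂ :=
  (((nL (18/5) Φ).toReal ^ (-(3/5) : ℝ) * ‖Φ x‖ ^ (8/5 : ℝ) : ℝ) : ℂ) * cj (Φ x)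

lemma dualG_enorm (Φ : EC) (x : E3) :
    ‖dualG Φ x‖ₑ = eR ((nL (18/5) Φ).toReal ^ (-(3/5) : ℝ)) * ‖Φ x‖ₑ ^ (13/5:ℝ) := by
  unfold dualG
  rw [enorm_mul, RCLike.enorm_conj, ← ofReal_norm (((_ : ℝ) : ℂ)), Complex.norm_real,
    Real.norm_of_nonneg psv, ENNReal.ofReal_mul psv,
    ← ofReal_rpow_of_nonneg (norm_nonneg _) nmm, ofReal_norm, mul_assoc]
  congr 1
  have : (13/5:ℝ) = 8/5 + 1 := by norm_num
  rw [this, rpow_add_of_nonneg _ _ nmm nmm, ENNReal.rpow_one]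

lemma dualG_meas {Φ : EC} (h : Measurable Φ) : Measurable (dualG Φ) := by
  unfold dualG
  refine Measurable.mul ?_ (Complex.continuous_conj.measurable.comp h)
  exact Complex.measurable_ofReal.comp ((h.norm.pow_const _).const_mul _)

lemma dualG_good {Φ : EC} (h : Good Φ) {B : ℝ} (hB : ∀ x, ‖Φ x‖ ≤ B) : Good (dualG Φ) := by
  refine h.of_le (dualG_meas h.meas) (c := (nL (18/5) Φ).toReal ^ (-(3/5) : ℝ) * B ^ (8/5:ℝ)) fun x => ?_
  unfold dualG
  rw [norm_mul, RCLike.norm_conj, Complex.norm_real, Real.norm_of_nonneg psv]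
  gcongr
  exact hB x

lemma wt_mul {n : ENNReal} (hn : n ≠ ⊤) {e : ℝ} (he : 3/5 < e) :
    eR (n.toReal ^ (-(3/5) : ℝ)) * n ^ e = n ^ (e - 3/5) := by
  by_cases h0 : n = 0
  · rw [h0, ENNReal.zero_rpow_of_pos (by linarith), ENNReal.zero_rpow_of_pos (by linarith), mul_zero]
  · rw [← ofReal_rpow_of_pos (ENNReal.toReal_pos h0 hn), ENNReal.ofReal_toReal hn,
      ← ENNReal.rpow_add _ _ h0 hn]
    congr 1; ring

lemma dualG_norm {Φ : EC} (hn : nL (18/5) Φ ≠ ⊤) : nL (18/13) (dualG Φ) = nL (18/5) Φ ^ (2:ℝ) := by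
  unfold nL at *
  simp_rw [dualG_enorm]
  rw [Np_const_mul nmm (by simp), Np_pow_comp nmm nmm]
  have : (18/13 * (13/5) : ℝ) = 18/5 := by norm_num
  rw [this]
  have := wt_mul hn (e := 13/5) nmm
  unfold nL at *
  rw [this]; norm_num

lemma dualG_norm2 {Φ : EC} (hm : Measurable Φ) (hn : nL (18/5) Φ ≠ ⊤) :
    nL 2 (dualG Φ) ≤ nL 6 Φ ^ (2:ℝ) := by
  have hInt := Np_interp (μ := (volume : Measure E3)) (p := 18/5) (q := 6) (r := 26/5) (θ := 3/13)
    nmm nmm nmm nmm nmm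
    (F := fun x => ‖Φ x‖ₑ) hm.enorm.aemeasurable
  have hw := wt_mul hn (e := 3/5 + 1) nmm
  unfold nL at *
  simp_rw [dualG_enorm]
  rw [Np_const_mul nmm (by simp), Np_pow_comp nmm nmm]
  have : (2 * (13/5) : ℝ) = 26/5 := by norm_num
  rw [this]
  set n := Np (18/5) volume (fun x => ‖Φ x‖ₑ) with hn'
  set m := Np 6 volume (fun x => ‖Φ x‖ₑ)
  calc eR (n.toReal ^ (-(3/5):ℝ)) * Np (26/5) volume (fun x => ‖Φ x‖ₑ) ^ (13/5:ℝ)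
      ≤ eR (n.toReal ^ (-(3/5):ℝ)) * (n ^ (3/13:ℝ) * m ^ (1 - 3/13:ℝ)) ^ (13/5:ℝ) := by
        gcongr
    _ = eR (n.toReal ^ (-(3/5):ℝ)) * n ^ (3/5:ℝ) * m ^ (2:ℝ) := by
        rw [mul_rpow_of_nonneg _ _ nmm, ← ENNReal.rpow_mul, ← ENNReal.rpow_mul, mul_assoc]
        norm_num
    _ ≤ 1 * m ^ (2:ℝ) := by
        gcongr
        by_cases h0 : n = 0
        · rw [h0, ENNReal.zero_rpow_of_pos nmm, mul_zero]; simp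
        · rw [← ofReal_rpow_of_pos (ENNReal.toReal_pos h0 hn), ENNReal.ofReal_toReal hn,
            ← ENNReal.rpow_add _ _ h0 hn]
          norm_num
    _ = _ := one_mul _

lemma dualG_pair {Φ : EC} (hn : nL (18/5) Φ ≠ ⊤) (hm : Measurable Φ) :
    ∫ x, Φ x * dualG Φ x = (((nL (18/5) Φ ^ (3:ℝ)).toReal : ℝ) : ℂ) := by
  have e1 : ∀ x, Φ x * dualG Φ x = (((nL (18/5) Φ).toReal ^ (-(3/5) : ℝ) * ‖Φ x‖ ^ (18/5:ℝ) : ℝ) : ℂ) := by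
    intro x
    unfold dualG
    rw [mul_left_comm, Complex.mul_conj, Complex.normSq_eq_norm_sq, ← Complex.ofReal_mul, mul_assoc]
    congr 2
    have : (18/5:ℝ) = 8/5 + 2 := by norm_num
    rw [this, Real.rpow_add_of_nonneg (norm_nonneg _) nmm nmm]
    norm_num
  simp_rw [e1]
  rw [integral_complex_ofReal, integral_eq_lintegral_of_nonneg_ae (evt fun x => by positivity)
    ((hm.norm.pow_const _).const_mul _).aestronglyMeasurable]
  congr 2
  simp_rw [fun x => ENNReal.ofReal_mul (q := ‖Φ x‖ ^ (18/5:ℝ)) (by positivity : 0 ≤ (nL (18/5) Φ).toReal ^ (-(3/5) : ℝ)),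
    fun x => (ofReal_rpow_of_nonneg (norm_nonneg (Φ x)) (by norm_num : (0:ℝ) ≤ 18/5)).symm, ofReal_norm]
  rw [lintegral_const_mul' _ _ (by simp), ← Np_rpow nmm]
  have := wt_mul hn (e := 18/5) nmm
  unfold nL at *
  rw [this]; norm_num

/-- phase of the free flow. -/
def ph (t : ℝ) (ξ : E3) : ℂ := gau (4 * π ^ 2 * t * I) ξ

lemma norm_ph (t : ℝ) (ξ : E3) : ‖ph t ξ‖ = 1 := by
  unfold ph; rw [norm_gau, re_b]; simp

lemma ph_zero (ξ : E3) : ph 0 ξ = 1 := by simp [ph, gau]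

lemma ph_add (s t : ℝ) (ξ : E3) : ph (s + t) ξ = ph s ξ * ph t ξ := by
  unfold ph gau; rw [← Complex.exp_add]; congr 1; push_cast; ring

lemma ph_conj (t : ℝ) (ξ : E3) : cj (ph t ξ) = ph (-t) ξ := by
  unfold ph gau; rw [← Complex.exp_conj]; congr 1
  simp only [map_mul, map_neg, Complex.conj_ofReal, Complex.conj_I, map_pow, map_ofNat]
  push_cast; ring

lemma enorm_ph (t : ℝ) (ξ : E3) : ‖ph t ξ‖ₑ = 1 := by
  rw [← ofReal_norm, norm_ph]; simp

lemma Good.conj {f : EC} (hf : Good f) : Good (fun x => cj (f x)) :=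
  hf.of_le (c := 1) (Complex.continuous_conj.measurable.comp hf.meas) fun x => by simp

lemma dualG_meas_param {Φ : ℝ → EC} (h : Measurable (Function.uncurry Φ)) :
    Measurable (Function.uncurry fun t => dualG (Φ t)) := by
  unfold dualG Function.uncurry
  refine Measurable.mul ?_ (Complex.continuous_conj.measurable.comp h)
  refine Complex.measurable_ofReal.comp (Measurable.mul ?_ (h.norm.pow_const _))
  exact ((measurable_nL_param h (18/5)).ennreal_toReal.comp measurable_fst).pow_const _

lemma measurable_ph_sub (t0 : ℝ) : Measurable (fun q : ℝ × E3 => ph (q.1 - t0) q.2) := by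
  have h : Continuous (fun q : ℝ × E3 => ph (q.1 - t0) q.2) := by unfold ph gau; fun_prop
  exact h.measurable

/-- integrability on the product needed for the `TT*` argument. -/
lemma TT_int {a b : ℝ} {G : ℝ → EC} (hGm : Measurable (Function.uncurry G))
    (hG : ∀ t ∈ Icc a b, Good (G t)) {M : ENNReal} (hM : M ≠ ⊤) (hG2 : ∀ t ∈ Icc a b, nL 2 (G t) ≤ M) (t0 : ℝ) {f : EC} (hf : Good f) :
    Integrable (fun q : ℝ × E3 => ph (q.1 - t0) q.2 * 𝓕 f q.2 * 𝓕⁻ (G q.1) q.2)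
      ((volume.restrict (Icc a b)).prod volume) := by
  have hm : Measurable (fun q : ℝ × E3 => ph (q.1 - t0) q.2 * 𝓕 f q.2 * 𝓕⁻ (G q.1) q.2) := by
    have h1 := measurable_ph_sub t0
    have h2 : Measurable (fun q : ℝ × E3 => 𝓕 f q.2) :=
      (continuous_fourier hf.int).measurable.comp measurable_snd
    have h3 : Measurable (fun q : ℝ × E3 => 𝓕⁻ (G q.1) q.2) := measurable_fourierInv_param hGm
    exact (h1.mul h2).mul h3
  refine ⟨hm.aestronglyMeasurable, ?_⟩
  rw [HasFiniteIntegral, lintegral_prod _ hm.enorm.aemeasurable]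
  calc _ ≤ ∫⁻ t in Icc a b, nL 2 f * M := by
        refine setLIntegral_mono measurable_const fun t ht => ?_
        simp_rw [mul_assoc, enorm_mul, enorm_ph, one_mul, ← enorm_mul]
        exact (hf.prod_le (hG t ht)).trans (by gcongr; exact hG2 t ht)
    _ < ⊤ := by
        rw [setLIntegral_const]
        exact ENNReal.mul_lt_top (ENNReal.mul_lt_top hf.nL2_ne_top.lt_top hM.lt_top) (by simp)

lemma TT_int2 {a b : ℝ} {G : ℝ → EC} (hGm : Measurable (Function.uncurry G))
    (hG : ∀ t ∈ Icc a b, Good (G t)) {M : ENNReal} (hM : M ≠ ⊤) (hG2 : ∀ t ∈ Icc a b, nL 2 (G t) ≤ M) (t0 : ℝ) :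
    Integrable (fun q : E3 × (ℝ × ℝ) => (ph (q.2.1 - t0) q.1 * 𝓕⁻ (G q.2.1) q.1) *
      cj (ph (q.2.2 - t0) q.1 * 𝓕⁻ (G q.2.2) q.1))
      (volume.prod ((volume.restrict (Icc a b)).prod (volume.restrict (Icc a b)))) := by
  have hA : Measurable (fun q : ℝ × E3 => ph (q.1 - t0) q.2 * 𝓕⁻ (G q.1) q.2) := by
    have h3 : Measurable (fun q : ℝ × E3 => 𝓕⁻ (G q.1) q.2) := measurable_fourierInv_param hGm
    exact (measurable_ph_sub t0).mul h3
  have hm : Measurable (fun q : E3 × (ℝ × ℝ) => (ph (q.2.1 - t0) q.1 * 𝓕⁻ (G q.2.1) q.1) *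
      cj (ph (q.2.2 - t0) q.1 * 𝓕⁻ (G q.2.2) q.1)) := by
    have p1 : Measurable (fun q : E3 × (ℝ × ℝ) => ((q.2.1, q.1) : ℝ × E3)) :=
      measurable_snd.fst.prodMk measurable_fst
    have p2 : Measurable (fun q : E3 × (ℝ × ℝ) => ((q.2.2, q.1) : ℝ × E3)) :=
      measurable_snd.snd.prodMk measurable_fst
    have a1 := hA.comp p1
    have a2 := Complex.continuous_conj.measurable.comp (hA.comp p2)
    exact a1.mul a2
  refine ⟨hm.aestronglyMeasurable, ?_⟩
  rw [HasFiniteIntegral, lintegral_prod_symm _ hm.enorm.aemeasurable,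
    lintegral_prod _ hm.enorm.lintegral_prod_left'.aemeasurable]
  calc _ ≤ ∫⁻ t in Icc a b, ∫⁻ s in Icc a b, M * M := by
        refine setLIntegral_mono measurable_const fun t ht => ?_
        refine setLIntegral_mono measurable_const fun s hs => ?_
        have := sqint_mul (continuous_fourierInv (hG t ht).int) (continuous_fourierInv (hG s hs).int)
          (fourierInv_L2 (hG t ht).meas (hG t ht).int) (fourierInv_L2 (hG s hs).meas (hG s hs).int)
        refine le_trans (le_of_eq ?_) (this.trans (mul_le_mul' (hG2 t ht) (hG2 s hs)))
        refine lintegral_congr fun ξ => ?_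
        simp only [enorm_mul, RCLike.enorm_conj, enorm_ph, one_mul]
    _ < ⊤ := by
        rw [setLIntegral_const, setLIntegral_const]
        exact ENNReal.mul_lt_top (ENNReal.mul_lt_top (ENNReal.mul_lt_top hM.lt_top hM.lt_top) (by simp)) (by simp)

lemma TT_bound {a b : ℝ} {G : ℝ → EC} (hGm : Measurable (Function.uncurry G))
    (hG : ∀ t ∈ Icc a b, Good (G t)) {M : ENNReal} (hM : M ≠ ⊤) (hG2 : ∀ t ∈ Icc a b, nL 2 (G t) ≤ M) (t0 : ℝ) (hX : Np (3/2) (volume.restrict (Icc a b)) (fun t => nL (18/13) (G t)) ≠ ⊤) :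
    ∫⁻ ξ, ‖∫ t in Icc a b, ph (t - t0) ξ * 𝓕⁻ (G t) ξ‖ₑ ^ 2 ≤
      (11 * Np (3/2) (volume.restrict (Icc a b)) (fun t => nL (18/13) (G t))) ^ 2 := by
  set μ := volume.restrict (Icc a b) with hμ
  set V : EC := fun ξ => ∫ t, ph (t - t0) ξ * 𝓕⁻ (G t) ξ ∂μ with hV
  have hI2 := TT_int2 hGm hG hM hG2 t0
  have hVV : ∀ ξ, V ξ * cj (V ξ) = ∫ q : ℝ × ℝ, (ph (q.1 - t0) ξ * 𝓕⁻ (G q.1) ξ) *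
      cj (ph (q.2 - t0) ξ * 𝓕⁻ (G q.2) ξ) ∂(μ.prod μ) := by
    intro ξ
    rw [hV, ← integral_conj]
    exact (integral_prod_mul (fun t => ph (t - t0) ξ * 𝓕⁻ (G t) ξ)
      (fun t => cj (ph (t - t0) ξ * 𝓕⁻ (G t) ξ))).symm
  have hVi : Integrable (fun ξ => V ξ * cj (V ξ)) := by
    simp_rw [hVV]
    exact hI2.integral_prod_left
  have e1 : ∫⁻ ξ, ‖V ξ‖ₑ ^ 2 = ‖∫ ξ, V ξ * cj (V ξ)‖ₑ := by
    have e : ∀ ξ, V ξ * cj (V ξ) = ((‖V ξ‖ ^ 2 : ℝ) : ℂ) := fun ξ => by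
      rw [Complex.mul_conj, Complex.normSq_eq_norm_sq]
    simp_rw [e] at hVi ⊢
    rw [integral_complex_ofReal, ← ofReal_norm (_ : ℂ), Complex.norm_real, Real.norm_of_nonneg
        (integral_nonneg fun ξ => by positivity), ofReal_integral_eq_lintegral_ofReal
          (by simpa only [RCLike.re_eq_complex_re, Complex.ofReal_re] using hVi.re)
          (evt fun ξ => by positivity)]
    refine lintegral_congr fun ξ => ?_
    rw [ENNReal.ofReal_pow psv, ofReal_norm]
  have e2 : ∫ ξ, V ξ * cj (V ξ) = ∫ q : ℝ × ℝ, Af (q.1 - q.2) (fun x => cj (G q.2 x)) (G q.1) ∂(μ.prod μ) := by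
    simp_rw [hVV]
    rw [integral_integral_swap hI2]
    congr 1; ext q
    unfold Af
    congr 1; ext ξ
    have hc : cj (𝓕⁻ (G q.2) ξ) = 𝓕 (fun x => cj (G q.2 x)) ξ := by
      have := fourierInv_conj (fun x => cj (G q.2 x)) ξ
      simp only [Complex.conj_conj] at this
      change 𝓕⁻ (G q.2) ξ = _ at this
      rw [this, Complex.conj_conj]
    rw [map_mul, ph_conj, hc]
    have : ph (q.1 - t0) ξ * ph (-(q.2 - t0)) ξ = gau (4 * π ^ 2 * ((q.1 - q.2 : ℝ) : ℂ) * I) ξ := by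
      rw [← ph_add]; unfold ph; congr 2; push_cast; ring
    rw [← this]; ring
  rw [e1, e2]
  refine (enorm_integral_le_lintegral_enorm _).trans ?_
  have hnm : Measurable (fun t => nL (18/13) (G t)) := measurable_nL_param hGm _
  calc ∫⁻ q : ℝ × ℝ, ‖Af (q.1 - q.2) (fun x => cj (G q.2 x)) (G q.1)‖ₑ ∂(μ.prod μ)
      ≤ ∫⁻ q : ℝ × ℝ, 4 * (nL (18/13) (G q.1) * k23 (q.1 - q.2) * nL (18/13) (G q.2)) ∂(μ.prod μ) := by
        refine lintegral_mono_ae ?_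
        have h1 : ∀ᵐ q : ℝ × ℝ ∂(μ.prod μ), q.1 ∈ Icc a b ∧ q.2 ∈ Icc a b := by
          rw [hμ, Measure.prod_restrict]
          exact ae_restrict_mem (measurableSet_Icc.prod measurableSet_Icc)
        have h2 : ∀ᵐ q : ℝ × ℝ ∂(μ.prod μ), q.1 ≠ q.2 := by
          rw [ae_iff]
          simp only [ne_eq, not_not]
          rw [Measure.measure_prod_null (measurableSet_eq_fun measurable_fst measurable_snd)]
          refine evt fun t => ?_
          have : (Prod.mk t ⁻¹' {q : ℝ × ℝ | q.1 = q.2}) = {t} := by ext s; simp [eq_comm]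
          change μ (Prod.mk t ⁻¹' {q : ℝ × ℝ | q.1 = q.2}) = 0
          rw [this]; simp [hμ]
        filter_upwards [h1, h2] with q hq hne
        refine ((hG q.2 hq.2).conj.Af_disp (hG q.1 hq.1) (sub_ne_zero.2 hne)).trans (le_of_eq ?_)
        rw [nL_conj]; ring
    _ = 4 * ∫⁻ t, ∫⁻ s, nL (18/13) (G t) * k23 (t - s) * nL (18/13) (G s) ∂μ ∂μ := by
        have hm : Measurable (fun q : ℝ × ℝ => nL (18/13) (G q.1) * k23 (q.1 - q.2) * nL (18/13) (G q.2)) :=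
          ((hnm.comp measurable_fst).mul (measurable_k23.comp (measurable_fst.sub measurable_snd))).mul
            (hnm.comp measurable_snd)
        rw [lintegral_const_mul _ hm, lintegral_prod _ hm.aemeasurable]
    _ ≤ 4 * (28 * Np (3/2) μ (fun t => nL (18/13) (G t)) * Np (3/2) μ (fun t => nL (18/13) (G t))) := by
        gcongr
        have hne : ∀ t ∈ Icc a b, nL (18/13) (G t) ≠ ⊤ :=
          fun t ht => (hG t ht).nL_ne_top nmm nmm
        exact hls_restrict hnm hnm hne hne hX hX
    _ ≤ _ := by
        rw [mul_pow, sq (Np _ _ _), ← mul_assoc, ← mul_assoc, mul_assoc]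
        gcongr
        norm_num

lemma Good.schwartz (f : SchwartzMap E3 ℂ) : Good (f : EC) := by
  refine ⟨f.continuous.measurable, f.integrable, ?_⟩
  have := (f.memLp 2 (volume : Measure E3)).integrable_norm_pow nmm
  simpa using this

lemma schwartz_bdd (f : SchwartzMap E3 ℂ) : ∃ B : ℝ, ∀ x, ‖f x‖ ≤ B :=
  ⟨_, fun x => SchwartzMap.norm_le_seminorm ℝ f x⟩

lemma schwartz_inv (f : SchwartzMap E3 ℂ) : 𝓕⁻ (𝓕 (f : EC)) = f := by
  rw [← SchwartzMap.fourier_coe, ← SchwartzMap.fourierInv_coe]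
  simp

lemma schwartz_fourier_int (f : SchwartzMap E3 ℂ) : Integrable (𝓕 (f : EC)) := by
  rw [← SchwartzMap.fourier_coe]; exact (𝓕 f).integrable

lemma duh_pair {a b t0 t : ℝ} (ht0 : t0 ∈ Icc a b) (ht : t ∈ Icc a b) {F : ℝ → EC}
    (hFm : Measurable (Function.uncurry F)) (hF : ∀ s ∈ Icc a b, Good (F s)) {M : ENNReal}
    (hM : M ≠ ⊤) (hF2 : ∀ s ∈ Icc a b, nL 2 (F s) ≤ M) {g : EC} (hg : Good g) :
    Integrable (fun ξ => (∫ s in t0..t, ph (t - s) ξ * 𝓕 (F s) ξ) * 𝓕⁻ g ξ) ∧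
    ‖∫ ξ, (∫ s in t0..t, ph (t - s) ξ * 𝓕 (F s) ξ) * 𝓕⁻ g ξ‖ₑ ≤
      ∫⁻ s in Icc a b, ‖Af (t - s) (F s) g‖ₑ := by
  set ν := volume.restrict (uIoc t0 t) with hν
  have hsub : uIoc t0 t ⊆ Icc a b :=
    Set.uIoc_subset_uIcc.trans (Set.uIcc_subset_Icc ht0 ht)
  have hνμ : ν ≤ volume.restrict (Icc a b) := Measure.restrict_mono hsub le_rfl
  have hm : Measurable (fun q : ℝ × E3 => ph (t - q.1) q.2 * 𝓕 (F q.1) q.2 * 𝓕⁻ g q.2) := by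
    have h1 : Continuous (fun q : ℝ × E3 => ph (t - q.1) q.2) := by unfold ph gau; fun_prop
    have h2 : Measurable (fun q : ℝ × E3 => 𝓕 (F q.1) q.2) := measurable_fourier_param hFm
    have h3 : Measurable (fun q : ℝ × E3 => 𝓕⁻ g q.2) :=
      (continuous_fourierInv hg.int).measurable.comp measurable_snd
    exact (h1.measurable.mul h2).mul h3
  have hI : Integrable (fun q : ℝ × E3 => ph (t - q.1) q.2 * 𝓕 (F q.1) q.2 * 𝓕⁻ g q.2)
      (ν.prod volume) := by
    refine ⟨hm.aestronglyMeasurable, ?_⟩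
    rw [HasFiniteIntegral, lintegral_prod _ hm.enorm.aemeasurable]
    calc _ ≤ ∫⁻ s in uIoc t0 t, M * nL 2 g := by
          refine setLIntegral_mono measurable_const fun s hs => ?_
          simp_rw [mul_assoc, enorm_mul, enorm_ph, one_mul, ← enorm_mul]
          exact ((hF s (hsub hs)).prod_le hg).trans (by gcongr; exact hF2 s (hsub hs))
      _ < ⊤ := by
          rw [setLIntegral_const]
          exact ENNReal.mul_lt_top (ENNReal.mul_lt_top hM.lt_top hg.nL2_ne_top.lt_top)
            ((measure_mono hsub).trans_lt (by simp))
  set c : ℝ := if t0 ≤ t then 1 else -1 with hc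
  have hcn : ‖c‖ₑ = 1 := by rw [hc]; split_ifs <;> simp
  have e : ∀ ξ, (∫ s in t0..t, ph (t - s) ξ * 𝓕 (F s) ξ) * 𝓕⁻ g ξ =
      c • ∫ s, ph (t - s) ξ * 𝓕 (F s) ξ * 𝓕⁻ g ξ ∂ν := by
    intro ξ
    rw [intervalIntegral.intervalIntegral_eq_integral_uIoc, integral_mul_const, smul_mul_assoc]
  simp_rw [e]
  have hI' := hI.integral_prod_right
  refine ⟨hI'.smul c, ?_⟩
  rw [integral_smul, enorm_smul, hcn, one_mul]
  have hsw : ∫ ξ, ∫ s, ph (t - s) ξ * 𝓕 (F s) ξ * 𝓕⁻ g ξ ∂ν = ∫ s, Af (t - s) (F s) g ∂ν := by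
    exact (integral_integral_swap (f := fun s ξ => ph (t - s) ξ * 𝓕 (F s) ξ * 𝓕⁻ g ξ) hI).symm
  rw [hsw]
  refine (enorm_integral_le_lintegral_enorm _).trans ?_
  exact lintegral_mono' hνμ le_rfl

lemma hom_pair {a b t0 : ℝ} {G : ℝ → EC} (hGm : Measurable (Function.uncurry G))
    (hG : ∀ t ∈ Icc a b, Good (G t)) {M : ENNReal} (hM : M ≠ ⊤)
    (hG2 : ∀ t ∈ Icc a b, nL 2 (G t) ≤ M) {f : EC} (hf : Good f)
    (hX : Np (3/2) (volume.restrict (Icc a b)) (fun t => nL (18/13) (G t)) ≠ ⊤) :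
    Integrable (fun t => Af (t - t0) f (G t)) (volume.restrict (Icc a b)) ∧
    ‖∫ t in Icc a b, Af (t - t0) f (G t)‖ₑ ≤ 11 * nL 2 f *
      Np (3/2) (volume.restrict (Icc a b)) (fun t => nL (18/13) (G t)) := by
  have hI := TT_int hGm hG hM hG2 t0 hf
  refine ⟨hI.integral_prod_left, ?_⟩
  have hsw : ∫ t in Icc a b, Af (t - t0) f (G t) =
      ∫ ξ, 𝓕 f ξ * ∫ t in Icc a b, ph (t - t0) ξ * 𝓕⁻ (G t) ξ := by
    have := integral_integral_swap (f := fun t ξ => ph (t - t0) ξ * 𝓕 f ξ * 𝓕⁻ (G t) ξ) hI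
    refine this.trans ?_
    congr 1; ext ξ
    rw [← integral_const_mul]
    congr 1; ext t; ring
  rw [hsw]
  refine (enorm_integral_le_lintegral_enorm _).trans ?_
  have hVm : Measurable (fun ξ => ∫ t in Icc a b, ph (t - t0) ξ * 𝓕⁻ (G t) ξ) := by
    have h3 : Measurable (fun q : ℝ × E3 => 𝓕⁻ (G q.1) q.2) := measurable_fourierInv_param hGm
    have h4 := (measurable_ph_sub t0).mul h3
    exact h4.stronglyMeasurable.integral_prod_left'.measurable
  have hTT := TT_bound hGm hG hM hG2 t0 hX
  have hCS := Np_mul_le (μ := (volume : Measure E3)) (p := 2) (q := 2) (r := 1) nmm nmm nmm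
    (continuous_fourier hf.int).enorm.measurable.aemeasurable hVm.enorm.aemeasurable
  simp_rw [enorm_mul]
  have e1 : ∀ H : E3 → ENNReal, Np 1 volume H = ∫⁻ x, H x := fun H => by simp [Np]
  have e2 : ∀ (H : E3 → ENNReal) (B : ENNReal), ∫⁻ x, H x ^ 2 ≤ B ^ 2 → Np 2 volume H ≤ B := by
    intro H B h
    have h' : Np 2 volume H ^ (2:ℝ) ≤ B ^ (2:ℝ) := by
      rw [Np_rpow nmm]; simpa [ENNReal.rpow_two] using h
    exact (ENNReal.rpow_le_rpow_iff nmm).1 h'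
  rw [e1] at hCS
  refine hCS.trans ((mul_le_mul' (e2 _ _ (fourier_L2 hf.meas hf.int)) (e2 _ _ hTT)).trans (le_of_eq ?_))
  ring

lemma hls_pull {f g : ℝ → ENNReal} (hf : Measurable f) (hg : Measurable g) (c : ENNReal) (a b : ℝ) :
    ∫⁻ t in Icc a b, ∫⁻ s in Icc a b, c * (f t * k23 (t - s) * g s) =
      c * ∫⁻ t in Icc a b, ∫⁻ s in Icc a b, f t * k23 (t - s) * g s := by
  have hm : Measurable (fun q : ℝ × ℝ => f q.1 * k23 (q.1 - q.2) * g q.2) :=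
    ((hf.comp measurable_fst).mul (measurable_k23.comp (measurable_fst.sub measurable_snd))).mul
      (hg.comp measurable_snd)
  have hm1 : Measurable (fun t => ∫⁻ s in Icc a b, f t * k23 (t - s) * g s) :=
    hm.lintegral_prod_right'
  rw [← lintegral_const_mul _ hm1]
  refine lintegral_congr fun t => ?_
  have hm2 : Measurable (fun s => f t * k23 (t - s) * g s) :=
    hm.comp (measurable_const.prodMk measurable_id)
  rw [lintegral_const_mul _ hm2]

/-- Endpoint-free Strichartz estimate for the pair `(3, 18/5)`. -/
theorem strichartz {a b t0 : ℝ} (ht0 : t0 ∈ Icc a b) {Φ F : ℝ → EC}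
    (hΦm : Measurable (Function.uncurry Φ)) (hFm : Measurable (Function.uncurry F))
    (hΦS : ∀ t ∈ Icc a b, ∃ f : SchwartzMap E3 ℂ, Φ t = f)
    (hF : ∀ t ∈ Icc a b, Good (F t)) {M : ENNReal} (hM : M ≠ ⊤)
    (hΦ6 : ∀ t ∈ Icc a b, nL 6 (Φ t) ≤ M) (hΦ18 : ∀ t ∈ Icc a b, nL (18/5) (Φ t) ≤ M)
    (hF2 : ∀ t ∈ Icc a b, nL 2 (F t) ≤ M)
    (hD : ∀ t ∈ Icc a b, ∀ ξ, 𝓕 (Φ t) ξ = ph (t - t0) ξ * 𝓕 (Φ t0) ξ +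
      ∫ s in t0..t, ph (t - s) ξ * 𝓕 (F s) ξ) :
    Np 3 (volume.restrict (Icc a b)) (fun t => nL (18/5) (Φ t)) ≤
      112 * (nL 2 (Φ t0) + Np (3/2) (volume.restrict (Icc a b)) (fun t => nL (18/13) (F t))) := by
  set μ := volume.restrict (Icc a b) with hμ
  by_cases hFX : Np (3/2) μ (fun t => nL (18/13) (F t)) = ⊤
  · rw [hFX]; simp
  set n : ℝ → ENNReal := fun t => nL (18/5) (Φ t) with hn
  have hnm : Measurable n := measurable_nL_param hΦm _
  have hnt : ∀ t ∈ Icc a b, n t ≠ ⊤ := fun t ht => ne_top_of_le_ne_top hM (hΦ18 t ht)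
  set G : ℝ → EC := fun t => dualG (Φ t) with hGdef
  have hGm : Measurable (Function.uncurry G) := dualG_meas_param hΦm
  have hΦg : ∀ t ∈ Icc a b, Good (Φ t) := fun t ht => by
    obtain ⟨f, hf⟩ := hΦS t ht; rw [hf]; exact Good.schwartz f
  have hGg : ∀ t ∈ Icc a b, Good (G t) := fun t ht => by
    obtain ⟨f, hf⟩ := hΦS t ht
    obtain ⟨B, hB⟩ := schwartz_bdd f
    exact dualG_good (hΦg t ht) (B := B) (by rw [hf]; exact hB)
  have hG2 : ∀ t ∈ Icc a b, nL 2 (G t) ≤ M ^ (2:ℝ) := fun t ht =>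
    (dualG_norm2 (hΦg t ht).meas (hnt t ht)).trans (ENNReal.rpow_le_rpow (hΦ6 t ht) nmm)
  have hM2 : M ^ (2:ℝ) ≠ ⊤ := rpow_ne_top_of_nonneg nmm hM
  have hnt3 : Np 3 μ n ≠ ⊤ := by
    have : ∫⁻ t, n t ^ (3:ℝ) ∂μ < ⊤ := by
      calc _ ≤ ∫⁻ t in Icc a b, M ^ (3:ℝ) :=
            setLIntegral_mono measurable_const fun t ht => ENNReal.rpow_le_rpow (hΦ18 t ht) nmm
        _ < ⊤ := by
            rw [setLIntegral_const]
            exact ENNReal.mul_lt_top (ENNReal.rpow_lt_top_of_nonneg nmm hM) (by simp)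
    exact rpow_ne_top_of_nonneg nmm this.ne
  have hGX : Np (3/2) μ (fun t => nL (18/13) (G t)) = Np 3 μ n ^ (2:ℝ) := by
    have h1 : Np (3/2) μ (fun t => nL (18/13) (G t)) = Np (3/2) μ (fun t => n t ^ (2:ℝ)) := by
      refine Np_congr_ae ?_
      filter_upwards [ae_restrict_mem measurableSet_Icc] with t ht
      exact dualG_norm (hnt t ht)
    rw [h1, Np_pow_comp nmm nmm]
    norm_num
  have hGXt : Np (3/2) μ (fun t => nL (18/13) (G t)) ≠ ⊤ := by
    rw [hGX]; exact rpow_ne_top_of_nonneg nmm hnt3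
  obtain ⟨hHi, hHb⟩ := hom_pair (t0 := t0) hGm hGg hM2 hG2 (hΦg t0 ht0) hGXt
  rw [← hμ] at hHi hHb
  set P : ℝ → ℂ := fun t => (((n t ^ (3:ℝ)).toReal : ℝ) : ℂ) with hP
  have hPb : ∀ t ∈ Icc a b, ‖P t‖ₑ = n t ^ (3:ℝ) := fun t ht => by
    rw [hP]
    simp only [← ofReal_norm, Complex.norm_real, norm_of_nonneg ENNReal.toReal_nonneg]
    exact ENNReal.ofReal_toReal (rpow_ne_top_of_nonneg nmm (hnt t ht))
  have hP3 : ∫⁻ t, ‖P t‖ₑ ∂μ = Np 3 μ n ^ (3:ℝ) := by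
    rw [Np_rpow nmm]
    exact setLIntegral_congr_fun measurableSet_Icc fun t ht => hPb t ht
  have hPm : Measurable P := Complex.measurable_ofReal.comp (hnm.pow_const _).ennreal_toReal
  have hPi : Integrable P μ := ⟨hPm.aestronglyMeasurable, by
    rw [HasFiniteIntegral, hP3]; exact ENNReal.rpow_lt_top_of_nonneg nmm hnt3⟩
  have hPn : ‖∫ t, P t ∂μ‖ₑ = Np 3 μ n ^ (3:ℝ) := by
    rw [← hP3]
    have hr : ∫ t, P t ∂μ = ((∫ t, (n t ^ (3:ℝ)).toReal ∂μ : ℝ) : ℂ) := integral_complex_ofReal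
    have hPi' : Integrable (fun t => (n t ^ (3:ℝ)).toReal) μ := by
      simpa only [hP, RCLike.re_eq_complex_re, Complex.ofReal_re] using hPi.re
    rw [hr, ← ofReal_norm, Complex.norm_real, norm_of_nonneg (integral_nonneg fun t => ENNReal.toReal_nonneg),
      ofReal_integral_eq_lintegral_ofReal hPi' (evt fun t => ENNReal.toReal_nonneg)]
    refine lintegral_congr fun t => ?_
    rw [hP, ← ofReal_norm, Complex.norm_real, norm_of_nonneg ENNReal.toReal_nonneg]
  have hR : ∀ t ∈ Icc a b, ‖P t - Af (t - t0) (Φ t0) (G t)‖ₑ ≤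
      ∫⁻ s in Icc a b, ‖Af (t - s) (F s) (G t)‖ₑ := by
    intro t ht
    obtain ⟨hi, hb⟩ := duh_pair ht0 ht hFm hF hM hF2 (hGg t ht)
    have e1 : P t = ∫ ξ, 𝓕 (Φ t) ξ * 𝓕⁻ (G t) ξ := by
      obtain ⟨f, hf⟩ := hΦS t ht
      have e0 : P t = ∫ x, Φ t x * dualG (Φ t) x := (dualG_pair (hnt t ht) (hΦg t ht).meas).symm
      rw [e0, hf]
      have := fourierInv_flip (schwartz_fourier_int f) (hGg t ht).int
      rw [schwartz_inv] at this
      rw [hGdef] at this ⊢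
      simp only [hf] at this ⊢
      exact this
    have e2 : P t - Af (t - t0) (Φ t0) (G t) =
        ∫ ξ, (∫ s in t0..t, ph (t - s) ξ * 𝓕 (F s) ξ) * 𝓕⁻ (G t) ξ := by
      rw [e1, Af, ← integral_sub ((hΦg t ht).prod_int (hGg t ht))
        ((hΦg t0 ht0).Af_int (hGg t ht) (by rw [re_b]))]
      congr 1; ext ξ
      rw [hD t ht ξ]; unfold ph; ring
    rw [e2]; exact hb
  have hRint : ∫⁻ t, ‖P t - Af (t - t0) (Φ t0) (G t)‖ₑ ∂μ ≤
      112 * Np (3/2) μ (fun t => nL (18/13) (F t)) * Np 3 μ n ^ (2:ℝ) := by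
    have hGn := measurable_nL_param hGm (18/13)
    have hFn := measurable_nL_param hFm (18/13)
    calc _ ≤ ∫⁻ t in Icc a b, ∫⁻ s in Icc a b,
          4 * (nL (18/13) (G t) * k23 (t - s) * nL (18/13) (F s)) := by
          refine setLIntegral_mono' measurableSet_Icc fun t ht => (hR t ht).trans ?_
          refine lintegral_mono_ae ?_
          have h2 : ∀ᵐ s ∂(volume.restrict (Icc a b)), s ≠ t := by
            rw [ae_iff]; simp
          filter_upwards [ae_restrict_mem measurableSet_Icc, h2] with s hs hne
          refine ((hF s hs).Af_disp (hGg t ht) (sub_ne_zero.2 hne.symm)).trans (le_of_eq ?_)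
          ring
      _ = 4 * ∫⁻ t in Icc a b, ∫⁻ s in Icc a b,
          nL (18/13) (G t) * k23 (t - s) * nL (18/13) (F s) := by
          exact hls_pull hGn hFn 4 a b
      _ ≤ 4 * (28 * Np (3/2) μ (fun t => nL (18/13) (G t)) * Np (3/2) μ (fun t => nL (18/13) (F t))) := by
          gcongr
          exact hls_restrict hGn hFn (fun t ht => (hGg t ht).nL_ne_top nmm nmm)
            (fun t ht => (hF t ht).nL_ne_top nmm nmm) hGXt hFX
      _ = _ := by
          rw [hGX, show (112 : ENNReal) = 4 * 28 by norm_num]; ring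
  have hfin : Np 3 μ n ^ (3:ℝ) ≤ 112 * (nL 2 (Φ t0) + Np (3/2) μ (fun t => nL (18/13) (F t))) * Np 3 μ n ^ (2:ℝ) := by
    rw [← hPn]
    have e : ∫ t, P t ∂μ = ∫ t, Af (t - t0) (Φ t0) (G t) ∂μ + ∫ t, (P t - Af (t - t0) (Φ t0) (G t)) ∂μ := by
      rw [integral_sub hPi hHi]; ring
    rw [e]
    refine (enorm_add_le _ _).trans ?_
    have hHb' : ‖∫ t, Af (t - t0) (Φ t0) (G t) ∂μ‖ₑ ≤ 112 * nL 2 (Φ t0) * Np 3 μ n ^ (2:ℝ) := by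
      refine hHb.trans ?_
      rw [hGX]; gcongr; norm_num
    refine (add_le_add hHb' ((enorm_integral_le_lintegral_enorm _).trans hRint)).trans (le_of_eq ?_)
    ring
  by_cases h0 : Np 3 μ n = 0
  · rw [h0]; exact zero_le
  have h2 : Np 3 μ n ^ (2:ℝ) ≠ 0 := by simp [h0]
  have h2t : Np 3 μ n ^ (2:ℝ) ≠ ⊤ := rpow_ne_top_of_nonneg nmm hnt3
  have h3 : Np 3 μ n ^ (3:ℝ) = Np 3 μ n * Np 3 μ n ^ (2:ℝ) := by
    rw [show (3:ℝ) = 1 + 2 by norm_num, rpow_add_of_nonneg _ _ nmm nmm, ENNReal.rpow_one]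
  rw [h3] at hfin
  exact (ENNReal.mul_le_mul_iff_left h2 h2t).1 hfin

/-- `f` is a Schwartz function. -/
def Sch (f : EC) : Prop := ∃ g : SchwartzMap E3 ℂ, f = g

/-- Fourier multiplier. -/
def op (m : EC) (g : EC) : EC := fun x => 𝓕⁻ (fun ξ : E3 => m ξ * 𝓕 g ξ) x

namespace Sch
variable {f g : EC}

lemma mul (hf : Sch f) (hg : Sch g) : Sch (fun x => f x * g x) := by
  obtain ⟨a, rfl⟩ := hf; obtain ⟨b, rfl⟩ := hg
  exact ⟨SchwartzMap.pairing (ContinuousLinearMap.mul ℝ ℂ) a b, by ext x; simp⟩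

lemma tmul {m : EC} (hm : m.HasTemperateGrowth) (hf : Sch f) : Sch (fun x => m x * f x) := by
  obtain ⟨a, rfl⟩ := hf
  exact ⟨SchwartzMap.smulLeftCLM ℂ m a, by ext x; simp [hm]⟩

lemma conj (hf : Sch f) : Sch (fun x => cj (f x)) := by
  obtain ⟨a, rfl⟩ := hf
  exact ⟨SchwartzMap.postcompCLM (𝕜 := ℝ) (Complex.conjCLE : ℂ →L[ℝ] ℂ) a, by ext x; simp⟩

lemma add (hf : Sch f) (hg : Sch g) : Sch (fun x => f x + g x) := by
  obtain ⟨a, rfl⟩ := hf; obtain ⟨b, rfl⟩ := hg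
  exact ⟨a + b, by ext x; simp⟩

lemma sub (hf : Sch f) (hg : Sch g) : Sch (fun x => f x - g x) := by
  obtain ⟨a, rfl⟩ := hf; obtain ⟨b, rfl⟩ := hg
  exact ⟨a - b, by ext x; simp⟩

lemma const_mul (c : ℂ) (hf : Sch f) : Sch (fun x => c * f x) := by
  obtain ⟨a, rfl⟩ := hf
  exact ⟨c • a, by ext x; simp⟩

lemma zero : Sch (fun _ => 0) := ⟨0, by ext x; simp⟩

lemma sum {ι : Type*} (s : Finset ι) {F : ι → EC} (h : ∀ i ∈ s, Sch (F i)) :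
    Sch (fun x => ∑ i ∈ s, F i x) := by
  classical
  induction s using Finset.induction_on with
  | empty => simpa using zero
  | insert a s ha ih =>
    simp only [Finset.sum_insert ha]
    exact (h a (by simp)).add (ih fun i hi => h i (by simp [hi]))

lemma pd (hf : Sch f) (i : Fin 3) : Sch (fun x => pd f i x) := by
  obtain ⟨a, rfl⟩ := hf
  exact ⟨LineDeriv.lineDerivOp (e3 i) a, by ext x; rw [SchwartzMap.lineDerivOp_apply_eq_fderiv]; rfl⟩

lemma lap (hf : Sch f) : Sch (fun x => lap f x) :=
  sum _ fun i _ => (hf.pd i).pd i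

lemma fourier (hf : Sch f) : Sch (𝓕 f) := by
  obtain ⟨a, rfl⟩ := hf; exact ⟨𝓕 a, (SchwartzMap.fourier_coe a).symm⟩

lemma fourierInv (hf : Sch f) : Sch (𝓕⁻ f) := by
  obtain ⟨a, rfl⟩ := hf; exact ⟨𝓕⁻ a, (SchwartzMap.fourierInv_coe a).symm⟩

lemma op {m : EC} (hm : m.HasTemperateGrowth) (hf : Sch f) : Sch (op m f) :=
  (hf.fourier.tmul hm).fourierInv

lemma inv (hf : Sch f) : 𝓕⁻ (𝓕 f) = f := by
  obtain ⟨a, rfl⟩ := hf; exact schwartz_inv a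

lemma inv' (hf : Sch f) : 𝓕 (𝓕⁻ f) = f := by
  obtain ⟨a, rfl⟩ := hf
  rw [← SchwartzMap.fourierInv_coe, ← SchwartzMap.fourier_coe]; simp

lemma fourier_op {m : EC} (hm : m.HasTemperateGrowth) (hf : Sch f) :
    𝓕 (_root_.op m f) = fun ξ => m ξ * 𝓕 f ξ :=
  (hf.fourier.tmul hm).inv'

lemma ext_fourier (hf : Sch f) (hg : Sch g) (h : ∀ ξ, 𝓕 f ξ = 𝓕 g ξ) : f = g := by
  rw [← hf.inv, ← hg.inv, funext h]

lemma fourier_pd (hf : Sch f) (i : Fin 3) (ξ : E3) :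
    𝓕 (fun x => _root_.pd f i x) ξ = (2 * π * I) * (ξ i : ℂ) * 𝓕 f ξ := by
  obtain ⟨a, rfl⟩ := hf
  have e : (fun x => _root_.pd a i x) = (LineDeriv.lineDerivOp (e3 i) a : SchwartzMap E3 ℂ) := by
    ext x; rw [SchwartzMap.lineDerivOp_apply_eq_fderiv]; rfl
  have ht : (inner ℝ · (e3 i) : E3 → ℝ).HasTemperateGrowth :=
    ((innerSL ℝ).flip (e3 i)).hasTemperateGrowth
  rw [e, ← SchwartzMap.fourier_coe, SchwartzMap.fourier_lineDerivOp_eq, ← SchwartzMap.fourier_coe]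
  simp only [SchwartzMap.smul_apply, SchwartzMap.smulLeftCLM_apply_apply ht]
  have : inner ℝ ξ (e3 i) = ξ i := by simp [e3, EuclideanSpace.inner_single_right]
  rw [this]
  simp [mul_assoc]

lemma good (hf : Sch f) : Good f := by obtain ⟨a, rfl⟩ := hf; exact Good.schwartz a
lemma integrable (hf : Sch f) : Integrable f := hf.good.int
lemma contDiff (hf : Sch f) : ContDiff ℝ ∞ f := by
  obtain ⟨a, rfl⟩ := hf; exact a.smooth ⊤
lemma continuous (hf : Sch f) : Continuous f := hf.contDiff.continuous
lemma differentiable (hf : Sch f) : Differentiable ℝ f := hf.contDiff.differentiable (by simp)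
lemma measurable (hf : Sch f) : Measurable f := hf.continuous.measurable
lemma bdd (hf : Sch f) : ∃ B : ℝ, ∀ x, ‖f x‖ ≤ B := by obtain ⟨a, rfl⟩ := hf; exact schwartz_bdd a

lemma nL_ne_top (hf : Sch f) {p : ℝ} (hp : 0 < p) : nL p f ≠ ⊤ := by
  obtain ⟨a, rfl⟩ := hf
  rw [← eLpNorm_eq_nL hp]
  exact (a.eLpNorm_lt_top _ _).ne

lemma trans (hf : Sch f) (z : E3) : Sch (fun x => f (x - z)) := by
  obtain ⟨a, rfl⟩ := hf
  exact ⟨SchwartzMap.compSubConstCLM ℝ z a, by ext x; simp⟩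

lemma dil (hf : Sch f) {c : ℝ} (hc : c ≠ 0) : Sch (fun x => f (c • x)) := by
  obtain ⟨a, rfl⟩ := hf
  exact ⟨SchwartzMap.compCLMOfContinuousLinearEquiv ℝ
    (ContinuousLinearEquiv.smulLeft (Units.mk0 c hc)) a, by ext x; rfl⟩

lemma plancherel (hf : Sch f) : nL 2 (𝓕 f) = nL 2 f := by
  have h : ∀ g, Sch g → nL 2 (𝓕 g) ≤ nL 2 g := fun g hg => by
    have := fourier_L2 hg.measurable hg.integrable
    rw [← nL_two_sq] at this
    exact (ENNReal.pow_le_pow_left_iff nmm).1 this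
  refine le_antisymm (h f hf) ?_
  have h2 : nL 2 (𝓕⁻ (𝓕 f)) ≤ nL 2 (𝓕 f) := by
    have := fourierInv_L2 hf.fourier.measurable hf.fourier.integrable
    rw [← nL_two_sq] at this
    exact (ENNReal.pow_le_pow_left_iff nmm).1 this
  rwa [hf.inv] at h2

lemma parseval (hf : Sch f) (hg : Sch g) :
    ∫ ξ, 𝓕 f ξ * cj (𝓕 g ξ) = ∫ x, f x * cj (g x) := by
  obtain ⟨a, rfl⟩ := hf; obtain ⟨b, rfl⟩ := hg
  have := SchwartzMap.integral_inner_fourier_fourier b a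
  simpa only [RCLike.inner_apply, SchwartzMap.fourier_coe] using this

end Sch

/-- symbols on the line: constant near `-∞`, a power near `+∞`. -/
structure PowSym (f : ℝ → ℝ) : Prop where
  smooth : ContDiff ℝ ∞ f
  left : ∃ d : ℝ, ∀ y < 1/5, f y = d
  right : ∃ c a : ℝ, ∀ y > 4, f y = c * y ^ a

lemma PowSym.deriv {f : ℝ → ℝ} (h : PowSym f) : PowSym (deriv f) := by
  refine ⟨?_, ?_, ?_⟩
  · exact (contDiff_infty_iff_deriv.1 h.smooth).2
  · obtain ⟨d, hd⟩ := h.left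
    refine ⟨0, fun y hy => ?_⟩
    have : f =ᶠ[nhds y] fun _ => d := by
      filter_upwards [Iio_mem_nhds hy] with z hz using hd z hz
    rw [this.deriv_eq]; simp
  · obtain ⟨c, a, hc⟩ := h.right
    refine ⟨c * a, a - 1, fun y hy => ?_⟩
    have : f =ᶠ[nhds y] fun y => c * y ^ a := by
      filter_upwards [Ioi_mem_nhds hy] with z hz using hc z hz
    rw [this.deriv_eq]
    have := (Real.hasDerivAt_rpow_const (x := y) (p := a) (Or.inl (by linarith))).const_mul c
    rw [this.deriv]; ring

lemma PowSym.iter {f : ℝ → ℝ} (h : PowSym f) (n : ℕ) : PowSym (iteratedDeriv n f) := by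
  induction n with
  | zero => simpa using h
  | succ n ih => rw [iteratedDeriv_succ]; exact ih.deriv

lemma PowSym.bound {f : ℝ → ℝ} (h : PowSym f) :
    ∃ (k : ℕ) (C : ℝ), ∀ x, ‖f x‖ ≤ C * (1 + ‖x‖) ^ k := by
  obtain ⟨d, hd⟩ := h.left
  obtain ⟨c, a, hc⟩ := h.right
  obtain ⟨B, hB⟩ := isCompact_Icc.exists_bound_of_continuousOn (s := Icc (1/5:ℝ) 4) h.smooth.continuous.continuousOn
  obtain ⟨k, hk⟩ := exists_nat_ge a
  have hB0 : 0 ≤ B := (norm_nonneg _).trans (hB 1 nmm)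
  refine ⟨k, |d| + B + |c|, fun x => ?_⟩
  have h1 : 1 ≤ (1 + ‖x‖) ^ k := one_le_pow₀ (by simp)
  rcases lt_or_ge x (1/5) with hx | hx
  · rw [hd x hx, Real.norm_eq_abs]
    calc |d| = |d| * 1 := by ring
      _ ≤ (|d| + B + |c|) * (1 + ‖x‖) ^ k := by gcongr; linarith [abs_nonneg c]
  rcases le_or_gt x 4 with hx4 | hx4
  · calc ‖f x‖ ≤ B * 1 := by rw [mul_one]; exact hB x ⟨hx, hx4⟩
      _ ≤ (|d| + B + |c|) * (1 + ‖x‖) ^ k := by gcongr; linarith [abs_nonneg c, abs_nonneg d]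
  · have hx0 : 0 < x := by linarith
    rw [hc x hx4, norm_mul, Real.norm_eq_abs c, Real.norm_of_nonneg (Real.rpow_nonneg hx0.le a)]
    have : x ^ a ≤ (1 + ‖x‖) ^ k := by
      calc x ^ a ≤ x ^ (k:ℝ) := Real.rpow_le_rpow_of_exponent_le (by linarith) hk
        _ = x ^ k := Real.rpow_natCast x k
        _ ≤ _ := by gcongr; rw [Real.norm_of_nonneg hx0.le]; linarith
    gcongr
    linarith [abs_nonneg d]

lemma PowSym.temperate {f : ℝ → ℝ} (h : PowSym f) : f.HasTemperateGrowth := by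
  refine ⟨h.smooth, fun n => ?_⟩
  obtain ⟨k, C, hC⟩ := (h.iter n).bound
  exact ⟨k, C, fun x => by rw [norm_iteratedFDeriv_eq_norm_iteratedDeriv]; exact hC x⟩

lemma PowSym.radial {f : ℝ → ℝ} (h : PowSym f) : (fun ξ : E3 => (f (‖ξ‖^2) : ℂ)).HasTemperateGrowth :=
  Complex.ofRealCLM.hasTemperateGrowth.comp (h.temperate.comp (Function.hasTemperateGrowth_norm_sq E3))

/-- smooth radial function composed with the square root. -/
lemma contDiff_sqrt_comp {η : ℝ → ℝ} (h : ContDiff ℝ ∞ η) {c r : ℝ} (hr : 0 < r)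
    (h1 : ∀ y ≤ r, η y = c) : ContDiff ℝ ∞ (fun y => η (√y)) := by
  rw [contDiff_iff_contDiffAt]
  intro y
  rcases lt_or_ge y (r^2) with hy | hy
  · have : (fun y => η (√y)) =ᶠ[nhds y] fun _ => c := by
      filter_upwards [Iio_mem_nhds hy] with z hz
      exact h1 _ (Real.sqrt_le_iff.2 ⟨hr.le, le_of_lt hz⟩)
    exact contDiffAt_const.congr_of_eventuallyEq this
  · have : y ≠ 0 := ((pow_pos hr 2).trans_le hy).ne'
    exact h.contDiffAt.comp y (Real.contDiffAt_sqrt this)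

lemma cutoff_temperate {s : ℝ} {η : ℝ → ℝ} (hη : IsCutoff s η) (N : ℝ) (hN : 0 < N) :
    (fun ξ : E3 => (η (‖ξ‖ / N) : ℂ)).HasTemperateGrowth := by
  obtain ⟨h1, -, -, h4, h5⟩ := hη
  have hP : PowSym (fun y => η (√y)) := by
    refine ⟨contDiff_sqrt_comp h1 one_pos h4, ⟨1, fun y hy => h4 _ ?_⟩, ⟨1, (s-1)/2, fun y hy => ?_⟩⟩
    · exact Real.sqrt_le_iff.2 ⟨zero_le_one, by linarith⟩
    · rw [h5 _ (Real.le_sqrt_of_sq_le (by norm_num; linarith)), one_mul, Real.sqrt_eq_rpow,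
        ← Real.rpow_mul (by linarith)]
      congr 1; ring
  have h := (hP.temperate.comp (Function.hasTemperateGrowth_norm_sq E3)).comp
    ((N⁻¹ • ContinuousLinearMap.id ℝ E3).hasTemperateGrowth)
  have h2 := (Complex.ofRealCLM.hasTemperateGrowth).comp h
  convert h2 using 1
  ext ξ
  simp [Function.comp_def, norm_smul, abs_of_pos hN, div_eq_inv_mul]

/-- sum of the Lᵖ norms of the partial derivatives. -/
def nG (p : ℝ) (f : EC) : ENNReal := ∑ i, nL p (fun x => pd f i x)

lemma fderiv_norm_le (f : EC) (x : E3) : ‖fderiv ℝ f x‖ ≤ ∑ i, ‖pd f i x‖ := by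
  refine ContinuousLinearMap.opNorm_le_bound _ (Finset.sum_nonneg fun i _ => norm_nonneg _) fun v => ?_
  have hv : v = ∑ i, v i • e3 i := by
    ext j; simp [e3, Finset.sum_apply, Pi.single_apply]
  conv_lhs => rw [hv]
  rw [map_sum, Finset.sum_mul]
  refine (norm_sum_le _ _).trans (Finset.sum_le_sum fun i _ => ?_)
  rw [map_smul, norm_smul, mul_comm]
  gcongr
  · exact le_rfl
  · exact PiLp.norm_apply_le v i

lemma nL_fderiv_le {f : EC} (hf : Sch f) {p : ℝ} (hp : 1 ≤ p) :
    Np p volume (fun x => ‖fderiv ℝ f x‖ₑ) ≤ nG p f := by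
  have hp0 : 0 < p := by linarith
  have hm : ∀ i, AEMeasurable (fun x => ‖pd f i x‖ₑ) := fun i => (hf.pd i).measurable.enorm.aemeasurable
  calc _ ≤ Np p volume (fun x => ‖pd f 0 x‖ₑ + ‖pd f 1 x‖ₑ + ‖pd f 2 x‖ₑ) := by
        refine Np_mono hp0 fun x => ?_
        have := fderiv_norm_le f x
        rw [Fin.sum_univ_three] at this
        simp only [← ofReal_norm]
        rw [← ENNReal.ofReal_add psv psv, ← ENNReal.ofReal_add psv psv]
        exact ofReal_le_ofReal this
    _ ≤ _ := by
        rw [nG, Fin.sum_univ_three]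
        refine (Np_add_le hp ((hm 0).add (hm 1)) (hm 2)).trans ?_
        gcongr
        · exact Np_add_le hp (hm 0) (hm 1)
        · exact le_rfl

/-- cutoff on scale `n+1`. -/
def chiN (n : ℕ) (x : E3) : ℝ :=
  (⟨1, 2, by norm_num, by norm_num⟩ : ContDiffBump (0 : E3)) (((n:ℝ) + 1)⁻¹ • x)

lemma chiN_props : (∀ n, ContDiff ℝ ∞ (chiN n)) ∧ (∀ n, HasCompactSupport (chiN n)) ∧
    (∀ n x, 0 ≤ chiN n x ∧ chiN n x ≤ 1) ∧ (∀ x, ∀ᶠ n in atTop, chiN n x = 1) ∧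
    ∃ B : ℝ, 0 ≤ B ∧ ∀ n x, ‖fderiv ℝ (chiN n) x‖ ≤ B * ((n:ℝ) + 1)⁻¹ := by
  set c : ContDiffBump (0 : E3) := ⟨1, 2, by norm_num, by norm_num⟩ with hc
  have hcd : ContDiff ℝ ∞ c := c.contDiff
  have hn : ∀ n : ℕ, (0:ℝ) < ((n:ℝ) + 1)⁻¹ := fun n => by positivity
  refine ⟨fun n => hcd.comp (contDiff_const_smul _), fun n => ?_, fun n x => ⟨c.nonneg, c.le_one⟩, fun x => ?_, ?_⟩
  · exact c.hasCompactSupport.comp_smul (hn n).ne'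
  · obtain ⟨n0, hn0⟩ := exists_nat_ge ‖x‖
    filter_upwards [eventually_ge_atTop n0] with n hn'
    apply c.one_of_mem_closedBall
    rw [mem_closedBall_zero_iff, norm_smul, Real.norm_of_nonneg (hn n).le, inv_mul_le_iff₀ psv]
    have : (n0:ℝ) ≤ n := by exact_mod_cast hn'
    change ‖x‖ ≤ ((n:ℝ)+1) * 1
    linarith
  · obtain ⟨B, hB⟩ := (c.hasCompactSupport.fderiv (𝕜 := ℝ)).exists_bound_of_continuous
      (hcd.continuous_fderiv (by simp))
    refine ⟨B, (norm_nonneg _).trans (hB 0), fun n x => ?_⟩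
    have h1 : HasFDerivAt (chiN n) ((fderiv ℝ c (((n:ℝ) + 1)⁻¹ • x)).comp (((n:ℝ) + 1)⁻¹ • ContinuousLinearMap.id ℝ E3)) x :=
      ((hcd.differentiable (by simp)).differentiableAt.hasFDerivAt).comp x
        ((hasFDerivAt_id x).const_smul (((n:ℝ) + 1)⁻¹))
    rw [h1.fderiv]
    refine (ContinuousLinearMap.opNorm_comp_le _ _).trans ?_
    refine mul_le_mul (hB _) ?_ (norm_nonneg _) ((norm_nonneg _).trans (hB 0))
    rw [norm_smul, Real.norm_of_nonneg (hn n).le]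
    exact mul_le_of_le_one_right (hn n).le ContinuousLinearMap.norm_id_le

lemma sobolev_sch (p p' : ℝ) (hp : 1 ≤ p) (hp' : 0 < p') (h : 1 / p' = 1 / p - 1 / 3) :
    ∃ C : ENNReal, C ≠ ⊤ ∧ ∀ f, Sch f → nL p' f ≤ C * nG p f := by
  have hp0 : 0 < p := by linarith
  refine ⟨(SNormLESNormFDerivOfEqConst ℂ (volume : Measure E3) p : NNReal), ENNReal.coe_ne_top, fun f hf => ?_⟩
  set C := (SNormLESNormFDerivOfEqConst ℂ (volume : Measure E3) p : NNReal)
  obtain ⟨c1, c2, c3, c4, B, hB0, hB⟩ := chiN_props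
  have hfm : AEMeasurable (fun x => ‖f x‖ₑ) := hf.measurable.enorm.aemeasurable
  have hdm : AEMeasurable (fun x => ‖fderiv ℝ f x‖ₑ) :=
    (hf.contDiff.continuous_fderiv (by simp)).measurable.enorm.aemeasurable
  have key : ∀ n : ℕ, eLpNorm (fun x => chiN n x • f x) (eR p') volume ≤
      C * (nG p f + eR (B * ((n:ℝ)+1)⁻¹) * nL p f) := by
    intro n
    have hs := eLpNorm_le_eLpNorm_fderiv_of_eq (F := ℂ) (E := E3) volume (u := fun x => chiN n x • f x)
      (p := p.toNNReal) (p' := p'.toNNReal) (((c1 n).smul hf.contDiff).of_le (by norm_cast)) ((c2 n).smul_right)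
      (by rw [← NNReal.coe_le_coe, Real.coe_toNNReal _ hp0.le]; exact_mod_cast hp)
      (by simp) (by
        rw [Real.coe_toNNReal _ hp'.le]; simp only [NNReal.coe_inv, Real.coe_toNNReal _ hp0.le, finrank_euclideanSpace, Fintype.card_fin]
        simpa [one_div] using h)
    rw [Real.coe_toNNReal _ hp0.le] at hs
    refine hs.trans ?_
    gcongr
    rw [show ((p.toNNReal : NNReal) : ENNReal) = eR p from rfl, eLpNorm_eq_lintegral_rpow_enorm_toReal (by simpa using hp0) (by simp), ENNReal.toReal_ofReal hp0.le]
    calc _ ≤ Np p volume (fun x => ‖fderiv ℝ f x‖ₑ + eR (B * ((n:ℝ)+1)⁻¹) * ‖f x‖ₑ) := by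
          refine Np_mono hp0 fun x => ?_
          rw [fderiv_fun_smul ((c1 n).differentiable (by simp)).differentiableAt hf.differentiable.differentiableAt]
          simp only [← ofReal_norm]
          rw [← ENNReal.ofReal_mul psv, ← ENNReal.ofReal_add psv psv]
          apply ofReal_le_ofReal
          refine (norm_add_le _ _).trans (add_le_add ?_ ?_)
          · rw [norm_smul, Real.norm_of_nonneg (c3 n x).1]
            exact mul_le_of_le_one_left (norm_nonneg _) (c3 n x).2
          · refine (ContinuousLinearMap.norm_smulRight_apply _ _).le.trans ?_
            gcongr
            exact hB n x
      _ ≤ _ := by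
          refine (Np_add_le hp hdm (hfm.const_mul _)).trans ?_
          rw [Np_const_mul hp0 ENNReal.ofReal_ne_top]
          gcongr
          · exact nL_fderiv_le hf hp
          · exact le_rfl
  have hlim : Tendsto (fun n : ℕ => (C:ENNReal) * (nG p f + eR (B * ((n:ℝ)+1)⁻¹) * nL p f)) atTop
      (nhds (C * (nG p f + 0 * nL p f))) := by
    refine ENNReal.Tendsto.const_mul (Tendsto.add tendsto_const_nhds ?_) (Or.inr ENNReal.coe_ne_top)
    refine ENNReal.Tendsto.mul_const ?_ (Or.inr (hf.nL_ne_top hp0))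
    rw [← ENNReal.ofReal_zero]
    refine ENNReal.tendsto_ofReal ?_
    have := (tendsto_one_div_add_atTop_nhds_zero_nat (𝕜 := ℝ)).const_mul B
    simpa [one_div] using this
  rw [zero_mul, add_zero] at hlim
  rw [← eLpNorm_eq_nL hp']
  refine (Lp.eLpNorm_lim_le_liminf_eLpNorm (f := fun n x => chiN n x • f x) (fun n => ?_) f ?_).trans ?_
  · exact ((c1 n).continuous.smul hf.continuous).aestronglyMeasurable
  · refine evt fun x => ?_
    refine tendsto_const_nhds.congr' ?_
    filter_upwards [c4 x] with n hn; simp [hn]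
  · rw [← hlim.liminf_eq]
    exact liminf_le_liminf (evt key)

lemma fourierInv_cexp (f : EC) (x : E3) :
    𝓕⁻ f x = ∫ ξ, cexp (((2 * π * inner ℝ ξ x : ℝ) : ℂ) * I) * f ξ := by
  rw [Real.fourierInv_eq']; simp [smul_eq_mul]

lemma fourier_cexp (f : EC) (x : E3) :
    𝓕 f x = ∫ ξ, cexp (((-(2 * π * inner ℝ ξ x) : ℝ) : ℂ) * I) * f ξ := by
  rw [Real.fourier_eq']; simp [smul_eq_mul]

/-- convolution with a dilate of an integrable function. -/
lemma conv_dil {g f : EC} (hg : Integrable g) (hf : Sch f) (l : ℝ) (x : E3) :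
    𝓕⁻ (fun ξ => 𝓕 g (l • ξ) * 𝓕 f ξ) x = ∫ z, g z * f (x - l • z) := by
  have hF : Integrable (𝓕 f) := hf.fourier.integrable
  rw [fourierInv_cexp]
  have e1 : ∀ ξ, cexp (((2 * π * inner ℝ ξ x : ℝ) : ℂ) * I) * (𝓕 g (l • ξ) * 𝓕 f ξ) =
      ∫ z, g z * (cexp (((2 * π * inner ℝ ξ (x - l • z) : ℝ) : ℂ) * I) * 𝓕 f ξ) := by
    intro ξ
    rw [fourier_cexp g, ← integral_mul_const, ← integral_const_mul]
    congr 1; ext z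
    have : cexp (((2 * π * inner ℝ ξ (x - l • z) : ℝ) : ℂ) * I) =
        cexp (((2 * π * inner ℝ ξ x : ℝ) : ℂ) * I) * cexp (((-(2 * π * inner ℝ z (l • ξ)) : ℝ) : ℂ) * I) := by
      rw [← Complex.exp_add, inner_sub_right, inner_smul_right, inner_smul_right, real_inner_comm z ξ]
      congr 1; push_cast; ring
    rw [this]; ring
  simp_rw [e1]
  rw [integral_integral_swap (f := fun ξ z => g z * (cexp (((2 * π * inner ℝ ξ (x - l • z) : ℝ) : ℂ) * I) * 𝓕 f ξ))]
  · congr 1; ext z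
    rw [integral_const_mul, ← fourierInv_cexp, hf.inv]
  · have h1 : Integrable (fun p : E3 × E3 => 𝓕 f p.1 * g p.2) := hF.mul_prod hg
    have h2 : Continuous (fun p : E3 × E3 => cexp (((2 * π * inner ℝ p.1 (x - l • p.2) : ℝ) : ℂ) * I)) := by fun_prop
    have := h1.bdd_mul (c := 1) (f := fun p : E3 × E3 => cexp (((2 * π * inner ℝ p.1 (x - l • p.2) : ℝ) : ℂ) * I)) h2.aestronglyMeasurable
      (evt fun p => by rw [Complex.norm_exp_ofReal_mul_I])
    refine this.congr (evt fun p => ?_)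
    simp only [Function.uncurry]; ring

/-- data describing a symbol: Schwartz part plus a superposition of dilates. -/
structure KD (σ : EC) (b : ℝ) (q g : EC) : Prop where
  hq : Sch q
  hg : Sch g
  sup : ∀ ξ, ‖ξ‖ < 1/2 → 𝓕 g ξ = 0
  eq : ∀ ξ, σ ξ = 𝓕 q ξ + ∫ l in Ioo (0:ℝ) 1, ((l ^ (b-1) : ℝ) : ℂ) * 𝓕 g (l • ξ)

lemma KD.int_bound {σ q g : EC} {b : ℝ} (h : KD σ b q g) : ∃ C : ℝ, ∃ k : ℕ, ∀ ξ, ∀ l ∈ Ioo (0:ℝ) 1,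
    ‖((l ^ (b-1) : ℝ) : ℂ) * 𝓕 g (l • ξ)‖ ≤ C * (1 + ‖ξ‖) ^ k := by
  obtain ⟨B, hB⟩ := h.hg.fourier.bdd
  have hB0 : 0 ≤ B := (norm_nonneg _).trans (hB 0)
  obtain ⟨k, hk⟩ := exists_nat_ge (|b-1|)
  refine ⟨B * 2 ^ k, k, fun ξ l hl => ?_⟩
  rcases lt_or_ge ‖l • ξ‖ (1/2) with h1 | h1
  · rw [h.sup _ h1]; simp; positivity
  · rw [norm_mul, Complex.norm_real, Real.norm_of_nonneg (Real.rpow_nonneg hl.1.le _)]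
    rw [norm_smul, Real.norm_of_nonneg hl.1.le] at h1
    have hl2 : l⁻¹ ≤ 2 * (1 + ‖ξ‖) := by
      rw [inv_le_iff_one_le_mul₀ hl.1]
      nlinarith [hl.1]
    have h3 : l ^ (b-1) ≤ (2 * (1 + ‖ξ‖)) ^ k := by
      have h1l : 1 ≤ l⁻¹ := (one_le_inv₀ hl.1).2 hl.2.le
      calc l ^ (b-1) = (l⁻¹) ^ (-(b-1)) := by rw [Real.inv_rpow hl.1.le, ← Real.rpow_neg hl.1.le, neg_neg]
        _ ≤ (l⁻¹) ^ (k:ℝ) := Real.rpow_le_rpow_of_exponent_le h1l ((neg_le_abs _).trans hk)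
        _ = (l⁻¹) ^ k := Real.rpow_natCast _ _
        _ ≤ _ := by gcongr
    calc _ ≤ (2 * (1 + ‖ξ‖)) ^ k * B := by gcongr; exact hB _
      _ = _ := by rw [mul_pow]; ring

/-- multiplier action as a superposition of convolutions. -/
lemma KD.op_eq {σ q g : EC} {b : ℝ} (h : KD σ b q g) {f : EC} (hf : Sch f) (x : E3) :
    op σ f x = (∫ z, q z * f (x - z)) +
      ∫ l in Ioo (0:ℝ) 1, ((l ^ (b-1) : ℝ) : ℂ) * ∫ z, g z * f (x - l • z) := by
  obtain ⟨C, k, hC⟩ := h.int_bound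
  have hgm : Continuous (𝓕 g) := h.hg.fourier.continuous
  have hmeas : Measurable (fun p : E3 × ℝ => ((p.2 ^ (b-1) : ℝ) : ℂ) * 𝓕 g (p.2 • p.1)) := by
    have h1 : Measurable (fun p : E3 × ℝ => ((p.2 ^ (b-1) : ℝ) : ℂ)) := by fun_prop
    have h2 : Measurable (fun p : E3 × ℝ => 𝓕 g (p.2 • p.1)) :=
      hgm.measurable.comp (by fun_prop)
    exact h1.mul h2
  set ν : Measure ℝ := volume.restrict (Ioo (0:ℝ) 1) with hν
  have : IsFiniteMeasure ν := ⟨by simp [hν]⟩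
  have hpol : Integrable (fun ξ : E3 => (C * (1 + ‖ξ‖) ^ k) * ‖𝓕 f ξ‖) := by
    have : (fun ξ : E3 => ((C * (1 + ‖ξ‖^2) ^ k * 2 ^ k : ℝ) : ℂ)).HasTemperateGrowth := by
      have h1 : (fun ξ : E3 => (C * (1 + ‖ξ‖^2) ^ k * 2 ^ k : ℝ)).HasTemperateGrowth := by
        have := Function.hasTemperateGrowth_norm_sq E3
        have h2 := ((Function.HasTemperateGrowth.const (1:ℝ)).add this)
        have h3 : (fun y : ℝ => C * y ^ k * 2 ^ k).HasTemperateGrowth := by fun_prop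
        exact h3.comp h2
      exact Complex.ofRealCLM.hasTemperateGrowth.comp h1
    have hi := (hf.fourier.tmul this).integrable.norm
    refine hi.mono' (by
      have : Continuous (𝓕 f) := hf.fourier.continuous
      fun_prop) (evt fun ξ => ?_)
    rw [norm_mul, norm_mul, norm_norm, norm_mul, Complex.norm_real, norm_mul, norm_mul]
    refine mul_le_mul_of_nonneg_right ?_ (norm_nonneg _)
    rw [mul_assoc]
    refine mul_le_mul_of_nonneg_left ?_ (norm_nonneg _)
    rw [Real.norm_of_nonneg psv, Real.norm_of_nonneg psv, Real.norm_of_nonneg psv, ← mul_pow]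
    gcongr
    nlinarith [sq_nonneg (‖ξ‖ - 1), norm_nonneg ξ]
  have hInt : Integrable (fun p : E3 × ℝ => cexp (((2 * π * inner ℝ p.1 x : ℝ) : ℂ) * I) *
      ((((p.2 ^ (b-1) : ℝ) : ℂ) * 𝓕 g (p.2 • p.1)) * 𝓕 f p.1)) (volume.prod ν) := by
    have hdom : Integrable (fun p : E3 × ℝ => ((C * (1 + ‖p.1‖) ^ k) * ‖𝓕 f p.1‖) * (1:ℝ)) (volume.prod ν) :=
      hpol.mul_prod (integrable_const 1)
    have hm2 : Measurable (fun p : E3 × ℝ => 𝓕 f p.1) := hf.fourier.measurable.comp measurable_fst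
    have hm3 : Measurable (fun p : E3 × ℝ => cexp (((2 * π * inner ℝ p.1 x : ℝ) : ℂ) * I)) := by fun_prop
    refine hdom.mono' (hm3.mul (hmeas.mul hm2)).aestronglyMeasurable ?_
    have : ∀ᵐ p : E3 × ℝ ∂(volume.prod ν), p.2 ∈ Ioo (0:ℝ) 1 := by
      have : ∀ᵐ l ∂ν, l ∈ Ioo (0:ℝ) 1 := ae_restrict_mem measurableSet_Ioo
      exact Measure.quasiMeasurePreserving_snd.ae this
    filter_upwards [this] with p hp
    rw [norm_mul, Complex.norm_exp_ofReal_mul_I, one_mul, norm_mul, mul_one]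
    gcongr
    exact hC _ _ hp
  have hsplit : op σ f x = 𝓕⁻ (fun ξ => 𝓕 q ξ * 𝓕 f ξ) x +
      𝓕⁻ (fun ξ => (∫ l, ((l ^ (b-1) : ℝ) : ℂ) * 𝓕 g (l • ξ) ∂ν) * 𝓕 f ξ) x := by
    rw [op, fourierInv_cexp, fourierInv_cexp, fourierInv_cexp, ← integral_add]
    · congr 1; ext ξ; rw [h.eq]; ring
    · have := (h.hq.fourier.mul hf.fourier).integrable
      exact this.bdd_mul (c := 1) (by fun_prop) (evt fun p => by rw [Complex.norm_exp_ofReal_mul_I])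
    · have := hInt.integral_prod_left
      refine this.congr (evt fun ξ => ?_)
      simp only
      rw [integral_const_mul, integral_mul_const]
  rw [hsplit]
  congr 1
  · have := conv_dil h.hq.integrable hf 1 x
    simpa using this
  · rw [fourierInv_cexp]
    have e : ∀ ξ, cexp (((2 * π * inner ℝ ξ x : ℝ) : ℂ) * I) * ((∫ l, ((l ^ (b-1) : ℝ) : ℂ) * 𝓕 g (l • ξ) ∂ν) * 𝓕 f ξ) =
      ∫ l, cexp (((2 * π * inner ℝ ξ x : ℝ) : ℂ) * I) * ((((l ^ (b-1) : ℝ) : ℂ) * 𝓕 g (l • ξ)) * 𝓕 f ξ) ∂ν := by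
      intro ξ; rw [integral_const_mul, integral_mul_const]
    simp_rw [e]
    rw [integral_integral_swap (f := fun ξ l => cexp (((2 * π * inner ℝ ξ x : ℝ) : ℂ) * I) * ((((l ^ (b-1) : ℝ) : ℂ) * 𝓕 g (l • ξ)) * 𝓕 f ξ)) hInt]
    congr 1; ext l
    rw [← conv_dil h.hg.integrable hf l x, fourierInv_cexp, ← integral_const_mul]
    congr 1; ext ξ; ring

/-- smooth step from `0` (for `r ≤ 1/2`) to `1` (for `r ≥ 1`). -/
def Th (r : ℝ) : ℝ := Real.smoothTransition (2 * r - 1)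

lemma Th_contDiff : ContDiff ℝ ∞ Th := Real.smoothTransition.contDiff.comp (by fun_prop)
lemma Th_zero {r : ℝ} (h : r ≤ 1/2) : Th r = 0 := Real.smoothTransition.zero_of_nonpos (by linarith)
lemma Th_one {r : ℝ} (h : 1 ≤ r) : Th r = 1 := Real.smoothTransition.one_of_one_le (by linarith)

lemma Sch.of_compact {f : EC} (h : ContDiff ℝ ∞ f) {R : ℝ} (h0 : ∀ x, R < ‖x‖ → f x = 0) : Sch f := by
  have hc : HasCompactSupport f := HasCompactSupport.of_support_subset_isCompact (isCompact_closedBall 0 R) (by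
    intro x hx
    rw [mem_closedBall_zero_iff]
    by_contra hcon
    exact hx (h0 x (not_le.1 hcon)))
  exact ⟨hc.toSchwartzMap h, rfl⟩

/-- product of a function smooth away from the origin with a radial cutoff. -/
lemma contDiff_radial {h : EC} (hh : ContDiffOn ℝ ∞ h {0}ᶜ) {θ : ℝ → ℝ} (hθ : ContDiff ℝ ∞ θ)
    {r : ℝ} (hr : 0 < r) (h0 : ∀ y < r, θ y = 0) : ContDiff ℝ ∞ (fun ξ => h ξ * (θ ‖ξ‖ : ℂ)) := by
  rw [contDiff_iff_contDiffAt]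
  intro ξ
  by_cases hξ : ξ = 0
  · have : (fun ξ => h ξ * (θ ‖ξ‖ : ℂ)) =ᶠ[nhds ξ] fun _ => 0 := by
      have : ∀ᶠ x : E3 in nhds ξ, ‖x‖ < r := by
        apply continuous_norm.continuousAt.eventually_lt continuousAt_const
        simpa [hξ] using hr
      filter_upwards [this] with x hx
      simp [h0 _ hx]
    exact contDiffAt_const.congr_of_eventuallyEq this
  · have h1 : ContDiffAt ℝ ∞ h ξ := hh.contDiffAt (isOpen_compl_singleton.mem_nhds hξ)
    have h2 : ContDiffAt ℝ ∞ (fun ξ : E3 => θ ‖ξ‖) ξ := hθ.contDiffAt.comp ξ (contDiffAt_norm ℝ hξ)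
    exact h1.mul (Complex.ofRealCLM.contDiff.contDiffAt.comp ξ h2)

lemma KD.exists {σ h : EC} {b R : ℝ} (hσ : ContDiff ℝ ∞ σ) (hR : ∀ ξ, R ≤ ‖ξ‖ → σ ξ = h ξ)
    (hh : ContDiffOn ℝ ∞ h {0}ᶜ) (hom : ∀ l > 0, ∀ ξ ≠ 0, h (l • ξ) = ((l ^ (-b) : ℝ) : ℂ) * h ξ) :
    ∃ q g, KD σ b q g := by
  set θ : ℝ → ℝ := fun y => y * deriv Th y with hθ
  have hdTh : ContDiff ℝ ∞ (deriv Th) := (contDiff_infty_iff_deriv.1 Th_contDiff).2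
  have hθc : ContDiff ℝ ∞ θ := contDiff_id.mul hdTh
  have hθ0 : ∀ y < 1/2, θ y = 0 := fun y hy => by
    have : Th =ᶠ[nhds y] fun _ => 0 := by
      filter_upwards [Iio_mem_nhds hy] with z hz using Th_zero (le_of_lt hz)
    simp [hθ, this.deriv_eq]
  have hθ1 : ∀ y > 1, θ y = 0 := fun y hy => by
    have : Th =ᶠ[nhds y] fun _ => 1 := by
      filter_upwards [Ioi_mem_nhds hy] with z hz using Th_one (le_of_lt hz)
    simp [hθ, this.deriv_eq]
  have hG : Sch (fun ξ => h ξ * (θ ‖ξ‖ : ℂ)) :=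
    Sch.of_compact (R := 1) (contDiff_radial hh hθc nmm hθ0) fun x hx => by simp [hθ1 _ hx]
  have hT : ContDiff ℝ ∞ (fun ξ => h ξ * (Th ‖ξ‖ : ℂ)) :=
    contDiff_radial hh Th_contDiff (r := 1/2) nmm fun y hy => Th_zero hy.le
  have hQ : Sch (fun ξ => σ ξ - h ξ * (Th ‖ξ‖ : ℂ)) :=
    Sch.of_compact (R := max R 1) (hσ.sub hT) fun x hx => by
      rw [hR x ((le_max_left _ _).trans hx.le), Th_one ((le_max_right _ _).trans hx.le)]; simp
  refine ⟨𝓕⁻ (fun ξ => σ ξ - h ξ * (Th ‖ξ‖ : ℂ)), 𝓕⁻ (fun ξ => h ξ * (θ ‖ξ‖ : ℂ)), hQ.fourierInv, hG.fourierInv, ?_, ?_⟩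
  · intro ξ hξ
    rw [hG.inv']; simp [hθ0 _ hξ]
  · intro ξ
    rw [hG.inv', hQ.inv']
    suffices hs : ∫ l in Ioo (0:ℝ) 1, ((l ^ (b-1) : ℝ) : ℂ) * (h (l • ξ) * (θ ‖l • ξ‖ : ℂ)) = h ξ * (Th ‖ξ‖ : ℂ) by
      rw [hs]; ring
    by_cases hξ : ξ = 0
    · subst hξ
      simp [hθ0 0 nmm, Th_zero (r := 0) nmm]
    have e : ∀ l ∈ Ioo (0:ℝ) 1, ((l ^ (b-1) : ℝ) : ℂ) * (h (l • ξ) * (θ ‖l • ξ‖ : ℂ)) =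
        h ξ * ((deriv Th (l * ‖ξ‖) * ‖ξ‖ : ℝ) : ℂ) := by
      intro l hl
      rw [hom l hl.1 ξ hξ, norm_smul, Real.norm_of_nonneg hl.1.le]
      have : l ^ (b-1) * l ^ (-b) * l = 1 := by
        rw [← Real.rpow_add hl.1, ← Real.rpow_add_one hl.1.ne']
        ring_nf; simp
      have h2 : ((l ^ (b-1) : ℝ) : ℂ) * ((l ^ (-b) : ℝ) : ℂ) * (l : ℂ) = 1 := by exact_mod_cast this
      simp only [hθ]
      push_cast
      linear_combination (h ξ * ‖ξ‖ * ((deriv Th (l * ‖ξ‖) : ℝ) : ℂ)) * h2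
    rw [setIntegral_congr_fun measurableSet_Ioo e, integral_const_mul, integral_complex_ofReal,
      ← integral_Ioc_eq_integral_Ioo, ← intervalIntegral.integral_of_le zero_le_one]
    congr 2
    have hd : ∀ l ∈ uIcc (0:ℝ) 1, HasDerivAt (fun l => Th (l * ‖ξ‖)) (deriv Th (l * ‖ξ‖) * ‖ξ‖) l := by
      intro l _
      have h1 := ((Th_contDiff.differentiable (by simp)) (l * ‖ξ‖)).hasDerivAt
      have h2 : HasDerivAt (fun l : ℝ => l * ‖ξ‖) (1 * ‖ξ‖) l := (hasDerivAt_id l).mul_const ‖ξ‖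
      have := h1.comp l h2
      simpa [Function.comp_def] using this
    rw [intervalIntegral.integral_eq_sub_of_hasDerivAt hd]
    · simp [Th_zero (r := 0) nmm]
    · apply Continuous.intervalIntegrable
      have := hdTh.continuous
      fun_prop

lemma op_sub {m f g : EC} (hm : m.HasTemperateGrowth) (hf : Sch f) (hg : Sch g) :
    op m (fun x => f x - g x) = fun x => op m f x - op m g x := by
  refine Sch.ext_fourier ((hf.sub hg).op hm) ((hf.op hm).sub (hg.op hm)) fun ξ => ?_
  rw [(hf.sub hg).fourier_op hm, fourier_sub (hf.op hm).integrable (hg.op hm).integrable, hf.fourier_op hm,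
    hg.fourier_op hm]
  beta_reduce
  rw [fourier_sub hf.integrable hg.integrable]
  ring

lemma nL_trans (p : ℝ) (f : EC) (z : E3) : nL p (fun x => f (x - z)) = nL p f := by
  unfold nL Np
  rw [lintegral_sub_right_eq_self (fun x => ‖f x‖ₑ ^ p) z]

lemma nL_add_le {p : ℝ} (hp : 1 ≤ p) {f g : EC} (hf : Measurable f) (hg : Measurable g) :
    nL p (fun x => f x + g x) ≤ nL p f + nL p g :=
  (Np_mono (by linarith) fun x => enorm_add_le _ _).trans
    (Np_add_le hp hf.enorm.aemeasurable hg.enorm.aemeasurable)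

lemma nL_sub_le {p : ℝ} (hp : 1 ≤ p) {f g : EC} (hf : Measurable f) (hg : Measurable g) :
    nL p (fun x => f x - g x) ≤ nL p f + nL p g :=
  (Np_mono (by linarith) fun x => enorm_sub_le).trans
    (Np_add_le hp hf.enorm.aemeasurable hg.enorm.aemeasurable)

/-- difference bounded by the gradient. -/
lemma nL_diff_le {f : EC} (hf : Sch f) {p : ℝ} (hp : 1 ≤ p) (z : E3) :
    nL p (fun x => f (x - z) - f x) ≤ ‖z‖ₑ * nG p f := by
  have hp0 : 0 < p := by linarith
  have hc : Continuous (fderiv ℝ f) := hf.contDiff.continuous_fderiv (by simp)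
  have hpt : ∀ x, ‖f (x - z) - f x‖ₑ ≤ ∫⁻ l in Ioc (0:ℝ) 1, ‖z‖ₑ * ‖fderiv ℝ f (x - l • z)‖ₑ := by
    intro x
    have hd : ∀ l ∈ uIcc (0:ℝ) 1, HasDerivAt (fun l : ℝ => f (x - l • z)) (fderiv ℝ f (x - l • z) (-z)) l := by
      intro l _
      have h1 : HasDerivAt (fun l : ℝ => x - l • z) (-z) l := by
        simpa using ((hasDerivAt_id l).smul_const z).const_sub x
      exact (hf.differentiable _).hasFDerivAt.comp_hasDerivAt l h1
    have hi : Continuous (fun l : ℝ => fderiv ℝ f (x - l • z) (-z)) := by fun_prop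
    have := intervalIntegral.integral_eq_sub_of_hasDerivAt hd (hi.intervalIntegrable _ _)
    simp only [one_smul, zero_smul, sub_zero] at this
    rw [← this, intervalIntegral.integral_of_le zero_le_one]
    refine (enorm_integral_le_lintegral_enorm _).trans (lintegral_mono fun l => ?_)
    rw [mul_comm, ← enorm_neg z]
    exact ContinuousLinearMap.le_opENorm _ _
  calc nL p (fun x => f (x - z) - f x) ≤ Np p volume (fun x => ∫⁻ l in Ioc (0:ℝ) 1, ‖z‖ₑ * ‖fderiv ℝ f (x - l • z)‖ₑ) :=
        Np_mono hp0 hpt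
    _ ≤ ∫⁻ l in Ioc (0:ℝ) 1, Np p volume (fun x => ‖z‖ₑ * ‖fderiv ℝ f (x - l • z)‖ₑ) := by
        have h1 : Continuous (fun q : E3 × ℝ => fderiv ℝ f (q.1 - q.2 • z)) := by fun_prop
        have h2 : Measurable (fun q : E3 × ℝ => ‖z‖ₑ * ‖fderiv ℝ f (q.1 - q.2 • z)‖ₑ) :=
          h1.measurable.enorm.const_mul _
        exact minkowski hp h2
    _ ≤ ∫⁻ l in Ioc (0:ℝ) 1, ‖z‖ₑ * nG p f := by
        refine lintegral_mono fun l => ?_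
        rw [Np_const_mul hp0 enorm_ne_top]
        gcongr
        refine le_trans (le_of_eq ?_) (nL_fderiv_le hf hp)
        unfold Np
        rw [lintegral_sub_right_eq_self (fun x => ‖fderiv ℝ f x‖ₑ ^ p) (l • z)]
    _ = _ := by simp

/-- Hölder type bound on differences of a fixed Schwartz function. -/
lemma holder_diff {g : EC} (hg : Sch g) {r τ : ℝ} (hr : 1 ≤ r) (hτ : 0 ≤ τ) (hτ1 : τ ≤ 1) :
    ∃ C : ENNReal, C ≠ ⊤ ∧ ∀ h : E3, nL r (fun z => g (z - h) - g z) ≤ C * ‖h‖ₑ ^ τ := by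
  have hr0 : 0 < r := by linarith
  refine ⟨2 * nL r g + nG r g, ?_, fun h => ?_⟩
  · refine ENNReal.add_ne_top.2 ⟨ENNReal.mul_ne_top (by simp) (hg.nL_ne_top hr0), ?_⟩
    exact ENNReal.sum_ne_top.2 fun i _ => (hg.pd i).nL_ne_top hr0
  rcases le_total ‖h‖ₑ 1 with h1 | h1
  · calc _ ≤ ‖h‖ₑ * nG r g := nL_diff_le hg hr h
      _ ≤ ‖h‖ₑ ^ τ * (2 * nL r g + nG r g) := by
          gcongr
          · conv_lhs => rw [← ENNReal.rpow_one ‖h‖ₑ]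
            exact ENNReal.rpow_le_rpow_of_exponent_ge h1 hτ1
          · exact le_add_self
      _ = _ := mul_comm _ _
  · calc _ ≤ nL r g + nL r g := by
          have := nL_sub_le hr (hg.trans h).measurable hg.measurable
          rwa [nL_trans] at this
      _ ≤ (2 * nL r g + nG r g) * 1 := by rw [mul_one, two_mul]; exact le_self_add
      _ ≤ _ := by gcongr; simpa using ENNReal.rpow_le_rpow h1 hτ

lemma lintegral_dil (F : E3 → ENNReal) {c : ℝ} (hc : 0 < c) :
    ∫⁻ x, F (c • x) = eR (c ^ (-3:ℝ)) * ∫⁻ x, F x := by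
  have h1 := Measure.map_addHaar_smul (volume : Measure E3) hc.ne'
  have h2 := lintegral_map_equiv (μ := (volume : Measure E3)) F (Homeomorph.smulOfNeZero c hc.ne').toMeasurableEquiv
  have h3 : ⇑(Homeomorph.smulOfNeZero (α := E3) c hc.ne').toMeasurableEquiv = fun x => c • x := rfl
  rw [h3] at h2
  rw [← h2, h1, lintegral_smul_measure, finrank_euclideanSpace, Fintype.card_fin, abs_of_pos psv, smul_eq_mul]
  congr 2
  rw [Real.rpow_neg hc.le]; norm_cast

/-- scaling of the Lᵖ norm. -/
lemma nL_smul (f : EC) {p c : ℝ} (hp : 0 < p) (hc : 0 < c) :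
    nL p (fun x => f (c • x)) = eR (c ^ (-3 / p)) * nL p f := by
  unfold nL Np
  rw [lintegral_dil (fun x => ‖f x‖ₑ ^ p) hc, mul_rpow_of_nonneg _ _ psv,
    ofReal_rpow_of_pos psv, ← Real.rpow_mul hc.le]
  congr 3; ring

lemma nL_dil {g : EC} {r l : ℝ} (hr : 0 < r) (hl : 0 < l) :
    Np r volume (fun z => eR (l^(-3:ℝ)) * ‖g (l⁻¹ • z)‖ₑ) ≤
      eR (l ^ (-3 + 3 / r)) * nL r g := by
  rw [Np_const_mul hr ENNReal.ofReal_ne_top]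
  change _ * nL r (fun z => g (l⁻¹ • z)) ≤ _
  rw [nL_smul g hr (inv_pos.2 hl), ← mul_assoc, ← ENNReal.ofReal_mul psv,
    Real.inv_rpow hl.le, ← Real.rpow_neg hl.le, ← Real.rpow_add hl]
  apply le_of_eq; congr 3; ring

lemma dil_young {G f : EC} (hG : Sch G) (hf : Sch f) {p q r l : ℝ} (hp : 1 ≤ p) (hr : 1 ≤ r) (hq : 0 < q)
    (h : 1 + 1 / q = 1 / p + 1 / r) (hl : 0 < l) :
    nL q (fun x => ∫ z, G z * f (x - l • z)) ≤ eR (l ^ (-3 + 3 / r)) * nL r G * nL p f := by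
  have hr0 : 0 < r := by linarith
  have hp0 : 0 < p := by linarith
  have e : ∀ x, ∫ z, G z * f (x - l • z) = ∫ z, (((l^(-3:ℝ) : ℝ)) : ℂ) * G (l⁻¹ • z) * f (x - z) := by
    intro x
    have := Measure.integral_comp_smul (μ := (volume : Measure E3)) (fun z => (((l^(-3:ℝ) : ℝ)) : ℂ) * G (l⁻¹ • z) * f (x - z)) l
    simp only [smul_smul, inv_mul_cancel₀ hl.ne', one_smul, finrank_euclideanSpace, Fintype.card_fin] at this
    rw [abs_of_pos psv] at this
    have h2 : ∫ (x_1 : E3), ((l ^ (-3:ℝ) : ℝ) : ℂ) * G x_1 * f (x - l • x_1) = ((l ^ (-3:ℝ) : ℝ) : ℂ) * ∫ z, G z * f (x - l • z) := by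
      rw [← integral_const_mul]; congr 1; ext z; ring
    rw [h2] at this
    have h3 : (l ^ (-3:ℝ)) = (l ^ 3)⁻¹ := by rw [Real.rpow_neg hl.le]; norm_cast
    rw [h3, Complex.real_smul] at this
    have h4 : (((l^3)⁻¹ : ℝ) : ℂ) ≠ 0 := by exact_mod_cast psv
    rw [h3]
    exact mul_left_cancel₀ h4 this
  have hK := nL_dil (g := G) hr0 hl
  have hKt : Np r volume (fun z => eR (l^(-3:ℝ)) * ‖G (l⁻¹ • z)‖ₑ) ≠ ⊤ :=
    ne_top_of_le_ne_top (ENNReal.mul_ne_top (by simp) (hG.nL_ne_top hr0)) hK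
  have hy := young hp hr hq h (K := fun z => eR (l^(-3:ℝ)) * ‖G (l⁻¹ • z)‖ₑ) (F := fun x => ‖f x‖ₑ)
    (((hG.dil (inv_ne_zero hl.ne')).measurable.enorm).const_mul _) hf.measurable.enorm hKt (hf.nL_ne_top hp0)
  refine le_trans (Np_mono hq fun x => ?_) (hy.trans (by gcongr; exact le_rfl))
  beta_reduce
  rw [e]
  refine (enorm_integral_le_lintegral_enorm _).trans (lintegral_mono fun z => ?_)
  rw [enorm_mul, enorm_mul]
  gcongr
  rw [← ofReal_norm, Complex.norm_real, Real.norm_of_nonneg psv]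

lemma lintegral_rpow_ne_top {e : ℝ} (he : -1 < e) :
    ∫⁻ l in Ioo (0:ℝ) 1, eR (l ^ e) ≠ ⊤ := by
  have h := (intervalIntegral.intervalIntegrable_rpow' (a := 0) (b := 1) he).1
  have h2 : IntegrableOn (fun l : ℝ => l ^ e) (Ioo 0 1) := h.mono_set Set.Ioo_subset_Ioc_self
  have := h2.2
  refine ne_top_of_le_ne_top this.ne (lintegral_mono fun l => ?_)
  exact Real.ofReal_le_enorm _

lemma op_bound_gen {Q f A : EC} {G : ℝ → EC} {b p q r : ℝ} (hQ : Sch Q)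
    (hG : ∀ l ∈ Ioo (0:ℝ) 1, Sch (G l)) (hGm : Measurable (Function.uncurry G)) (hf : Sch f)
    (hp : 1 ≤ p) (hr : 1 ≤ r) (hq : 1 ≤ q) (h : 1 + 1 / q = 1 / p + 1 / r)
    (hA : ∀ x, A x = (∫ z, Q z * f (x - z)) +
      ∫ l in Ioo (0:ℝ) 1, ((l ^ (b-1) : ℝ) : ℂ) * ∫ z, G l z * f (x - l • z)) :
    nL q A ≤ nL r Q * nL p f + ∫⁻ l in Ioo (0:ℝ) 1,
      eR (l ^ (b-1)) * (eR (l ^ (-3 + 3 / r)) * nL r (G l) * nL p f) := by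
  have hq0 : 0 < q := by linarith
  have hmG : Measurable (fun w : (E3 × ℝ) × E3 => G w.1.2 w.2) := by
    have h1 : Measurable (fun w : (E3 × ℝ) × E3 => (w.1.2, w.2)) := by fun_prop
    exact hGm.comp h1
  have hmf : Measurable (fun w : (E3 × ℝ) × E3 => f (w.1.1 - w.1.2 • w.2)) :=
    hf.measurable.comp (by fun_prop)
  have hm1 : StronglyMeasurable (fun w : (E3 × ℝ) × E3 => G w.1.2 w.2 * f (w.1.1 - w.1.2 • w.2)) :=
    (hmG.mul hmf).stronglyMeasurable
  have hm2 : Measurable (fun w : E3 × ℝ => ∫ z, G w.2 z * f (w.1 - w.2 • z)) :=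
    hm1.integral_prod_right'.measurable
  have hm3 : Measurable (fun w : E3 × ℝ => eR (w.2 ^ (b-1)) * ‖∫ z, G w.2 z * f (w.1 - w.2 • z)‖ₑ) := by
    have : Measurable (fun w : E3 × ℝ => eR (w.2 ^ (b-1))) := by fun_prop
    exact this.mul hm2.enorm
  have hm4 : Measurable (fun w : E3 × E3 => Q w.2 * f (w.1 - w.2)) :=
    (hQ.measurable.comp measurable_snd).mul (hf.measurable.comp (by fun_prop))
  have hm5 : Measurable (fun x => ∫ z, Q z * f (x - z)) :=
    hm4.stronglyMeasurable.integral_prod_right'.measurable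
  calc nL q A ≤ Np q volume (fun x => ‖∫ z, Q z * f (x - z)‖ₑ + ∫⁻ l in Ioo (0:ℝ) 1,
          eR (l ^ (b-1)) * ‖∫ z, G l z * f (x - l • z)‖ₑ) := by
        refine Np_mono hq0 fun x => ?_
        rw [hA]
        refine (enorm_add_le _ _).trans ?_
        gcongr
        refine (enorm_integral_le_lintegral_enorm _).trans (setLIntegral_mono' measurableSet_Ioo fun l hl => ?_)
        rw [enorm_mul]
        gcongr
        rw [← ofReal_norm, Complex.norm_real, Real.norm_of_nonneg (Real.rpow_nonneg hl.1.le _)]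
    _ ≤ _ := by
        refine (Np_add_le hq hm5.enorm.aemeasurable hm3.lintegral_prod_right'.aemeasurable).trans ?_
        gcongr
        · have := dil_young hQ hf hp hr hq0 h one_pos
          simp only [one_smul, Real.one_rpow, ENNReal.ofReal_one, one_mul] at this
          exact this
        · refine (minkowski hq hm3).trans ?_
          refine setLIntegral_mono' measurableSet_Ioo fun l hl => ?_
          beta_reduce
          dsimp only
          rw [Np_const_mul hq0 ENNReal.ofReal_ne_top]
          gcongr
          exact dil_young (hG l hl) hf hp hr hq0 h hl.1

lemma KD.bound0 {σ q' g : EC} {b p q r : ℝ} (h : KD σ b q' g) 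
    (hp : 1 ≤ p) (hr : 1 ≤ r) (hq : 1 ≤ q) (hpq : 1 + 1 / q = 1 / p + 1 / r) (hb : 3 - 3 / r < b) :
    ∃ C : ENNReal, C ≠ ⊤ ∧ ∀ f, Sch f → nL q (op σ f) ≤ C * nL p f := by
  have hr0 : 0 < r := by linarith
  refine ⟨nL r q' + (∫⁻ l in Ioo (0:ℝ) 1, eR (l ^ (b - 1 + (-3 + 3 / r)))) * nL r g, ?_, fun f hf => ?_⟩
  · exact ENNReal.add_ne_top.2 ⟨h.hq.nL_ne_top hr0, ENNReal.mul_ne_top (lintegral_rpow_ne_top (by linarith)) (h.hg.nL_ne_top hr0)⟩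
  have hgm : Measurable (Function.uncurry (fun (_ : ℝ) => g)) := by
    have : Measurable (fun w : ℝ × E3 => g w.2) := h.hg.measurable.comp (by fun_prop)
    exact this
  refine (op_bound_gen (b := b) h.hq (fun l _ => h.hg) hgm hf hp hr hq hpq (h.op_eq hf)).trans ?_
  rw [add_mul]
  gcongr
  rw [mul_assoc, ← lintegral_mul_const' _ _ (ENNReal.mul_ne_top (h.hg.nL_ne_top hr0) (hf.nL_ne_top (by linarith)))]
  refine setLIntegral_mono' measurableSet_Ioo fun l hl => ?_
  rw [Real.rpow_add hl.1 (b-1) (-3 + 3/r), ENNReal.ofReal_mul (Real.rpow_nonneg hl.1.le _)]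
  apply le_of_eq; ring

lemma KD.op_trans {σ q' g : EC} {b : ℝ} (h : KD σ b q' g) {f : EC} (hf : Sch f) (x y : E3) :
    op σ (fun x => f (x - y)) x = op σ f (x - y) := by
  rw [h.op_eq hf, h.op_eq (hf.trans y)]
  have : ∀ z, x - z - y = x - y - z := fun z => by abel
  simp only [this]

lemma KD.boundD {σ q' g : EC} {b p q r τ : ℝ} (h : KD σ b q' g) (hσ : σ.HasTemperateGrowth)
    (hp : 1 ≤ p) (hr : 1 ≤ r) (hq : 1 ≤ q) (hpq : 1 + 1 / q = 1 / p + 1 / r) (hτ : 0 ≤ τ) (hτ1 : τ ≤ 1)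
    (hb : 3 - 3 / r + τ < b) :
    ∃ C : ENNReal, C ≠ ⊤ ∧ ∀ f, Sch f → ∀ y : E3, nL q (fun x => op σ f (x - y) - op σ f x) ≤ C * ‖y‖ₑ ^ τ * nL p f := by
  have hr0 : 0 < r := by linarith
  obtain ⟨C1, hC1, hq'⟩ := holder_diff h.hq hr hτ hτ1
  obtain ⟨C2, hC2, hg'⟩ := holder_diff h.hg hr hτ hτ1
  refine ⟨C1 + (∫⁻ l in Ioo (0:ℝ) 1, eR (l ^ (b - 1 + (-3 + 3 / r) - τ))) * C2, ?_, fun f hf y => ?_⟩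
  · exact ENNReal.add_ne_top.2 ⟨hC1, ENNReal.mul_ne_top (lintegral_rpow_ne_top (by linarith)) hC2⟩
  have hgm : Measurable (Function.uncurry (fun (l : ℝ) z => g (z - l⁻¹ • y) - g z)) := by
    have h1 : Measurable (fun w : ℝ × E3 => g (w.2 - w.1⁻¹ • y)) := h.hg.measurable.comp (by fun_prop)
    have h2 : Measurable (fun w : ℝ × E3 => g w.2) := h.hg.measurable.comp (by fun_prop)
    exact h1.sub h2
  have hInt : ∀ (G : EC), Sch G → ∀ (l : ℝ) x, Integrable (fun z => G z * f (x - l • z)) := by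
    intro G hG l x
    obtain ⟨B, hB⟩ := hf.bdd
    have hc := hf.continuous
    have := hG.integrable.bdd_mul (c := B) (f := fun z => f (x - l • z)) (by fun_prop) (evt fun z => hB _)
    refine this.congr (evt fun z => ?_)
    simp only; ring
  have hsh : ∀ (G : EC), Sch G → ∀ l : ℝ, l ≠ 0 → ∀ x,
      ∫ z, G z * (f (x - l • z - y) - f (x - l • z)) = ∫ z, (G (z - l⁻¹ • y) - G z) * f (x - l • z) := by
    intro G hG l hl x
    have e1 : ∫ z, G (z - l⁻¹ • y) * f (x - l • z) = ∫ z, G z * f (x - l • z - y) := by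
      rw [← integral_sub_right_eq_self (fun z => G z * f (x - l • z - y)) (l⁻¹ • y)]
      congr 1; ext z
      rw [smul_sub, smul_smul, mul_inv_cancel₀ hl, one_smul]
      congr 2; abel
    have e2 : ∀ z, (G (z - l⁻¹ • y) - G z) * f (x - l • z) = G (z - l⁻¹ • y) * f (x - l • z) - G z * f (x - l • z) := fun z => by ring
    have e3 : ∀ z, G z * (f (x - l • z - y) - f (x - l • z)) = G z * f (x - l • z - y) - G z * f (x - l • z) := fun z => by ring
    simp only [e2, e3]
    have i1 := hInt _ (hG.trans (l⁻¹ • y)) l x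
    have i2 : Integrable (fun z => G z * f (x - l • z - y)) := by
      have := hInt _ hG l (x - y)
      refine this.congr (evt fun z => ?_)
      simp only; congr 2; abel
    rw [integral_sub i1 (hInt _ hG l x), integral_sub i2 (hInt _ hG l x), e1]
  have hA : ∀ x, op σ f (x - y) - op σ f x = (∫ z, (q' (z - y) - q' z) * f (x - z)) +
      ∫ l in Ioo (0:ℝ) 1, ((l ^ (b-1) : ℝ) : ℂ) * ∫ z, (g (z - l⁻¹ • y) - g z) * f (x - l • z) := by
    intro x
    have h1 := congrFun (op_sub hσ (hf.trans y) hf) x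
    rw [h.op_trans hf] at h1
    rw [← h1, h.op_eq ((hf.trans y).sub hf)]
    congr 1
    · simpa using hsh q' h.hq 1 one_ne_zero x
    · refine setIntegral_congr_fun measurableSet_Ioo fun l hl => ?_
      beta_reduce
      rw [hsh g h.hg l hl.1.ne' x]
  refine (op_bound_gen (b := b) ((h.hq.trans y).sub h.hq) (fun l _ => (h.hg.trans (l⁻¹ • y)).sub h.hg) hgm hf hp hr hq hpq hA).trans ?_
  rw [add_mul, add_mul]
  gcongr
  · exact hq' y
  have ht : C2 * ‖y‖ₑ ^ τ * nL p f ≠ ⊤ := ENNReal.mul_ne_top (ENNReal.mul_ne_top hC2 (rpow_ne_top_of_nonneg hτ enorm_ne_top)) (hf.nL_ne_top (by linarith))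
  rw [mul_assoc _ C2, mul_assoc, ← lintegral_mul_const' _ _ ht]
  refine setLIntegral_mono' measurableSet_Ioo fun l hl => ?_
  have := hg' (l⁻¹ • y)
  rw [enorm_smul, mul_rpow_of_nonneg _ _ hτ, ← ofReal_norm l⁻¹, Real.norm_of_nonneg (inv_nonneg.2 hl.1.le),
    ofReal_rpow_of_pos (inv_pos.2 hl.1), Real.inv_rpow hl.1.le, ← Real.rpow_neg hl.1.le] at this
  calc _ ≤ eR (l ^ (b-1)) * (eR (l ^ (-3 + 3 / r)) * (C2 * (eR (l ^ (-τ)) * ‖y‖ₑ ^ τ)) * nL p f) := by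
        gcongr
    _ = _ := by
        rw [sub_eq_add_neg _ τ, Real.rpow_add hl.1 (b - 1 + (-3 + 3/r)), Real.rpow_add hl.1 (b-1) (-3 + 3/r), ENNReal.ofReal_mul (by have := hl.1; positivity), ENNReal.ofReal_mul (Real.rpow_nonneg hl.1.le _)]
        ring

/-- radial profile: smooth, constant on `(-∞,1/2]`, power `a` on `[2,∞)`. -/
structure Prof (ρ : ℝ → ℝ) (a : ℝ) : Prop where
  smooth : ContDiff ℝ ∞ ρ
  left : ∃ d, ∀ r ≤ 1/2, ρ r = d
  right : ∀ r ≥ 2, ρ r = r ^ a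

lemma Prof.temp {ρ : ℝ → ℝ} {a : ℝ} (h : Prof ρ a) : (fun ξ : E3 => (ρ ‖ξ‖ : ℂ)).HasTemperateGrowth := by
  obtain ⟨d, hd⟩ := h.left
  have hP : PowSym (fun y => ρ (√y)) := by
    refine ⟨contDiff_sqrt_comp h.smooth nmm hd, ⟨d, fun y hy => hd _ ?_⟩, ⟨1, a/2, fun y hy => ?_⟩⟩
    · exact Real.sqrt_le_iff.2 ⟨by norm_num, by linarith⟩
    · rw [h.right _ (Real.le_sqrt_of_sq_le (by norm_num; linarith)), one_mul, Real.sqrt_eq_rpow,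
        ← Real.rpow_mul (by linarith)]
      congr 1; ring
  have := hP.radial
  simpa using this

lemma coord_temp (c : ℂ) (j : Fin 3) : (fun ξ : E3 => c * ((ξ j : ℝ) : ℂ)).HasTemperateGrowth := by
  have h1 : (fun ξ : E3 => ((ξ j : ℝ) : ℂ)).HasTemperateGrowth := 
    (Complex.ofRealCLM.comp (EuclideanSpace.proj j : E3 →L[ℝ] ℝ)).hasTemperateGrowth
  exact (Function.HasTemperateGrowth.const c).mul h1

lemma Prof.temp' {ρ : ℝ → ℝ} {a : ℝ} (h : Prof ρ a) (c : ℂ) (j : Fin 3) : 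
    (fun ξ : E3 => c * ((ξ j : ℝ) : ℂ) * (ρ ‖ξ‖ : ℂ)).HasTemperateGrowth :=
  (coord_temp c j).mul h.temp

lemma contDiffOn_normpow (a : ℝ) : ContDiffOn ℝ ∞ (fun ξ : E3 => ((‖ξ‖ ^ a : ℝ) : ℂ)) {0}ᶜ := by
  intro ξ hξ
  have h0 : ξ ≠ 0 := hξ
  apply ContDiffAt.contDiffWithinAt
  apply Complex.ofRealCLM.contDiff.contDiffAt.comp
  exact (contDiffAt_norm ℝ h0).rpow_const_of_ne (norm_ne_zero_iff.2 h0)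

lemma Prof.kd {ρ : ℝ → ℝ} {a : ℝ} (h : Prof ρ a) : ∃ q g, KD (fun ξ : E3 => (ρ ‖ξ‖ : ℂ)) (-a) q g := by
  refine KD.exists (R := 2) (h := fun ξ => ((‖ξ‖ ^ a : ℝ) : ℂ)) h.temp.1 (fun ξ hξ => by rw [h.right _ hξ]) (contDiffOn_normpow a) ?_
  intro l hl ξ hξ
  rw [norm_smul, Real.norm_of_nonneg hl.le, Real.mul_rpow hl.le (norm_nonneg _), neg_neg]
  push_cast; ring

lemma Prof.kd' {ρ : ℝ → ℝ} {a b : ℝ} (h : Prof ρ a) (c : ℂ) (j : Fin 3) (hb : b = -1 - a) : 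
    ∃ q g, KD (fun ξ : E3 => c * ((ξ j : ℝ) : ℂ) * (ρ ‖ξ‖ : ℂ)) b q g := by
  refine KD.exists (R := 2) (h := fun ξ => c * ((ξ j : ℝ) : ℂ) * ((‖ξ‖ ^ a : ℝ) : ℂ)) (h.temp' c j).1 (fun ξ hξ => by rw [h.right _ hξ]) 
    ((coord_temp c j).1.contDiffOn.mul (contDiffOn_normpow a)) ?_
  intro l hl ξ hξ
  rw [norm_smul, Real.norm_of_nonneg hl.le, Real.mul_rpow hl.le (norm_nonneg _), hb,
    show -(-1 - a) = 1 + a by ring, Real.rpow_add hl 1 a, Real.rpow_one]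
  simp only [PiLp.smul_apply, smul_eq_mul]
  push_cast; ring

section cutoff
variable {s : ℝ} {η : ℝ → ℝ}

lemma IsCutoff.pos (hη : IsCutoff s η) (r : ℝ) : 0 < η r := by
  obtain ⟨_, _, h3, h4, _⟩ := hη
  rcases le_or_gt r 1 with h | h
  · rw [h4 r h]; exact one_pos
  · exact (h3 r (by linarith)).1

lemma IsCutoff.prof (hη : IsCutoff s η) : Prof η (s-1) := by
  obtain ⟨h1, h2, h3, h4, h5⟩ := hη
  exact ⟨h1, ⟨1, fun r hr => h4 r (by linarith)⟩, h5⟩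

lemma contDiff_Th_div {f : ℝ → ℝ} (hf : ContDiff ℝ ∞ f) : ContDiff ℝ ∞ (fun r => Th r * f r * (r^2)⁻¹) := by
  rw [contDiff_iff_contDiffAt]
  intro r
  rcases lt_or_ge r (1/2) with h | h
  · have : (fun r => Th r * f r * (r^2)⁻¹) =ᶠ[nhds r] fun _ => 0 := by
      filter_upwards [Iio_mem_nhds h] with z hz
      rw [Th_zero (le_of_lt hz)]; simp
    exact contDiffAt_const.congr_of_eventuallyEq this
  · have h0 : r^2 ≠ 0 := by positivity
    exact (Th_contDiff.contDiffAt.mul hf.contDiffAt).mul ((contDiffAt_id.pow 2).inv h0)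

lemma IsCutoff.prof1 (hη : IsCutoff s η) : Prof (fun r => Th r * (η r)⁻¹ * (r^2)⁻¹) (-1-s) := by
  refine ⟨contDiff_Th_div (hη.1.inv fun r => (hη.pos r).ne'), ⟨0, fun r hr => by rw [Th_zero hr]; simp⟩, fun r hr => ?_⟩
  have h0 : 0 < r := by linarith
  rw [Th_one (by linarith), hη.prof.right r hr, one_mul, ← Real.rpow_neg h0.le, ← Real.rpow_natCast, ← Real.rpow_neg h0.le,
    ← Real.rpow_add h0]
  congr 1; push_cast; ring

lemma prof2 : Prof (fun r => Th r * 1 * (r^2)⁻¹) (-2) := by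
  refine ⟨contDiff_Th_div contDiff_const, ⟨0, fun r hr => by rw [Th_zero hr]; simp⟩, fun r hr => ?_⟩
  have h0 : 0 < r := by linarith
  rw [Th_one (by linarith), one_mul, one_mul, ← Real.rpow_natCast, ← Real.rpow_neg h0.le]
  norm_num

/-- the operators giving `v = u - Iu` from `∇ I u`. -/
def kap1 (η : ℝ → ℝ) (j : Fin 3) (ξ : E3) : ℂ := 
  (2*π*I : ℂ)⁻¹ * ((ξ j : ℝ) : ℂ) * ((Th ‖ξ‖ * (η ‖ξ‖)⁻¹ * (‖ξ‖^2)⁻¹ : ℝ) : ℂ)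
def kap2 (j : Fin 3) (ξ : E3) : ℂ := 
  (2*π*I : ℂ)⁻¹ * ((ξ j : ℝ) : ℂ) * ((Th ‖ξ‖ * 1 * (‖ξ‖^2)⁻¹ : ℝ) : ℂ)

lemma kap1_temp (hη : IsCutoff s η) (j) : (kap1 η j).HasTemperateGrowth := hη.prof1.temp' _ j
lemma kap2_temp (j) : (kap2 j).HasTemperateGrowth := prof2.temp' _ j

/-- symbol of `I_1`. -/
def sI (η : ℝ → ℝ) (ξ : E3) : ℂ := (η ‖ξ‖ : ℂ)
lemma sI_temp (hη : IsCutoff s η) : (sI η).HasTemperateGrowth := hη.prof.temp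

lemma v_identity (hη : IsCutoff s η) {u : EC} (hu : Sch u) :
    (fun x => u x - op (sI η) u x) = 
      fun x => ∑ j, (op (kap1 η j) (fun y => pd (op (sI η) u) j y) x - op (kap2 j) (fun y => pd (op (sI η) u) j y) x) := by
  have hw : Sch (op (sI η) u) := hu.op (sI_temp hη)
  have hj : ∀ j, Sch (fun x => op (kap1 η j) (fun y => pd (op (sI η) u) j y) x) := fun j => (hw.pd j).op (kap1_temp hη j)
  have hj2 : ∀ j, Sch (fun x => op (kap2 j) (fun y => pd (op (sI η) u) j y) x) := fun j => (hw.pd j).op (kap2_temp j)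
  refine Sch.ext_fourier (hu.sub hw) (Sch.sum _ fun j _ => (hj j).sub (hj2 j)) ?_
  intro ξ
  rw [fourier_sub hu.integrable hw.integrable, hu.fourier_op (sI_temp hη)]
  have e1 : 𝓕 (fun x => ∑ j, (op (kap1 η j) (fun y => pd (op (sI η) u) j y) x - op (kap2 j) (fun y => pd (op (sI η) u) j y) x)) ξ
      = ∑ j, (kap1 η j ξ - kap2 j ξ) * ((2*π*I)*(ξ j:ℂ)*(sI η ξ * 𝓕 u ξ)) := by
    simp only [Real.fourier_eq, Finset.smul_sum]
    rw [integral_finsetSum]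
    · refine Finset.sum_congr rfl fun j _ => ?_
      rw [← Real.fourier_eq, fourier_sub (hj j).integrable (hj2 j).integrable]
      have a1 := congrFun ((hw.pd j).fourier_op (kap1_temp hη j)) ξ
      have a2 := congrFun ((hw.pd j).fourier_op (kap2_temp j)) ξ
      rw [show (fun x => op (kap1 η j) (fun y => pd (op (sI η) u) j y) x) = op (kap1 η j) (fun y => pd (op (sI η) u) j y) from rfl,
       show (fun x => op (kap2 j) (fun y => pd (op (sI η) u) j y) x) = op (kap2 j) (fun y => pd (op (sI η) u) j y) from rfl, a1, a2, hw.fourier_pd, hu.fourier_op (sI_temp hη), ← Real.fourier_eq]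
      ring
    · intro j _
      exact (Real.fourierIntegral_convergent_iff ξ).2 ((hj j).sub (hj2 j)).integrable
  rw [e1]
  simp only [kap1, kap2, sI]
  have hp : (2*π*I : ℂ) ≠ 0 := by simp [Real.pi_ne_zero]
  have hη0 := (hη.pos ‖ξ‖).ne'
  have : ∀ j : Fin 3, ((2*π*I : ℂ)⁻¹ * ((ξ j : ℝ) : ℂ) * ((Th ‖ξ‖ * (η ‖ξ‖)⁻¹ * (‖ξ‖^2)⁻¹ : ℝ) : ℂ) - (2*π*I : ℂ)⁻¹ * ((ξ j : ℝ) : ℂ) * ((Th ‖ξ‖ * 1 * (‖ξ‖^2)⁻¹ : ℝ) : ℂ))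
     * ((2*π*I)*(ξ j:ℂ)*((η ‖ξ‖ : ℂ) * 𝓕 u ξ)) = (((ξ j)^2 * ((Th ‖ξ‖) * (‖ξ‖^2)⁻¹ * (1 - η ‖ξ‖)) : ℝ) : ℂ) * 𝓕 u ξ := by
    intro j
    have hη1 : (η ‖ξ‖ : ℂ) ≠ 0 := by exact_mod_cast hη0
    have h1 : (2*π*I : ℂ)⁻¹ * (2*π*I : ℂ) = 1 := inv_mul_cancel₀ hp
    have h2 : (η ‖ξ‖ : ℂ)⁻¹ * (η ‖ξ‖ : ℂ) = 1 := inv_mul_cancel₀ hη1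
    push_cast
    linear_combination ((ξ j : ℂ)^2 * Th ‖ξ‖ * (‖ξ‖^2 : ℂ)⁻¹ * 𝓕 u ξ * ((η ‖ξ‖ : ℂ)⁻¹ * (η ‖ξ‖ : ℂ) - (η ‖ξ‖ : ℂ))) * h1 + 
      ((ξ j : ℂ)^2 * Th ‖ξ‖ * (‖ξ‖^2 : ℂ)⁻¹ * 𝓕 u ξ) * h2
  rw [Finset.sum_congr rfl fun j _ => this j, ← Finset.sum_mul, ← Complex.ofReal_sum, ← Finset.sum_mul, 
    ← EuclideanSpace.real_norm_sq_eq]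
  rcases le_or_gt ‖ξ‖ 1 with h | h
  · rw [hη.2.2.2.1 _ h]; simp
  · rw [Th_one h.le]
    have : ‖ξ‖^2 * (1 * (‖ξ‖^2)⁻¹ * (1 - η ‖ξ‖)) = 1 - η ‖ξ‖ := by
      have : ‖ξ‖^2 ≠ 0 := by positivity
      field_simp
    rw [this]; push_cast; ring
end cutoff

lemma nL_sum_le {p : ℝ} (hp : 1 ≤ p) {ι : Type*} (S : Finset ι) {f : ι → EC} (hf : ∀ i, Measurable (f i)) :
    nL p (fun x => ∑ i ∈ S, f i x) ≤ ∑ i ∈ S, nL p (f i) := by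
  classical
  induction S using Finset.induction_on with
  | empty => 
    have hp0 : 0 < p := by linarith
    simp [nL, Np, hp0]
  | insert a S ha ih =>
    simp only [Finset.sum_insert ha]
    exact (nL_add_le hp (hf a) (Finset.measurable_sum _ fun i _ => hf i)).trans (by gcongr)

/-- bounds for `v = u - I u` at `N = 1`. -/
lemma v_bound {s : ℝ} {η : ℝ → ℝ} (hη : IsCutoff s η) (hs : s < 1) {p q r : ℝ} (hp : 1 ≤ p) (hr : 1 ≤ r) (hq : 1 ≤ q) 
    (hpq : 1 + 1/q = 1/p + 1/r) (hb : 3 - 3/r < s) :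
    ∃ C : ENNReal, C ≠ ⊤ ∧ ∀ u, Sch u → nL q (fun x => u x - op (sI η) u x) ≤ C * nG p (op (sI η) u) := by
  have h1 : ∀ j, ∃ C : ENNReal, C ≠ ⊤ ∧ ∀ f, Sch f → nL q (op (kap1 η j) f) ≤ C * nL p f := fun j => by
    obtain ⟨a, b, h⟩ := hη.prof1.kd' (b := s) (2*π*I : ℂ)⁻¹ j (by ring)
    exact h.bound0 hp hr hq hpq hb
  have h2 : ∀ j, ∃ C : ENNReal, C ≠ ⊤ ∧ ∀ f, Sch f → nL q (op (kap2 j) f) ≤ C * nL p f := fun j => by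
    obtain ⟨a, b, h⟩ := prof2.kd' (b := 1) (2*π*I : ℂ)⁻¹ j (by ring)
    exact h.bound0 hp hr hq hpq (by linarith)
  choose C1 hC1 hB1 using h1
  choose C2 hC2 hB2 using h2
  refine ⟨∑ j, (C1 j + C2 j), by simp [ENNReal.sum_eq_top, hC1, hC2], fun u hu => ?_⟩
  have hw : Sch (op (sI η) u) := hu.op (sI_temp hη)
  rw [v_identity hη hu]
  refine (nL_sum_le hq _ fun j => ?_).trans ?_
  · exact (((hw.pd j).op (kap1_temp hη j)).sub ((hw.pd j).op (kap2_temp j))).measurable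
  rw [Finset.sum_mul]
  refine Finset.sum_le_sum fun j _ => ?_
  refine (nL_sub_le hq ((hw.pd j).op (kap1_temp hη j)).measurable ((hw.pd j).op (kap2_temp j)).measurable).trans ?_
  rw [add_mul]
  have h3 : nL p (fun y => pd (op (sI η) u) j y) ≤ nG p (op (sI η) u) := 
    Finset.single_le_sum (f := fun j => nL p (fun y => pd (op (sI η) u) j y)) (fun _ _ => zero_le) (Finset.mem_univ j)
  exact add_le_add ((hB1 j _ (hw.pd j)).trans (by gcongr)) ((hB2 j _ (hw.pd j)).trans (by gcongr))

lemma v_boundD {s : ℝ} {η : ℝ → ℝ} (hη : IsCutoff s η) (hs : s < 1) {p q r τ : ℝ} (hp : 1 ≤ p) (hr : 1 ≤ r) (hq : 1 ≤ q) 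
    (hpq : 1 + 1/q = 1/p + 1/r) (hτ : 0 ≤ τ) (hτ1 : τ ≤ 1) (hb : 3 - 3/r + τ < s) :
    ∃ C : ENNReal, C ≠ ⊤ ∧ ∀ u, Sch u → ∀ y, nL q (fun x => (u (x-y) - op (sI η) u (x-y)) - (u x - op (sI η) u x)) 
      ≤ C * ‖y‖ₑ^τ * nG p (op (sI η) u) := by
  have h1 : ∀ j, ∃ C : ENNReal, C ≠ ⊤ ∧ ∀ f, Sch f → ∀ y, nL q (fun x => op (kap1 η j) f (x-y) - op (kap1 η j) f x) ≤ C * ‖y‖ₑ^τ * nL p f := fun j => by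
    obtain ⟨a, b, h⟩ := hη.prof1.kd' (b := s) (2*π*I : ℂ)⁻¹ j (by ring)
    exact h.boundD (kap1_temp hη j) hp hr hq hpq hτ hτ1 hb
  have h2 : ∀ j, ∃ C : ENNReal, C ≠ ⊤ ∧ ∀ f, Sch f → ∀ y, nL q (fun x => op (kap2 j) f (x-y) - op (kap2 j) f x) ≤ C * ‖y‖ₑ^τ * nL p f := fun j => by
    obtain ⟨a, b, h⟩ := prof2.kd' (b := 1) (2*π*I : ℂ)⁻¹ j (by ring)
    exact h.boundD (kap2_temp j) hp hr hq hpq hτ hτ1 (by linarith)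
  choose C1 hC1 hB1 using h1
  choose C2 hC2 hB2 using h2
  refine ⟨∑ j, (C1 j + C2 j), by simp [ENNReal.sum_eq_top, hC1, hC2], fun u hu y => ?_⟩
  have hw : Sch (op (sI η) u) := hu.op (sI_temp hη)
  set W : Fin 3 → EC := fun j y => pd (op (sI η) u) j y with hW
  have hWS : ∀ j, Sch (W j) := fun j => hw.pd j
  have hv := v_identity hη hu
  have e : (fun x => (u (x-y) - op (sI η) u (x-y)) - (u x - op (sI η) u x)) = fun x => ∑ j, 
     ((op (kap1 η j) (W j) (x-y) - op (kap1 η j) (W j) x) - (op (kap2 j) (W j) (x-y) - op (kap2 j) (W j) x)) := by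
    ext x
    have a1 := congrFun hv (x-y)
    have a2 := congrFun hv x
    rw [a1, a2, ← Finset.sum_sub_distrib]
    refine Finset.sum_congr rfl fun j _ => ?_
    simp only [hW]; ring
  rw [e]
  have m1 : ∀ j, Measurable (fun x => op (kap1 η j) (W j) (x-y) - op (kap1 η j) (W j) x) := fun j => by
    have := ((hWS j).op (kap1_temp hη j)).measurable
    exact (this.comp (measurable_id.sub_const y)).sub this
  have m2 : ∀ j, Measurable (fun x => op (kap2 j) (W j) (x-y) - op (kap2 j) (W j) x) := fun j => by
    have := ((hWS j).op (kap2_temp j)).measurable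
    exact (this.comp (measurable_id.sub_const y)).sub this
  refine (nL_sum_le hq _ fun j => (m1 j).sub (m2 j)).trans ?_
  rw [Finset.sum_mul, Finset.sum_mul]
  refine Finset.sum_le_sum fun j _ => ?_
  refine (nL_sub_le hq (m1 j) (m2 j)).trans ?_
  rw [add_mul, add_mul]
  have h3 : nL p (W j) ≤ nG p (op (sI η) u) := 
    Finset.single_le_sum (f := fun j => nL p (fun y => pd (op (sI η) u) j y)) (fun _ _ => zero_le) (Finset.mem_univ j)
  exact add_le_add ((hB1 j _ (hWS j) y).trans (by gcongr)) ((hB2 j _ (hWS j) y).trans (by gcongr))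

/-- boundedness of `I_1` on `L^p`. -/
lemma sI_bound {s : ℝ} {η : ℝ → ℝ} (hη : IsCutoff s η) (hs : s < 1) {p : ℝ} (hp : 1 ≤ p) :
    ∃ C : ENNReal, C ≠ ⊤ ∧ ∀ u, Sch u → nL p (op (sI η) u) ≤ C * nL p u := by
  obtain ⟨a, b, h⟩ := hη.prof.kd
  exact h.bound0 hp le_rfl hp (by ring) (by linarith)

/-- the cubic nonlinearity `|u|²u`. -/
def cub (u : EC) (x : E3) : ℂ := u x * u x * cj (u x)

lemma Sch.cub {u : EC} (hu : Sch u) : Sch (cub u) := (hu.mul hu).mul hu.conj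

lemma op_const_mul {m f : EC} (_hm : m.HasTemperateGrowth) (_hf : Sch f) (c : ℂ) :
    op m (fun x => c * f x) = fun x => c * op m f x := by
  ext x
  simp only [op]
  have h1 : ∀ ξ, 𝓕 (fun x => c * f x) ξ = c * 𝓕 f ξ := fun ξ => by
    simp only [Real.fourier_eq, ← integral_const_mul, Circle.smul_def, smul_eq_mul]
    congr 1; ext v; ring
  simp only [h1, Real.fourierInv_eq, ← integral_const_mul, Circle.smul_def, smul_eq_mul]
  congr 1; ext v; ring

/-- quadratic remainder. -/
def Qf (u : EC) (x z : E3) : ℂ :=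
  cj (u x) * (u (x - z) - u x)^2 + (u x + u (x - z)) * ((u (x - z) - u x) * cj (u (x - z) - u x))

lemma Sch.moment {q : EC} (hq : Sch q) {a : ℝ} (ha : 0 ≤ a) (ha2 : a ≤ 2) :
    ∫⁻ z, ‖q z‖ₑ * (‖z‖ₑ ^ a + ‖z‖ₑ ^ (2:ℝ)) ≠ ⊤ := by
  have ht : (fun ξ : E3 => (((1 + 2 * ‖ξ‖^2 : ℝ)) : ℂ)).HasTemperateGrowth := by
    have h1 : (fun ξ : E3 => (1 + 2 * ‖ξ‖^2 : ℝ)).HasTemperateGrowth := by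
      have := Function.hasTemperateGrowth_norm_sq E3
      fun_prop
    exact Complex.ofRealCLM.hasTemperateGrowth.comp h1
  have h := (hq.tmul ht).integrable.2
  refine ne_top_of_le_ne_top h.ne (lintegral_mono fun z => ?_)
  beta_reduce
  rw [enorm_mul, mul_comm]
  gcongr
  rw [← ofReal_norm, ← ofReal_norm, Complex.norm_real, Real.norm_of_nonneg psv,
    ofReal_rpow_of_nonneg (norm_nonneg _) ha, ofReal_rpow_of_nonneg (norm_nonneg _) nmm,
    ← ENNReal.ofReal_add psv psv]
  refine ofReal_le_ofReal ?_
  rw [Real.rpow_two]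
  have : ‖z‖ ^ a ≤ 1 + ‖z‖ ^ 2 := by
    rcases le_or_gt ‖z‖ 1 with h1 | h1
    · have := Real.rpow_le_one (norm_nonneg z) h1 ha
      nlinarith [sq_nonneg ‖z‖]
    · have := Real.rpow_le_rpow_of_exponent_le h1.le ha2
      rw [Real.rpow_two] at this
      linarith
  linarith

lemma KD.quad_id {σ q g : EC} {b : ℝ} (h : KD σ b q g) (hσ : σ.HasTemperateGrowth) (h0 : σ 0 = 0) {u : EC} (hu : Sch u) (x : E3) :
    op σ (cub u) x - 2 * (u x * cj (u x)) * op σ u x - (u x)^2 * op σ (fun y => cj (u y)) x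
     = (∫ z, q z * Qf u x z) +
      ∫ l in Ioo (0:ℝ) 1, ((l ^ (b-1) : ℝ) : ℂ) * ∫ z, g z * Qf u x (l • z) := by
  have hg0 : ∫ z, g z = 0 := by
    have := h.sup 0 (by simp)
    simpa [Real.fourier_eq] using this
  have hq0 : ∫ z, q z = 0 := by
    have := h.eq 0
    rw [h0] at this
    have h2 : ∀ l : ℝ, 𝓕 g (l • (0:E3)) = 0 := fun l => h.sup _ (by simp)
    simp only [h2, mul_zero, integral_zero, add_zero] at this
    simpa [Real.fourier_eq] using this.symm
  set c1 : ℂ := 2 * (u x * cj (u x)) with hc1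
  set c2 : ℂ := (u x)^2 with hc2
  set f : EC := fun y => cub u y - (c1 * u y) - c2 * cj (u y) with hf
  have hfS : Sch f := (hu.cub.sub (hu.const_mul c1)).sub (hu.conj.const_mul c2)
  have e1 : op σ (cub u) x - c1 * op σ u x - c2 * op σ (fun y => cj (u y)) x = op σ f x := by
    rw [hf, op_sub hσ (hu.cub.sub (hu.const_mul c1)) (hu.conj.const_mul c2), op_sub hσ hu.cub (hu.const_mul c1),
      op_const_mul hσ hu, op_const_mul hσ hu.conj]
  have e2 : ∀ z, Qf u x z = f (x - z) + c1 * u x := fun z => by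
    simp only [hf, Qf, hc1, hc2, cub, map_sub]; ring
  have hb : ∃ B, ∀ y, ‖f y‖ ≤ B := hfS.bdd
  obtain ⟨B, hB⟩ := hb
  have e3 : ∀ (k : EC) (l : ℝ), Sch k → ∫ z, k z = 0 → ∫ z, k z * f (x - l • z) = ∫ z, k z * Qf u x (l • z) := by
    intro k l hk hk0
    have hi : Integrable (fun z => k z * f (x - l • z)) := by
      have := hk.integrable.bdd_mul (c := B) (f := fun z => f (x - l • z))
        ((hfS.continuous.comp (by fun_prop)).aestronglyMeasurable) (evt fun z => hB _)
      simpa [mul_comm] using this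
    simp only [e2, mul_add]
    rw [integral_add hi (hk.integrable.mul_const _), integral_mul_const, hk0, zero_mul, add_zero]
  rw [e1, h.op_eq hfS]
  have := e3 q 1 h.hq hq0
  simp only [one_smul] at this
  rw [this]
  congr 1
  refine integral_congr_ae (evt fun l => ?_)
  beta_reduce
  rw [e3 g l h.hg hg0]

lemma measurable_Qf {u : EC} (hu : Sch u) : Measurable (fun p : E3 × E3 => Qf u p.1 p.2) := by
  have h1 : Measurable (fun p : E3 × E3 => u p.1) := hu.measurable.comp measurable_fst
  have h2 : Measurable (fun p : E3 × E3 => u (p.1 - p.2)) := hu.measurable.comp (by fun_prop)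
  have hc : Measurable cj := Complex.continuous_conj.measurable
  unfold Qf
  exact ((hc.comp h1).mul ((h2.sub h1).pow_const 2)).add ((h1.add h2).mul ((h2.sub h1).mul (hc.comp (h2.sub h1))))

lemma KD.quad_bound {σ q g : EC} {b : ℝ} (h : KD σ b q g) (hσ : σ.HasTemperateGrowth) (h0 : σ 0 = 0)
    {a p : ℝ} (ha0 : 0 ≤ a) (ha : -b < a) (ha2 : a ≤ 2) (hp : 1 ≤ p) :
    ∃ C : ENNReal, C ≠ ⊤ ∧ ∀ u, Sch u → ∀ K : ENNReal, (∀ z, nL p (fun x => Qf u x z) ≤ K * (‖z‖ₑ ^ a + ‖z‖ₑ ^ (2:ℝ))) →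
     nL p (fun x => op σ (cub u) x - 2 * (u x * cj (u x)) * op σ u x - (u x)^2 * op σ (fun y => cj (u y)) x)
      ≤ C * K := by
  have hp0 : 0 < p := by linarith
  set Mq := ∫⁻ z, ‖q z‖ₑ * (‖z‖ₑ ^ a + ‖z‖ₑ ^ (2:ℝ)) with hMq
  set Mg := ∫⁻ z, ‖g z‖ₑ * (‖z‖ₑ ^ a + ‖z‖ₑ ^ (2:ℝ)) with hMg
  set L := ∫⁻ l in Ioo (0:ℝ) 1, eR (l ^ (b-1+a)) with hL
  have hLt : L ≠ ⊤ := lintegral_rpow_ne_top (by linarith)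
  have hqt : Mq ≠ ⊤ := h.hq.moment ha0 ha2
  have hgt : Mg ≠ ⊤ := h.hg.moment ha0 ha2
  refine ⟨Mq + L * Mg, ENNReal.add_ne_top.2 ⟨hqt, ENNReal.mul_ne_top hLt hgt⟩, fun u hu K hK => ?_⟩
  have hQ := measurable_Qf hu
  have hm1 : Measurable (fun p : E3 × E3 => ‖q p.2‖ₑ * ‖Qf u p.1 p.2‖ₑ) :=
    (h.hq.measurable.comp measurable_snd).enorm.mul hQ.enorm
  have hm2 : Measurable (fun w : (E3 × ℝ) × E3 => ‖g w.2‖ₑ * ‖Qf u w.1.1 (w.1.2 • w.2)‖ₑ) := by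
    have h1 : Measurable (fun w : (E3 × ℝ) × E3 => g w.2) := h.hg.measurable.comp measurable_snd
    have h2 : Measurable (fun w : (E3 × ℝ) × E3 => (w.1.1, w.1.2 • w.2)) := by fun_prop
    have h3 : Measurable (fun w : (E3 × ℝ) × E3 => Qf u w.1.1 (w.1.2 • w.2)) := hQ.comp h2
    exact h1.enorm.mul h3.enorm
  have hm3 : Measurable (fun w : E3 × ℝ => eR (w.2 ^ (b-1)) * ∫⁻ z, ‖g z‖ₑ * ‖Qf u w.1 (w.2 • z)‖ₑ) := by
    have : Measurable (fun w : E3 × ℝ => eR (w.2 ^ (b-1))) := by fun_prop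
    exact this.mul hm2.lintegral_prod_right'
  -- key single-kernel estimate
  have key : ∀ (k : EC), Sch k → ∀ l : ℝ, 0 < l → l ≤ 1 →
      Np p volume (fun x => ∫⁻ z, ‖k z‖ₑ * ‖Qf u x (l • z)‖ₑ) ≤ 
        eR (l ^ a) * (K * ∫⁻ z, ‖k z‖ₑ * (‖z‖ₑ ^ a + ‖z‖ₑ ^ (2:ℝ))) := by
    intro k hk l hl hl1
    have hmk : Measurable (Function.uncurry (fun (x z : E3) => ‖k z‖ₑ * ‖Qf u x (l • z)‖ₑ)) := by
      have h1 : Measurable (fun w : E3 × E3 => k w.2) := hk.measurable.comp measurable_snd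
      have h2 : Measurable (fun w : E3 × E3 => (w.1, l • w.2)) := by fun_prop
      have h3 : Measurable (fun w : E3 × E3 => Qf u w.1 (l • w.2)) := hQ.comp h2
      exact h1.enorm.mul h3.enorm
    have hmz : Measurable (fun z : E3 => ‖k z‖ₑ * (‖z‖ₑ ^ a + ‖z‖ₑ ^ (2:ℝ))) := by
      have := hk.measurable
      fun_prop
    refine (minkowski hp hmk).trans ?_
    rw [← mul_assoc, ← lintegral_const_mul _ hmz]
    refine lintegral_mono fun z => ?_
    beta_reduce
    rw [Np_const_mul hp0 enorm_ne_top]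
    calc ‖k z‖ₑ * nL p (fun x => Qf u x (l • z)) ≤ ‖k z‖ₑ * (K * (‖l • z‖ₑ ^ a + ‖l • z‖ₑ ^ (2:ℝ))) := by
          gcongr; exact hK _
      _ ≤ ‖k z‖ₑ * (K * (eR (l ^ a) * (‖z‖ₑ ^ a + ‖z‖ₑ ^ (2:ℝ)))) := by
          gcongr
          rw [enorm_smul, mul_rpow_of_nonneg _ _ ha0, mul_rpow_of_nonneg _ _ nmm, mul_add,
            ← ofReal_norm, Real.norm_of_nonneg hl.le, ofReal_rpow_of_pos hl, ofReal_rpow_of_pos hl]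
          exact add_le_add le_rfl (mul_le_mul' (ofReal_le_ofReal
            (Real.rpow_le_rpow_of_exponent_ge hl hl1 ha2)) le_rfl)
      _ = _ := by ring
  calc _ ≤ Np p volume (fun x => (∫⁻ z, ‖q z‖ₑ * ‖Qf u x z‖ₑ) + ∫⁻ l in Ioo (0:ℝ) 1,
          eR (l ^ (b-1)) * ∫⁻ z, ‖g z‖ₑ * ‖Qf u x (l • z)‖ₑ) := by
        refine Np_mono hp0 fun x => ?_
        beta_reduce
        rw [h.quad_id hσ h0 hu]
        refine (enorm_add_le _ _).trans ?_
        gcongr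
        · refine (enorm_integral_le_lintegral_enorm _).trans (lintegral_mono fun z => ?_)
          rw [enorm_mul]
        · refine (enorm_integral_le_lintegral_enorm _).trans (setLIntegral_mono' measurableSet_Ioo fun l hl => ?_)
          rw [enorm_mul]
          gcongr
          · rw [← ofReal_norm, Complex.norm_real, Real.norm_of_nonneg (Real.rpow_nonneg hl.1.le _)]
          · refine (enorm_integral_le_lintegral_enorm _).trans (lintegral_mono fun z => ?_)
            rw [enorm_mul]
    _ ≤ _ := by
        refine (Np_add_le hp hm1.lintegral_prod_right'.aemeasurable hm3.lintegral_prod_right'.aemeasurable).trans ?_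
        rw [add_mul]
        refine add_le_add ?_ ?_
        · have := key q h.hq 1 one_pos le_rfl
          simp only [one_smul, Real.one_rpow, ENNReal.ofReal_one, one_mul] at this
          rw [mul_comm]
          exact this
        · refine (minkowski hp hm3).trans ?_
          calc _ ≤ ∫⁻ l in Ioo (0:ℝ) 1, eR (l ^ (b-1+a)) * (K * Mg) := by
                refine setLIntegral_mono' measurableSet_Ioo fun l hl => ?_
                dsimp only
                rw [Np_const_mul hp0 ENNReal.ofReal_ne_top, Real.rpow_add hl.1 (b-1) a, 
                  ENNReal.ofReal_mul (Real.rpow_nonneg hl.1.le _), mul_assoc]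
                gcongr
                exact key g h.hg l hl.1 hl.2.le
            _ = L * Mg * K := by
                rw [lintegral_mul_const _ (by fun_prop)]; ring

lemma om_le {t : ENNReal} {a b : ℝ} (h : a ≤ b) (h2 : b ≤ 2) : t ^ b ≤ t ^ a + t ^ (2:ℝ) := by
  rcases le_or_gt t 1 with ht | ht
  · exact (ENNReal.rpow_le_rpow_of_exponent_ge ht h).trans (le_add_right le_rfl)
  · exact (ENNReal.rpow_le_rpow_of_exponent_le ht.le h2).trans (le_add_left le_rfl)

lemma star_le {f : EC} (hf : Measurable f) {p : ℝ} (hp : 1 ≤ p) (z : E3) :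
    Np p volume (fun x => 2 * ‖f x‖ₑ + ‖f (x - z)‖ₑ) ≤ 3 * nL p f := by
  have h2 : Measurable (fun x => f (x - z)) := hf.comp (measurable_id.sub_const z)
  refine (Np_add_le hp (hf.enorm.const_mul 2).aemeasurable h2.enorm.aemeasurable).trans ?_
  rw [Np_const_mul (by linarith) (by simp)]
  have := nL_trans p f z
  unfold nL at this ⊢
  rw [this, show (3:ENNReal) = 2 + 1 by norm_num, add_mul, one_mul]

lemma Qf_enorm (u w : EC) (x z : E3) : ‖Qf u x z‖ₑ ≤
    (2 * ‖w x‖ₑ + ‖w (x - z)‖ₑ) * (‖w (x-z) - w x‖ₑ + ‖(u (x-z) - w (x-z)) - (u x - w x)‖ₑ) * (‖w (x-z) - w x‖ₑ + ‖(u (x-z) - w (x-z)) - (u x - w x)‖ₑ)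
    + 2 * ((2 * ‖u x - w x‖ₑ + ‖u (x - z) - w (x-z)‖ₑ) * ‖w (x-z) - w x‖ₑ * ‖w (x-z) - w x‖ₑ)
    + 2 * ((2 * ‖u x - w x‖ₑ + ‖u (x - z) - w (x-z)‖ₑ) * ‖(u (x-z) - w (x-z)) - (u x - w x)‖ₑ * ‖(u (x-z) - w (x-z)) - (u x - w x)‖ₑ) := by
  set a := w (x-z) - w x
  set d := (u (x-z) - w (x-z)) - (u x - w x)
  set W := w x
  set W' := w (x-z)
  set V := u x - W with hV
  set V' := u (x-z) - W' with hV'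
  have hu : u x = W + V := by rw [hV]; ring
  have hu' : u (x-z) = W' + V' := by rw [hV']; ring
  have hd : u (x - z) - u x = a + d := by simp only [a, d]; ring
  have key : ‖Qf u x z‖ ≤ (2 * ‖W‖ + ‖W'‖) * (‖a‖ + ‖d‖) * (‖a‖ + ‖d‖) + 2 * ((2 * ‖V‖ + ‖V'‖) * ‖a‖ * ‖a‖) + 
      2 * ((2 * ‖V‖ + ‖V'‖) * ‖d‖ * ‖d‖) := by
    have h1 : ‖Qf u x z‖ ≤ (2 * ‖u x‖ + ‖u (x-z)‖) * ‖a + d‖^2 := by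
      unfold Qf
      rw [hd]
      calc _ ≤ ‖u x‖ * ‖a + d‖^2 + (‖u x‖ + ‖u (x-z)‖) * (‖a+d‖ * ‖a+d‖) := by
            refine (norm_add_le _ _).trans (add_le_add ?_ ?_)
            · rw [norm_mul, norm_pow, RCLike.norm_conj]
            · rw [norm_mul, norm_mul, RCLike.norm_conj]
              gcongr; exact norm_add_le _ _
        _ = _ := by ring
    have h2 : ‖u x‖ ≤ ‖W‖ + ‖V‖ := by rw [hu]; exact norm_add_le _ _
    have h3 : ‖u (x-z)‖ ≤ ‖W'‖ + ‖V'‖ := by rw [hu']; exact norm_add_le _ _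
    have h4 : ‖a + d‖ ≤ ‖a‖ + ‖d‖ := norm_add_le _ _
    calc _ ≤ (2 * (‖W‖ + ‖V‖) + (‖W'‖ + ‖V'‖)) * (‖a‖ + ‖d‖)^2 := h1.trans (by gcongr)
      _ = (2 * ‖W‖ + ‖W'‖) * (‖a‖ + ‖d‖) * (‖a‖ + ‖d‖) + (2 * ‖V‖ + ‖V'‖) * (‖a‖ + ‖d‖)^2 := by ring
      _ ≤ (2 * ‖W‖ + ‖W'‖) * (‖a‖ + ‖d‖) * (‖a‖ + ‖d‖) + (2 * ‖V‖ + ‖V'‖) * (2 * ‖a‖^2 + 2 * ‖d‖^2) := by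
          gcongr; nlinarith [sq_nonneg (‖a‖ - ‖d‖)]
      _ = _ := by ring
  simp only [← ofReal_norm]
  have e2 : (2:ENNReal) = eR 2 := by simp
  rw [e2]
  repeat first
    | rw [← ENNReal.ofReal_mul psv]
    | rw [← ENNReal.ofReal_add psv psv]
  exact ofReal_le_ofReal key

lemma Q_bound {s : ℝ} {η : ℝ → ℝ} (hη : IsCutoff s η) (hs0 : 1/2 < s) (hs : s < 1) :
    ∃ a : ℝ, s < a ∧ a ≤ 2 ∧ ∃ C : ENNReal, C ≠ ⊤ ∧ ∀ u, Sch u → ∀ z, nL (18/13) (fun x => Qf u x z) ≤ 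
      C * (nG (18/5) (op (sI η) u))^2 * nG 2 (op (sI η) u) * (‖z‖ₑ ^ a + ‖z‖ₑ ^ (2:ℝ)) := by
  set σ1 := s - (s-1/2)/4 with h1
  set σ2 := 3/4*(s-1/2) with h2
  obtain ⟨S, hS, hSob⟩ := sobolev_sch 2 6 nmm nmm nmm
  obtain ⟨C1, hC1, hB1⟩ := v_boundD hη hs (p := 18/5) (q := 18/5) (r := 1) (τ := σ1) nmm le_rfl nmm nmm (by linarith) (by linarith) (by linarith)
  obtain ⟨C2, hC2, hB2⟩ := v_boundD hη hs (p := 2) (q := 3) (r := 6/5) (τ := σ2) nmm nmm nmm nmm (by linarith) (by linarith) (by linarith)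
  obtain ⟨C3, hC3, hB3⟩ := v_bound hη hs (p := 18/5) (q := 18/5) (r := 1) nmm le_rfl nmm nmm (by linarith)
  obtain ⟨C4, hC4, hB4⟩ := v_bound hη hs (p := 18/5) (q := 9) (r := 6/5) nmm nmm nmm nmm (by linarith)
  set a := min (min (2*σ1) 1) (σ1+σ2) with ha
  have ha1 : a ≤ 2*σ1 := (min_le_left _ _).trans (min_le_left _ _)
  have ha2 : a ≤ 1 := (min_le_left _ _).trans (min_le_right _ _)
  have ha3 : a ≤ σ1 + σ2 := min_le_right _ _
  refine ⟨a, ?_, by linarith, 3 * S * (4 * (1 + C1)^2) + 2 * (3 * C3 * (2 * S)) + 2 * (3 * C4 * C1 * C2), ?_, fun u hu z => ?_⟩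
  · rw [ha, lt_min_iff, lt_min_iff]
    exact ⟨⟨by linarith, hs⟩, by linarith⟩
  · finiteness
  set w := op (sI η) u with hw'
  have hw : Sch w := hu.op (sI_temp hη)
  set Z1 := nG (18/5) w with hZ1
  set Z2 := nG 2 w with hZ2
  set t := ‖z‖ₑ with ht
  set Om := t ^ a + t ^ (2:ℝ) with hOm
  have hwm := hw.measurable
  have hum := hu.measurable
  have hvm : Measurable (fun x => u x - w x) := hum.sub hwm
  have sh : ∀ {f : EC}, Measurable f → Measurable (fun x => f (x - z)) := fun hf => hf.comp (measurable_id.sub_const z)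
  have ma : AEMeasurable (fun x => ‖w (x-z) - w x‖ₑ) := ((sh hwm).sub hwm).enorm.aemeasurable
  have md : AEMeasurable (fun x => ‖(u (x-z) - w (x-z)) - (u x - w x)‖ₑ) := ((sh hvm).sub hvm).enorm.aemeasurable
  have mW : AEMeasurable (fun x => 2 * ‖w x‖ₑ + ‖w (x-z)‖ₑ) := ((hwm.enorm.const_mul 2).add (sh hwm).enorm).aemeasurable
  have mV : AEMeasurable (fun x => 2 * ‖u x - w x‖ₑ + ‖u (x-z) - w (x-z)‖ₑ) := ((hvm.enorm.const_mul 2).add (sh hvm).enorm).aemeasurable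
  have b1 : Np (18/5) volume (fun x => ‖w (x-z) - w x‖ₑ) ≤ t * Z1 := nL_diff_le hw nmm z
  have b2 : Np 6 volume (fun x => ‖w (x-z) - w x‖ₑ) ≤ 2 * S * Z2 := by
    refine (nL_sub_le nmm (sh hwm) hwm).trans ?_
    rw [nL_trans, ← two_mul, mul_assoc]
    gcongr
    exact hSob w hw
  have b3 : Np (18/5) volume (fun x => ‖(u (x-z) - w (x-z)) - (u x - w x)‖ₑ) ≤ C1 * t ^ σ1 * Z1 := hB1 u hu z
  have b4 : Np 3 volume (fun x => ‖(u (x-z) - w (x-z)) - (u x - w x)‖ₑ) ≤ C2 * t ^ σ2 * Z2 := hB2 u hu z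
  have b5 : Np 6 volume (fun x => 2 * ‖w x‖ₑ + ‖w (x-z)‖ₑ) ≤ 3 * (S * Z2) := 
    (star_le hwm nmm z).trans (by gcongr; exact hSob w hw)
  have b6 : Np (18/5) volume (fun x => 2 * ‖u x - w x‖ₑ + ‖u (x-z) - w (x-z)‖ₑ) ≤ 3 * (C3 * Z1) := 
    (star_le hvm nmm z).trans (by gcongr; exact hB3 u hu)
  have b7 : Np 9 volume (fun x => 2 * ‖u x - w x‖ₑ + ‖u (x-z) - w (x-z)‖ₑ) ≤ 3 * (C4 * Z1) := 
    (star_le hvm nmm z).trans (by gcongr; exact hB4 u hu)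
  have b8 : Np (18/5) volume (fun x => ‖w (x-z) - w x‖ₑ + ‖(u (x-z) - w (x-z)) - (u x - w x)‖ₑ) ≤ (1 + C1) * (t + t^σ1) * Z1 := by
    refine (Np_add_le nmm ma md).trans ((add_le_add b1 b3).trans ?_)
    rw [← add_mul]
    gcongr
    calc t + C1 * t^σ1 ≤ (t + C1 * t^σ1) + (C1 * t + t^σ1) := le_add_right le_rfl
      _ = _ := by ring
  have o1 : (t + t^σ1) * (t + t^σ1) ≤ 4 * Om := by
    calc (t + t^σ1) * (t + t^σ1) = t * t + 2 * (t * t^σ1) + t^σ1 * t^σ1 := by ring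
      _ = t^(2:ℝ) + 2 * t^(1+σ1) + t^(2*σ1) := by
          rw [rpow_add_of_nonneg _ _ nmm (by linarith), two_mul σ1, rpow_add_of_nonneg _ _ (by linarith) (by linarith), ENNReal.rpow_one,
            ENNReal.rpow_two, sq]
      _ ≤ Om + 2 * Om + Om := by
          gcongr
          · exact le_add_left le_rfl
          · exact om_le (by linarith) (by linarith)
          · exact om_le (by linarith) (by linarith)
      _ = _ := by ring
  have o2 : t ≤ Om := by
    have := om_le (t := t) ha2 nmm
    rwa [ENNReal.rpow_one] at this
  have o3 : t ^ σ1 * t ^ σ2 ≤ Om := by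
    rw [← rpow_add_of_nonneg _ _ (by linarith) (by linarith)]
    exact om_le ha3 (by linarith)
  have t1 := (Np_mul3_le (r := 18/13) nmm nmm nmm nmm mW (ma.add md) (ma.add md)).trans (mul_le_mul' (mul_le_mul' b5 b8) b8)
  have t2 := (Np_mul3_le (r := 18/13) nmm nmm nmm nmm mV ma ma).trans (mul_le_mul' (mul_le_mul' b6 b1) b2)
  have t3 := (Np_mul3_le (r := 18/13) nmm nmm nmm nmm mV md md).trans (mul_le_mul' (mul_le_mul' b7 b3) b4)
  have hp1 : (1:ℝ) ≤ 18/13 := by norm_num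
  calc nL (18/13) (fun x => Qf u x z) ≤ _ := Np_mono nmm fun x => Qf_enorm u w x z
    _ ≤ _ := Np_add_le hp1 ((mW.mul (ma.add md)).mul (ma.add md) |>.add (((mV.mul ma).mul ma).const_mul 2)) (((mV.mul md).mul md).const_mul 2)
    _ ≤ _ := add_le_add (Np_add_le hp1 ((mW.mul (ma.add md)).mul (ma.add md)) (((mV.mul ma).mul ma).const_mul 2)) le_rfl
    _ = Np (18/13) volume (fun x => (2 * ‖w x‖ₑ + ‖w (x - z)‖ₑ) * (‖w (x-z) - w x‖ₑ + ‖(u (x-z) - w (x-z)) - (u x - w x)‖ₑ) * (‖w (x-z) - w x‖ₑ + ‖(u (x-z) - w (x-z)) - (u x - w x)‖ₑ))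
      + 2 * Np (18/13) volume (fun x => (2 * ‖u x - w x‖ₑ + ‖u (x - z) - w (x-z)‖ₑ) * ‖w (x-z) - w x‖ₑ * ‖w (x-z) - w x‖ₑ)
      + 2 * Np (18/13) volume (fun x => (2 * ‖u x - w x‖ₑ + ‖u (x - z) - w (x-z)‖ₑ) * ‖(u (x-z) - w (x-z)) - (u x - w x)‖ₑ * ‖(u (x-z) - w (x-z)) - (u x - w x)‖ₑ) := by
        rw [Np_const_mul nmm (by simp), Np_const_mul nmm (by simp)]
    _ ≤ _ := add_le_add (add_le_add t1 (mul_le_mul' le_rfl t2)) (mul_le_mul' le_rfl t3)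
    _ = (3 * S * ((1 + C1)^2 * ((t + t^σ1) * (t + t^σ1))) + 2 * (3 * C3 * (2 * S)) * t + 2 * (3 * C4 * C1 * C2) * (t^σ1 * t^σ2)) * (Z1^2 * Z2) := by ring
    _ ≤ (3 * S * ((1 + C1)^2 * (4 * Om)) + 2 * (3 * C3 * (2 * S)) * Om + 2 * (3 * C4 * C1 * C2) * Om) * (Z1^2 * Z2) := by gcongr
    _ = _ := by ring

lemma pd_mul {f g : EC} (hf : Differentiable ℝ f) (hg : Differentiable ℝ g) (j : Fin 3) (x : E3) :
    pd (fun y => f y * g y) j x = pd f j x * g x + f x * pd g j x := by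
  unfold pd
  rw [fderiv_fun_mul (hf x) (hg x)]
  simp; ring

lemma pd_sub {f g : EC} (hf : Differentiable ℝ f) (hg : Differentiable ℝ g) (j : Fin 3) (x : E3) :
    pd (fun y => f y - g y) j x = pd f j x - pd g j x := by
  unfold pd
  rw [fderiv_fun_sub (hf x) (hg x)]
  simp

lemma pd_conj {f : EC} (hf : Differentiable ℝ f) (j : Fin 3) (x : E3) :
    pd (fun y => cj (f y)) j x = cj (pd f j x) := by
  unfold pd
  have := (Complex.conjCLE.toContinuousLinearMap.hasFDerivAt.comp x (hf x).hasFDerivAt).fderiv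
  have e : (⇑Complex.conjCLE.toContinuousLinearMap ∘ f) = fun y => cj (f y) := rfl
  rw [e] at this
  rw [this]; simp

lemma pd_cub {w : EC} (hw : Differentiable ℝ w) (j : Fin 3) (x : E3) :
    pd (cub w) j x = 2 * (w x * cj (w x)) * pd w j x + (w x)^2 * cj (pd w j x) := by
  have hc : Differentiable ℝ (fun y => cj (w y)) := Complex.conjCLE.differentiable.comp hw
  have : cub w = fun y => (w y * w y) * cj (w y) := rfl
  rw [this, pd_mul (f := fun y => w y * w y) (hw.mul hw) hc, pd_mul hw hw, pd_conj hw]; ring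

lemma op_conj {m f : EC} (hm : ∀ ξ, m (-ξ) = cj (m ξ)) (x : E3) :
    op m (fun y => cj (f y)) x = cj (op m f x) := by
  have h1 : ∀ ξ, 𝓕 (fun y => cj (f y)) ξ = cj (𝓕 f (-ξ)) := fun ξ => by
    rw [← fourierInv_conj f (-ξ), Real.fourierInv_eq_fourier_neg, neg_neg]
  unfold op
  simp only [h1]
  have h2 : (fun ξ => m ξ * cj (𝓕 f (-ξ))) = fun ξ => cj ((fun ζ => (fun ζ => m ζ * 𝓕 f ζ) (-ζ)) ξ) := by
    ext ξ
    simp only [map_mul]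
    rw [hm, Complex.conj_conj]
  rw [h2, fourierInv_conj, Real.fourierInv_eq_fourier_comp_neg]

/-- symbol of `∂_j I_1`. -/
def sJ (η : ℝ → ℝ) (j : Fin 3) (ξ : E3) : ℂ := (2*π*I : ℂ) * ((ξ j : ℝ) : ℂ) * (η ‖ξ‖ : ℂ)

lemma sJ_temp {s : ℝ} {η : ℝ → ℝ} (hη : IsCutoff s η) (j) : (sJ η j).HasTemperateGrowth := hη.prof.temp' _ j

lemma op_sJ {s : ℝ} {η : ℝ → ℝ} (hη : IsCutoff s η) (j) {f : EC} (hf : Sch f) : 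
    op (sJ η j) f = fun x => pd (op (sI η) f) j x := by
  have hw := hf.op (sI_temp hη)
  refine Sch.ext_fourier (hf.op (sJ_temp hη j)) (hw.pd j) fun ξ => ?_
  rw [hf.fourier_op (sJ_temp hη j), hw.fourier_pd, hf.fourier_op (sI_temp hη)]
  simp only [sJ, sI]; ring

lemma D_ident {s : ℝ} {η : ℝ → ℝ} (hη : IsCutoff s η) (j) {u w : EC} (hu : Sch u) (hwd : w = op (sI η) u) (x : E3) :
    pd (fun x => op (sI η) (cub u) x - cub w x) j x = 
     (op (sJ η j) (cub u) x - 2 * (u x * cj (u x)) * op (sJ η j) u x - (u x)^2 * op (sJ η j) (fun y => cj (u y)) x)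
     + 2 * (u x * cj (u x) - w x * cj (w x)) * pd w j x + ((u x)^2 - (w x)^2) * cj (pd w j x) := by
  have hw : Sch w := hwd ▸ hu.op (sI_temp hη)
  rw [pd_sub (hu.cub.op (sI_temp hη)).differentiable hw.cub.differentiable, pd_cub hw.differentiable,
    op_conj (fun ξ => by simp [sJ, Complex.conj_ofNat]), op_sJ hη j hu, op_sJ hη j hu.cub, ← hwd]
  ring

lemma D_enorm (R u w p : ℂ) : ‖R + 2 * (u * cj u - w * cj w) * p + (u^2 - w^2) * cj p‖ₑ ≤
    ‖R‖ₑ + 3 * (‖u - w‖ₑ * ‖u - w‖ₑ * ‖p‖ₑ) + 6 * (‖w‖ₑ * ‖u - w‖ₑ * ‖p‖ₑ) := by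
  have h : ‖R + 2 * (u * cj u - w * cj w) * p + (u^2 - w^2) * cj p‖ ≤
    ‖R‖ + 3 * (‖u - w‖ * ‖u - w‖ * ‖p‖) + 6 * (‖w‖ * ‖u - w‖ * ‖p‖) := by
    have e1 : u * cj u - w * cj w = (u - w) * cj (u - w) + (u - w) * cj w + w * cj (u - w) := by
      simp only [map_sub]; ring
    have e2 : u^2 - w^2 = (u-w)*(u-w) + 2 * (w * (u - w)) := by ring
    have h1 : ‖u * cj u - w * cj w‖ ≤ ‖u-w‖*‖u-w‖ + 2 * (‖w‖ * ‖u-w‖) := by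
      rw [e1]
      refine (norm_add₃_le).trans ?_
      simp only [norm_mul, RCLike.norm_conj]
      linarith
    have h2 : ‖u^2 - w^2‖ ≤ ‖u-w‖*‖u-w‖ + 2 * (‖w‖ * ‖u-w‖) := by
      rw [e2]
      refine (norm_add_le _ _).trans ?_
      simp
    refine (norm_add₃_le).trans ?_
    simp only [norm_mul, RCLike.norm_conj, Complex.norm_ofNat]
    have := mul_le_mul_of_nonneg_right h1 (norm_nonneg p)
    have := mul_le_mul_of_nonneg_right h2 (norm_nonneg p)
    nlinarith
  simp only [← ofReal_norm]
  have e2 : (3:ENNReal) = eR 3 := by simp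
  have e3 : (6:ENNReal) = eR 6 := by simp
  rw [e2, e3]
  repeat first
    | rw [← ENNReal.ofReal_mul psv]
    | rw [← ENNReal.ofReal_add psv psv]
  exact ofReal_le_ofReal h

lemma D_bound1 {s : ℝ} {η : ℝ → ℝ} (hη : IsCutoff s η) (hs0 : 1/2 < s) (hs : s < 1) (j : Fin 3) :
    ∃ C : ENNReal, C ≠ ⊤ ∧ ∀ u, Sch u → nL (18/13) (fun x => pd (fun x => op (sI η) (cub u) x - cub (op (sI η) u) x) j x) ≤ 
      C * ((nG (18/5) (op (sI η) u))^2 * nG 2 (op (sI η) u)) := by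
  obtain ⟨a, ha, ha2, CQ, hCQ, hQ⟩ := Q_bound hη hs0 hs
  obtain ⟨q', g', hKD⟩ := hη.prof.kd' (b := -s) (2*π*I : ℂ) j (by ring)
  obtain ⟨CR, hCR, hR⟩ := KD.quad_bound (σ := sJ η j) hKD (sJ_temp hη j) (by simp [sJ]) (a := a) (p := 18/13) (by linarith) (by linarith) ha2 nmm
  obtain ⟨S, hS, hSob⟩ := sobolev_sch 2 6 nmm nmm nmm
  obtain ⟨C2, hC2, hB2⟩ := v_bound hη hs (p := 2) (q := 3) (r := 6/5) nmm nmm nmm nmm (by linarith)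
  obtain ⟨C3, hC3, hB3⟩ := v_bound hη hs (p := 18/5) (q := 18/5) (r := 1) nmm le_rfl nmm nmm (by linarith)
  obtain ⟨C4, hC4, hB4⟩ := v_bound hη hs (p := 18/5) (q := 9) (r := 6/5) nmm nmm nmm nmm (by linarith)
  refine ⟨CR * CQ + 3 * (C4 * C2) + 6 * (S * C3), by finiteness, fun u hu => ?_⟩
  set w := op (sI η) u with hwd
  have hw : Sch w := hu.op (sI_temp hη)
  set Z1 := nG (18/5) w with hZ1
  set Z2 := nG 2 w with hZ2
  set R : EC := fun x => op (sJ η j) (cub u) x - 2 * (u x * cj (u x)) * op (sJ η j) u x - (u x)^2 * op (sJ η j) (fun y => cj (u y)) x with hRd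
  have hRS : Sch R := by
    have a1 := (hu.cub.op (sJ_temp hη j))
    have a2 := (hu.op (sJ_temp hη j))
    have a3 := (hu.conj.op (sJ_temp hη j))
    exact (a1.sub (((hu.mul hu.conj).const_mul 2).mul a2)).sub (by
      have := (hu.mul hu).mul a3
      simp only [← sq] at this
      exact this)
  have hRb : nL (18/13) R ≤ CR * (CQ * Z1^2 * Z2) := hR u hu _ fun z => hQ u hu z
  have hpj : nL (18/5) (fun x => pd w j x) ≤ Z1 :=
    Finset.single_le_sum (f := fun j => nL (18/5) (fun y => pd w j y)) (fun _ _ => zero_le) (Finset.mem_univ j)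
  have mR := hRS.measurable.enorm.aemeasurable (μ := volume)
  have mw := hw.measurable.enorm.aemeasurable (μ := volume)
  have mv : AEMeasurable (fun x => ‖u x - w x‖ₑ) := (hu.sub hw).measurable.enorm.aemeasurable
  have mp : AEMeasurable (fun x => ‖pd w j x‖ₑ) := (hw.pd j).measurable.enorm.aemeasurable
  have t1 := (Np_mul3_le (p := 9) (q := 3) (l := 18/5) (r := 18/13) nmm nmm nmm nmm mv mv mp).trans (mul_le_mul' (mul_le_mul' (hB4 u hu) (hB2 u hu)) hpj)
  have t2 := (Np_mul3_le (p := 6) (q := 18/5) (l := 18/5) (r := 18/13) nmm nmm nmm nmm mw mv mp).trans (mul_le_mul' (mul_le_mul' (hSob w hw) (hB3 u hu)) hpj)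
  have hp1 : (1:ℝ) ≤ 18/13 := by norm_num
  calc _ ≤ Np (18/13) volume (fun x => ‖R x‖ₑ + 3 * (‖u x - w x‖ₑ * ‖u x - w x‖ₑ * ‖pd w j x‖ₑ) + 6 * (‖w x‖ₑ * ‖u x - w x‖ₑ * ‖pd w j x‖ₑ)) := by
        refine Np_mono nmm fun x => ?_
        beta_reduce
        rw [D_ident hη j hu hwd x]
        exact D_enorm _ _ _ _
    _ ≤ _ := Np_add_le hp1 (mR.add (((mv.mul mv).mul mp).const_mul 3)) (((mw.mul mv).mul mp).const_mul 6)
    _ ≤ _ := add_le_add (Np_add_le hp1 mR (((mv.mul mv).mul mp).const_mul 3)) le_rfl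
    _ = nL (18/13) R + 3 * Np (18/13) volume (fun x => ‖u x - w x‖ₑ * ‖u x - w x‖ₑ * ‖pd w j x‖ₑ) + 6 * Np (18/13) volume (fun x => ‖w x‖ₑ * ‖u x - w x‖ₑ * ‖pd w j x‖ₑ) := by
        rw [Np_const_mul nmm (by simp), Np_const_mul nmm (by simp)]; rfl
    _ ≤ _ := add_le_add (add_le_add hRb (mul_le_mul' le_rfl t1)) (mul_le_mul' le_rfl t2)
    _ = _ := by ring

/-! scaling -/
lemma fourier_dil (f : EC) {c : ℝ} (hc : 0 < c) (ξ : E3) : 𝓕 (fun x => f (c • x)) ξ = ((c ^ 3)⁻¹ : ℝ) * 𝓕 f (c⁻¹ • ξ) := by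
  rw [Real.fourier_eq, Real.fourier_eq]
  have h := Measure.integral_comp_smul (volume : Measure E3) (fun v => 𝐞 (-inner ℝ v (c⁻¹ • ξ)) • f v) c
  have e : ∀ v : E3, inner ℝ (c • v) (c⁻¹ • ξ) = inner ℝ v ξ := fun v => by
    rw [inner_smul_left, inner_smul_right]; simp; field_simp
  simp only [e] at h
  rw [h]
  simp [abs_of_pos hc]

lemma op_dil (m u : EC) {c : ℝ} (hc : 0 < c) (x : E3) : op m (fun x => u (c • x)) x = op (fun ζ => m (c • ζ)) u (c • x) := by
  unfold op
  simp only [fourier_dil u hc]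
  rw [Real.fourierInv_eq_fourier_neg, Real.fourierInv_eq_fourier_neg]
  have e : (fun ξ => m ξ * (((c ^ 3)⁻¹ : ℝ) * 𝓕 u (c⁻¹ • ξ))) = fun ξ => (fun ζ => (((c ^ 3)⁻¹ : ℝ) : ℂ) * (m (c • ζ) * 𝓕 u ζ)) (c⁻¹ • ξ) := by
    ext ξ
    simp only [smul_smul, mul_inv_cancel₀ hc.ne', one_smul]; ring
  rw [e, fourier_dil (fun ζ => (((c ^ 3)⁻¹ : ℝ) : ℂ) * (m (c • ζ) * 𝓕 u ζ)) (inv_pos.2 hc), inv_inv, smul_neg]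
  rw [Real.fourier_eq, Real.fourier_eq, ← integral_const_mul]
  congr 1; ext v
  simp only [Circle.smul_def, smul_eq_mul]
  have : (c:ℂ) ≠ 0 := by exact_mod_cast hc.ne'
  push_cast; field_simp

lemma pd_dil {f : EC} (hf : Differentiable ℝ f) (c : ℝ) (j : Fin 3) (x : E3) : 
    pd (fun x => f (c • x)) j x = c * pd f j (c • x) := by
  unfold pd
  have h := (hf (c • x)).hasFDerivAt.comp x ((hasFDerivAt_id x).const_smul c)
  have := h.fderiv
  have e : (f ∘ HSMul.hSMul c) = fun x => f (c • x) := rfl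
  rw [e] at this
  rw [this]; simp

/-- symbol of `I_N` -/
def sN (η : ℝ → ℝ) (N : ℝ) (ξ : E3) : ℂ := (η (‖ξ‖ / N) : ℂ)

lemma nL_pd_dil {f : EC} (hf : Differentiable ℝ f) {c p : ℝ} (hc : 0 < c) (hp : 0 < p) (j : Fin 3) :
    nL p (fun x => pd (fun x => f (c • x)) j x) = eR (c ^ (1 - 3/p)) * nL p (fun x => pd f j x) := by
  simp only [pd_dil hf]
  have h1 : nL p (fun x => (c:ℂ) * pd f j (c • x)) = eR c * nL p (fun x => pd f j (c • x)) := by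
    unfold nL
    simp only [enorm_mul]
    rw [Np_const_mul hp enorm_ne_top, ← ofReal_norm, Complex.norm_real, Real.norm_of_nonneg hc.le]
  rw [h1, nL_smul (fun x => pd f j x) hp hc, ← mul_assoc, ← ENNReal.ofReal_mul hc.le, sub_eq_add_neg, Real.rpow_add hc 1, Real.rpow_one, neg_div]

lemma nG_dil {f : EC} (hf : Differentiable ℝ f) {c p : ℝ} (hc : 0 < c) (hp : 0 < p) :
    nG p (fun x => f (c • x)) = eR (c ^ (1 - 3/p)) * nG p f := by
  simp only [nG, nL_pd_dil hf hc hp, Finset.mul_sum]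

/-- core spatial estimate. -/
lemma D_bound {s : ℝ} {η : ℝ → ℝ} (hη : IsCutoff s η) (hs0 : 1/2 < s) (hs : s < 1) :
    ∃ C : ENNReal, C ≠ ⊤ ∧ ∀ N : ℝ, 0 < N → ∀ u, Sch u → nG (18/13) (fun x => op (sN η N) (cub u) x - cub (op (sN η N) u) x) ≤ 
      C * eR N⁻¹ * ((nG (18/5) (op (sN η N) u))^2 * nG 2 (op (sN η N) u)) := by
  choose C hC hB using D_bound1 hη hs0 hs
  refine ⟨∑ j, C j, by simp [ENNReal.sum_eq_top, hC], fun N hN u hu => ?_⟩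
  unfold nG
  rw [Finset.sum_mul, Finset.sum_mul]
  refine Finset.sum_le_sum fun j _ => ?_
  have hc : 0 < N⁻¹ := inv_pos.2 hN
  set c := N⁻¹ with hcd
  have ht : (sN η N).HasTemperateGrowth := cutoff_temperate hη N hN
  have e0 : (fun ζ => sI η (c • ζ)) = sN η N := by
    ext ζ
    simp only [sI, sN, norm_smul, Real.norm_of_nonneg hc.le]
    rw [hcd, div_eq_inv_mul]
  have e1 : ∀ f : EC, op (sI η) (fun x => f (c • x)) = fun x => op (sN η N) f (c • x) := fun f => by
    ext x; rw [op_dil _ _ hc, e0]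
  have h := hB j (fun x => u (c • x)) (hu.dil hc.ne')
  have e2 : cub (fun x => u (c • x)) = fun x => cub u (c • x) := rfl
  set w := op (sN η N) u with hwd
  have hw : Sch w := hu.op ht
  have hD : Sch (fun x => op (sN η N) (cub u) x - cub w x) := (hu.cub.op ht).sub hw.cub
  rw [e2, e1 (cub u), e1 u] at h
  have e3 : (fun x => (fun x => op (sN η N) (cub u) (c • x)) x - cub (fun x => op (sN η N) u (c • x)) x) = 
    fun x => (fun x => op (sN η N) (cub u) x - cub w x) (c • x) := rfl
  rw [e3, nL_pd_dil hD.differentiable hc nmm, nG_dil hw.differentiable hc nmm, nG_dil hw.differentiable hc nmm] at h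
  set X := nL (18/13) (fun x => pd (fun x => op (sN η N) (cub u) x - cub w x) j x)
  have hk : eR (c ^ ((7:ℝ)/6)) * eR (c ^ (1 - 3/(18/13):ℝ)) = 1 := by
    rw [← ENNReal.ofReal_mul psv, ← Real.rpow_add hc]; norm_num
  have h2 : X = eR (c ^ ((7:ℝ)/6)) * (eR (c ^ (1 - 3/(18/13):ℝ)) * X) := by
    rw [← mul_assoc, hk, one_mul]
  rw [h2]
  refine (mul_le_mul' le_rfl h).trans (le_of_eq ?_)
  have hk2 : eR (c ^ ((7:ℝ)/6)) * (eR (c ^ (1 - 3/(18/5):ℝ)))^2 * eR (c ^ (1 - 3/2:ℝ)) = eR c := by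
    rw [← ENNReal.ofReal_pow psv, ← ENNReal.ofReal_mul psv, ← ENNReal.ofReal_mul psv, 
      ← Real.rpow_natCast, ← Real.rpow_mul hc.le, ← Real.rpow_add hc, ← Real.rpow_add hc]
    norm_num
  rw [← hk2]
  simp only [nG]
  ring

/-- uniform boundedness of `I_N` on `L^p`. -/
lemma sN_bound {s : ℝ} {η : ℝ → ℝ} (hη : IsCutoff s η) (hs : s < 1) {p : ℝ} (hp : 1 ≤ p) :
    ∃ C : ENNReal, C ≠ ⊤ ∧ ∀ N : ℝ, 0 < N → ∀ u, Sch u → nL p (op (sN η N) u) ≤ C * nL p u := by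
  obtain ⟨C, hC, hB⟩ := sI_bound hη hs hp
  refine ⟨C, hC, fun N hN u hu => ?_⟩
  have hc : 0 < N⁻¹ := inv_pos.2 hN
  set c := N⁻¹ with hcd
  have e0 : (fun ζ => sI η (c • ζ)) = sN η N := by
    ext ζ
    simp only [sI, sN, norm_smul, Real.norm_of_nonneg hc.le]
    rw [hcd, div_eq_inv_mul]
  have e1 : op (sI η) (fun x => u (c • x)) = fun x => op (sN η N) u (c • x) := by
    ext x; rw [op_dil _ _ hc, e0]
  have h := hB _ (hu.dil hc.ne')
  rw [e1, nL_smul _ (by linarith) hc, nL_smul _ (by linarith) hc, mul_left_comm] at h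
  exact (ENNReal.mul_le_mul_iff_right (by simp only [ne_eq, ENNReal.ofReal_eq_zero, not_le]; positivity) ENNReal.ofReal_ne_top).1 h

lemma nL_le_of_norm {f g : EC} {p : ℝ} (hp : 0 < p) (h : ∀ x, ‖f x‖ ≤ ‖g x‖) : nL p f ≤ nL p g :=
  Np_mono hp fun x => enorm_le_iff_norm_le.2 (h x)

lemma nL_const_mul {p : ℝ} (hp : 0 < p) (c : ℂ) (f : EC) : nL p (fun x => c * f x) = ‖c‖ₑ * nL p f := by
  unfold nL
  simp only [enorm_mul]
  exact Np_const_mul hp enorm_ne_top _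

lemma nL_interp_le {p q r : ℝ} (hp : 0 < p) (hpr : p ≤ r) (hrq : r ≤ q) {f : EC} (hf : Measurable f)
    {A : ENNReal} (h1 : nL p f ≤ A) (h2 : nL q f ≤ A) : nL r f ≤ A := by
  rcases eq_or_lt_of_le hpr with rfl | hpr
  · exact h1
  rcases eq_or_lt_of_le hrq with rfl | hrq
  · exact h2
  have hr : 0 < r := hp.trans hpr
  have hq : 0 < q := hr.trans hrq
  set θ : ℝ := (1/r - 1/q)/(1/p-1/q) with hθ
  have d1 : 1/q < 1/r := one_div_lt_one_div_of_lt hr hrq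
  have d2 : 1/r < 1/p := one_div_lt_one_div_of_lt hp hpr
  have hθ0 : 0 < θ := div_pos (by linarith) (by linarith)
  have hθ1 : θ < 1 := by rw [hθ, div_lt_one (by linarith)]; linarith
  have he : θ * (1/p-1/q) = 1/r-1/q := by rw [hθ]; exact div_mul_cancel₀ _ (by linarith)
  have h : 1 / r = θ / p + (1 - θ) / q := by
    have : θ / p + (1 - θ) / q = θ * (1/p-1/q) + 1/q := by ring
    rw [this, he]; ring
  calc nL r f ≤ nL p f ^ θ * nL q f ^ (1-θ) := Np_interp hp hq hθ0 hθ1 h hf.enorm.aemeasurable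
    _ ≤ A ^ θ * A ^ (1-θ) := by
        have : 0 ≤ 1 - θ := by linarith
        gcongr
    _ = A := by
        rw [← rpow_add_of_nonneg _ _ hθ0.le (by linarith)]; simp

/-- `(1 + |ξ|²)` as a differential operator. -/
def Lam (f : EC) (x : E3) : ℂ := f x - ((4 * π^2)⁻¹ : ℝ) * lap f x

def H2 (f : EC) : ENNReal := nL 2 (Lam f)

lemma Sch.Lam {f : EC} (hf : Sch f) : Sch (Lam f) := hf.sub (hf.lap.const_mul _)

lemma fourier_sum_sch {F : Fin 3 → EC} (h : ∀ i, Sch (F i)) (ξ : E3) :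
    𝓕 (fun x => ∑ i, F i x) ξ = ∑ i, 𝓕 (F i) ξ := by
  simp only [Real.fourier_eq, Finset.smul_sum]
  rw [integral_finsetSum]
  intro i _
  exact (Real.fourierIntegral_convergent_iff ξ).2 (h i).integrable

lemma fourier_const_mul (c : ℂ) (f : EC) (ξ : E3) : 𝓕 (fun x => c * f x) ξ = c * 𝓕 f ξ := by
  simp only [Real.fourier_eq]
  rw [← integral_const_mul]
  congr 1; ext x
  simp only [Circle.smul_def, smul_eq_mul]; ring

lemma norm_sq_coords (ξ : E3) : ‖ξ‖^2 = ∑ i, (ξ i)^2 := by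
  rw [EuclideanSpace.norm_sq_eq]; simp

lemma Sch.fourier_lap {f : EC} (hf : Sch f) (ξ : E3) :
    𝓕 (_root_.lap f) ξ = -((4*π^2*‖ξ‖^2 : ℝ) : ℂ) * 𝓕 f ξ := by
  have e : _root_.lap f = fun x => ∑ i, _root_.pd (fun y => _root_.pd f i y) i x := rfl
  rw [e, fourier_sum_sch fun i => (hf.pd i).pd i]
  simp only [(hf.pd _).fourier_pd, hf.fourier_pd]
  rw [norm_sq_coords]
  push_cast
  have hI : I * I = -1 := Complex.I_mul_I
  simp only [Fin.sum_univ_three]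
  linear_combination (4*π^2*𝓕 f ξ*((ξ 0:ℂ)^2+(ξ 1:ℂ)^2+(ξ 2:ℂ)^2)) * hI

lemma Sch.fourier_Lam {f : EC} (hf : Sch f) (ξ : E3) :
    𝓕 (_root_.Lam f) ξ = ((1+‖ξ‖^2 : ℝ) : ℂ) * 𝓕 f ξ := by
  have e : _root_.Lam f = fun x => f x - (((4 * π^2)⁻¹ : ℝ) : ℂ) * _root_.lap f x := rfl
  rw [e, fourier_sub hf.integrable (hf.lap.const_mul _).integrable]
  rw [fourier_const_mul, hf.fourier_lap]
  have : (π:ℂ) ≠ 0 := by exact_mod_cast Real.pi_ne_zero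
  push_cast
  field_simp
  ring

lemma nL2_le_fourier {f g : EC} (hf : Sch f) (hg : Sch g) {c : ℝ} (hc : 0 ≤ c)
    (h : ∀ ξ, ‖𝓕 f ξ‖ ≤ c * ‖𝓕 g ξ‖) : nL 2 f ≤ eR c * nL 2 g := by
  rw [← hf.plancherel, ← hg.plancherel]
  have e : eR c = ‖(c:ℂ)‖ₑ := by rw [← ofReal_norm]; simp [abs_of_nonneg hc]
  rw [e, ← nL_const_mul nmm]
  refine nL_le_of_norm nmm fun ξ => (h ξ).trans ?_
  simp [abs_of_nonneg hc]

lemma nL2_le_H2 {f g : EC} (hf : Sch f) (hg : Sch g) {c : ℝ} (hc : 0 ≤ c)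
    (h : ∀ ξ, ‖𝓕 f ξ‖ ≤ c * ((1+‖ξ‖^2) * ‖𝓕 g ξ‖)) : nL 2 f ≤ eR c * H2 g := by
  refine nL2_le_fourier hf hg.Lam hc fun ξ => (h ξ).trans ?_
  rw [hg.fourier_Lam, norm_mul, Complex.norm_real, Real.norm_of_nonneg psv]

lemma abs_coord_le (ξ : E3) (i : Fin 3) : |ξ i| ≤ ‖ξ‖ := by
  have := EuclideanSpace.norm_sq_eq ξ
  have h2 : (ξ i)^2 ≤ ‖ξ‖^2 := by
    rw [norm_sq_coords]
    exact Finset.single_le_sum (f := fun i => (ξ i)^2) (fun i _ => sq_nonneg _) (Finset.mem_univ i)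
  exact abs_le_of_sq_le_sq h2 (norm_nonneg _)

lemma nL2_f_le {f : EC} (hf : Sch f) : nL 2 f ≤ H2 f := by
  have := nL2_le_H2 hf hf (c := 1) nmm fun ξ => by
    have := norm_nonneg (𝓕 f ξ); nlinarith [mul_nonneg (sq_nonneg ‖ξ‖) this]
  simpa using this

lemma nL2_pd_le {f : EC} (hf : Sch f) (j : Fin 3) :
    nL 2 (fun x => pd f j x) ≤ eR (2*π) * H2 f := by
  refine nL2_le_H2 (hf.pd j) hf psv fun ξ => ?_
  rw [hf.fourier_pd, norm_mul]
  have h : ‖(2*π*I*(ξ j:ℂ))‖ ≤ 2*π*(1+‖ξ‖^2) := by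
    simp only [norm_mul, Complex.norm_real, Complex.norm_I, Complex.norm_ofNat, Real.norm_eq_abs, abs_of_pos Real.pi_pos]
    have := abs_coord_le ξ j
    have h2 : ‖ξ‖ ≤ 1 + ‖ξ‖^2 := by nlinarith [sq_nonneg (‖ξ‖-1), norm_nonneg ξ]
    rw [mul_one]; gcongr; linarith
  calc _ ≤ 2*π*(1+‖ξ‖^2) * ‖𝓕 f ξ‖ := by gcongr
    _ = _ := by ring

lemma nL2_pd_pd_le {f : EC} (hf : Sch f) (i j : Fin 3) :
    nL 2 (fun x => pd (fun y => pd f i y) j x) ≤ eR (4*π^2) * H2 f := by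
  refine nL2_le_H2 ((hf.pd i).pd j) hf psv fun ξ => ?_
  rw [(hf.pd i).fourier_pd, hf.fourier_pd, ← mul_assoc, norm_mul]
  have h : ‖(2*π*I*(ξ j:ℂ))*(2*π*I*(ξ i:ℂ))‖ ≤ 4*π^2*(1+‖ξ‖^2) := by
    simp only [norm_mul, Complex.norm_real, Complex.norm_I, Complex.norm_ofNat, Real.norm_eq_abs, abs_of_pos Real.pi_pos]
    have h1 := abs_coord_le ξ j
    have h2 := abs_coord_le ξ i
    have h3 : |ξ j| * |ξ i| ≤ ‖ξ‖*‖ξ‖ := by gcongr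
    calc _ = 4*π^2*(|ξ j| * |ξ i|) := by ring
      _ ≤ _ := by gcongr; nlinarith
  calc _ ≤ 4*π^2*(1+‖ξ‖^2) * ‖𝓕 f ξ‖ := by gcongr
    _ = _ := by ring

lemma sup_H2 : ∃ C : ENNReal, C ≠ ⊤ ∧ ∀ f, Sch f → ∀ x, ‖f x‖ₑ ≤ C * H2 f := by
  have hInt : Integrable (fun ξ : E3 => ((1 : ℝ) + ‖ξ‖ ^ 2) ^ (-(4:ℝ) / 2)) := by
    apply integrable_rpow_neg_one_add_norm_sq; simp; norm_num
  refine ⟨Np 2 volume (fun ξ : E3 => eR ((1+‖ξ‖^2)⁻¹)), ?_, fun f hf x => ?_⟩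
  · unfold Np
    refine rpow_ne_top_of_nonneg nmm ?_
    have := hInt.lintegral_lt_top
    refine ne_of_lt (lt_of_le_of_lt (lintegral_mono fun ξ => ?_) this)
    rw [ofReal_rpow_of_nonneg psv nmm]
    apply ofReal_le_ofReal
    rw [show (-(4:ℝ)/2) = -2 by norm_num, Real.rpow_neg psv, Real.inv_rpow psv]
  · have h1 : ‖f x‖ₑ ≤ ∫⁻ ξ, ‖𝓕 f ξ‖ₑ := by
      conv_lhs => rw [← hf.inv]
      rw [Real.fourierInv_eq]
      refine (enorm_integral_le_lintegral_enorm _).trans (le_of_eq ?_)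
      refine lintegral_congr fun ξ => ?_
      rw [← ofReal_norm, ← ofReal_norm, Circle.norm_smul]
    refine h1.trans ?_
    have h2 : ∀ ξ, ‖𝓕 f ξ‖ₑ = eR ((1+‖ξ‖^2)⁻¹) * ‖𝓕 (Lam f) ξ‖ₑ := fun ξ => by
      rw [hf.fourier_Lam, ← ofReal_norm, ← ofReal_norm, ← ENNReal.ofReal_mul psv, norm_mul,
        Complex.norm_real, Real.norm_of_nonneg psv, ← mul_assoc, inv_mul_cancel₀ psv, one_mul]
    simp only [h2]
    have h3 := Np_mul_le (μ := (volume : Measure E3)) (p := 2) (q := 2) (r := 1) nmm nmm nmm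
      (F := fun ξ : E3 => eR ((1+‖ξ‖^2)⁻¹)) (G := fun ξ => ‖𝓕 (Lam f) ξ‖ₑ)
      (by fun_prop) hf.Lam.fourier.measurable.enorm.aemeasurable
    have h4 : ∫⁻ ξ, eR ((1+‖ξ‖^2)⁻¹) * ‖𝓕 (Lam f) ξ‖ₑ = Np 1 volume (fun ξ : E3 => eR ((1+‖ξ‖^2)⁻¹) * ‖𝓕 (Lam f) ξ‖ₑ) := by
      simp [Np]
    rw [h4]
    refine h3.trans (le_of_eq ?_)
    congr 1
    exact hf.Lam.plancherel

/-- All the embeddings of `H²` that we need. -/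
lemma H2_bounds : ∃ C : ENNReal, C ≠ ⊤ ∧ 1 ≤ C ∧ ∀ f, Sch f → (∀ x, ‖f x‖ₑ ≤ C * H2 f) ∧ nL 2 f ≤ C * H2 f ∧
    nL 2 (lap f) ≤ C * H2 f ∧ ∀ j, ∀ p, 2 ≤ p → p ≤ 6 → nL p (fun x => pd f j x) ≤ C * H2 f := by
  obtain ⟨C1, hC1, h1⟩ := sup_H2
  obtain ⟨C2, hC2, h2⟩ := sobolev_sch 2 6 nmm nmm nmm
  set D := eR (4*π^2) with hD
  have hDt : D ≠ ⊤ := ENNReal.ofReal_ne_top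
  refine ⟨1 + C1 + eR (2*π) + 3*D + C2*(3*D), by finiteness, ?_, fun f hf => ⟨fun x => ?_, ?_, ?_, fun j p hp hp6 => ?_⟩⟩
  · rw [add_assoc, add_assoc, add_assoc]; exact le_self_add
  · refine (h1 f hf x).trans ?_
    gcongr
    calc C1 ≤ 1 + C1 := le_add_self
      _ ≤ _ := by rw [add_assoc, add_assoc]; exact le_self_add
  · refine (nL2_f_le hf).trans ?_
    conv_lhs => rw [← one_mul (H2 f)]
    gcongr
    rw [add_assoc, add_assoc, add_assoc]; exact le_self_add
  · have h3 : nL 2 (lap f) ≤ 3*D * H2 f := by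
      have e : lap f = fun x => ∑ i, pd (fun y => pd f i y) i x := rfl
      rw [e]
      refine (nL_sum_le nmm Finset.univ fun i => ((hf.pd i).pd i).measurable).trans ?_
      refine (Finset.sum_le_sum fun i _ => nL2_pd_pd_le hf i i).trans (le_of_eq ?_)
      rw [← hD]; simp only [Finset.sum_const, Finset.card_univ, Fintype.card_fin, nsmul_eq_mul]; push_cast; ring
    refine h3.trans ?_
    gcongr
    calc 3*D ≤ 1 + C1 + eR (2*π) + 3*D := le_add_self
      _ ≤ _ := le_self_add
  · refine nL_interp_le nmm hp hp6 (hf.pd j).measurable ?_ ?_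
    · refine (nL2_pd_le hf j).trans ?_
      gcongr
      calc eR (2*π) ≤ 1 + C1 + eR (2*π) := le_add_self
        _ ≤ _ := by rw [add_assoc _ (3*D)]; exact le_self_add
    · refine (h2 _ (hf.pd j)).trans ?_
      have : nG 2 (fun x => pd f j x) ≤ 3*D*H2 f := by
        unfold nG
        refine (Finset.sum_le_sum fun i _ => nL2_pd_pd_le hf j i).trans (le_of_eq ?_)
        rw [← hD]; simp only [Finset.sum_const, Finset.card_univ, Fintype.card_fin, nsmul_eq_mul]; push_cast; ring
      calc _ ≤ C2 * (3*D*H2 f) := by gcongr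
        _ = C2*(3*D)*H2 f := by ring
        _ ≤ _ := by gcongr; exact le_add_self

lemma pd_add {f g : EC} (hf : Differentiable ℝ f) (hg : Differentiable ℝ g) (j : Fin 3) (x : E3) :
    pd (fun y => f y + g y) j x = pd f j x + pd g j x := by
  unfold pd
  rw [fderiv_fun_add (hf x) (hg x)]
  simp

lemma pd_const_mul {f : EC} (hf : Differentiable ℝ f) (c : ℂ) (j : Fin 3) (x : E3) :
    pd (fun y => c * f y) j x = c * pd f j x := by
  unfold pd
  rw [fderiv_const_mul (hf x)]
  simp

lemma norm_cub (f : EC) (x : E3) : ‖cub f x‖ = ‖f x‖^3 := by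
  unfold cub; rw [norm_mul, norm_mul, RCLike.norm_conj]; ring

lemma enorm_cub (f : EC) (x : E3) : ‖cub f x‖ₑ = ‖f x‖ₑ^3 := by
  rw [← ofReal_norm, norm_cub, ← ofReal_norm, ENNReal.ofReal_pow (norm_nonneg _)]

lemma pd_pd_cub {f : EC} (hf : Sch f) (j : Fin 3) (x : E3) :
    pd (fun y => pd (cub f) j y) j x =
      2 * (f x * cj (f x)) * pd (fun y => pd f j y) j x
      + (f x)^2 * cj (pd (fun y => pd f j y) j x)
      + (2 * (pd f j x)^2 * cj (f x) + 4 * f x * (pd f j x * cj (pd f j x))) := by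
  have hd := hf.differentiable
  have hp := (hf.pd j).differentiable
  have hc := hf.conj.differentiable
  have hcp := (hf.pd j).conj.differentiable
  have e : (fun y => pd (cub f) j y) = fun y => ((2 * (f y * cj (f y))) * pd f j y)
      + (f y * f y) * cj (pd f j y) := by
    funext y; rw [pd_cub hd]; ring
  rw [e, pd_add (f := fun y => (2 * (f y * cj (f y))) * pd f j y)
      (g := fun y => (f y * f y) * cj (pd f j y)) (((hf.mul hf.conj).const_mul 2).mul (hf.pd j)).differentiable
      ((hf.mul hf).mul (hf.pd j).conj).differentiable,
    pd_mul (f := fun y => (2 * (f y * cj (f y)))) (g := fun y => pd f j y)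
      ((hf.mul hf.conj).const_mul 2).differentiable hp,
    pd_mul (f := fun y => f y * f y) (g := fun y => cj (pd f j y)) (hf.mul hf).differentiable hcp,
    pd_const_mul (f := fun y => f y * cj (f y)) (hf.mul hf.conj).differentiable,
    pd_mul hd hc, pd_mul hd hd, pd_conj hd, pd_conj hp]
  ring

lemma lap_cub {f : EC} (hf : Sch f) (x : E3) : lap (cub f) x =
    2 * (f x * cj (f x)) * lap f x + (f x)^2 * cj (lap f x) +
    ∑ j, (2 * (pd f j x)^2 * cj (f x) + 4 * f x * (pd f j x * cj (pd f j x))) := by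
  have e : ∀ g : EC, lap g x = ∑ i, pd (fun y => pd g i y) i x := fun g => rfl
  rw [e, e, map_sum, Finset.mul_sum, Finset.mul_sum, ← Finset.sum_add_distrib, ← Finset.sum_add_distrib]
  exact Finset.sum_congr rfl fun j _ => pd_pd_cub hf j x

lemma norm_Lam_cub {f : EC} (hf : Sch f) (x : E3) :
    ‖Lam (cub f) x‖ ≤ 4 * ‖f x‖^3 + 3 * (‖f x‖^2 * ‖Lam f x‖) + 6 * (‖f x‖ * ∑ j, ‖pd f j x‖^2) := by
  set c : ℝ := (4 * π^2)⁻¹ with hc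
  have hc0 : 0 ≤ c := by positivity
  have hc1 : c ≤ 1 := by
    apply inv_le_one_of_one_le₀
    nlinarith [Real.pi_gt_three]
  set S := ∑ j, (2 * (pd f j x)^2 * cj (f x) + 4 * f x * (pd f j x * cj (pd f j x))) with hS
  have hSn : ‖S‖ ≤ 6 * (‖f x‖ * ∑ j, ‖pd f j x‖^2) := by
    refine (norm_sum_le _ _).trans ?_
    rw [Finset.mul_sum, Finset.mul_sum]
    refine Finset.sum_le_sum fun j _ => (norm_add_le _ _).trans (le_of_eq ?_)
    simp only [norm_mul, norm_pow, RCLike.norm_conj, Complex.norm_ofNat]; ring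
  have hL : (c:ℂ) * lap f x = f x - Lam f x := by unfold Lam; rw [hc]; ring
  have hL' : (c:ℂ) * cj (lap f x) = cj (f x) - cj (Lam f x) := by
    rw [← map_sub, ← hL, map_mul, Complex.conj_ofReal]
  have e : Lam (cub f) x = cub f x - (2 * (f x * cj (f x)) * (f x - Lam f x)
      + (f x)^2 * (cj (f x) - cj (Lam f x)) + c * S) := by
    rw [← hL, ← hL']
    have : Lam (cub f) x = cub f x - (c:ℂ) * lap (cub f) x := rfl
    rw [this, lap_cub hf, ← hS]; ring
  have e2 : Lam (cub f) x = (-2 : ℂ) * cub f x + 2 * (f x * cj (f x)) * Lam f x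
     + (f x)^2 * cj (Lam f x) - c * S := by rw [e]; unfold cub; ring
  rw [e2]
  calc _ ≤ ‖(-2 : ℂ) * cub f x‖ + ‖2 * (f x * cj (f x)) * Lam f x‖
     + ‖(f x)^2 * cj (Lam f x)‖ + ‖c * S‖ := by
        refine (norm_sub_le _ _).trans ?_
        gcongr
        exact norm_add₃_le
    _ = 2 * ‖f x‖^3 + 3 * (‖f x‖^2 * ‖Lam f x‖) + c * ‖S‖ := by
        simp only [norm_mul, norm_pow, RCLike.norm_conj, Complex.norm_ofNat, norm_neg, norm_cub, Complex.norm_real,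
          Real.norm_of_nonneg hc0]; ring
    _ ≤ _ := by
        have : c * ‖S‖ ≤ 1 * ‖S‖ := by gcongr
        have h3 : 0 ≤ ‖f x‖^3 := by positivity
        linarith

lemma enorm_Lam_cub {f : EC} (hf : Sch f) (x : E3) :
    ‖Lam (cub f) x‖ₑ ≤ 4 * ‖f x‖ₑ^3 + 3 * (‖f x‖ₑ^2 * ‖Lam f x‖ₑ) + 6 * ∑ j, ‖f x‖ₑ * ‖pd f j x‖ₑ^2 := by
  have h := norm_Lam_cub hf x
  rw [Finset.mul_sum] at h
  have h2 := ofReal_le_ofReal h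
  rw [ofReal_norm] at h2
  refine h2.trans (le_of_eq ?_)
  rw [ENNReal.ofReal_add psv psv, ENNReal.ofReal_add psv psv,
    ENNReal.ofReal_mul nmm, ENNReal.ofReal_mul nmm, ENNReal.ofReal_mul nmm,
    ENNReal.ofReal_mul psv, ENNReal.ofReal_pow psv, ENNReal.ofReal_pow psv,
    ENNReal.ofReal_sum_of_nonneg (fun i _ => by positivity)]
  simp only [ENNReal.ofReal_mul (norm_nonneg _), ENNReal.ofReal_pow (norm_nonneg _), ofReal_norm]
  norm_num

lemma enorm_pd_cub {f : EC} (hf : Sch f) (j : Fin 3) (x : E3) :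
    ‖pd (cub f) j x‖ₑ ≤ 3 * (‖f x‖ₑ^2 * ‖pd f j x‖ₑ) := by
  have h : ‖pd (cub f) j x‖ ≤ 3 * (‖f x‖^2 * ‖pd f j x‖) := by
    rw [pd_cub hf.differentiable]
    refine (norm_add_le _ _).trans (le_of_eq ?_)
    simp only [norm_mul, norm_pow, RCLike.norm_conj, Complex.norm_ofNat]; ring
  have h2 := ofReal_le_ofReal h
  rw [ofReal_norm, ENNReal.ofReal_mul nmm, ENNReal.ofReal_mul psv, ENNReal.ofReal_pow psv,
    ofReal_norm, ofReal_norm] at h2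
  simpa using h2

/-- Hölder for trilinear expressions. -/
lemma Np_sq_mul_le {p q r : ℝ} (hp : 0 < p) (hq : 0 < q) (h : 1 / r = 2 / p + 1 / q)
    {F G : E3 → ENNReal} (hF : Measurable F) (hG : Measurable G) :
    Np r volume (fun x => F x ^ 2 * G x) ≤ Np p volume F ^ 2 * Np q volume G := by
  have := Np_mul3_le (μ := (volume : Measure E3)) hp hp hq (r := r) (by rw [h]; ring) hF.aemeasurable hF.aemeasurable hG.aemeasurable
  simpa only [← pow_two] using this

lemma nL_pd_cub {f : EC} (hf : Sch f) (j : Fin 3) {p q r : ℝ} (hr : 0 < r) (hp : 0 < p) (hq : 0 < q) (h : 1 / r = 2 / p + 1 / q) :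
    nL r (fun x => pd (cub f) j x) ≤ 3 * (nL p f ^ 2 * nL q (fun x => pd f j x)) := by
  calc _ ≤ Np r volume (fun x => 3 * (‖f x‖ₑ^2 * ‖pd f j x‖ₑ)) := Np_mono hr fun x => enorm_pd_cub hf j x
    _ = 3 * Np r volume (fun x => (‖f x‖ₑ^2 * ‖pd f j x‖ₑ)) := Np_const_mul hr (by simp) _
    _ ≤ _ := by
      gcongr
      exact Np_sq_mul_le hp hq h hf.measurable.enorm (hf.pd j).measurable.enorm

lemma Np_sum_le {p : ℝ} (hp : 1 ≤ p) {ι : Type*} (S : Finset ι) {f : ι → E3 → ENNReal} (hf : ∀ i, Measurable (f i)) :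
    Np p volume (fun x => ∑ i ∈ S, f i x) ≤ ∑ i ∈ S, Np p volume (f i) := by
  classical
  induction S using Finset.induction_on with
  | empty =>
    have hp0 : 0 < p := by linarith
    simp [Np, hp0]
  | insert a S ha ih =>
    simp only [Finset.sum_insert ha]
    refine (Np_add_le hp (hf a).aemeasurable (Finset.measurable_fun_sum S fun i _ => hf i).aemeasurable).trans ?_
    gcongr

/-- General estimate for `Λ(|f|²f)`. -/
lemma nL_Lam_cub_gen {f : EC} (hf : Sch f) {r : ℝ} (hr : 1 ≤ r) :
    nL r (Lam (cub f)) ≤ 4 * Np r volume (fun x => ‖f x‖ₑ^3) + 3 * Np r volume (fun x => ‖f x‖ₑ^2 * ‖Lam f x‖ₑ)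
      + 6 * ∑ j, Np r volume (fun x => ‖f x‖ₑ * ‖pd f j x‖ₑ^2) := by
  have hr0 : 0 < r := by linarith
  have m0 := hf.measurable.enorm
  have m1 := hf.Lam.measurable.enorm
  have m2 := fun j => (hf.pd j).measurable.enorm
  have mA : Measurable (fun x => 4 * ‖f x‖ₑ^3) := by fun_prop
  have mB : Measurable (fun x => 3 * (‖f x‖ₑ^2 * ‖Lam f x‖ₑ)) := by fun_prop
  have mD : ∀ j, Measurable (fun x => ‖f x‖ₑ * ‖pd f j x‖ₑ^2) := fun j => m0.mul ((m2 j).pow_const 2)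
  have mC : Measurable (fun x => 6 * ∑ j, ‖f x‖ₑ * ‖pd f j x‖ₑ^2) :=
    (Finset.measurable_fun_sum _ fun j _ => mD j).const_mul _
  calc _ ≤ Np r volume (fun x => 4 * ‖f x‖ₑ^3 + 3 * (‖f x‖ₑ^2 * ‖Lam f x‖ₑ) + 6 * ∑ j, ‖f x‖ₑ * ‖pd f j x‖ₑ^2) :=
        Np_mono hr0 fun x => enorm_Lam_cub hf x
    _ ≤ Np r volume (fun x => 4 * ‖f x‖ₑ^3) + Np r volume (fun x => 3 * (‖f x‖ₑ^2 * ‖Lam f x‖ₑ))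
        + Np r volume (fun x => 6 * ∑ j, ‖f x‖ₑ * ‖pd f j x‖ₑ^2) := by
        refine (Np_add_le hr (mA.add mB).aemeasurable mC.aemeasurable).trans ?_
        gcongr
        exact Np_add_le hr mA.aemeasurable mB.aemeasurable
    _ ≤ _ := by
        rw [Np_const_mul hr0 (by simp), Np_const_mul hr0 (by simp), Np_const_mul hr0 (by simp)]
        gcongr
        exact Np_sum_le hr _ mD

lemma Np_bdd_mul {r : ℝ} (hr : 0 < r) {F G : E3 → ENNReal} {S : ENNReal} (hS : S ≠ ⊤) (h : ∀ x, F x ≤ S) :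
    Np r volume (fun x => F x * G x) ≤ S * Np r volume G := by
  rw [← Np_const_mul hr hS]
  exact Np_mono hr fun x => by gcongr; exact h x

lemma H2_cub : ∃ C : ENNReal, C ≠ ⊤ ∧ ∀ f, Sch f → H2 (cub f) ≤ C * H2 f ^ 3 ∧ nL 1 (cub f) ≤ C * H2 f ^ 3 := by
  obtain ⟨C, hC, hC1, h⟩ := H2_bounds
  refine ⟨C^3*25, by finiteness, fun f hf => ?_⟩
  obtain ⟨hs, h2, -, hp⟩ := h f hf
  have hH : H2 f ≠ ⊤ := hf.Lam.nL_ne_top nmm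
  have hS : C * H2 f ≠ ⊤ := by finiteness
  have hS2 : (C * H2 f)^2 ≠ ⊤ := by finiteness
  have hsq : ∀ x, ‖f x‖ₑ^2 ≤ (C * H2 f)^2 := fun x => by gcongr; exact hs x
  constructor
  · refine (nL_Lam_cub_gen hf (r := 2) nmm).trans ?_
    have t1 : Np 2 volume (fun x => ‖f x‖ₑ^3) ≤ C^3 * H2 f^3 := by
      calc _ = Np 2 volume (fun x => ‖f x‖ₑ^2 * ‖f x‖ₑ) := by congr 1
        _ ≤ (C * H2 f)^2 * nL 2 f := Np_bdd_mul nmm hS2 hsq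
        _ ≤ (C * H2 f)^2 * (C * H2 f) := by gcongr
        _ = _ := by ring
    have t2 : Np 2 volume (fun x => ‖f x‖ₑ^2 * ‖Lam f x‖ₑ) ≤ C^3 * H2 f^3 := by
      calc _ ≤ (C * H2 f)^2 * nL 2 (Lam f) := Np_bdd_mul nmm hS2 hsq
        _ ≤ (C * H2 f)^2 * (C * H2 f) := by
            gcongr
            calc nL 2 (Lam f) = 1 * H2 f := by rw [one_mul]; rfl
              _ ≤ _ := by gcongr
        _ = _ := by ring
    have t3 : ∀ j, Np 2 volume (fun x => ‖f x‖ₑ * ‖pd f j x‖ₑ^2) ≤ C^3 * H2 f^3 := fun j => by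
      have m2 := (hf.pd j).measurable.enorm.aemeasurable (μ := volume)
      calc _ ≤ (C * H2 f) * Np 2 volume (fun x => ‖pd f j x‖ₑ^2) := Np_bdd_mul nmm hS hs
        _ ≤ (C * H2 f) * (nL 4 (fun x => pd f j x) * nL 4 (fun x => pd f j x)) := by
            gcongr
            simp only [pow_two]
            exact Np_mul_le nmm nmm nmm m2 m2
        _ ≤ (C * H2 f) * ((C * H2 f) * (C * H2 f)) := by
            gcongr <;> exact hp j 4 nmm nmm
        _ = _ := by ring
    calc _ ≤ 4 * (C^3 * H2 f^3) + 3 * (C^3 * H2 f^3) + 6 * ∑ j : Fin 3, (C^3 * H2 f^3) := by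
          gcongr
          exact t3 _
      _ = _ := by simp only [Finset.sum_const, Finset.card_univ, Fintype.card_fin, nsmul_eq_mul]; push_cast; ring
  · have m := hf.measurable.enorm.aemeasurable (μ := volume)
    calc nL 1 (cub f) = Np 1 volume (fun x => ‖f x‖ₑ * (‖f x‖ₑ * ‖f x‖ₑ)) := by
          unfold nL; simp only [enorm_cub]; congr 1; ext x; ring
      _ ≤ (C * H2 f) * Np 1 volume (fun x => ‖f x‖ₑ * ‖f x‖ₑ) := Np_bdd_mul nmm hS hs
      _ ≤ (C * H2 f) * (nL 2 f * nL 2 f) := by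
          gcongr
          exact Np_mul_le nmm nmm nmm m m
      _ ≤ (C * H2 f) * ((C * H2 f) * (C * H2 f)) := by gcongr
      _ = C^3*1*H2 f^3 := by ring
      _ ≤ _ := by gcongr; norm_num

lemma contDiff_slice_pd {f : ℝ × E3 → ℂ} (hf : ContDiff ℝ ∞ f) (j : Fin 3) :
    ContDiff ℝ ∞ (fun p : ℝ × E3 => pd (fun y => f (p.1, y)) j p.2) := by
  unfold pd
  have h1 : ContDiff ℝ ∞ (fun p : ℝ × E3 => fderiv ℝ (fun y => f (p.1, y)) p.2) := by
    refine ContDiff.fderiv (m := ∞) (n := ∞) (f := fun (p : ℝ × E3) (y : E3) => f (p.1, y)) (g := fun p => p.2) ?_ contDiff_snd (by simp)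
    exact hf.comp ((contDiff_fst.comp contDiff_fst).prodMk contDiff_snd)
  exact h1.clm_apply contDiff_const

abbrev Sol (T : ℝ) (u : ℝ → EC) : Prop := IsSolution 1 1 (fun z => z) T u

namespace Sol
variable {T : ℝ} {u : ℝ → EC}

lemma sch (hu : Sol T u) (t : ℝ) : Sch (u t) := by
  obtain ⟨g, hg⟩ := hu.schwartz 0 t
  exact ⟨g, funext fun x => by simpa using hg x⟩

lemma cd_pd (hu : Sol T u) (j : Fin 3) : ContDiff ℝ ∞ (fun p : ℝ × E3 => pd (u p.1) j p.2) :=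
  contDiff_slice_pd hu.smooth j

lemma cd_lap (hu : Sol T u) : ContDiff ℝ ∞ (fun p : ℝ × E3 => lap (u p.1) p.2) := by
  have : (fun p : ℝ × E3 => lap (u p.1) p.2) = fun p => ∑ i, pd (fun y => pd (u p.1) i y) i p.2 := rfl
  rw [this]
  exact ContDiff.sum fun i _ => contDiff_slice_pd (hu.cd_pd i) i

lemma cont (hu : Sol T u) : Continuous (fun p : ℝ × E3 => u p.1 p.2) := hu.smooth.continuous

lemma cont_cub (hu : Sol T u) : Continuous (fun p : ℝ × E3 => cub (u p.1) p.2) := by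
  unfold cub
  exact (hu.cont.mul hu.cont).mul (Complex.continuous_conj.comp hu.cont)

lemma cont_Lam (hu : Sol T u) : Continuous (fun p : ℝ × E3 => Lam (u p.1) p.2) :=
  hu.cont.sub (continuous_const.mul hu.cd_lap.continuous)

lemma meas (hu : Sol T u) : Measurable (Function.uncurry u) := hu.cont.measurable

end Sol

/-- time derivative of the solution -/
def Gt (u : ℝ → EC) (t : ℝ) (x : E3) : ℂ := I * (lap (u t) x - cub (u t) x)

namespace Sol
variable {T : ℝ} {u : ℝ → EC}

lemma sch_Gt (hu : Sol T u) (t : ℝ) : Sch (Gt u t) := ((hu.sch t).lap.sub (hu.sch t).cub).const_mul I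

lemma cont_Gt (hu : Sol T u) : Continuous (fun p : ℝ × E3 => Gt u p.1 p.2) :=
  continuous_const.mul (hu.cd_lap.continuous.sub hu.cont_cub)

lemma hasDerivAt (hu : Sol T u) {t : ℝ} (ht : t ∈ Icc (0:ℝ) T) (x : E3) :
    HasDerivAt (fun s => u s x) (Gt u t x) t := by
  have hd : DifferentiableAt ℝ (fun s => u s x) t := by
    have h : ContDiff ℝ ∞ (fun s => u s x) := hu.smooth.comp (contDiff_id.prodMk contDiff_const)
    exact (h.differentiable (by simp)) t
  have h := hd.hasDerivAt
  suffices hs : Gt u t x = deriv (fun s => u s x) t by rw [hs]; exact h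
  have e := hu.eqn t ht x
  have hc : (((1:ℝ) * Complex.normSq (u t x) : ℝ) : ℂ) * u t x = cub (u t) x := by
    unfold cub; rw [one_mul, Complex.normSq_eq_conj_mul_self]; ring
  rw [hc] at e
  unfold Gt
  rw [← e]
  push_cast
  linear_combination (-deriv (fun s => u s x) t) * Complex.I_mul_I

lemma sub_eq (hu : Sol T u) {t1 t2 : ℝ} (h1 : t1 ∈ Icc (0:ℝ) T) (h2 : t2 ∈ Icc (0:ℝ) T) (x : E3) :
    u t2 x - u t1 x = ∫ s in t1..t2, Gt u s x := by
  symm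
  apply intervalIntegral.integral_eq_sub_of_hasDerivAt
  · intro s hs
    exact hu.hasDerivAt (Set.uIcc_subset_Icc h1 h2 hs) x
  · exact (hu.cont_Gt.comp (continuous_id.prodMk continuous_const)).intervalIntegrable _ _

end Sol

/-- Time interval on which the solution is bounded in `H²`, with derived bounds. -/
structure Blk (T : ℝ) (u : ℝ → EC) (a b : ℝ) (R : ENNReal) : Prop where
  sol : Sol T u
  a0 : 0 ≤ a
  ab : a ≤ b
  bT : b ≤ T
  fin : R ≠ ⊤
  sup : ∀ t ∈ Icc a b, ∀ x, ‖u t x‖ₑ ≤ R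
  two : ∀ t ∈ Icc a b, nL 2 (u t) ≤ R
  pd : ∀ t ∈ Icc a b, ∀ j, ∀ p, 2 ≤ p → p ≤ 6 → nL p (fun x => pd (u t) j x) ≤ R
  lam : ∀ t ∈ Icc a b, H2 (u t) ≤ R
  cone : ∀ t ∈ Icc a b, nL 1 (cub (u t)) ≤ R
  ctwo : ∀ t ∈ Icc a b, nL 2 (cub (u t)) ≤ R
  clam : ∀ t ∈ Icc a b, H2 (cub (u t)) ≤ R
  cpd : ∀ t ∈ Icc a b, ∀ j, nL 2 (fun x => _root_.pd (cub (u t)) j x) ≤ R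
  gt : ∀ t ∈ Icc a b, nL 2 (Gt u t) ≤ R

lemma Blk.of_H2 {T : ℝ} {u : ℝ → EC} {a b : ℝ} (hu : Sol T u) (ha : 0 ≤ a) (hab : a ≤ b) (hb : b ≤ T)
    {M : ENNReal} (hM : M ≠ ⊤) (h : ∀ t ∈ Icc a b, H2 (u t) ≤ M) : ∃ R, Blk T u a b R := by
  obtain ⟨C, hC, hC1, hb1⟩ := H2_bounds
  obtain ⟨D, hD, hb2⟩ := H2_cub
  set R1 := C * M with hR1
  set R2 := C * (D * M^3) with hR2
  have hc2 : ∀ t ∈ Icc a b, H2 (cub (u t)) ≤ D * M^3 := fun t ht =>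
    ((hb2 _ (hu.sch t)).1).trans (by gcongr; exact h t ht)
  have e1 : ∀ K : ENNReal, K ≤ C * K := fun K => by
    conv_lhs => rw [← one_mul K]
    gcongr
  have k1 : R1 ≤ R1 + R2 := le_self_add
  have k2 : R2 ≤ R1 + R2 := le_add_self
  have g1 : ∀ t ∈ Icc a b, C * H2 (u t) ≤ R1 + R2 := fun t ht => le_trans (by rw [hR1]; gcongr; exact h t ht) k1
  have g2 : ∀ t ∈ Icc a b, C * H2 (cub (u t)) ≤ R1 + R2 := fun t ht => le_trans (by rw [hR2]; gcongr; exact hc2 t ht) k2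
  refine ⟨R1 + R2, hu, ha, hab, hb, by finiteness, fun t ht x => ((hb1 _ (hu.sch t)).1 x).trans (g1 t ht),
    fun t ht => ((hb1 _ (hu.sch t)).2.1).trans (g1 t ht),
    fun t ht j p hp hp6 => ((hb1 _ (hu.sch t)).2.2.2 j p hp hp6).trans (g1 t ht),
    fun t ht => (e1 _).trans (g1 t ht), fun t ht => ?_, fun t ht => ((hb1 _ (hu.sch t).cub).2.1).trans (g2 t ht),
    fun t ht => (e1 _).trans (g2 t ht),
    fun t ht j => ((hb1 _ (hu.sch t).cub).2.2.2 j 2 le_rfl nmm).trans (g2 t ht), fun t ht => ?_⟩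
  · refine ((hb2 _ (hu.sch t)).2).trans (le_trans ?_ k2)
    calc D * H2 (u t)^3 ≤ D * M^3 := by gcongr; exact h t ht
      _ ≤ _ := e1 _
  · have h1 : nL 2 (Gt u t) ≤ nL 2 (lap (u t)) + nL 2 (cub (u t)) := by
      have : Gt u t = fun x => I * (lap (u t) x - cub (u t) x) := rfl
      rw [this, nL_const_mul (f := fun x => lap (u t) x - cub (u t) x) nmm]
      have hI : ‖I‖ₑ = 1 := by rw [← ofReal_norm]; simp
      rw [hI, one_mul]
      exact nL_sub_le nmm (hu.sch t).lap.measurable (hu.sch t).cub.measurable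
    refine h1.trans (add_le_add (((hb1 _ (hu.sch t)).2.2.1).trans ?_) (((hb1 _ (hu.sch t).cub).2.1).trans ?_))
    · rw [hR1]; gcongr; exact h t ht
    · rw [hR2]; gcongr; exact hc2 t ht

namespace Blk
variable {T : ℝ} {u : ℝ → EC} {a b : ℝ} {R : ENNReal}

lemma mem (h : Blk T u a b R) {t : ℝ} (ht : t ∈ Icc a b) : t ∈ Icc (0:ℝ) T :=
  ⟨h.a0.trans ht.1, ht.2.trans h.bT⟩

lemma lip (h : Blk T u a b R) {t1 t2 : ℝ} (h1 : t1 ∈ Icc a b) (h2 : t2 ∈ Icc a b) :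
    nL 2 (fun x => u t2 x - u t1 x) ≤ R * eR |t2 - t1| := by
  have hsub : uIoc t1 t2 ⊆ Icc a b := Set.uIoc_subset_uIcc.trans (Set.uIcc_subset_Icc h1 h2)
  calc _ ≤ Np 2 volume (fun x => ∫⁻ s in uIoc t1 t2, ‖Gt u s x‖ₑ) := by
        refine Np_mono nmm fun x => ?_
        beta_reduce
        rw [h.sol.sub_eq (h.mem h1) (h.mem h2)]
        rw [← enorm_norm, intervalIntegral.norm_intervalIntegral_eq, enorm_norm]
        exact enorm_integral_le_lintegral_enorm _
    _ ≤ ∫⁻ s in uIoc t1 t2, nL 2 (Gt u s) := by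
        have hm : Measurable (fun q : E3 × ℝ => ‖Gt u q.2 q.1‖ₑ) :=
          (h.sol.cont_Gt.comp continuous_swap).measurable.enorm
        exact minkowski (μ := (volume : Measure E3)) (ν := volume.restrict (uIoc t1 t2)) (p := 2) nmm
          (F := fun x s => ‖Gt u s x‖ₑ) hm
    _ ≤ ∫⁻ s in uIoc t1 t2, R := setLIntegral_mono' measurableSet_uIoc fun s hs => h.gt s (hsub hs)
    _ = _ := by
      rw [setLIntegral_const]; congr 1
      rw [uIoc, Real.volume_Ioc]
      congr 1; exact max_sub_min_eq_abs' _ _ |>.trans (abs_sub_comm _ _)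

end Blk

lemma cub_sub_le (p q : ℂ) : ‖p * p * cj p - q * q * cj q‖ ≤ (‖p‖+‖q‖)^2 * ‖p - q‖ := by
  have e : p * p * cj p - q * q * cj q =
      (p + q) * (p - q) * cj p + q^2 * cj (p - q) := by rw [map_sub]; ring
  rw [e]
  refine (norm_add_le _ _).trans ?_
  simp only [norm_mul, norm_pow, RCLike.norm_conj]
  have h1 := norm_add_le p q
  have : ‖p+q‖*‖p-q‖*‖p‖ ≤ (‖p‖+‖q‖)*‖p-q‖*‖p‖ := by gcongr
  nlinarith [mul_nonneg (mul_nonneg (norm_nonneg p) (norm_nonneg q)) (norm_nonneg (p-q))]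

lemma enorm_cub_sub (f g : EC) (x : E3) :
    ‖cub f x - cub g x‖ₑ ≤ (‖f x‖ₑ + ‖g x‖ₑ)^2 * ‖f x - g x‖ₑ := by
  have h := ofReal_le_ofReal (cub_sub_le (f x) (g x))
  rw [ENNReal.ofReal_mul psv, ENNReal.ofReal_pow psv, ENNReal.ofReal_add psv psv] at h
  simp only [ofReal_norm] at h
  exact h

/-- `L²` and `L¹` Lipschitz bounds for the cubic nonlinearity. -/
lemma nL2_cub_sub {f g : EC} {S : ENNReal} (hS : S ≠ ⊤) (h1 : ∀ x, ‖f x‖ₑ ≤ S) (h2 : ∀ x, ‖g x‖ₑ ≤ S) :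
    nL 2 (fun x => cub f x - cub g x) ≤ (S+S)^2 * nL 2 (fun x => f x - g x) := by
  calc _ ≤ Np 2 volume (fun x => (‖f x‖ₑ + ‖g x‖ₑ)^2 * ‖f x - g x‖ₑ) := Np_mono nmm fun x => enorm_cub_sub f g x
    _ ≤ _ := Np_bdd_mul nmm (by finiteness) fun x => by gcongr; exacts [h1 x, h2 x]

lemma nL1_cub_sub {f g : EC} (hf : Measurable f) (hg : Measurable g) {S : ENNReal} (hS : S ≠ ⊤)
    (h1 : ∀ x, ‖f x‖ₑ ≤ S) (h2 : ∀ x, ‖g x‖ₑ ≤ S) :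
    nL 1 (fun x => cub f x - cub g x) ≤ (S+S) * ((nL 2 f + nL 2 g) * nL 2 (fun x => f x - g x)) := by
  have m1 := hf.enorm.aemeasurable (μ := volume)
  have m2 := hg.enorm.aemeasurable (μ := volume)
  have m3 := (hf.sub hg).enorm.aemeasurable (μ := volume)
  calc _ ≤ Np 1 volume (fun x => (‖f x‖ₑ + ‖g x‖ₑ) * ((‖f x‖ₑ + ‖g x‖ₑ) * ‖f x - g x‖ₑ)) :=
        Np_mono nmm fun x => (enorm_cub_sub f g x).trans (le_of_eq (by ring))
    _ ≤ (S+S) * Np 1 volume (fun x => (‖f x‖ₑ + ‖g x‖ₑ) * ‖f x - g x‖ₑ) :=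
        Np_bdd_mul nmm (by finiteness) fun x => by gcongr; exacts [h1 x, h2 x]
    _ ≤ (S+S) * (Np 2 volume (fun x => ‖f x‖ₑ + ‖g x‖ₑ) * nL 2 (fun x => f x - g x)) := by
        gcongr
        exact Np_mul_le nmm nmm nmm (m1.add m2) m3
    _ ≤ _ := by
        gcongr
        exact Np_add_le nmm m1 m2

lemma nL_one (f : EC) : nL 1 f = ∫⁻ x, ‖f x‖ₑ := by simp [nL, Np]

lemma enorm_fourier_le (f : EC) (ξ : E3) : ‖𝓕 f ξ‖ₑ ≤ nL 1 f := by
  rw [nL_one, Real.fourier_eq]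
  refine (enorm_integral_le_lintegral_enorm _).trans (le_of_eq ?_)
  refine lintegral_congr fun ξ => ?_
  rw [← ofReal_norm, ← ofReal_norm, Circle.norm_smul]

lemma continuousOn_of_edist_lip {f : ℝ → ℂ} {s : Set ℝ} {K : ENNReal} (hK : K ≠ ⊤)
    (h : ∀ t1 ∈ s, ∀ t2 ∈ s, ‖f t2 - f t1‖ₑ ≤ K * eR |t2 - t1|) : ContinuousOn f s := by
  have : LipschitzOnWith K.toNNReal f s := by
    intro t2 h2 t1 h1
    rw [ENNReal.coe_toNNReal hK, edist_eq_enorm_sub, edist_dist, Real.dist_eq]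
    exact h t1 h1 t2 h2
  exact this.continuousOn

lemma Blk.cont_fourier_cub {T : ℝ} {u : ℝ → EC} {a b : ℝ} {R : ENNReal} (h : Blk T u a b R) (ξ : E3) :
    ContinuousOn (fun t => 𝓕 (cub (u t)) ξ) (Icc a b) := by
  have hR := h.fin
  refine continuousOn_of_edist_lip (K := (R+R)*((R+R)*R)) (by finiteness) fun t1 h1 t2 h2 => ?_
  rw [← fourier_sub (h.sol.sch t2).cub.integrable (h.sol.sch t1).cub.integrable]
  refine (enorm_fourier_le _ _).trans ?_
  refine (nL1_cub_sub (h.sol.sch t2).measurable (h.sol.sch t1).measurable hR (h.sup t2 h2) (h.sup t1 h1)).trans ?_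
  calc _ ≤ (R+R) * ((R+R) * (R * eR |t2 - t1|)) := by
        gcongr; exacts [h.two t2 h2, h.two t1 h1, h.lip h1 h2]
    _ = _ := by ring

lemma cont_ph_neg (s : ℝ) : Continuous (fun ξ : E3 => ph (-s) ξ) := by unfold ph gau; fun_prop

lemma cont_ph_neg2 : Continuous (fun q : ℝ × E3 => ph (-q.1) q.2) := by unfold ph gau; fun_prop

lemma Sol.cont_slice {T : ℝ} {u : ℝ → EC} (hu : Sol T u) (x : E3) : Continuous (fun s => u s x) :=
  Continuous.comp (g := fun p : ℝ × E3 => u p.1 p.2) (f := fun s : ℝ => (s, x)) hu.cont (by fun_prop)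

lemma Sol.cont_Gt_slice {T : ℝ} {u : ℝ → EC} (hu : Sol T u) (x : E3) : Continuous (fun s => Gt u s x) :=
  Continuous.comp (g := fun p : ℝ × E3 => Gt u p.1 p.2) (f := fun s : ℝ => (s, x)) hu.cont_Gt (by fun_prop)

lemma lintegral_mul_le_nL2 {f g : EC} (hf : Measurable f) (hg : Measurable g) :
    ∫⁻ x, ‖f x * g x‖ₑ ≤ nL 2 f * nL 2 g := by
  have := Np_mul_le (μ := (volume : Measure E3)) (p := 2) (q := 2) (r := 1) nmm nmm nmm
    hf.enorm.aemeasurable hg.enorm.aemeasurable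
  simp only [← enorm_mul] at this
  refine le_trans (le_of_eq ?_) this
  simp [Np]

lemma pair_integrable {P Q : ℝ → EC} (hP : Measurable (fun q : ℝ × E3 => P q.1 q.2)) (hQ : Measurable (fun q : ℝ × E3 => Q q.1 q.2))
    {t1 t2 : ℝ} {A B : ENNReal} (hA : A ≠ ⊤) (hB : B ≠ ⊤) (h1 : ∀ s ∈ Icc t1 t2, nL 2 (P s) ≤ A)
    (h2 : ∀ s ∈ Icc t1 t2, nL 2 (Q s) ≤ B) :
    Integrable (fun q : ℝ × E3 => P q.1 q.2 * Q q.1 q.2) ((volume.restrict (Ioc t1 t2)).prod volume) := by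
  refine ⟨(hP.mul hQ).aestronglyMeasurable, ?_⟩
  have hm : Measurable (fun q : ℝ × E3 => ‖P q.1 q.2 * Q q.1 q.2‖ₑ) := (hP.mul hQ).enorm
  rw [HasFiniteIntegral, lintegral_prod _ hm.aemeasurable]
  calc _ ≤ ∫⁻ s in Ioc t1 t2, A * B := by
        refine setLIntegral_mono' measurableSet_Ioc fun s hs => ?_
        have hs' := Set.Ioc_subset_Icc_self hs
        refine (lintegral_mul_le_nL2 (hP.comp measurable_prodMk_left) (hQ.comp measurable_prodMk_left)).trans ?_
        gcongr
        exacts [h1 s hs', h2 s hs']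
    _ < ⊤ := by
        rw [setLIntegral_const, Real.volume_Ioc]
        finiteness

/-- multiplication by `4π²|ξ|² i` -/
def frq (g : EC) (ξ : E3) : ℂ := ((4 * π^2 * ‖ξ‖^2 : ℝ) : ℂ) * I * g ξ

lemma Sch.frq {g : EC} (hg : Sch g) : Sch (frq g) := by
  have h := hg.fourierInv.lap.fourier.const_mul (-I)
  convert h using 1
  funext ξ
  rw [show (fun x => _root_.lap (𝓕⁻ g) x) = _root_.lap (𝓕⁻ g) from rfl, hg.fourierInv.fourier_lap, hg.inv']
  unfold _root_.frq; ring

lemma hasDerivAt_ph (s : ℝ) (ξ : E3) :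
    HasDerivAt (fun s : ℝ => ph (-s) ξ) (((4 * π^2 * ‖ξ‖^2 : ℝ) : ℂ) * I * ph (-s) ξ) s := by
  have e : (fun s : ℝ => ph (-s) ξ) = fun s : ℝ => cexp ((s:ℂ) * (((4 * π^2 * ‖ξ‖^2 : ℝ) : ℂ) * I)) := by
    funext s; unfold ph gau; congr 1; push_cast; ring
  rw [e]
  have h1 : HasDerivAt (fun s : ℝ => (s:ℂ) * (((4 * π^2 * ‖ξ‖^2 : ℝ) : ℂ) * I)) (1 * (((4 * π^2 * ‖ξ‖^2 : ℝ) : ℂ) * I)) s :=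
    (Complex.ofRealCLM.hasDerivAt (x := s)).mul_const _
  have h2 := h1.cexp
  have e2 : ph (-s) ξ = cexp ((s:ℂ) * (((4 * π^2 * ‖ξ‖^2 : ℝ) : ℂ) * I)) := congrFun e s
  rw [e2]
  convert h2 using 1; ring

def psi (g : EC) (s : ℝ) (x : E3) : ℂ := 𝓕 (fun ξ => ph (-s) ξ * g ξ) x

lemma psi_good {g : EC} (hg : Sch g) (s : ℝ) : Good (fun ξ => ph (-s) ξ * g ξ) := by
  refine hg.good.of_le (c := 1) ?_ fun ξ => by rw [norm_mul, norm_ph]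
  have := cont_ph_neg s
  exact (this.mul hg.continuous).measurable

lemma psi_deriv {g : EC} (hg : Sch g) (s : ℝ) (x : E3) :
    HasDerivAt (fun s => psi g s x) (psi (frq g) s x) s := by
  unfold psi
  simp only [Real.fourier_eq]
  refine (hasDerivAt_integral_of_dominated_loc_of_deriv_le (F := fun s ξ => 𝐞 (-inner ℝ ξ x) • (ph (-s) ξ * g ξ))
    (F' := fun s ξ => 𝐞 (-inner ℝ ξ x) • (ph (-s) ξ * frq g ξ)) (s := Set.univ) (bound := fun ξ => ‖frq g ξ‖)
    univ_mem ?_ ?_ ?_ ?_ ?_ ?_).2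
  · exact evt fun t => ((Real.fourierIntegral_convergent_iff x).2 (psi_good hg t).int).aestronglyMeasurable
  · exact (Real.fourierIntegral_convergent_iff x).2 (psi_good hg s).int
  · exact ((Real.fourierIntegral_convergent_iff x).2 (psi_good hg.frq s).int).aestronglyMeasurable
  · refine evt fun ξ t _ => ?_
    rw [Circle.norm_smul, norm_mul, norm_ph, one_mul]
  · exact hg.frq.integrable.norm
  · refine evt fun ξ t _ => ?_
    have := ((hasDerivAt_ph t ξ).mul_const (g ξ)).const_smul (𝐞 (-inner ℝ ξ x) : Circle)
    have e : (fun s => 𝐞 (-inner ℝ ξ x) • (ph (-s) ξ * g ξ)) = (𝐞 (-inner ℝ ξ x) • fun y => ph (-y) ξ * g ξ) := rfl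
    rw [e]
    suffices hs : 𝐞 (-inner ℝ ξ x) • (ph (-t) ξ * frq g ξ) = 𝐞 (-inner ℝ ξ x) • (((4 * π^2 * ‖ξ‖^2 : ℝ) : ℂ) * I * ph (-t) ξ * g ξ) by
      rw [hs]; exact this
    congr 1
    unfold frq; ring

lemma psi_meas {g : EC} (hg : Sch g) : Measurable (fun q : ℝ × E3 => psi g q.1 q.2) := by
  have h1 : Continuous (fun q : ℝ × E3 => ph (-q.1) q.2 * g q.2) :=
    cont_ph_neg2.mul (hg.continuous.comp continuous_snd)
  exact measurable_fourier_param (f := fun s ξ => ph (-s) ξ * g ξ) h1.measurable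

lemma psi_nL2 {g : EC} (hg : Sch g) (s : ℝ) : nL 2 (psi g s) ≤ nL 2 g := by
  have h := psi_good hg s
  have := fourier_L2 h.meas h.int
  rw [← nL_two_sq] at this
  refine ((ENNReal.pow_le_pow_left_iff nmm).1 this).trans ?_
  exact nL_le_of_norm nmm fun ξ => by rw [norm_mul, norm_ph, one_mul]

lemma psi_pair {f g : EC} (hf : Sch f) (hg : Sch g) (s : ℝ) :
    ∫ x, f x * psi g s x = ∫ ξ, ph (-s) ξ * 𝓕 f ξ * g ξ := by
  unfold psi
  rw [← fourier_flip hf.integrable (psi_good hg s).int]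
  congr 1; ext ξ; ring

lemma Blk.weak {T : ℝ} {u : ℝ → EC} {a b : ℝ} {R : ENNReal} (h : Blk T u a b R) {g : EC} (hg : Sch g)
    {t1 t2 : ℝ} (h1 : t1 ∈ Icc a b) (h2 : t2 ∈ Icc a b) (h12 : t1 ≤ t2) :
    (∫ ξ, ph (-t2) ξ * 𝓕 (u t2) ξ * g ξ) - (∫ ξ, ph (-t1) ξ * 𝓕 (u t1) ξ * g ξ) =
      ∫ s in t1..t2, ∫ ξ, -I * (ph (-s) ξ * 𝓕 (cub (u s)) ξ) * g ξ := by
  have hu := h.sol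
  have hsub : Icc t1 t2 ⊆ Icc a b := Set.Icc_subset_Icc h1.1 h2.2
  have hpc : ∀ (g : EC), Sch g → ∀ x, Continuous (fun s => psi g s x) := fun g hg x =>
    continuous_iff_continuousAt.2 fun s => (psi_deriv hg s x).continuousAt
  have hx : ∀ x, u t2 x * psi g t2 x - u t1 x * psi g t1 x =
      ∫ s in Ioc t1 t2, (Gt u s x * psi g s x + u s x * psi (frq g) s x) := fun x => by
    rw [← intervalIntegral.integral_of_le h12]
    symm
    refine intervalIntegral.integral_eq_sub_of_hasDerivAt (f := fun s => u s x * psi g s x) (fun s hs => ?_) ?_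
    · rw [Set.uIcc_of_le h12] at hs
      exact (hu.hasDerivAt (h.mem (hsub hs)) x).mul (psi_deriv hg s x)
    · apply Continuous.intervalIntegrable
      have c1 : Continuous (fun s => Gt u s x) := hu.cont_Gt_slice x
      have c2 : Continuous (fun s => u s x) := hu.cont_slice x
      exact (c1.mul (hpc g hg x)).add (c2.mul (hpc _ hg.frq x))
  have hg2 := hg.nL_ne_top (p := 2) nmm
  have hg2' := hg.frq.nL_ne_top (p := 2) nmm
  have i1 := pair_integrable (P := Gt u) (Q := psi g) hu.cont_Gt.measurable (psi_meas hg) (t1 := t1) (t2 := t2) h.fin hg2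
    (fun s hs => h.gt s (hsub hs)) (fun s _ => psi_nL2 hg s)
  have i2 := pair_integrable (P := u) (Q := psi (frq g)) hu.cont.measurable (psi_meas hg.frq) (t1 := t1) (t2 := t2) h.fin hg2'
    (fun s hs => h.two s (hsub hs)) (fun s _ => psi_nL2 hg.frq s)
  have is : ∀ (f g : EC), Sch f → Sch g → ∀ s, Integrable (fun x => f x * psi g s x) := fun f g hf hg s => by
    obtain ⟨B, hB⟩ := (psi_good hg s).int |> fun hi => (⟨_, fun x => norm_fourier_le _ x⟩ : ∃ B : ℝ, ∀ x, ‖psi g s x‖ ≤ B)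
    refine hf.integrable.mul_bdd (c := B) ?_ (evt hB)
    exact (continuous_fourier (psi_good hg s).int).aestronglyMeasurable
  rw [← psi_pair (hu.sch t2) hg, ← psi_pair (hu.sch t1) hg, ← integral_sub (is _ _ (hu.sch t2) hg _) (is _ _ (hu.sch t1) hg _)]
  simp only [hx]
  rw [intervalIntegral.integral_of_le h12]
  rw [integral_integral_swap (f := fun x s => Gt u s x * psi g s x + u s x * psi (frq g) s x)]
  · refine setIntegral_congr_fun measurableSet_Ioc fun s _ => ?_
    beta_reduce
    have e1 : ∀ x, Gt u s x * psi g s x + u s x * psi (frq g) s x =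
        I * (lap (u s) x * psi g s x) + -I * (cub (u s) x * psi g s x) + u s x * psi (frq g) s x := fun x => by
      unfold Gt; ring
    simp only [e1]
    rw [integral_add, integral_add, integral_const_mul, integral_const_mul, psi_pair (hu.sch s).lap hg, psi_pair (hu.sch s).cub hg,
      psi_pair (hu.sch s) hg.frq]
    · have e2 : ∫ ξ, ph (-s) ξ * 𝓕 (u s) ξ * frq g ξ = - (I * ∫ ξ, ph (-s) ξ * 𝓕 (lap (u s)) ξ * g ξ) := by
        rw [← integral_const_mul, ← integral_neg]
        congr 1; ext ξ
        rw [(hu.sch s).fourier_lap]; unfold frq; ring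
      rw [e2]
      have e3 : ∀ A B : ℂ, A + B + -A = B := fun A B => by ring
      rw [e3, ← integral_const_mul]
      congr 1; ext ξ; ring
    · exact (is _ _ (hu.sch s).lap hg s).const_mul _
    · exact (is _ _ (hu.sch s).cub hg s).const_mul _
    · exact ((is _ _ (hu.sch s).lap hg s).const_mul _).add ((is _ _ (hu.sch s).cub hg s).const_mul _)
    · exact is _ _ (hu.sch s) hg.frq s
  · exact (i1.add i2).swap

lemma Blk.sol_meas_cub {T : ℝ} {u : ℝ → EC} {a b : ℝ} {R : ENNReal} (h : Blk T u a b R) :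
    Measurable (fun q : ℝ × E3 => 𝓕 (cub (u q.1)) q.2) :=
  measurable_fourier_param (f := fun s => cub (u s)) h.sol.cont_cub.measurable

lemma Blk.duh1 {T : ℝ} {u : ℝ → EC} {a b : ℝ} {R : ENNReal} (h : Blk T u a b R)
    {t1 t2 : ℝ} (h1 : t1 ∈ Icc a b) (h2 : t2 ∈ Icc a b) (h12 : t1 ≤ t2) (ξ : E3) :
    ph (-t2) ξ * 𝓕 (u t2) ξ - ph (-t1) ξ * 𝓕 (u t1) ξ =
      ∫ s in t1..t2, -I * (ph (-s) ξ * 𝓕 (cub (u s)) ξ) := by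
  have hu := h.sol
  have hsub : Icc t1 t2 ⊆ Icc a b := Set.Icc_subset_Icc h1.1 h2.2
  have cph : ∀ s, Continuous (fun ξ : E3 => ph (-s) ξ) := cont_ph_neg
  have hbd : ∀ s ∈ Icc t1 t2, ∀ ξ, ‖-I * (ph (-s) ξ * 𝓕 (cub (u s)) ξ)‖ ≤ R.toReal := fun s hs ξ => by
    rw [norm_mul, norm_mul, norm_ph, norm_neg, Complex.norm_I, one_mul, one_mul]
    have := (enorm_fourier_le (cub (u s)) ξ).trans (h.cone s (hsub hs))
    rw [← toReal_enorm]
    exact ENNReal.toReal_mono h.fin this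
  have hm : Measurable (fun q : ℝ × E3 => -I * (ph (-q.1) q.2 * 𝓕 (cub (u q.1)) q.2)) := by
    have m1 : Measurable (fun q : ℝ × E3 => ph (-q.1) q.2) :=
      cont_ph_neg2.measurable
    exact (m1.mul h.sol_meas_cub).const_mul _
  set A : EC := fun ξ => ph (-t2) ξ * 𝓕 (u t2) ξ - ph (-t1) ξ * 𝓕 (u t1) ξ -
      ∫ s in t1..t2, -I * (ph (-s) ξ * 𝓕 (cub (u s)) ξ) with hA
  have cI : Continuous (fun ξ => ∫ s in t1..t2, -I * (ph (-s) ξ * 𝓕 (cub (u s)) ξ)) := by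
    refine intervalIntegral.continuous_of_dominated_interval (bound := fun _ => R.toReal) ?_ ?_ ?_ ?_
    · exact fun ξ => (hm.comp measurable_prodMk_right).aestronglyMeasurable
    · refine fun ξ => evt fun s hs => hbd s ?_ ξ
      rw [Set.uIoc_of_le h12] at hs; exact Set.Ioc_subset_Icc_self hs
    · exact intervalIntegrable_const
    · exact evt fun s _ => continuous_const.mul ((cph s).mul (continuous_fourier (hu.sch s).cub.integrable))
  have cA : Continuous A :=
    (((cph t2).mul (continuous_fourier (hu.sch t2).integrable)).sub ((cph t1).mul (continuous_fourier (hu.sch t1).integrable))).sub cI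
  have hz : ∀ᵐ ξ : E3, A ξ = 0 := by
    refine ae_eq_zero_of_integral_contDiff_smul_eq_zero cA.locallyIntegrable fun g hg hgc => ?_
    have hgS : Sch (fun ξ => (g ξ : ℂ)) := by
      obtain ⟨r, hr⟩ := hgc.isCompact.isBounded.subset_closedBall (0 : E3)
      refine Sch.of_compact (R := r) (Complex.ofRealCLM.contDiff.comp hg) fun ξ hξ => ?_
      have : ξ ∉ tsupport g := fun hh => by
        have := hr hh; rw [mem_closedBall_zero_iff] at this; linarith
      simp [image_eq_zero_of_notMem_tsupport this]
    have hw := h.weak hgS h1 h2 h12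
    have ib : ∀ (B : EC), Continuous B → Integrable (fun ξ => B ξ * (g ξ : ℂ)) := fun B hB => by
      refine (hB.mul hgS.continuous).integrable_of_hasCompactSupport ?_
      exact HasCompactSupport.mul_left (hgc.comp_left (g := fun r : ℝ => (r:ℂ)) (by simp))
    have iP : Integrable (fun q : ℝ × E3 => -I * (ph (-q.1) q.2 * 𝓕 (cub (u q.1)) q.2) * (g q.2 : ℂ))
        ((volume.restrict (Ioc t1 t2)).prod volume) := by
      have : Integrable (fun q : ℝ × E3 => (R.toReal : ℝ) * ‖(g q.2 : ℂ)‖) ((volume.restrict (Ioc t1 t2)).prod volume) :=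
        Integrable.mul_prod (f := fun _ : ℝ => R.toReal) (g := fun ξ => ‖(g ξ : ℂ)‖) (by simp) hgS.integrable.norm
      refine this.mono' (hm.mul (hgS.measurable.comp measurable_snd)).aestronglyMeasurable ?_
      have hae : ∀ᵐ q : ℝ × E3 ∂((volume.restrict (Ioc t1 t2)).prod volume), q.1 ∈ Ioc t1 t2 :=
        Measure.quasiMeasurePreserving_fst.ae (ae_restrict_mem measurableSet_Ioc)
      filter_upwards [hae] with q hq
      rw [norm_mul]
      gcongr
      exact hbd _ (Set.Ioc_subset_Icc_self hq) _
    have e : ∀ ξ, g ξ • A ξ = (ph (-t2) ξ * 𝓕 (u t2) ξ * (g ξ : ℂ) - ph (-t1) ξ * 𝓕 (u t1) ξ * (g ξ : ℂ))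
        - (∫ s in Ioc t1 t2, -I * (ph (-s) ξ * 𝓕 (cub (u s)) ξ) * (g ξ : ℂ)) := fun ξ => by
      rw [integral_mul_const, ← intervalIntegral.integral_of_le h12, Complex.real_smul, hA]; ring
    simp only [e]
    have j1 := ib (fun ξ => ph (-t2) ξ * 𝓕 (u t2) ξ) ((cph t2).mul (continuous_fourier (hu.sch t2).integrable))
    have j2 := ib (fun ξ => ph (-t1) ξ * 𝓕 (u t1) ξ) ((cph t1).mul (continuous_fourier (hu.sch t1).integrable))
    have j3 : Integrable (fun ξ => ∫ s in Ioc t1 t2, -I * (ph (-s) ξ * 𝓕 (cub (u s)) ξ) * (g ξ : ℂ)) := iP.integral_prod_right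
    have k := integral_sub (j1.sub j2) j3
    simp only [Pi.sub_apply] at k
    rw [k, integral_sub j1 j2, hw, intervalIntegral.integral_of_le h12, sub_eq_zero]
    exact integral_integral_swap (f := fun s ξ => -I * (ph (-s) ξ * 𝓕 (cub (u s)) ξ) * (g ξ : ℂ)) iP
  have : A = fun _ => 0 := (cA.ae_eq_iff_eq volume continuous_const).1 hz
  have := congrFun this ξ
  exact sub_eq_zero.1 this

lemma Blk.duh {T : ℝ} {u : ℝ → EC} {a b : ℝ} {R : ENNReal} (h : Blk T u a b R)
    {t1 t2 : ℝ} (h1 : t1 ∈ Icc a b) (h2 : t2 ∈ Icc a b) (ξ : E3) :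
    ph (-t2) ξ * 𝓕 (u t2) ξ - ph (-t1) ξ * 𝓕 (u t1) ξ =
      ∫ s in t1..t2, -I * (ph (-s) ξ * 𝓕 (cub (u s)) ξ) := by
  rcases le_total t1 t2 with h12 | h12
  · exact h.duh1 h1 h2 h12 ξ
  · rw [intervalIntegral.integral_symm, ← h.duh1 h2 h1 h12 ξ]; ring

/-- Duhamel's formula after application of a Fourier multiplier, in the form used by Strichartz. -/
lemma Blk.duh_op {T : ℝ} {u : ℝ → EC} {a b : ℝ} {R : ENNReal} (h : Blk T u a b R)
    {t0 t : ℝ} (h0 : t0 ∈ Icc a b) (ht : t ∈ Icc a b) (k : EC) (ξ : E3) :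
    k ξ * 𝓕 (u t) ξ = ph (t - t0) ξ * (k ξ * 𝓕 (u t0) ξ) +
      ∫ s in t0..t, ph (t - s) ξ * (-I * (k ξ * 𝓕 (cub (u s)) ξ)) := by
  have e := h.duh h0 ht ξ
  have e1 : ∀ s, ph (t - s) ξ * (-I * (k ξ * 𝓕 (cub (u s)) ξ)) = (k ξ * ph t ξ) * (-I * (ph (-s) ξ * 𝓕 (cub (u s)) ξ)) := fun s => by
    rw [sub_eq_add_neg, ph_add]; ring
  simp only [e1]
  rw [intervalIntegral.integral_const_mul, ← e]
  have e2 : ph t ξ * ph (-t) ξ = 1 := by rw [← ph_add]; simp [ph_zero]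
  rw [sub_eq_add_neg t t0, ph_add]
  linear_combination (-k ξ * 𝓕 (u t) ξ) * e2

lemma cont_ph_neg3 (ξ : E3) : Continuous (fun s : ℝ => ph (-s) ξ) := by unfold ph gau; fun_prop

namespace Blk
variable {T : ℝ} {u : ℝ → EC} {a b : ℝ} {R : ENNReal}

lemma normsq_eq (h : Blk T u a b R) {t1 t2 : ℝ} (h1 : t1 ∈ Icc a b) (h2 : t2 ∈ Icc a b) (h12 : t1 ≤ t2) (ξ : E3) :
    ‖𝓕 (u t2) ξ‖^2 - ‖𝓕 (u t1) ξ‖^2 =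
      ∫ s in t1..t2, 2 * (cj (𝓕 (u s) ξ) * (-I * 𝓕 (cub (u s)) ξ)).re := by
  have hsub : Icc t1 t2 ⊆ Icc a b := Set.Icc_subset_Icc h1.1 h2.2
  set F : ℝ → ℂ := fun s => -I * (ph (-s) ξ * 𝓕 (cub (u s)) ξ) with hF
  set V : ℝ → ℂ := fun s => ph (-s) ξ * 𝓕 (u s) ξ with hV
  have cF : ContinuousOn F (Icc t1 t2) :=
    continuousOn_const.mul ((cont_ph_neg3 ξ).continuousOn.mul ((h.cont_fourier_cub ξ).mono hsub))
  have iF : IntervalIntegrable F volume t1 t2 := cF.intervalIntegrable_of_Icc h12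
  have eV : ∀ t ∈ Icc t1 t2, V t = V t1 + ∫ s in t1..t, F s := fun t ht => by
    have := h.duh h1 (hsub ht) ξ
    rw [hF, ← this, hV]; ring
  have cV : ContinuousOn V (Icc t1 t2) := by
    have : ContinuousOn (fun t => V t1 + ∫ s in t1..t, F s) (Icc t1 t2) := by
      refine continuousOn_const.add ?_
      have := intervalIntegral.continuousOn_primitive_interval' (μ := volume) (f := F) (a := t1) iF Set.left_mem_uIcc
      rwa [Set.uIcc_of_le h12] at this
    exact this.congr eV
  have dV : ∀ t ∈ Ioo t1 t2, HasDerivAt V (F t) t := fun t ht => by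
    have hn : Icc t1 t2 ∈ nhds t := Icc_mem_nhds ht.1 ht.2
    have hd : HasDerivAt (fun t => V t1 + ∫ s in t1..t, F s) (F t) t := by
      refine HasDerivAt.const_add _ ?_
      refine intervalIntegral.integral_hasDerivAt_right ?_ ?_ (cF.continuousAt hn)
      · exact (cF.mono (Set.Icc_subset_Icc_right ht.2.le)).intervalIntegrable_of_Icc ht.1.le
      · exact (cF.mono Set.Ioo_subset_Icc_self).stronglyMeasurableAtFilter isOpen_Ioo t ht
    refine hd.congr_of_eventuallyEq ?_
    filter_upwards [hn] with t ht using eV t ht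
  have key : ∫ s in t1..t2, 2 * inner ℝ (V s) (F s) = ‖V t2‖^2 - ‖V t1‖^2 := by
    refine intervalIntegral.integral_eq_sub_of_hasDeriv_right_of_le h12 (f := fun t => ‖V t‖^2) ?_ ?_ ?_
    · exact (cV.norm).pow 2
    · exact fun t ht => ((dV t ht).norm_sq).hasDerivWithinAt
    · exact (continuousOn_const.mul (cV.inner (𝕜 := ℝ) cF)).intervalIntegrable_of_Icc h12
  have n : ∀ t, ‖V t‖ = ‖𝓕 (u t) ξ‖ := fun t => by rw [hV]; simp [norm_ph]
  rw [n, n] at key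
  rw [← key]
  refine intervalIntegral.integral_congr fun s _ => ?_
  beta_reduce
  rw [Complex.inner, hV, hF]
  beta_reduce
  have e : cj (ph (-s) ξ) * ph (-s) ξ = 1 := by
    rw [mul_comm, Complex.mul_conj, Complex.normSq_eq_norm_sq, norm_ph]; simp
  congr 2
  rw [map_mul]
  linear_combination (cj (𝓕 (u s) ξ) * (-I * 𝓕 (cub (u s)) ξ)) * e

end Blk

lemma Sch.sq_eq {f : EC} (hf : Sch f) : ∫ x, ‖f x‖^2 = ∫ ξ, ‖𝓕 f ξ‖^2 := by
  have := hf.parseval hf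
  simp only [Complex.mul_conj, Complex.normSq_eq_norm_sq] at this
  have h2 := congrArg Complex.re this
  rw [integral_complex_ofReal, integral_complex_ofReal] at h2
  simpa using h2.symm

lemma Sch.sq_int {f : EC} (hf : Sch f) : Integrable (fun x => ‖f x‖^2) := by
  obtain ⟨B, hB⟩ := hf.bdd
  have := hf.integrable.norm.mul_bdd (c := B) (f := fun x => ‖f x‖) hf.continuous.norm.aestronglyMeasurable (evt fun x => by simpa using hB x)
  simpa [sq] using this

namespace Blk
variable {T : ℝ} {u : ℝ → EC} {a b : ℝ} {R : ENNReal}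

/-- Evolution of quadratic quantities. -/
lemma quad (h : Blk T u a b R) {t1 t2 : ℝ} (h1 : t1 ∈ Icc a b) (h2 : t2 ∈ Icc a b) (h12 : t1 ≤ t2)
    {M : EC} (hM : Measurable M) {c : ℝ} (hc : ∀ ξ, ‖M ξ‖ ≤ c * (1 + ‖ξ‖^2)) {f g : ℝ → EC}
    (hf : ∀ t, Sch (f t)) (hg : ∀ t, Sch (g t)) (ef : ∀ t ξ, 𝓕 (f t) ξ = M ξ * 𝓕 (u t) ξ)
    (eg : ∀ t ξ, 𝓕 (g t) ξ = M ξ * 𝓕 (cub (u t)) ξ) :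
    IntervalIntegrable (fun s => 2 * (-I * ∫ x, g s x * cj (f s x)).re) volume t1 t2 ∧
    (∫ x, ‖f t2 x‖^2) - (∫ x, ‖f t1 x‖^2) = ∫ s in t1..t2, 2 * (-I * ∫ x, g s x * cj (f s x)).re := by
  have hsub : Icc t1 t2 ⊆ Icc a b := Set.Icc_subset_Icc h1.1 h2.2
  have hu := h.sol
  have mu : Measurable (fun q : ℝ × E3 => 𝓕 (u q.1) q.2) := measurable_fourier_param (f := u) hu.meas
  have mc := h.sol_meas_cub
  have mw : Measurable (fun q : ℝ × E3 => M q.2) := hM.comp measurable_snd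
  have bd : ∀ v : EC, Sch v → ∀ f : EC, (∀ ξ, f ξ = M ξ * 𝓕 v ξ) → nL 2 f ≤ eR c * H2 v := fun v hv f e => by
    have hc0 : 0 ≤ c := by have := (norm_nonneg _).trans (hc 0); simpa using this
    have : nL 2 f ≤ nL 2 (fun ξ => ((c:ℝ):ℂ) * 𝓕 (Lam v) ξ) := by
      refine nL_le_of_norm nmm fun ξ => ?_
      rw [e, hv.fourier_Lam, norm_mul, norm_mul, norm_mul, ← mul_assoc]
      gcongr
      rw [Complex.norm_real, Complex.norm_real, Real.norm_of_nonneg hc0, Real.norm_of_nonneg psv]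
      exact hc ξ
    refine this.trans (le_of_eq ?_)
    rw [nL_const_mul nmm, hv.Lam.plancherel, H2]
    congr 1
    rw [← ofReal_norm, Complex.norm_real, Real.norm_of_nonneg hc0]
  have hR := h.fin
  have iP := pair_integrable (P := fun s ξ => cj (M ξ * 𝓕 (u s) ξ)) (Q := fun s ξ => -I * (M ξ * 𝓕 (cub (u s)) ξ)) (t1 := t1) (t2 := t2)
    (A := eR c * R) (B := eR c * R)
    (Complex.continuous_conj.measurable.comp (mw.mul mu)) ((mw.mul mc).const_mul _) (by finiteness) (by finiteness)
    (fun s hs => by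
      rw [nL_conj]
      exact (bd _ (hu.sch s) _ fun _ => rfl).trans (by gcongr; exact h.lam s (hsub hs)))
    (fun s hs => by
      rw [nL_const_mul nmm (f := fun ξ => M ξ * 𝓕 (cub (u s)) ξ)]
      have : ‖-I‖ₑ = 1 := by rw [← ofReal_norm]; simp
      rw [this, one_mul]
      exact (bd _ (hu.sch s).cub _ fun _ => rfl).trans (by gcongr; exact h.clam s (hsub hs)))
  have iR := iP.re.const_mul 2
  have es : ∀ s, ∫ ξ, 2 * (cj (M ξ * 𝓕 (u s) ξ) * (-I * (M ξ * 𝓕 (cub (u s)) ξ))).re =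
      2 * (-I * ∫ x, g s x * cj (f s x)).re := fun s => by
    rw [integral_const_mul, ← (hg s).parseval (hf s)]
    congr 1
    rw [← integral_const_mul (-I)]
    have ii : Integrable (fun ξ => -I * (𝓕 (g s) ξ * cj (𝓕 (f s) ξ))) :=
      ((hg s).fourier.mul (hf s).fourier.conj).integrable.const_mul _
    have := integral_re ii
    simp only [RCLike.re_eq_complex_re] at this
    rw [← this]
    congr 1; ext ξ
    rw [ef, eg]; congr 1; ring
  have i2 := iR.integral_prod_left
  simp only [RCLike.re_eq_complex_re] at i2 iR
  simp only [es] at i2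
  refine ⟨(intervalIntegrable_iff_integrableOn_Ioc_of_le h12).2 i2, ?_⟩
  rw [(hf t2).sq_eq, (hf t1).sq_eq, ← integral_sub (hf t2).fourier.sq_int (hf t1).fourier.sq_int]
  rw [intervalIntegral.integral_of_le h12]
  simp only [← es]
  rw [integral_integral_swap iR]
  congr 1; ext ξ
  rw [ef, ef, norm_mul, norm_mul, mul_pow, mul_pow, ← mul_sub, h.normsq_eq h1 h2 h12, ← intervalIntegral.integral_of_le h12,
    ← intervalIntegral.integral_const_mul]
  congr 1; ext s
  have : cj (M ξ * 𝓕 (u s) ξ) * (-I * (M ξ * 𝓕 (cub (u s)) ξ)) =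
    ((‖M ξ‖^2 : ℝ) : ℂ) * (cj (𝓕 (u s) ξ) * (-I * 𝓕 (cub (u s)) ξ)) := by
    rw [map_mul, ← Complex.normSq_eq_norm_sq, Complex.normSq_eq_conj_mul_self]; ring
  rw [this, Complex.re_ofReal_mul]; ring

end Blk

/-- A real Fourier multiplier of size at most one. -/
structure RM (m : EC) : Prop where
  temp : m.HasTemperateGrowth
  real : ∀ ξ, cj (m ξ) = m ξ
  le : ∀ ξ, ‖m ξ‖ ≤ 1

namespace RM
variable {m : EC}

lemma meas (hm : RM m) : Measurable m := hm.temp.1.continuous.measurable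

lemma op_two (hm : RM m) {f : EC} (hf : Sch f) : nL 2 (op m f) ≤ nL 2 f := by
  have := nL2_le_fourier (hf.op hm.temp) hf (c := 1) nmm fun ξ => by
    rw [hf.fourier_op hm.temp, norm_mul]; gcongr; exact hm.le ξ
  simpa using this

lemma op_H2 (hm : RM m) {f : EC} (hf : Sch f) : H2 (op m f) ≤ H2 f := by
  have := nL2_le_fourier (hf.op hm.temp).Lam hf.Lam (c := 1) nmm fun ξ => by
    rw [(hf.op hm.temp).fourier_Lam, hf.fourier_Lam, hf.fourier_op hm.temp, norm_mul, norm_mul, norm_mul, one_mul]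
    gcongr
    exact mul_le_of_le_one_left (norm_nonneg _) (hm.le ξ)
  simpa [H2] using this

lemma op_adj (hm : RM m) {f g : EC} (hf : Sch f) (hg : Sch g) :
    ∫ x, op m f x * cj (g x) = ∫ x, f x * cj (op m g x) := by
  rw [← (hf.op hm.temp).parseval hg, ← hf.parseval (hg.op hm.temp), hf.fourier_op hm.temp, hg.fourier_op hm.temp]
  congr 1; ext ξ
  rw [map_mul, hm.real]; ring

lemma op_meas (hm : RM m) {v : ℝ → EC} (hv : Measurable (fun q : ℝ × E3 => v q.1 q.2)) :
    Measurable (fun q : ℝ × E3 => op m (v q.1) q.2) := by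
  have h1 : Measurable (fun q : ℝ × E3 => 𝓕 (v q.1) q.2) := measurable_fourier_param (f := v) hv
  have h2 : Measurable (fun q : ℝ × E3 => m q.2 * 𝓕 (v q.1) q.2) := (hm.meas.comp measurable_snd).mul h1
  exact measurable_fourierInv_param (f := fun t ξ => m ξ * 𝓕 (v t) ξ) h2

end RM

lemma quartic_taylor (p q : ℂ) :
    |(1/4) * ‖q‖^4 - (1/4) * ‖p‖^4 - ((q - p) * cj (p * p * cj p)).re| ≤ (‖p‖+‖q‖)^2 * ‖q - p‖^2 := by
  set d := ‖q - p‖ with hd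
  set r := ((q - p) * cj p).re with hr
  have e1 : ((q - p) * cj (p * p * cj p)).re = ‖p‖^2 * r := by
    rw [hr, ← Complex.re_ofReal_mul]
    congr 1
    rw [← Complex.normSq_eq_norm_sq, Complex.normSq_eq_conj_mul_self, map_mul, map_mul, Complex.conj_conj]; ring
  have e2 : ‖q‖^2 - ‖p‖^2 = 2 * r + d^2 := by
    rw [hr, hd]
    simp only [← Complex.normSq_eq_norm_sq, Complex.normSq_apply]
    simp; ring
  rw [e1]
  have hy : ‖q‖^2 = ‖p‖^2 + 2 * r + d^2 := by linarith
  have e3 : (1/4:ℝ) * ‖q‖^4 - (1/4) * ‖p‖^4 - ‖p‖^2 * r = (1/2) * ‖p‖^2 * d^2 + (1/4) * (‖q‖^2 - ‖p‖^2)^2 := by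
    have : ‖q‖^4 = (‖q‖^2)^2 := by ring
    rw [this, hy]; ring
  rw [e3, abs_of_nonneg psv]
  have hd2 : |‖q‖ - ‖p‖| ≤ d := abs_norm_sub_norm_le _ _
  have h4 : (‖q‖^2 - ‖p‖^2)^2 ≤ (‖p‖+‖q‖)^2 * d^2 := by
    have : (‖q‖^2 - ‖p‖^2)^2 = (‖p‖+‖q‖)^2 * |‖q‖ - ‖p‖|^2 := by rw [sq_abs]; ring
    rw [this]; gcongr
  have h5 : ‖p‖^2 * d^2 ≤ (‖p‖+‖q‖)^2 * d^2 := by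
    gcongr; linarith [norm_nonneg q]
  nlinarith [sq_nonneg (‖p‖*d)]

lemma const_of_quad {Θ : ℝ → ℝ} {a b C : ℝ} (hab : a ≤ b)
    (h : ∀ t1 ∈ Icc a b, ∀ t2 ∈ Icc a b, t1 ≤ t2 → |Θ t2 - Θ t1| ≤ C * (t2 - t1)^2) : Θ b = Θ a := by
  have hC : ∀ x ∈ Icc a b, ∀ y ∈ Icc a b, |Θ y - Θ x| ≤ |C| * |y - x|^2 := fun x hx y hy => by
    rcases le_total x y with hh | hh
    · refine (h x hx y hy hh).trans ?_
      rw [sq_abs]; gcongr; exact le_abs_self C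
    · rw [abs_sub_comm]
      refine (h y hy x hx hh).trans ?_
      rw [sq_abs, show (y - x)^2 = (x-y)^2 by ring]; gcongr; exact le_abs_self C
  have hd : ∀ x ∈ Icc a b, HasDerivWithinAt Θ 0 (Icc a b) x := fun x hx => by
    rw [hasDerivWithinAt_iff_isLittleO]
    have h1 : (fun y => Θ y - Θ x - (y - x) • (0:ℝ)) =O[nhdsWithin x (Icc a b)] fun y => (y - x)^2 := by
      refine Asymptotics.IsBigO.of_bound |C| ?_
      filter_upwards [self_mem_nhdsWithin] with y hy
      simpa using hC x hx y hy
    refine h1.trans_isLittleO ?_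
    have h2 : (fun y : ℝ => (y - x)^2) =o[nhds x] fun y => y - x := by
      have := Asymptotics.isLittleO_pow_id (𝕜 := ℝ) (n := 2) nmm
      have h3 : Tendsto (fun y : ℝ => y - x) (nhds x) (nhds 0) := by
        have : Continuous (fun y : ℝ => y - x) := by fun_prop
        simpa using this.tendsto x
      exact this.comp_tendsto h3
    exact h2.mono nhdsWithin_le_nhds
  have hc : ContinuousOn Θ (Icc a b) := fun x hx => (hd x hx).continuousWithinAt
  refine constant_of_has_deriv_right_zero hc (fun x hx => ?_) b (Set.right_mem_Icc.2 hab)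
  have := (hd x (Set.Ico_subset_Icc_self hx)).mono (t := Icc a b) (s := Icc x b) (Set.Icc_subset_Icc_left hx.1)
  exact this.mono_of_mem_nhdsWithin (Icc_mem_nhdsGE hx.2)

lemma pair_le {f g : EC} (hf : Measurable f) (hg : Measurable g) {A B : ℝ} (hA : 0 ≤ A) (hB : 0 ≤ B)
    (h1 : nL 2 f ≤ eR A) (h2 : nL 2 g ≤ eR B) : ‖∫ x, f x * g x‖ ≤ A * B := by
  have : ‖∫ x, f x * g x‖ₑ ≤ eR (A * B) := by
    refine (enorm_integral_le_lintegral_enorm _).trans ((lintegral_mul_le_nL2 hf hg).trans ?_)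
    rw [ENNReal.ofReal_mul hA]; gcongr
  rw [← ofReal_norm] at this
  exact (ENNReal.ofReal_le_ofReal_iff psv).1 this

lemma nL_sub_comm (p : ℝ) (f g : EC) : nL p (fun x => f x - g x) = nL p (fun x => g x - f x) := by
  unfold nL; congr 1; ext x; exact enorm_sub_rev _ _

lemma Sch.quart_int {f : EC} (hf : Sch f) : Integrable (fun x => ‖f x‖^4) := by
  have := (hf.mul hf).sq_int
  refine this.congr (evt fun x => ?_)
  beta_reduce
  rw [norm_mul]; ring

lemma cub_meas {v : ℝ → EC} (hv : Measurable (fun q : ℝ × E3 => v q.1 q.2)) :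
    Measurable (fun q : ℝ × E3 => cub (v q.1) q.2) := by
  unfold cub
  exact (hv.mul hv).mul (Complex.continuous_conj.measurable.comp hv)

namespace Blk
variable {T : ℝ} {u : ℝ → EC} {a b : ℝ} {R : ENNReal} {m : EC}

/-- Uniform sup bound for the filtered solution. -/
lemma op_bds (h : Blk T u a b R) (hm : RM m) : ∃ S : ℝ, 0 ≤ S ∧ R ≤ eR S ∧
    (∀ t ∈ Icc a b, ∀ x, ‖op m (u t) x‖ₑ ≤ eR S) ∧
    (∀ t ∈ Icc a b, nL 2 (cub (op m (u t))) ≤ eR S) := by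
  obtain ⟨C, hC, hC1, hb1⟩ := H2_bounds
  obtain ⟨D, hD, hb2⟩ := H2_cub
  have hR := h.fin
  have hw := fun t => (h.sol.sch t).op hm.temp
  set Q := R + C * R + C * (D * R^3) with hQ
  have hQt : Q ≠ ⊤ := by finiteness
  refine ⟨Q.toReal, ENNReal.toReal_nonneg, ?_, ?_, ?_⟩ <;> rw [ENNReal.ofReal_toReal hQt]
  · rw [hQ, add_assoc]; exact le_self_add
  · intro t ht x
    refine ((hb1 _ (hw t)).1 x).trans (le_trans ?_ (le_self_add.trans' le_add_self))
    gcongr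
    exact (hm.op_H2 (h.sol.sch t)).trans (h.lam t ht)
  · intro t ht
    refine ((hb1 _ (hw t).cub).2.1).trans (le_trans ?_ le_add_self)
    gcongr
    refine ((hb2 _ (hw t)).1).trans ?_
    gcongr
    exact (hm.op_H2 (h.sol.sch t)).trans (h.lam t ht)

lemma op_lip (h : Blk T u a b R) (hm : RM m) {t1 t2 : ℝ} (h1 : t1 ∈ Icc a b) (h2 : t2 ∈ Icc a b) :
    nL 2 (fun x => op m (u t2) x - op m (u t1) x) ≤ R * eR |t2 - t1| := by
  rw [← op_sub hm.temp (h.sol.sch t2) (h.sol.sch t1)]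
  exact (hm.op_two ((h.sol.sch t2).sub (h.sol.sch t1))).trans (h.lip h1 h2)

/-- pairing of `w(t₂)-w(t₁)` with a fixed Schwartz function -/
lemma pair_diff (h : Blk T u a b R) (hm : RM m) {t1 t2 : ℝ} (h1 : t1 ∈ Icc a b) (h2 : t2 ∈ Icc a b) (h12 : t1 ≤ t2)
    {c : EC} (hc : Sch c) :
    IntervalIntegrable (fun s => ∫ x, op m (Gt u s) x * cj (c x)) volume t1 t2 ∧
    ∫ x, (op m (u t2) x - op m (u t1) x) * cj (c x) = ∫ s in t1..t2, ∫ x, op m (Gt u s) x * cj (c x) := by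
  have hsub : Icc t1 t2 ⊆ Icc a b := Set.Icc_subset_Icc h1.1 h2.2
  have hu := h.sol
  have hk := hc.op hm.temp
  have iP := pair_integrable (P := Gt u) (Q := fun _ x => cj (op m c x)) (t1 := t1) (t2 := t2) (A := R) (B := nL 2 (op m c))
    hu.cont_Gt.measurable (hk.conj.measurable.comp measurable_snd) h.fin (hk.nL_ne_top nmm)
    (fun s hs => h.gt s (hsub hs)) (fun s _ => by rw [nL_conj])
  have e : ∀ s, ∫ x, Gt u s x * cj (op m c x) = ∫ x, op m (Gt u s) x * cj (c x) :=
    fun s => (hm.op_adj (hu.sch_Gt s) hc).symm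
  have i1 := iP.integral_prod_left
  simp only [e] at i1
  refine ⟨(intervalIntegrable_iff_integrableOn_Ioc_of_le h12).2 i1, ?_⟩
  rw [intervalIntegral.integral_of_le h12]
  simp only [← e]
  rw [integral_integral_swap iP]
  have e2 := hm.op_adj ((hu.sch t2).sub (hu.sch t1)) hc
  rw [op_sub hm.temp (hu.sch t2) (hu.sch t1)] at e2
  rw [e2]
  congr 1; ext x
  rw [hu.sub_eq (h.mem h1) (h.mem h2), intervalIntegral.integral_of_le h12, integral_mul_const]

/-- the density of the potential energy variation -/
def pdens (m : EC) (u : ℝ → EC) (s : ℝ) : ℝ := (∫ x, op m (Gt u s) x * cj (cub (op m (u s)) x)).re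

lemma pot_int (h : Blk T u a b R) (hm : RM m) {t1 t2 : ℝ} (h1 : t1 ∈ Icc a b) (h2 : t2 ∈ Icc a b) (h12 : t1 ≤ t2) :
    IntervalIntegrable (fun s => ∫ x, op m (Gt u s) x * cj (cub (op m (u s)) x)) volume t1 t2 := by
  have hsub : Icc t1 t2 ⊆ Icc a b := Set.Icc_subset_Icc h1.1 h2.2
  have hu := h.sol
  obtain ⟨S, hS0, hRS, hSup, hc2⟩ := h.op_bds hm
  have mQ : Measurable (fun q : ℝ × E3 => cj (cub (op m (u q.1)) q.2)) := by
    have h0 : Measurable (fun q : ℝ × E3 => cub (op m (u q.1)) q.2) := cub_meas (v := fun s => op m (u s)) (hm.op_meas hu.cont.measurable)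
    exact Complex.continuous_conj.measurable.comp h0
  have mP : Measurable (fun q : ℝ × E3 => op m (Gt u q.1) q.2) := hm.op_meas hu.cont_Gt.measurable
  have bP : ∀ s ∈ Icc t1 t2, nL 2 (op m (Gt u s)) ≤ R := fun s hs => (hm.op_two (hu.sch_Gt s)).trans (h.gt s (hsub hs))
  have bQ : ∀ s ∈ Icc t1 t2, nL 2 (fun x => cj (cub (op m (u s)) x)) ≤ eR S := fun s hs => by
    rw [nL_conj]; exact hc2 s (hsub hs)
  have iP := pair_integrable (P := fun s => op m (Gt u s)) (Q := fun s x => cj (cub (op m (u s)) x))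
    mP mQ h.fin ENNReal.ofReal_ne_top bP bQ
  have iQ := iP.integral_prod_left
  exact (intervalIntegrable_iff_integrableOn_Ioc_of_le h12).2 iQ

lemma re_int {f : ℝ → ℂ} {t1 t2 : ℝ} (hf : IntervalIntegrable f volume t1 t2) :
    IntervalIntegrable (fun s => (f s).re) volume t1 t2 ∧ ∫ s in t1..t2, (f s).re = (∫ s in t1..t2, f s).re := by
  refine ⟨⟨hf.1.re, hf.2.re⟩, ?_⟩
  exact Complex.reCLM.intervalIntegral_comp_comm hf

lemma pot_step (h : Blk T u a b R) (hm : RM m) : ∃ C : ℝ, ∀ t1 ∈ Icc a b, ∀ t2 ∈ Icc a b, t1 ≤ t2 →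
    |(∫ x, (1/4) * ‖op m (u t2) x‖^4) - (∫ x, (1/4) * ‖op m (u t1) x‖^4) - ∫ s in t1..t2, pdens m u s| ≤ C * (t2 - t1)^2 := by
  have hu := h.sol
  obtain ⟨S, hS0, hRS, hSup, hc2⟩ := h.op_bds hm
  have hR := h.fin
  have hw := fun t => (hu.sch t).op hm.temp
  refine ⟨(S+S)^2 * S^2 + (S+S)^2*S*S, fun t1 h1 t2 h2 h12 => ?_⟩
  have hsub : Icc t1 t2 ⊆ Icc a b := Set.Icc_subset_Icc h1.1 h2.2
  obtain ⟨iA, eA⟩ := h.pair_diff hm h1 h2 h12 (hw t1).cub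
  have iB := h.pot_int hm h1 h2 h12
  have lip : ∀ s ∈ Icc t1 t2, nL 2 (fun x => op m (u s) x - op m (u t1) x) ≤ eR (S * (s - t1)) := fun s hs => by
    refine (h.op_lip hm h1 (hsub hs)).trans ?_
    rw [ENNReal.ofReal_mul hS0, abs_of_nonneg (by linarith [hs.1])]
    gcongr
  have supN : ∀ s ∈ Icc a b, ∀ x, ‖op m (u s) x‖ ≤ S := fun s hs x => by
    have := hSup s hs x
    rw [← ofReal_norm] at this
    exact (ENNReal.ofReal_le_ofReal_iff hS0).1 this
  -- first part
  have p1 : |(∫ x, (1/4) * ‖op m (u t2) x‖^4) - (∫ x, (1/4) * ‖op m (u t1) x‖^4) -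
      (∫ x, (op m (u t2) x - op m (u t1) x) * cj (cub (op m (u t1)) x)).re| ≤ (S+S)^2 * S^2 * (t2-t1)^2 := by
    have hd := (hw t2).sub (hw t1)
    have ip : Integrable (fun x => (op m (u t2) x - op m (u t1) x) * cj (cub (op m (u t1)) x)) :=
      (hd.mul (hw t1).cub.conj).integrable
    have ir := integral_re ip
    simp only [RCLike.re_eq_complex_re] at ir
    rw [← ir, ← integral_sub ((hw t2).quart_int.const_mul _) ((hw t1).quart_int.const_mul _), ← integral_sub]
    · have sq : ∫ x, ‖op m (u t2) x - op m (u t1) x‖^2 ≤ (S * (t2 - t1))^2 := by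
        have := pair_le hd.measurable hd.conj.measurable (A := S * (t2-t1)) (B := S*(t2-t1))
          (mul_nonneg hS0 (by linarith)) (mul_nonneg hS0 (by linarith)) (lip t2 (Set.right_mem_Icc.2 h12))
          (by rw [nL_conj]; exact lip t2 (Set.right_mem_Icc.2 h12))
        simp only [Complex.mul_conj, Complex.normSq_eq_norm_sq] at this
        rw [integral_complex_ofReal, Complex.norm_real, Real.norm_eq_abs] at this
        rw [sq]; exact (le_abs_self _).trans this
      calc _ ≤ ∫ x, (S+S)^2 * ‖op m (u t2) x - op m (u t1) x‖^2 := by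
            rw [← Real.norm_eq_abs]
            refine norm_integral_le_of_norm_le (hd.sq_int.const_mul _) (evt fun x => ?_)
            refine (quartic_taylor (op m (u t1) x) (op m (u t2) x)).trans ?_
            gcongr
            exacts [supN t1 h1 x, supN t2 h2 x]
        _ ≤ (S+S)^2 * (S * (t2 - t1))^2 := by rw [integral_const_mul]; gcongr
        _ = _ := by ring
    · exact ((hw t2).quart_int.const_mul _).sub ((hw t1).quart_int.const_mul _)
    · exact ip.re
  -- second part
  have p2 : |(∫ x, (op m (u t2) x - op m (u t1) x) * cj (cub (op m (u t1)) x)).re - ∫ s in t1..t2, pdens m u s| ≤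
      (S+S)^2*S*S * (t2-t1)^2 := by
    have er := (re_int iB).2
    unfold pdens
    rw [er, eA, ← Complex.sub_re, ← intervalIntegral.integral_sub iA iB]
    refine (Complex.abs_re_le_norm _).trans ?_
    have := intervalIntegral.norm_integral_le_of_norm_le_const (a := t1) (b := t2) (C := (S+S)^2*S*S*(t2-t1))
      (f := fun s => (∫ x, op m (Gt u s) x * cj (cub (op m (u t1)) x)) - ∫ x, op m (Gt u s) x * cj (cub (op m (u s)) x))
      (fun s hs => by
        rw [Set.uIoc_of_le h12] at hs
        have hs' := Set.Ioc_subset_Icc_self hs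
        have hG := (hu.sch_Gt s).op hm.temp
        rw [← integral_sub (hG.mul (hw t1).cub.conj).integrable (hG.mul (hw s).cub.conj).integrable]
        have hcs := (hw t1).cub.sub (hw s).cub
        have e : ∀ x, op m (Gt u s) x * cj (cub (op m (u t1)) x) - op m (Gt u s) x * cj (cub (op m (u s)) x) =
          op m (Gt u s) x * cj (cub (op m (u t1)) x - cub (op m (u s)) x) := fun x => by rw [map_sub]; ring
        simp only [e]
        refine (pair_le hG.measurable hcs.conj.measurable (A := S) (B := (S+S)^2 * (S * (s - t1))) hS0
          (mul_nonneg psv (mul_nonneg hS0 (by linarith [hs.1]))) ?_ ?_).trans ?_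
        · exact ((hm.op_two (hu.sch_Gt s)).trans (h.gt s (hsub hs'))).trans hRS
        · rw [nL_conj]
          refine (nL2_cub_sub ENNReal.ofReal_ne_top (hSup t1 h1) (hSup s (hsub hs'))).trans ?_
          rw [nL_sub_comm, ENNReal.ofReal_mul psv, ENNReal.ofReal_pow psv, ENNReal.ofReal_add hS0 hS0]
          gcongr
          exact lip s hs'
        · calc _ = (S+S)^2*S*S*(s-t1) := by ring
            _ ≤ _ := by gcongr; exact hs.2)
    refine this.trans (le_of_eq ?_)
    rw [abs_of_nonneg (by linarith)]; ring
  rw [abs_le] at p1 p2 ⊢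
  constructor <;> nlinarith [p1.1, p1.2, p2.1, p2.2]

lemma pot (h : Blk T u a b R) (hm : RM m) {t1 t2 : ℝ} (h1 : t1 ∈ Icc a b) (h2 : t2 ∈ Icc a b) (h12 : t1 ≤ t2) :
    (∫ x, (1/4) * ‖op m (u t2) x‖^4) - (∫ x, (1/4) * ‖op m (u t1) x‖^4) = ∫ s in t1..t2, pdens m u s := by
  obtain ⟨C, hC⟩ := h.pot_step hm
  have hsub : Icc t1 t2 ⊆ Icc a b := Set.Icc_subset_Icc h1.1 h2.2
  have := const_of_quad (Θ := fun t => (∫ x, (1/4) * ‖op m (u t) x‖^4) - ∫ s in t1..t, pdens m u s) (C := C) h12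
    (fun r1 hr1 r2 hr2 hr => by
      have := hC r1 (hsub hr1) r2 (hsub hr2) hr
      have e := intervalIntegral.integral_add_adjacent_intervals (f := pdens m u) (a := t1) (b := r1) (c := r2) (μ := volume)
        (re_int (h.pot_int hm h1 (hsub hr1) hr1.1)).1 (re_int (h.pot_int hm (hsub hr1) (hsub hr2) hr)).1
      beta_reduce
      rw [← e]
      convert this using 2; ring)
  beta_reduce at this
  rw [intervalIntegral.integral_same] at this
  linarith

end Blk

lemma Sch.ibp {f g : EC} (hf : Sch f) (hg : Sch g) :
    ∫ x, _root_.lap f x * cj (g x) = - ∑ j, ∫ x, _root_.pd f j x * cj (_root_.pd g j x) := by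
  rw [← hf.lap.parseval hg]
  have h1 : ∀ j, ∫ x, _root_.pd f j x * cj (_root_.pd g j x) =
      ∫ ξ, ((4 * π^2 * (ξ j)^2 : ℝ) : ℂ) * (𝓕 f ξ * cj (𝓕 g ξ)) := fun j => by
    rw [← (hf.pd j).parseval (hg.pd j)]
    congr 1; ext ξ
    rw [hf.fourier_pd, hg.fourier_pd]
    simp only [map_mul, Complex.conj_ofReal, Complex.conj_I]
    have e2 : cj 2 = 2 := Complex.conj_ofNat 2
    rw [e2]
    push_cast
    linear_combination (-4 * (π:ℂ)^2 * (ξ j:ℂ)^2 * (𝓕 f ξ * cj (𝓕 g ξ))) * Complex.I_mul_I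
  have i1 : ∀ j, Integrable (fun ξ : E3 => ((4 * π^2 * (ξ j)^2 : ℝ) : ℂ) * (𝓕 f ξ * cj (𝓕 g ξ))) := fun j => by
    have := ((hf.pd j).fourier.mul (hg.pd j).fourier.conj).integrable
    refine this.congr (evt fun ξ => ?_)
    beta_reduce
    rw [hf.fourier_pd, hg.fourier_pd]
    simp only [map_mul, Complex.conj_ofReal, Complex.conj_I]
    have e2 : cj 2 = 2 := Complex.conj_ofNat 2
    rw [e2]
    push_cast
    linear_combination (-4 * (π:ℂ)^2 * (ξ j:ℂ)^2 * (𝓕 f ξ * cj (𝓕 g ξ))) * Complex.I_mul_I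
  simp only [h1]
  rw [← integral_finsetSum _ fun j _ => i1 j, ← integral_neg]
  congr 1; ext ξ
  rw [hf.fourier_lap, ← Finset.sum_mul, norm_sq_coords]
  push_cast
  rw [← Finset.mul_sum]; ring

lemma op_lap {m f : EC} (hm : m.HasTemperateGrowth) (hf : Sch f) : op m (lap f) = lap (op m f) := by
  refine Sch.ext_fourier (hf.lap.op hm) (hf.op hm).lap fun ξ => ?_
  rw [hf.lap.fourier_op hm, (hf.op hm).fourier_lap, hf.fourier_op hm]
  beta_reduce
  rw [hf.fourier_lap]; ring

/-- commutator of the multiplier with the nonlinearity -/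
def Dm (m : EC) (f : EC) (x : E3) : ℂ := op m (cub f) x - cub (op m f) x

lemma RM.Dm {m f : EC} (hm : RM m) (hf : Sch f) : Sch (Dm m f) := (hf.cub.op hm.temp).sub (hf.op hm.temp).cub

lemma energyE_eq {w : EC} (hw : Sch w) :
    energyE w = (1/2) * ∑ j, (∫ x, ‖pd w j x‖^2) + ∫ x, (1/4) * ‖w x‖^4 := by
  unfold energyE
  simp only [Complex.normSq_eq_norm_sq]
  rw [integral_add, integral_const_mul, integral_finsetSum]
  · exact fun j _ => (hw.pd j).sq_int
  · exact (integrable_finsetSum _ fun j _ => (hw.pd j).sq_int).const_mul _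
  · exact hw.quart_int.const_mul _

lemma pairing_enorm {f g : EC} (hf : Measurable f) (hg : Measurable g) {p q : ℝ} (hp : 0 < p) (hq : 0 < q) (h : 1 = 1/p + 1/q) :
    ‖∫ x, f x * cj (g x)‖ₑ ≤ nL p f * nL q g := by
  refine (enorm_integral_le_lintegral_enorm _).trans ?_
  have := Np_mul_le (μ := (volume : Measure E3)) (p := p) (q := q) (r := 1) hp hq (by rw [← h]; norm_num)
    hf.enorm.aemeasurable hg.enorm.aemeasurable
  refine le_trans (le_of_eq ?_) this
  simp [Np]

/-- the energy density variation -/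
def Jd (m : EC) (f : EC) : ℝ :=
  (∑ j, (-I * ∫ x, pd (Dm m f) j x * cj (pd (op m f) j x)).re) +
    (-I * ∫ x, Dm m f x * cj (cub (op m f) x)).re

lemma Jd_eq {m : EC} (hm : RM m) {T : ℝ} {u : ℝ → EC} (hu : Sol T u) (s : ℝ) :
    (∑ j, (-I * ∫ x, pd (op m (cub (u s))) j x * cj (pd (op m (u s)) j x)).re) + Blk.pdens m u s = Jd m (u s) := by
  have hf := hu.sch s
  have hw := hf.op hm.temp
  have hA := hf.cub.op hm.temp
  have hD := hm.Dm hf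
  set w := op m (u s) with hwd
  set A := op m (cub (u s)) with hAd
  set D := Dm m (u s) with hDd
  have eG : op m (Gt u s) = fun x => I * (lap w x - A x) := by
    have e1 : Gt u s = fun x => I * ((fun x => lap (u s) x - cub (u s) x) x) := rfl
    rw [e1, op_const_mul hm.temp (hf.lap.sub hf.cub), op_sub hm.temp hf.lap hf.cub]
    funext x
    have : op m (fun x => lap (u s) x) = lap w := op_lap hm.temp hf
    rw [← this]
  have eA : ∀ x, A x = D x + cub w x := fun x => by rw [hDd]; unfold Dm; ring
  have eAp : ∀ j x, pd A j x = pd D j x + pd (cub w) j x := fun j x => by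
    have : D = fun x => A x - cub w x := rfl
    rw [this, pd_sub hA.differentiable hw.cub.differentiable]; ring
  have k1 : ∀ j, ∫ x, pd A j x * cj (pd w j x) =
      (∫ x, pd D j x * cj (pd w j x)) + ∫ x, pd (cub w) j x * cj (pd w j x) := fun j => by
    rw [← integral_add ((hD.pd j).mul (hw.pd j).conj).integrable ((hw.cub.pd j).mul (hw.pd j).conj).integrable]
    congr 1; ext x; rw [eAp]; ring
  have k2 : ∫ x, op m (Gt u s) x * cj (cub w x) = I * (∫ x, lap w x * cj (cub w x)) +
      (-I * (∫ x, D x * cj (cub w x)) + -I * ∫ x, cub w x * cj (cub w x)) := by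
    rw [← integral_const_mul, ← integral_const_mul, ← integral_const_mul, ← integral_add, ← integral_add]
    · congr 1; ext x; rw [eG]; beta_reduce; rw [eA]; ring
    · exact (hw.lap.mul hw.cub.conj).integrable.const_mul _
    · exact ((hD.mul hw.cub.conj).integrable.const_mul _).add ((hw.cub.mul hw.cub.conj).integrable.const_mul _)
    · exact (hD.mul hw.cub.conj).integrable.const_mul _
    · exact (hw.cub.mul hw.cub.conj).integrable.const_mul _
  have k3 : ∀ j, ∫ x, pd w j x * cj (pd (cub w) j x) =
      cj (∫ x, pd (cub w) j x * cj (pd w j x)) := fun j => by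
    rw [← integral_conj]; congr 1; ext x; rw [map_mul, Complex.conj_conj, mul_comm]
  have k4 : (-I * ∫ x, cub w x * cj (cub w x)).re = 0 := by
    simp only [Complex.mul_conj]
    rw [integral_complex_ofReal]; simp
  unfold Blk.pdens Jd
  rw [← hwd, ← hDd, k2, Complex.add_re, Complex.add_re, k4, hw.ibp hw.cub]
  simp only [k1, k3, mul_add, Complex.add_re, Finset.sum_add_distrib]
  have k5 : (I * -∑ j, cj (∫ x, pd (cub w) j x * cj (pd w j x))).re =
      - ∑ j, (-I * ∫ x, pd (cub w) j x * cj (pd w j x)).re := by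
    rw [← Finset.sum_neg_distrib, ← Finset.sum_neg_distrib, Finset.mul_sum, Complex.re_sum]
    refine Finset.sum_congr rfl fun j _ => ?_
    simp
  rw [k5]; ring

lemma Jd_le {m : EC} (hm : RM m) {f : EC} (hf : Sch f) :
    ‖Jd m f‖ₑ ≤ ∑ j, nL (18/13) (fun x => pd (Dm m f) j x) * nL (18/5) (fun x => pd (op m f) j x) +
      nL (18/7) (Dm m f) * nL (18/11) (cub (op m f)) := by
  have hw := hf.op hm.temp
  have hD := hm.Dm hf
  have hre : ∀ z : ℂ, ‖(-I * z).re‖ₑ ≤ ‖z‖ₑ := fun z => by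
    refine enorm_le_iff_norm_le.2 ?_
    refine (Complex.abs_re_le_norm _).trans ?_
    simp
  unfold Jd
  refine (enorm_add_le _ _).trans (add_le_add ((enorm_sum_le _ _).trans (Finset.sum_le_sum fun j _ => ?_)) ?_)
  · exact (hre _).trans (pairing_enorm (hD.pd j).measurable (hw.pd j).measurable nmm nmm nmm)
  · exact (hre _).trans (pairing_enorm hD.measurable hw.cub.measurable nmm nmm nmm)

lemma pd_M_le {m : EC} (hm : RM m) (j : Fin 3) (ξ : E3) : ‖(2 * π * I) * (ξ j : ℂ) * m ξ‖ ≤ π * (1 + ‖ξ‖^2) := by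
  rw [norm_mul, norm_mul, Complex.norm_real]
  have e : ‖(2 * (π:ℂ) * I)‖ = 2 * π := by simp [abs_of_pos Real.pi_pos]
  rw [e]
  calc 2 * π * ‖ξ j‖ * ‖m ξ‖ ≤ 2 * π * ‖ξ‖ * 1 := by
        gcongr
        exacts [abs_coord_le ξ j, hm.le ξ]
    _ ≤ _ := by nlinarith [Real.pi_pos, sq_nonneg (‖ξ‖ - 1), mul_nonneg Real.pi_pos.le (sq_nonneg (‖ξ‖ - 1))]

lemma energy_id {T : ℝ} {u : ℝ → EC} {a b : ℝ} {R : ENNReal} {m : EC} (h : Blk T u a b R) (hm : RM m)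
    {t1 t2 : ℝ} (h1 : t1 ∈ Icc a b) (h2 : t2 ∈ Icc a b) (h12 : t1 ≤ t2) :
    energyE (op m (u t2)) - energyE (op m (u t1)) = ∫ s in t1..t2, Jd m (u s) := by
  have hu := h.sol
  have hw := fun t => (hu.sch t).op hm.temp
  have hA := fun t => (hu.sch t).cub.op hm.temp
  have q := fun j => h.quad h1 h2 h12 (M := fun ξ => (2 * π * I) * (ξ j : ℂ) * m ξ) (c := π)
    (by have := hm.meas; fun_prop)
    (pd_M_le hm j) (f := fun t x => pd (op m (u t)) j x) (g := fun t x => pd (op m (cub (u t))) j x)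
    (fun t => (hw t).pd j) (fun t => (hA t).pd j)
    (fun t ξ => by rw [(hw t).fourier_pd, (hu.sch t).fourier_op hm.temp]; ring)
    (fun t ξ => by rw [(hA t).fourier_pd, (hu.sch t).cub.fourier_op hm.temp]; ring)
  have ip : IntervalIntegrable (fun s => Blk.pdens m u s) volume t1 t2 := (Blk.re_int (h.pot_int hm h1 h2 h12)).1
  have hp := h.pot hm h1 h2 h12
  have iq : ∀ j, IntervalIntegrable (fun s => (-I * ∫ x, pd (op m (cub (u s))) j x * cj (pd (op m (u s)) j x)).re) volume t1 t2 := fun j => by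
    have := (q j).1.const_mul (1/2)
    refine this.congr fun s _ => ?_
    beta_reduce; ring
  have is : IntervalIntegrable (fun s => ∑ j, (-I * ∫ x, pd (op m (cub (u s))) j x * cj (pd (op m (u s)) j x)).re) volume t1 t2 := by
    have := IntervalIntegrable.sum (μ := volume) (a := t1) (b := t2) Finset.univ (f := fun j s => (-I * ∫ x, pd (op m (cub (u s))) j x * cj (pd (op m (u s)) j x)).re) fun j _ => iq j
    refine IntervalIntegrable.congr (fun s _ => ?_) this
    rw [Finset.sum_apply]
  simp only [← Jd_eq hm hu]
  rw [intervalIntegral.integral_add is ip, ← hp, intervalIntegral.integral_finsetSum fun j _ => iq j]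
  have e : ∀ j, ∫ s in t1..t2, (-I * ∫ x, pd (op m (cub (u s))) j x * cj (pd (op m (u s)) j x)).re =
      (1/2) * ((∫ x, ‖pd (op m (u t2)) j x‖^2) - ∫ x, ‖pd (op m (u t1)) j x‖^2) := fun j => by
    rw [(q j).2, intervalIntegral.integral_const_mul]; ring
  simp only [e]
  rw [energyE_eq (hw t2), energyE_eq (hw t1), ← Finset.mul_sum, Finset.sum_sub_distrib]; ring

/-- Bound for the energy increment. -/
lemma energy_le {T : ℝ} {u : ℝ → EC} {a b : ℝ} {R : ENNReal} {m : EC} (h : Blk T u a b R) (hm : RM m)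
    {t1 t2 : ℝ} (h1 : t1 ∈ Icc a b) (h2 : t2 ∈ Icc a b) (h12 : t1 ≤ t2) :
    ‖energyE (op m (u t2)) - energyE (op m (u t1))‖ₑ ≤ ∫⁻ s in Icc t1 t2,
      (∑ j, nL (18/13) (fun x => pd (Dm m (u s)) j x) * nL (18/5) (fun x => pd (op m (u s)) j x) +
      nL (18/7) (Dm m (u s)) * nL (18/11) (cub (op m (u s)))) := by
  rw [energy_id h hm h1 h2 h12, intervalIntegral.integral_of_le h12, ← integral_Icc_eq_integral_Ioc]
  refine (enorm_integral_le_lintegral_enorm _).trans ?_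
  exact lintegral_mono fun s => Jd_le hm (h.sol.sch s)

/-- conservation of energy -/
lemma energy_cons {T : ℝ} {u : ℝ → EC} {a b : ℝ} {R : ENNReal} (h : Blk T u a b R)
    {t1 t2 : ℝ} (h1 : t1 ∈ Icc a b) (h2 : t2 ∈ Icc a b) (h12 : t1 ≤ t2) :
    energyE (u t2) = energyE (u t1) := by
  have hm : RM (fun _ => 1) := ⟨.const 1, fun _ => by simp, fun _ => by simp⟩
  have e : ∀ f, Sch f → op (fun _ => 1) f = f := fun f hf => by
    unfold op; simp only [one_mul]
    exact hf.inv
  have := energy_id h hm h1 h2 h12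
  rw [e _ (h.sol.sch t2), e _ (h.sol.sch t1)] at this
  have hD : ∀ s, Dm (fun _ => 1) (u s) = fun _ => 0 := fun s => by
    funext x; unfold Dm; rw [e _ (h.sol.sch s), e _ (h.sol.sch s).cub]; ring
  have hJ : ∀ s, Jd (fun _ => 1) (u s) = 0 := fun s => by
    unfold Jd; rw [hD]; simp [pd]
  simp only [hJ] at this
  simp at this; linarith

/-- conservation of mass -/
lemma mass_cons {T : ℝ} {u : ℝ → EC} {a b : ℝ} {R : ENNReal} (h : Blk T u a b R)
    {t1 t2 : ℝ} (h1 : t1 ∈ Icc a b) (h2 : t2 ∈ Icc a b) (h12 : t1 ≤ t2) :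
    ∫ x, ‖u t2 x‖^2 = ∫ x, ‖u t1 x‖^2 := by
  have hu := h.sol
  have q := (h.quad h1 h2 h12 (M := fun _ => 1) measurable_const (c := 1) (fun ξ => by simp) (f := u) (g := fun t => cub (u t))
    hu.sch (fun t => (hu.sch t).cub) (fun t ξ => by simp) (fun t ξ => by simp)).2
  have e : ∀ s, (-I * ∫ x, cub (u s) x * cj (u s x)).re = 0 := fun s => by
    have : ∀ x, cub (u s) x * cj (u s x) = ((Complex.normSq (u s x) ^2 : ℝ) : ℂ) := fun x => by
      unfold cub; push_cast; rw [← Complex.mul_conj]; ring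
    simp only [this]
    rw [integral_complex_ofReal]; simp
  simp only [e] at q
  simp at q; linarith

lemma setNp_le (p : ℝ) (hp : 1 < p) {f : EC} (hf : Measurable f) :
    ∫⁻ y in Metric.ball (0:E3) 1, ‖f y‖ₑ ≤ volume (Metric.ball (0:E3) 1) ^ (1 - 1/p) * nL p f := by
  have hp0 : 0 < p := by linarith
  have hq : 0 < 1 - 1/p := by rw [sub_pos, div_lt_one hp0]; exact hp
  have h := Np_mul_le (μ := volume.restrict (Metric.ball (0:E3) 1)) (r := 1) (p := (1 - 1/p)⁻¹) (q := p)
    psv hp0 (by rw [one_div, one_div, inv_inv]; ring) (F := fun _ => 1) (G := fun y => ‖f y‖ₑ)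
    aemeasurable_const hf.enorm.aemeasurable
  refine (le_of_eq ?_).trans (h.trans ?_)
  · simp [Np]
  · gcongr
    · simp [Np]
    · unfold nL Np
      gcongr
      exact Measure.restrict_le_self

lemma morrey : ∃ C : ENNReal, C ≠ ⊤ ∧ ∀ f, Sch f → ∀ x, ‖f x‖ₑ ≤ C * (nG (18/5) f + nL 2 f) := by
  set V := volume (Metric.ball (0:E3) 1) with hV
  have hV0 : V ≠ 0 := (Metric.measure_ball_pos _ _ one_pos).ne'
  have hVt : V ≠ ⊤ := measure_ball_lt_top.ne
  set K : ENNReal := V ^ (1 - 1/(18/5):ℝ) * eR 6 + V ^ (1 - 1/2:ℝ) with hK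
  have hKt : K ≠ ⊤ := by rw [hK]; finiteness
  refine ⟨V⁻¹ * K, ENNReal.mul_ne_top (ENNReal.inv_ne_top.2 hV0) hKt, fun f hf x => ?_⟩
  have hdc : Continuous (fderiv ℝ f) := hf.contDiff.continuous_fderiv (by simp)
  have e1 : ∀ y ∈ Metric.ball (0:E3) 1, ‖f x‖ₑ ≤
      (∫⁻ r in Ioc (0:ℝ) 1, ‖fderiv ℝ f (x + r • y)‖ₑ) + ‖f (x + y)‖ₑ := by
    intro y hy
    have h1 : ∀ r : ℝ, HasDerivAt (fun r : ℝ => f (x + r • y)) (fderiv ℝ f (x + r • y) y) r := fun r => by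
      have h0 : HasDerivAt (fun r : ℝ => x + r • y) y r := by
        simpa using ((hasDerivAt_id r).smul_const y).const_add x
      exact (hf.differentiable (x + r • y)).hasFDerivAt.comp_hasDerivAt r h0
    have hc : Continuous fun r : ℝ => fderiv ℝ f (x + r • y) y :=
      (hdc.comp (by fun_prop)).clm_apply continuous_const
    have h2 := intervalIntegral.integral_eq_sub_of_hasDerivAt (a := 0) (b := 1) (fun r _ => h1 r)
      (hc.intervalIntegrable _ _)
    simp only [one_smul, zero_smul, add_zero] at h2
    rw [intervalIntegral.integral_of_le zero_le_one] at h2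
    have h3 : f x = -(∫ r in Ioc (0:ℝ) 1, fderiv ℝ f (x + r • y) y) + f (x + y) := by rw [h2]; ring
    rw [h3]
    refine (enorm_add_le _ _).trans ?_
    rw [enorm_neg]
    gcongr
    refine (enorm_integral_le_lintegral_enorm _).trans (lintegral_mono fun r => ?_)
    rw [← ofReal_norm, ← ofReal_norm]
    refine ofReal_le_ofReal (((fderiv ℝ f (x + r • y)).le_opNorm y).trans ?_)
    exact mul_le_of_le_one_right (norm_nonneg _) (by simpa using (Metric.mem_ball.1 hy).le)
  have mF : Measurable (fun q : E3 × ℝ => ‖fderiv ℝ f (x + q.2 • q.1)‖ₑ) :=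
    (hdc.comp (by fun_prop)).measurable.enorm
  have e2 : V * ‖f x‖ₑ ≤ (∫⁻ r in Ioc (0:ℝ) 1, ∫⁻ y in Metric.ball (0:E3) 1, ‖fderiv ℝ f (x + r • y)‖ₑ)
      + ∫⁻ y in Metric.ball (0:E3) 1, ‖f (x + y)‖ₑ := by
    rw [← lintegral_lintegral_swap mF.aemeasurable, ← lintegral_add_right _ (by
      exact (hf.measurable.comp (measurable_const_add x)).enorm)]
    calc _ = ∫⁻ y in Metric.ball (0:E3) 1, ‖f x‖ₑ := by simp [mul_comm, hV]
      _ ≤ _ := setLIntegral_mono' measurableSet_ball e1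
  have e3 : ∫⁻ y in Metric.ball (0:E3) 1, ‖f (x + y)‖ₑ ≤ V ^ (1 - 1/2:ℝ) * nL 2 f := by
    refine (setNp_le 2 nmm (f := fun y => f (x + y)) (hf.measurable.comp (measurable_const_add x))).trans (le_of_eq ?_)
    have := nL_trans 2 f (-x)
    simp only [sub_neg_eq_add] at this
    rw [← this]; simp only [add_comm, hV]
  have e4 : ∀ r ∈ Ioc (0:ℝ) 1, ∫⁻ y in Metric.ball (0:E3) 1, ‖fderiv ℝ f (x + r • y)‖ₑ ≤
      V ^ (1 - 1/(18/5):ℝ) * nG (18/5) f * eR (r ^ (-(5/6):ℝ)) := by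
    intro r hr
    have mp : ∀ i, Measurable (fun y => pd f i (x + r • y)) := fun i =>
      (hf.pd i).measurable.comp (by fun_prop)
    calc _ ≤ ∫⁻ y in Metric.ball (0:E3) 1, ∑ i, ‖pd f i (x + r • y)‖ₑ := by
          refine lintegral_mono fun y => ?_
          simp only [← ofReal_norm]
          rw [← ENNReal.ofReal_sum_of_nonneg fun i _ => norm_nonneg _]
          exact ofReal_le_ofReal (fderiv_norm_le _ _)
      _ = ∑ i, ∫⁻ y in Metric.ball (0:E3) 1, ‖pd f i (x + r • y)‖ₑ :=
          lintegral_finsetSum _ fun i _ => (mp i).enorm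
      _ ≤ ∑ i, V ^ (1 - 1/(18/5):ℝ) * nL (18/5) (fun y => pd f i (x + r • y)) :=
          Finset.sum_le_sum fun i _ => setNp_le (18/5) nmm (mp i)
      _ = _ := by
          rw [← Finset.mul_sum, mul_assoc, nG, Finset.sum_mul]
          congr 1
          refine Finset.sum_congr rfl fun i _ => ?_
          have := nL_trans (18/5) (fun y => pd f i y) (-x)
          simp only [sub_neg_eq_add] at this
          rw [← this]
          have h2 := nL_smul (fun y => pd f i (y + x)) (show (0:ℝ) < 18/5 by norm_num) hr.1
          beta_reduce at h2
          simp only [add_comm x]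
          rw [h2, mul_comm]
          norm_num
  have e5 : ∫⁻ r in Ioc (0:ℝ) 1, ∫⁻ y in Metric.ball (0:E3) 1, ‖fderiv ℝ f (x + r • y)‖ₑ ≤
      V ^ (1 - 1/(18/5):ℝ) * nG (18/5) f * eR 6 := by
    refine (setLIntegral_mono' measurableSet_Ioc e4).trans ?_
    rw [lintegral_const_mul _ (by fun_prop), lintegral_rpow_Ioc 1 zero_le_one _ nmm]
    norm_num
  rw [mul_assoc, mul_comm V⁻¹, ← div_eq_mul_inv, ENNReal.le_div_iff_mul_le (.inl hV0) (.inl hVt), mul_comm]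
  refine e2.trans ((add_le_add e5 e3).trans ?_)
  rw [hK, add_mul]
  refine add_le_add ?_ ?_
  · rw [mul_right_comm]; gcongr; exact le_self_add
  · gcongr; exact le_add_self

lemma pd_meas {v : ℝ → EC} (hv : Measurable (fun q : ℝ × E3 => v q.1 q.2)) (hs : ∀ t, Sch (v t)) (j : Fin 3) :
    Measurable (fun q : ℝ × E3 => pd (v q.1) j q.2) := by
  have h1 : Measurable (fun q : ℝ × E3 => 𝓕 (v q.1) q.2) := measurable_fourier_param (f := v) hv
  have h2 : Measurable (fun q : ℝ × E3 => (2*π*I) * (q.2 j : ℂ) * 𝓕 (v q.1) q.2) := by fun_prop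
  have h3 := measurable_fourierInv_param (f := fun t ξ => (2*π*I) * ((ξ j : ℝ) : ℂ) * 𝓕 (v t) ξ) h2
  convert h3 using 2 with q
  change pd (v q.1) j q.2 = 𝓕⁻ (fun ξ => (2*π*I) * ((ξ j : ℝ) : ℂ) * 𝓕 (v q.1) ξ) q.2
  have e : (fun ξ => (2*π*I) * ((ξ j : ℝ) : ℂ) * 𝓕 (v q.1) ξ) = 𝓕 (fun x => pd (v q.1) j x) :=
    funext fun ξ => ((hs q.1).fourier_pd j ξ).symm
  rw [e, ((hs q.1).pd j).inv]

lemma nL_pd_meas {v : ℝ → EC} (hv : Measurable (fun q : ℝ × E3 => v q.1 q.2)) (hs : ∀ t, Sch (v t)) (p : ℝ) (j : Fin 3) :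
    Measurable (fun t => nL p (fun x => pd (v t) j x)) :=
  measurable_nL_param (f := fun t x => pd (v t) j x) (pd_meas hv hs j) p

lemma nG_meas {v : ℝ → EC} (hv : Measurable (fun q : ℝ × E3 => v q.1 q.2)) (hs : ∀ t, Sch (v t)) (p : ℝ) :
    Measurable (fun t => nG p (v t)) :=
  Finset.measurable_sum _ fun j _ => nL_pd_meas hv hs p j

lemma Sol.op_meas {T : ℝ} {u : ℝ → EC} {m : EC} (h : Sol T u) (hm : RM m) :
    Measurable (fun q : ℝ × E3 => op m (u q.1) q.2) ∧ Measurable (fun q : ℝ × E3 => op m (cub (u q.1)) q.2) := by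
  have h0 : Measurable (fun q : ℝ × E3 => u q.1 q.2) := h.meas
  exact ⟨hm.op_meas h0, hm.op_meas (v := fun t => cub (u t)) (cub_meas h0)⟩

lemma nL_le_nG (p : ℝ) (f : EC) (j : Fin 3) : nL p (fun x => pd f j x) ≤ nG p f :=
  Finset.single_le_sum (f := fun j => nL p (fun x => pd f j x)) (fun _ _ => bot_le) (Finset.mem_univ j)

lemma Np_sum3 {α : Type*} [MeasurableSpace α] {μ : Measure α} {p : ℝ} (hp : 1 ≤ p) {f : Fin 3 → α → ENNReal}
    (hf : ∀ i, Measurable (f i)) : Np p μ (fun x => ∑ i, f i x) ≤ ∑ i, Np p μ (f i) := by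
  simp only [Fin.sum_univ_three]
  refine (Np_add_le hp ((hf 0).add (hf 1)).aemeasurable (hf 2).aemeasurable).trans ?_
  gcongr
  exact Np_add_le hp (hf 0).aemeasurable (hf 1).aemeasurable

/-- Strichartz estimate for the gradient of the filtered solution. -/
lemma grad_str {T : ℝ} {u : ℝ → EC} {a b : ℝ} {R : ENNReal} {m : EC} (h : Blk T u a b R) (hm : RM m)
    {t0 : ℝ} (h0 : t0 ∈ Icc a b) :
    Np 3 (volume.restrict (Icc a b)) (fun t => nG (18/5) (op m (u t))) ≤
      336 * (nG 2 (op m (u t0)) + Np (3/2) (volume.restrict (Icc a b)) (fun t => nG (18/13) (op m (cub (u t))))) := by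
  obtain ⟨C, hC, hC1, hb1⟩ := H2_bounds
  have hu := h.sol
  have hw := fun t => (hu.sch t).op hm.temp
  have hA := fun t => (hu.sch t).cub.op hm.temp
  obtain ⟨m1, m2⟩ := hu.op_meas hm
  have st : ∀ j, Np 3 (volume.restrict (Icc a b)) (fun t => nL (18/5) (fun x => pd (op m (u t)) j x)) ≤
      112 * (nL 2 (fun x => pd (op m (u t0)) j x) + Np (3/2) (volume.restrict (Icc a b)) (fun t => nG (18/13) (op m (cub (u t))))) := by
    intro j
    have hs : ∀ t, Sch (fun x => -I * pd (op m (cub (u t))) j x) := fun t => ((hA t).pd j).const_mul _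
    have m3 : Measurable (fun q : ℝ × E3 => -I * pd (op m (cub (u q.1))) j q.2) := (pd_meas m2 hA j).const_mul _
    have eF : ∀ p, 0 < p → ∀ t, nL p (fun x => -I * pd (op m (cub (u t))) j x) = nL p (fun x => pd (op m (cub (u t))) j x) :=
      fun p hp t => by rw [nL_const_mul hp, enorm_neg, ← ofReal_norm, Complex.norm_I]; simp
    have bF : ∀ t ∈ Icc a b, ∀ p, 2 ≤ p → p ≤ 6 → nL p (fun x => pd (op m (u t)) j x) ≤ C * R := fun t ht p h2 h6 =>
      ((hb1 _ (hw t)).2.2.2 j p h2 h6).trans (by gcongr; exact (hm.op_H2 (hu.sch t)).trans (h.lam t ht))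
    refine (strichartz h0 (Φ := fun t x => pd (op m (u t)) j x) (F := fun t x => -I * pd (op m (cub (u t))) j x)
      (pd_meas m1 hw j) m3 (fun t _ => (hw t).pd j) (fun t _ => (hs t).good) (M := C * R)
      (by have := h.fin; finiteness) (fun t ht => bF t ht 6 nmm nmm)
      (fun t ht => bF t ht (18/5) nmm nmm) (fun t ht => ?_) (fun t ht ξ => ?_)).trans ?_
    · rw [eF 2 nmm]
      exact ((hb1 _ (hA t)).2.2.2 j 2 le_rfl nmm).trans (by gcongr; exact (hm.op_H2 (hu.sch t).cub).trans (h.clam t ht))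
    · have hd := h.duh_op h0 ht (fun ξ => (2*π*I) * ((ξ j : ℝ) : ℂ) * m ξ) ξ
      beta_reduce at hd
      rw [(hw t).fourier_pd, (hw t0).fourier_pd, (hu.sch t).fourier_op hm.temp, (hu.sch t0).fourier_op hm.temp]
      simp only [fourier_const_mul, (hA _).fourier_pd, (hu.sch _).cub.fourier_op hm.temp]
      simp only [mul_assoc] at hd ⊢
      exact hd
    · gcongr
      refine Np_mono nmm fun t => ?_
      rw [eF _ nmm]
      exact nL_le_nG _ _ j
  calc _ ≤ ∑ j, Np 3 (volume.restrict (Icc a b)) (fun t => nL (18/5) (fun x => pd (op m (u t)) j x)) :=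
        Np_sum3 nmm fun j => nL_pd_meas m1 hw _ j
    _ ≤ ∑ j, 112 * (nL 2 (fun x => pd (op m (u t0)) j x) + Np (3/2) (volume.restrict (Icc a b)) (fun t => nG (18/13) (op m (cub (u t))))) :=
        Finset.sum_le_sum fun j _ => st j
    _ ≤ _ := by
        rw [← Finset.mul_sum, Finset.sum_add_distrib, show (336:ENNReal) = 112 * 3 by norm_num, mul_assoc]
        gcongr
        rw [mul_add]
        gcongr
        · rw [← nG]; exact le_mul_of_one_le_left' nmm
        · simp

lemma small_tau {L : ENNReal} (hL : L ≠ ⊤) : ∃ τ : ℝ, 0 < τ ∧ τ ≤ 1 ∧ L * eR τ ^ (1/3:ℝ) ≤ 1/2 := by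
  set l := L.toReal
  have hl : 0 ≤ l := ENNReal.toReal_nonneg
  set r := (1 / (2 * (l + 1)))
  have hr : 0 < r := by positivity
  have hr1 : r ≤ 1 := by rw [div_le_one psv]; linarith
  refine ⟨r^3, by positivity, pow_le_one₀ hr.le hr1, ?_⟩
  rw [ofReal_rpow_of_pos psv, ← Real.rpow_natCast r 3, ← Real.rpow_mul hr.le,
    ← ENNReal.ofReal_toReal hL, ← ENNReal.ofReal_mul hl]
  norm_num
  rw [show (2:ENNReal) = eR 2 by simp, ← ENNReal.ofReal_mul psv, ← ENNReal.ofReal_one]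
  apply ofReal_le_ofReal
  change l * (1 / (2 * (l + 1))) * 2 ≤ 1
  rw [mul_one_div, div_mul_eq_mul_div, div_le_one psv]; linarith

lemma absorb {X A : ENNReal} (hX : X ≠ ⊤) (h : X ≤ A + 1/2 * X) : X ≤ 2 * A := by
  have h2 : X = 1/2 * X + 1/2 * X := by rw [← add_mul]; simp [ENNReal.inv_two_add_inv_two]
  have h3 : 1/2 * X ≤ A := by
    have : 1/2 * X + 1/2 * X ≤ A + 1/2 * X := by rw [← h2]; exact h
    exact (ENNReal.add_le_add_iff_right (by finiteness)).1 this
  calc X = 1/2 * X + 1/2 * X := h2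
    _ ≤ A + A := add_le_add h3 h3
    _ = _ := (two_mul A).symm

lemma Np_time {a b r p q : ℝ} (hp : 0 < p) (hq : 0 < q) (h : 1 / r = 1 / p + 1 / q) {g : ℝ → ENNReal} (hg : Measurable g) :
    Np r (volume.restrict (Icc a b)) g ≤ eR (b - a) ^ (1/q) * Np p (volume.restrict (Icc a b)) g := by
  have := Np_mul_le (μ := volume.restrict (Icc a b)) (r := r) hq hp (by rw [h, add_comm]) (F := fun _ => 1) (G := g)
    aemeasurable_const hg.aemeasurable
  simpa [Np] using this

lemma Sch.nL2_sq {f : EC} (hf : Sch f) : nL 2 f ^ 2 = eR (∫ x, ‖f x‖^2) := by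
  rw [nL_two_sq, ofReal_integral_eq_lintegral_ofReal hf.sq_int (evt fun x => by positivity)]
  refine lintegral_congr fun x => ?_
  rw [← ofReal_norm, ENNReal.ofReal_pow (norm_nonneg _)]

lemma nL2_le_sqrt {f : EC} (hf : Sch f) {e : ℝ} (h : ∫ x, ‖f x‖^2 ≤ e) : nL 2 f ≤ eR (√e) := by
  have he : 0 ≤ e := (integral_nonneg fun x => by positivity).trans h
  have h2 : nL 2 f ^ 2 ≤ eR (√e) ^ 2 := by
    rw [hf.nL2_sq, ← ENNReal.ofReal_pow psv, Real.sq_sqrt he]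
    exact ofReal_le_ofReal h
  exact (ENNReal.pow_le_pow_left_iff two_ne_zero).1 h2

lemma nG2_le {w : EC} (hw : Sch w) {e : ℝ} (h : energyE w ≤ e) : nG 2 w ≤ 3 * eR (√(2*e)) := by
  rw [energyE_eq hw] at h
  have h4 : 0 ≤ ∫ x, (1/4) * ‖w x‖^4 := integral_nonneg fun x => by positivity
  have h5 : ∀ j, 0 ≤ ∫ x, ‖pd w j x‖^2 := fun j => integral_nonneg fun x => by positivity
  calc _ ≤ ∑ j : Fin 3, eR (√(2*e)) := Finset.sum_le_sum fun j _ => nL2_le_sqrt (hw.pd j) (by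
        have := Finset.single_le_sum (f := fun j => ∫ x, ‖pd w j x‖^2) (fun j _ => h5 j) (Finset.mem_univ j)
        beta_reduce at this
        linarith)
    _ = _ := by simp

lemma nG_cub_le {f : EC} (hf : Sch f) : nG (18/13) (cub f) ≤ 3 * nL (9/2) f ^ 2 * nG (18/5) f := by
  unfold nG
  rw [Finset.mul_sum]
  refine Finset.sum_le_sum fun j _ => ?_
  rw [mul_assoc]
  exact nL_pd_cub hf j nmm nmm nmm nmm

lemma Lam_cub_morrey : ∃ C : ENNReal, C ≠ ⊤ ∧ ∀ f, Sch f →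
    nL 2 (Lam (cub f)) ≤ C * ((nG (18/5) f + nL 2 f)^2 * H2 f) := by
  obtain ⟨C, hC, hC1, hb⟩ := H2_bounds
  obtain ⟨D, hD, hm⟩ := morrey
  refine ⟨4 * D^2 * C + 3 * D^2 + 18 * D * C, by finiteness, fun f hf => ?_⟩
  set Y := nG (18/5) f + nL 2 f with hY
  have hYt : Y ≠ ⊤ := by
    have h1 : nG (18/5) f ≠ ⊤ := ENNReal.sum_ne_top.2 fun j _ => (hf.pd j).nL_ne_top nmm
    exact ENNReal.add_ne_top.2 ⟨h1, hf.nL_ne_top nmm⟩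
  have hs := hm f hf
  have s2 : ∀ x, ‖f x‖ₑ^2 ≤ (D * Y)^2 := fun x => pow_le_pow_left₀ bot_le (hs x) 2
  obtain ⟨-, b2, -, b4⟩ := hb f hf
  have t1 : Np 2 volume (fun x => ‖f x‖ₑ^3) ≤ (D * Y)^2 * (C * H2 f) := by
    simp only [pow_succ _ 2]
    refine (Np_bdd_mul nmm (by finiteness) s2).trans ?_
    gcongr
    exact b2
  have t2 : Np 2 volume (fun x => ‖f x‖ₑ^2 * ‖Lam f x‖ₑ) ≤ (D * Y)^2 * H2 f :=
    Np_bdd_mul nmm (by finiteness) s2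
  have t3 : ∀ j, Np 2 volume (fun x => ‖f x‖ₑ * ‖pd f j x‖ₑ^2) ≤ (D * Y) * (Y * (C * H2 f)) := fun j => by
    refine (Np_bdd_mul nmm (by finiteness) hs).trans ?_
    gcongr
    simp only [sq]
    refine (Np_mul_le (p := 18/5) (q := 9/2) nmm nmm nmm (hf.pd j).measurable.enorm.aemeasurable
      (hf.pd j).measurable.enorm.aemeasurable).trans (mul_le_mul' ?_ ?_)
    · exact (nL_le_nG _ _ j).trans le_self_add
    · exact b4 j (9/2) nmm nmm
  refine (nL_Lam_cub_gen hf nmm).trans ?_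
  calc _ ≤ 4 * ((D * Y)^2 * (C * H2 f)) + 3 * ((D * Y)^2 * H2 f) + 6 * ∑ j : Fin 3, (D * Y) * (Y * (C * H2 f)) := by
        gcongr with j
        exact t3 j
    _ = _ := by
        simp only [Finset.sum_const, Finset.card_univ, Fintype.card_fin, nsmul_eq_mul]; push_cast; ring

/-- growth of the `H²` norm -/
lemma H2_inc {T : ℝ} {u : ℝ → EC} {a b : ℝ} {R : ENNReal} (h : Blk T u a b R)
    {t1 t2 : ℝ} (h1 : t1 ∈ Icc a b) (h2 : t2 ∈ Icc a b) :
    H2 (u t2) ^ 2 ≤ H2 (u t1) ^ 2 + ∫⁻ s in Icc a b, 2 * (nL 2 (Lam (cub (u s))) * H2 (u s)) := by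
  have hu := h.sol
  have main : ∀ {t1 t2 : ℝ}, t1 ∈ Icc a b → t2 ∈ Icc a b → t1 ≤ t2 →
      eR |(∫ x, ‖Lam (u t2) x‖^2) - ∫ x, ‖Lam (u t1) x‖^2| ≤
        ∫⁻ s in Icc a b, 2 * (nL 2 (Lam (cub (u s))) * H2 (u s)) := by
    intro t1 t2 h1 h2 h12
    have q := (h.quad h1 h2 h12 (M := fun ξ => ((1 + ‖ξ‖^2 : ℝ) : ℂ)) (by fun_prop) (c := 1)
      (fun ξ => by rw [Complex.norm_real, Real.norm_of_nonneg psv, one_mul])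
      (f := fun t => Lam (u t)) (g := fun t => Lam (cub (u t))) (fun t => (hu.sch t).Lam) (fun t => (hu.sch t).cub.Lam)
      (fun t ξ => (hu.sch t).fourier_Lam ξ) (fun t ξ => (hu.sch t).cub.fourier_Lam ξ)).2
    rw [q, ← Real.norm_eq_abs, ofReal_norm, intervalIntegral.integral_of_le h12]
    refine (enorm_integral_le_lintegral_enorm _).trans ?_
    refine (lintegral_mono' (Measure.restrict_mono (Set.Ioc_subset_Icc_self.trans (Set.Icc_subset_Icc h1.1 h2.2)) le_rfl) fun s => ?_)
    rw [enorm_mul, show ‖(2:ℝ)‖ₑ = 2 by rw [← ofReal_norm]; simp]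
    gcongr
    refine le_trans ?_ (pairing_enorm (hu.sch s).cub.Lam.measurable (hu.sch s).Lam.measurable (p := 2) (q := 2) nmm nmm nmm)
    rw [← ofReal_norm, ← ofReal_norm]
    refine ofReal_le_ofReal ((Complex.abs_re_le_norm _).trans ?_)
    simp
  have key : eR |(∫ x, ‖Lam (u t2) x‖^2) - ∫ x, ‖Lam (u t1) x‖^2| ≤
        ∫⁻ s in Icc a b, 2 * (nL 2 (Lam (cub (u s))) * H2 (u s)) := by
    rcases le_total t1 t2 with h12 | h12
    · exact main h1 h2 h12
    · rw [abs_sub_comm]; exact main h2 h1 h12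
  unfold H2
  rw [(hu.sch t2).Lam.nL2_sq, (hu.sch t1).Lam.nL2_sq]
  refine le_trans ?_ (add_le_add le_rfl key)
  rw [← ENNReal.ofReal_add (integral_nonneg fun x => by positivity) (abs_nonneg _)]
  apply ofReal_le_ofReal
  linarith [le_abs_self ((∫ x, ‖Lam (u t2) x‖^2) - ∫ x, ‖Lam (u t1) x‖^2)]

lemma RM_one : RM (fun _ => 1) := ⟨.const 1, fun _ => by simp, fun _ => by simp⟩

lemma op_one {f : EC} (hf : Sch f) : op (fun _ => 1) f = f := by
  unfold op; simp only [one_mul]; exact hf.inv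

lemma Np_fin {a b p : ℝ} (hp : 0 < p) {g : ℝ → ENNReal} {M : ENNReal} (hM : M ≠ ⊤) (h : ∀ t ∈ Icc a b, g t ≤ M) :
    Np p (volume.restrict (Icc a b)) g ≠ ⊤ := by
  refine ne_top_of_le_ne_top ?_ (Np_mono_ae hp (G := fun _ => M) ((ae_restrict_iff' measurableSet_Icc).2 (evt h)))
  simp only [Np, lintegral_const, MeasurableSet.univ, Measure.restrict_apply, Set.univ_inter, Real.volume_Icc]
  have : M ^ p * eR (b - a) ≠ ⊤ := by finiteness
  finiteness

/-- Short time control of the `H²` norm with time depending only on mass and energy. -/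
lemma lemA (K : ℝ) : ∃ τ : ℝ, 0 < τ ∧ ∀ (T : ℝ) (u : ℝ → EC) (a b : ℝ) (R : ENNReal), Blk T u a b R → b - a ≤ τ →
    ∀ t1 ∈ Icc a b, ∫ x, ‖u t1 x‖^2 ≤ K → energyE (u t1) ≤ K →
    ∀ t ∈ Icc a b, H2 (u t) ≤ 2 * H2 (u t1) := by
  obtain ⟨Cs, hCs, sob⟩ := sobolev_sch 2 6 nmm nmm nmm
  obtain ⟨CM, hCM, hmor⟩ := Lam_cub_morrey
  set A : ENNReal := eR (√K) + 3 * eR (√(2*K)) + Cs * (3 * eR (√(2*K))) with hA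
  have hAt : A ≠ ⊤ := by finiteness
  obtain ⟨τ, hτ, hτ1, hL⟩ := small_tau (L := 1008 * A^2 + 2 * CM * (673 * A)^2) (by finiteness)
  refine ⟨τ, hτ, fun T u a b R h hab t1 h1 hK hE => ?_⟩
  have hu := h.sol
  set μ := volume.restrict (Icc a b) with hμ
  set σ := eR (b - a) with hσ
  have hσ1 : σ ≤ 1 := by rw [hσ, ENNReal.ofReal_le_one]; linarith
  have hσL : (1008 * A^2 + 2 * CM * (673 * A)^2) * σ ^ (1/3:ℝ) ≤ 1/2 := by
    refine le_trans ?_ hL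
    gcongr
    exact ofReal_le_ofReal hab
  have e1 := fun t ht => (le_total t1 t).elim (fun h' => mass_cons h h1 ht h') (fun h' => (mass_cons h ht h1 h').symm)
  have e2 := fun t ht => (le_total t1 t).elim (fun h' => energy_cons h h1 ht h') (fun h' => (energy_cons h ht h1 h').symm)
  have a2 : ∀ t ∈ Icc a b, nL 2 (u t) ≤ A := fun t ht =>
    (nL2_le_sqrt (hu.sch t) ((e1 t ht).le.trans hK)).trans (by rw [hA, add_assoc]; exact le_self_add)
  have g2 : ∀ t ∈ Icc a b, nG 2 (u t) ≤ 3 * eR (√(2*K)) := fun t ht =>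
    nG2_le (hu.sch t) ((e2 t ht).le.trans hE)
  have g2A : ∀ t ∈ Icc a b, nG 2 (u t) ≤ A := fun t ht =>
    (g2 t ht).trans (by rw [hA]; exact le_add_self.trans le_self_add)
  have a6 : ∀ t ∈ Icc a b, nL 6 (u t) ≤ A := fun t ht => (sob _ (hu.sch t)).trans (by
    rw [hA]; refine le_trans ?_ le_add_self; gcongr; exact g2 t ht)
  have a9 : ∀ t ∈ Icc a b, nL (9/2) (u t) ≤ A := fun t ht =>
    nL_interp_le nmm nmm nmm (hu.sch t).measurable (a2 t ht) (a6 t ht)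
  have mu : Measurable (fun q : ℝ × E3 => u q.1 q.2) := hu.meas
  have my : Measurable (fun t => nG (18/5) (u t)) := nG_meas mu hu.sch _
  set X := Np 3 μ (fun t => nG (18/5) (u t)) with hX
  have hXt : X ≠ ⊤ := Np_fin (M := 3 * R) nmm (by have := h.fin; finiteness) fun t ht => by
    calc _ ≤ ∑ j : Fin 3, R := Finset.sum_le_sum fun j _ => h.pd t ht j _ nmm nmm
      _ = _ := by simp
  have X1 : X ≤ 2 * (336 * A) := by
    refine absorb hXt ?_
    have st := grad_str h RM_one h1
    simp only [op_one (hu.sch _), op_one (hu.sch _).cub] at st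
    refine st.trans ?_
    rw [mul_add]
    refine add_le_add (by gcongr; exact g2A t1 h1) ?_
    calc _ ≤ 336 * Np (3/2) μ (fun t => 3 * A^2 * nG (18/5) (u t)) := by
          gcongr
          refine Np_mono_ae nmm ((ae_restrict_iff' measurableSet_Icc).2 (evt fun t ht => ?_))
          refine (nG_cub_le (hu.sch t)).trans ?_
          gcongr
          exact a9 t ht
      _ ≤ 336 * (3 * A^2 * (σ ^ (1/3:ℝ) * X)) := by
          rw [Np_const_mul nmm (by finiteness)]
          gcongr
          exact Np_time nmm nmm nmm my
      _ = (1008 * A^2 * σ ^ (1/3:ℝ)) * X := by ring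
      _ ≤ _ := by
          gcongr
          refine le_trans ?_ hσL
          gcongr
          exact le_self_add
  have I2 : ∫⁻ s in Icc a b, (nG (18/5) (u s) + A)^2 ≤ σ ^ (1/3:ℝ) * (673 * A)^2 := by
    have n1 : Np 2 μ (fun s => nG (18/5) (u s) + A) ≤ σ ^ (1/6:ℝ) * (673 * A) := by
      refine (Np_time (p := 3) (q := 6) nmm nmm nmm (my.add_const A)).trans ?_
      gcongr
      refine (Np_add_le nmm my.aemeasurable aemeasurable_const).trans ?_
      have : Np 3 μ (fun _ => A) ≤ A := by
        have := Np_const_mul (μ := μ) (show (0:ℝ) < 3 by norm_num) hAt (fun _ => 1)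
        simp only [mul_one] at this
        rw [this]
        refine mul_le_of_le_one_right' ?_
        simp only [Np, ENNReal.one_rpow, lintegral_one, hμ, Measure.restrict_apply_univ, Real.volume_Icc]
        exact ENNReal.rpow_le_one hσ1 nmm
      calc _ ≤ 2 * (336 * A) + A := add_le_add X1 this
        _ = _ := by ring
    have n2 := Np_rpow (μ := μ) (show (0:ℝ) < 2 by norm_num) (fun s => nG (18/5) (u s) + A)
    simp only [ENNReal.rpow_two] at n2
    rw [← n2]
    refine (pow_le_pow_left₀ bot_le n1 2).trans (le_of_eq ?_)
    rw [mul_pow, ← ENNReal.rpow_natCast, ← ENNReal.rpow_mul]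
    norm_num
  set B2 := ⨆ t ∈ Icc a b, H2 (u t) ^ 2 with hB2
  have hB2t : B2 ≠ ⊤ := ne_top_of_le_ne_top (b := R^2) (by have := h.fin; finiteness)
    (iSup₂_le fun t ht => pow_le_pow_left₀ bot_le (h.lam t ht) 2)
  have hB2' : ∀ t ∈ Icc a b, H2 (u t) ^ 2 ≤ B2 := fun t ht => le_iSup₂_of_le t ht le_rfl
  have key : B2 ≤ 2 * H2 (u t1) ^ 2 := by
    refine absorb hB2t (iSup₂_le fun t ht => (H2_inc h h1 ht).trans ?_)
    gcongr
    calc _ ≤ ∫⁻ s in Icc a b, (2 * CM * B2) * (nG (18/5) (u s) + A)^2 := by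
          refine setLIntegral_mono' measurableSet_Icc fun s hs => ?_
          calc _ ≤ 2 * (CM * ((nG (18/5) (u s) + A)^2 * H2 (u s)) * H2 (u s)) := by
                gcongr
                refine (hmor _ (hu.sch s)).trans ?_
                gcongr
                exact a2 s hs
            _ = (2 * CM * H2 (u s)^2) * (nG (18/5) (u s) + A)^2 := by ring
            _ ≤ _ := by gcongr; exact hB2' s hs
      _ = (2 * CM * B2) * ∫⁻ s in Icc a b, (nG (18/5) (u s) + A)^2 :=
          lintegral_const_mul _ ((my.add_const A).pow_const 2)
      _ ≤ (2 * CM * B2) * (σ ^ (1/3:ℝ) * (673 * A)^2) := by gcongr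
      _ = (2 * CM * (673 * A)^2) * σ ^ (1/3:ℝ) * B2 := by ring
      _ ≤ _ := by
          gcongr
          refine le_trans ?_ hσL
          gcongr
          exact le_add_self
  intro t ht
  refine (ENNReal.pow_le_pow_left_iff two_ne_zero).1 ((hB2' t ht).trans (key.trans ?_))
  rw [mul_pow]
  gcongr
  norm_num

/-- boundedness of `h` on a set -/
def Bd (h : ℝ → ENNReal) (A : Set ℝ) : Prop := ∃ M : ENNReal, M ≠ ⊤ ∧ ∀ t ∈ A, h t ≤ M

lemma Bd.mono {h : ℝ → ENNReal} {A B : Set ℝ} (hB : Bd h B) (hAB : A ⊆ B) : Bd h A :=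
  let ⟨M, hM, hb⟩ := hB; ⟨M, hM, fun t ht => hb t (hAB ht)⟩

lemma Bd.union {h : ℝ → ENNReal} {A B : Set ℝ} (hA : Bd h A) (hB : Bd h B) : Bd h (A ∪ B) := by
  obtain ⟨M, hM, hb⟩ := hA
  obtain ⟨M', hM', hb'⟩ := hB
  exact ⟨M + M', by finiteness, fun t ht => ht.elim (fun q => (hb t q).trans le_self_add) (fun q => (hb' t q).trans le_add_self)⟩

lemma baire_abs {S : Set ℝ} (hS : IsCompact S) (hSo : S.OrdConnected) (h : ℝ → ENNReal) (hfin : ∀ t ∈ S, h t ≠ ⊤)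
    (hcl : ∀ n : ℕ, IsClosed {t | h t ≤ n}) (τ : ℝ → ℝ) (hτ : ∀ t, 0 < τ t)
    (h1 : ∀ x ∈ S, ∀ y ∈ S, Bd h (uIcc x y) → τ x = τ y)
    (h2 : ∀ x ∈ S, ∀ y ∈ S, Bd h (uIcc x y) → |x - y| ≤ τ x → h y ≤ 2 * h x)
    (h3 : ∀ n : ℕ, ∃ τ0 > 0, ∀ x ∈ S, ∀ y ∈ S, Bd h (uIcc x y) → |x - y| ≤ τ0 → h x ≤ n → h y ≤ 2 * h x) :
    Bd h S := by
  set G : Set ℝ := {t | ∃ ε > 0, Bd h (S ∩ Metric.ball t ε)} with hG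
  have hGo : IsOpen G := by
    rw [Metric.isOpen_iff]
    rintro t ⟨ε, hε, hb⟩
    refine ⟨ε/2, by positivity, fun s hs => ⟨ε/2, by positivity, hb.mono ?_⟩⟩
    refine Set.inter_subset_inter_right _ (Metric.ball_subset_ball' ?_)
    have := Metric.mem_ball.1 hs
    linarith
  have cpt : ∀ A : Set ℝ, IsCompact A → A ⊆ S → A ⊆ G → Bd h A := fun A hA hAS hAG => by
    refine hA.induction_on (p := Bd h) ⟨0, by simp, by simp⟩ (fun _ _ h' q => q.mono h') (fun _ _ => Bd.union) fun t ht => ?_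
    obtain ⟨ε, hε, hb⟩ := hAG ht
    exact ⟨A ∩ Metric.ball t ε, inter_mem_nhdsWithin _ (Metric.ball_mem_nhds t hε), hb.mono (Set.inter_subset_inter_left _ hAS)⟩
  by_contra hbad
  set B := S \ G with hB
  have hBc : IsCompact B := hS.diff hGo
  have hBne : B.Nonempty := by
    by_contra hne
    rw [Set.not_nonempty_iff_eq_empty, Set.sdiff_eq_empty] at hne
    exact hbad (cpt S hS le_rfl hne)
  -- Baire category
  obtain ⟨n, b0, hb0, ε, hε, hn⟩ : ∃ n : ℕ, ∃ b0 ∈ B, ∃ ε > 0, ∀ t ∈ B, |t - b0| < ε → h t ≤ n := by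
    have : CompactSpace B := isCompact_iff_compactSpace.1 hBc
    have : Nonempty B := hBne.to_subtype
    obtain ⟨n, b, hb⟩ := nonempty_interior_of_iUnion_of_closed (X := B) (f := fun n : ℕ => {t | h t ≤ n})
      (fun n => (hcl n).preimage continuous_subtype_val) (by
        rw [Set.eq_univ_iff_forall]
        intro t
        obtain ⟨n, hn⟩ := ENNReal.exists_nat_gt (hfin t t.2.1)
        exact Set.mem_iUnion.2 ⟨n, hn.le⟩)
    rw [mem_interior_iff_mem_nhds, Metric.mem_nhds_iff] at hb
    obtain ⟨ε, hε, hb⟩ := hb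
    exact ⟨n, b, b.2, ε, hε, fun t ht hd => hb (a := ⟨t, ht⟩) (by simpa [Metric.mem_ball, Subtype.dist_eq, Real.dist_eq] using hd)⟩
  obtain ⟨τ0, hτ0, h4⟩ := h3 n
  refine hb0.2 ⟨min ε τ0, by positivity, 2 * n, by finiteness, ?_⟩
  rintro t ⟨htS, htb⟩
  rw [Metric.mem_ball, Real.dist_eq, lt_min_iff] at htb
  by_cases htB : t ∈ B
  · exact (hn t htB htb.1).trans (le_mul_of_one_le_left' nmm)
  -- nearest bad point
  obtain ⟨c, ⟨hcB, hcI⟩, hcm⟩ := (hBc.inter_right (isCompact_uIcc (a := b0) (b := t)).isClosed).exists_isMinOn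
    ⟨b0, hb0, Set.left_mem_uIcc⟩ (f := fun c => |t - c|) (by fun_prop)
  have hct : c ≠ t := fun e => htB (e ▸ hcB)
  set D := uIcc c t \ {c} with hD
  have hcS : c ∈ S := hcB.1
  have hDS : D ⊆ S := Set.sdiff_subset.trans (hSo.uIcc_subset hcS htS)
  have hDlt : ∀ r ∈ D, |t - r| < |t - c| := by
    rintro r ⟨hr, hrc⟩
    have hrc : r ≠ c := hrc
    rcases Set.mem_uIcc.1 hr with ⟨q1, q2⟩ | ⟨q1, q2⟩
    · rw [abs_of_nonneg (by linarith), abs_of_nonneg (by linarith)]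
      have := lt_of_le_of_ne q1 hrc.symm; linarith
    · rw [abs_of_nonpos (by linarith), abs_of_nonpos (by linarith)]
      have := lt_of_le_of_ne q2 hrc; linarith
  have hDG : D ⊆ G := fun r hr => by
    by_contra hrG
    have : r ∈ B ∩ uIcc b0 t := ⟨⟨hDS hr, hrG⟩, (Set.uIcc_subset_uIcc hcI Set.right_mem_uIcc) hr.1⟩
    exact absurd (hcm this) (not_le.2 (hDlt r hr))
  have hDo : D.OrdConnected := by
    rcases le_total c t with q | q
    · rw [hD, Set.uIcc_of_le q, Set.Icc_sdiff_left]; exact Set.ordConnected_Ioc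
    · rw [hD, Set.uIcc_of_ge q, Set.Icc_sdiff_right]; exact Set.ordConnected_Ico
  have hDb : ∀ r ∈ D, ∀ r' ∈ D, Bd h (uIcc r r') := fun r hr r' hr' =>
    cpt _ isCompact_uIcc ((hDo.uIcc_subset hr hr').trans hDS) ((hDo.uIcc_subset hr hr').trans hDG)
  have htD : t ∈ D := ⟨Set.right_mem_uIcc, hct.symm⟩
  -- a point near `c`
  obtain ⟨t1, ht1, ht1d⟩ : ∃ t1 ∈ D, |c - t1| ≤ τ t := by
    have hp : 0 < |t - c| := abs_pos.2 (sub_ne_zero.2 hct.symm)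
    set l := min 1 (τ t / |t - c|) with hl
    have hl0 : 0 < l := lt_min one_pos (div_pos (hτ t) hp)
    have hl1 : l ≤ 1 := min_le_left _ _
    refine ⟨c + l * (t - c), ⟨?_, fun e => ?_⟩, ?_⟩
    · rw [Set.mem_uIcc]
      rcases le_total c t with q | q
      · left; constructor <;> nlinarith
      · right; constructor <;> nlinarith
    · have e : c + l * (t - c) = c := e
      have : l * (t - c) = 0 := by linarith
      rcases mul_eq_zero.1 this with q | q
      · exact hl0.ne' q
      · exact hct (by linarith)
    · rw [show c - (c + l * (t - c)) = -(l * (t - c)) by ring, abs_neg, abs_mul, abs_of_pos hl0]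
      calc _ ≤ τ t / |t - c| * |t - c| := by gcongr; exact min_le_right _ _
        _ = _ := div_mul_cancel₀ _ hp.ne'
  have hτ1 : τ t1 = τ t := h1 t1 (hDS ht1) t htS (hDb t1 ht1 t htD)
  have b1 : Bd h (uIcc c t1) := by
    refine ⟨h c + 2 * h t1, by have := hfin c hcS; have := hfin t1 (hDS ht1); finiteness, fun s hs => ?_⟩
    by_cases hsc : s = c
    · rw [hsc]; exact le_self_add
    · have hsD : s ∈ D := ⟨Set.uIcc_subset_uIcc Set.left_mem_uIcc ht1.1 hs, hsc⟩
      refine (h2 t1 (hDS ht1) s (hDS hsD) (hDb t1 ht1 s hsD) ?_).trans le_add_self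
      rw [hτ1]
      refine le_trans ?_ ht1d
      rw [abs_sub_comm c]
      exact Set.abs_sub_left_of_mem_uIcc (Set.uIcc_comm c t1 ▸ hs) |>.trans_eq' (abs_sub_comm _ _) |>.trans (abs_sub_comm _ _).le
  have b2 : Bd h (uIcc c t) := (b1.union (hDb t1 ht1 t htD)).mono Set.uIcc_subset_uIcc_union_uIcc
  have hd : |c - t| ≤ |t - b0| := by
    have := hcm (show b0 ∈ B ∩ uIcc b0 t from ⟨hb0, Set.left_mem_uIcc⟩)
    rw [abs_sub_comm]; exact this
  have hdb : |c - b0| ≤ |t - b0| := Set.abs_sub_left_of_mem_uIcc hcI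
  have hcn := hn c hcB (hdb.trans_lt htb.1)
  refine (h4 c hcS t htS b2 (hd.trans htb.2.le) hcn).trans ?_
  gcongr

lemma mass_energy_bound {n : ENNReal} (hn : n ≠ ⊤) : ∃ K : ℝ, ∀ f, Sch f → H2 f ≤ n → ∫ x, ‖f x‖^2 ≤ K ∧ energyE f ≤ K := by
  obtain ⟨C, hC, hC1, hb⟩ := H2_bounds
  set c := (C * n).toReal with hc
  have hc0 : 0 ≤ c := ENNReal.toReal_nonneg
  have hcn : C * n = eR c := (ENNReal.ofReal_toReal (by finiteness)).symm
  refine ⟨c^2 + (1/2) * (3 * c^2) + 1/4 * (c^2 * c^2), fun f hf hfn => ?_⟩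
  obtain ⟨b1, b2, -, b4⟩ := hb f hf
  have hH : C * H2 f ≤ eR c := by rw [← hcn]; gcongr
  have sq : ∀ g, Sch g → nL 2 g ≤ C * H2 f → ∫ x, ‖g x‖^2 ≤ c^2 := fun g hg q => by
    have := pow_le_pow_left₀ bot_le (q.trans hH) 2
    rw [hg.nL2_sq, ← ENNReal.ofReal_pow hc0, ENNReal.ofReal_le_ofReal_iff psv] at this
    exact this
  have s1 := sq f hf b2
  have s2 := fun j => sq _ (hf.pd j) (b4 j 2 le_rfl nmm)
  have hsup : ∀ x, ‖f x‖ ≤ c := fun x => by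
    have := (b1 x).trans hH
    rwa [← ofReal_norm, ENNReal.ofReal_le_ofReal_iff hc0] at this
  have s4 : ∫ x, (1/4) * ‖f x‖^4 ≤ 1/4 * (c^2 * c^2) := by
    rw [integral_const_mul]
    gcongr
    calc _ ≤ ∫ x, c^2 * ‖f x‖^2 := by
          refine integral_mono hf.quart_int (hf.sq_int.const_mul _) fun x => ?_
          have := pow_le_pow_left₀ (norm_nonneg _) (hsup x) 2
          beta_reduce
          nlinarith [sq_nonneg ‖f x‖]
      _ ≤ _ := by rw [integral_const_mul]; gcongr
  rw [energyE_eq hf]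
  have s5 : ∑ j : Fin 3, (∫ x, ‖pd f j x‖^2) ≤ 3 * c^2 := by
    calc _ ≤ ∑ j : Fin 3, c^2 := Finset.sum_le_sum fun j _ => s2 j
      _ = _ := by simp
  constructor <;> nlinarith [sq_nonneg c, mul_nonneg (sq_nonneg c) (sq_nonneg c)]

lemma Sol.closed {T : ℝ} {u : ℝ → EC} (hu : Sol T u) (n : ENNReal) : IsClosed {t | H2 (u t) ≤ n} := by
  refine IsSeqClosed.isClosed fun ts t hts htt => ?_
  have hc : Continuous (fun q : ℝ × E3 => Lam (u q.1) q.2) := hu.cont_Lam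
  have hsq : ∀ t, H2 (u t) ^ 2 = ∫⁻ x, ‖Lam (u t) x‖ₑ^2 := fun t => nL_two_sq _
  refine (ENNReal.pow_le_pow_left_iff two_ne_zero).1 ?_
  beta_reduce
  rw [hsq]
  have hl : ∀ x, Tendsto (fun k => ‖Lam (u (ts k)) x‖ₑ^2) atTop (nhds (‖Lam (u t) x‖ₑ^2)) := fun x => by
    have h1 : Continuous (fun s : ℝ => ‖Lam (u s) x‖ₑ^2) := by
      have h0 : Continuous (fun s : ℝ => Lam (u s) x) := hc.comp (Continuous.prodMk_left x)
      exact (ENNReal.continuous_pow 2).comp h0.enorm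
    exact (h1.tendsto t).comp htt
  calc ∫⁻ x, ‖Lam (u t) x‖ₑ^2 = ∫⁻ x, liminf (fun k => ‖Lam (u (ts k)) x‖ₑ^2) atTop :=
        lintegral_congr fun x => (hl x).liminf_eq.symm
    _ ≤ liminf (fun k => ∫⁻ x, ‖Lam (u (ts k)) x‖ₑ^2) atTop :=
        lintegral_liminf_le fun k => (hu.sch _).Lam.measurable.enorm.pow_const 2
    _ ≤ n^2 := by
        refine liminf_le_of_le (by isBoundedDefault) fun b hb => ?_
        obtain ⟨k, hk⟩ := hb.exists
        refine hk.trans ?_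
        rw [← hsq]
        exact pow_le_pow_left₀ bot_le (hts k) 2

/-- The whole time interval is a good block. -/
lemma Sol.blk {T : ℝ} {u : ℝ → EC} (hu : Sol T u) (hT : 0 ≤ T) : ∃ R, Blk T u 0 T R := by
  set K : ℝ → ℝ := fun t => max (∫ x, ‖u t x‖^2) (energyE (u t)) with hK
  have mk : ∀ x ∈ Icc 0 T, ∀ y ∈ Icc 0 T, Bd (fun t => H2 (u t)) (uIcc x y) →
      ∃ R, Blk T u (min x y) (max x y) R := by
    rintro x hx y hy ⟨M, hM, hb⟩
    exact Blk.of_H2 hu (le_min hx.1 hy.1) min_le_max (max_le hx.2 hy.2) hM hb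
  have e : ∀ x y : ℝ, max x y - min x y = |x - y| := fun x y => by rw [max_sub_min_eq_abs, abs_sub_comm]
  have hb : Bd (fun t => H2 (u t)) (Icc 0 T) := by
    refine baire_abs isCompact_Icc Set.ordConnected_Icc _ (fun t _ => (hu.sch t).Lam.nL_ne_top nmm) (fun n => hu.closed n)
      (fun t => (lemA (K t)).choose) (fun t => (lemA (K t)).choose_spec.1) ?_ ?_ ?_
    · intro x hx y hy hb
      obtain ⟨R, hR⟩ := mk x hx y hy hb
      have hxm : x ∈ Icc (min x y) (max x y) := ⟨min_le_left _ _, le_max_left _ _⟩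
      have hym : y ∈ Icc (min x y) (max x y) := ⟨min_le_right _ _, le_max_right _ _⟩
      have : K x = K y := by
        rcases le_total x y with q | q
        · simp only [hK, mass_cons hR hxm hym q, energy_cons hR hxm hym q]
        · simp only [hK, mass_cons hR hym hxm q, energy_cons hR hym hxm q]
      beta_reduce
      rw [this]
    · intro x hx y hy hb hxy
      obtain ⟨R, hR⟩ := mk x hx y hy hb
      exact (lemA (K x)).choose_spec.2 T u _ _ R hR (by rw [e]; exact hxy) x ⟨min_le_left _ _, le_max_left _ _⟩
        (le_max_left _ _) (le_max_right _ _) y ⟨min_le_right _ _, le_max_right _ _⟩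
    · intro n
      obtain ⟨K0, hK0⟩ := mass_energy_bound (n := n) (by finiteness)
      obtain ⟨τ, hτ, hA⟩ := lemA K0
      refine ⟨τ, hτ, fun x hx y hy hb hxy hn => ?_⟩
      obtain ⟨R, hR⟩ := mk x hx y hy hb
      exact hA T u _ _ R hR (by rw [e]; exact hxy) x ⟨min_le_left _ _, le_max_left _ _⟩
        (hK0 _ (hu.sch x) hn).1 (hK0 _ (hu.sch x) hn).2 y ⟨min_le_right _ _, le_max_right _ _⟩
  obtain ⟨M, hM, hb⟩ := hb
  exact Blk.of_H2 hu le_rfl hT le_rfl hM hb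

lemma sN_RM {s : ℝ} {η : ℝ → ℝ} (hη : IsCutoff s η) {N : ℝ} (hN : 0 < N) : RM (sN η N) := by
  refine ⟨cutoff_temperate hη N hN, fun ξ => by simp [sN], fun ξ => ?_⟩
  have := hη.2.2.1 (‖ξ‖ / N) psv
  simp only [sN, Complex.norm_real, Real.norm_eq_abs, abs_of_pos this.1]
  exact this.2

/-- Mixed norm interpolation between `L⁴_{t,x}` and `L^∞_t L⁶_x`. -/
lemma mixed_interp {w : ℝ → EC} (hw : ∀ t, Sch (w t)) {a b q r θ : ℝ} {A S : ENNReal} (hA : A ≠ ⊤)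
    (h6 : ∀ t ∈ Icc a b, nL 6 (w t) ≤ A)
    (h4 : Np 4 (volume.restrict (Icc a b)) (fun t => nL 4 (w t)) ≤ S)
    (hr : 0 < r) (hθ : 0 < θ) (hθ1 : θ < 1) (hq : 1/q = θ/4 + (1-θ)/6) (hrθ : r * θ = 4) :
    Np r (volume.restrict (Icc a b)) (fun t => nL q (w t)) ≤ A ^ (1-θ) * S ^ θ := by
  have h1 : 0 < 1 - θ := by linarith
  calc _ ≤ Np r (volume.restrict (Icc a b)) (fun t => A ^ (1-θ) * nL 4 (w t) ^ θ) := by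
        refine Np_mono_ae hr ((ae_restrict_iff' measurableSet_Icc).2 (evt fun t ht => ?_))
        refine (Np_interp (p := 4) (q := 6) nmm nmm hθ hθ1 hq (hw t).measurable.enorm.aemeasurable).trans ?_
        rw [mul_comm]
        gcongr
        · exact h6 t ht
        · exact le_rfl
    _ = A ^ (1-θ) * Np 4 (volume.restrict (Icc a b)) (fun t => nL 4 (w t)) ^ θ := by
        rw [Np_const_mul hr (by finiteness), Np_pow_comp hr hθ, hrθ]
    _ ≤ _ := by gcongr

/-- Pointwise in time bound of the energy increment integrand. -/
lemma incr_le {m f : EC} (hm : RM m) (hf : Sch f) {C : ENNReal}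
    (sob : ∀ f, Sch f → nL (18/7) f ≤ C * nG (18/13) f) :
    (∑ j, nL (18/13) (fun x => pd (Dm m f) j x) * nL (18/5) (fun x => pd (op m f) j x))
      + nL (18/7) (Dm m f) * nL (18/11) (cub (op m f)) ≤
    nG (18/13) (Dm m f) * (nG (18/5) (op m f) + C * nL (54/11) (op m f) ^ (3:ℝ)) := by
  rw [mul_add]
  refine add_le_add ?_ ?_
  · rw [nG, Finset.sum_mul]
    exact Finset.sum_le_sum fun j _ => by gcongr; exact nL_le_nG _ _ _
  · have : nL (18/11) (cub (op m f)) = nL (54/11) (op m f) ^ (3:ℝ) := by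
      have := Np_pow_comp (μ := volume) (p := 18/11) (θ := 3) nmm nmm (fun x => ‖op m f x‖ₑ)
      unfold nL
      simp only [enorm_cub]
      norm_num at this ⊢
      exact this
    rw [this]
    calc _ ≤ C * nG (18/13) (Dm m f) * nL (54/11) (op m f) ^ (3:ℝ) := by
          gcongr; exact sob _ (hm.Dm hf)
      _ = _ := by ring

lemma nG_op_cub_le {m f : EC} (hm : RM m) (hf : Sch f) :
    nG (18/13) (op m (cub f)) ≤ nG (18/13) (cub (op m f)) + nG (18/13) (Dm m f) := by
  have hc := (hf.op hm.temp).cub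
  have hd := hm.Dm hf
  have e : op m (cub f) = fun x => cub (op m f) x + Dm m f x := by funext x; simp [Dm]
  unfold nG
  rw [← Finset.sum_add_distrib]
  refine Finset.sum_le_sum fun j _ => ?_
  rw [e]
  simp only [pd_add hc.differentiable hd.differentiable]
  exact nL_add_le nmm (hc.pd j).measurable (hd.pd j).measurable

lemma Blk.sub {T : ℝ} {u : ℝ → EC} {a b c : ℝ} {R : ENNReal} (h : Blk T u a b R) (hac : a ≤ c) (hcb : c ≤ b) :
    ∃ R', Blk T u a c R' :=
  Blk.of_H2 h.sol h.a0 hac (hcb.trans h.bT) h.fin fun t ht => h.lam t ⟨ht.1, ht.2.trans hcb⟩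

set_option maxHeartbeats 1000000 in
/-- The nonlinear a priori estimates on an interval where the modified energy is at most two. -/
lemma apriori {s : ℝ} {η : ℝ → ℝ} (hη : IsCutoff s η) (hs : 1/2 < s) (hs1 : s < 1) :
    ∃ δ : ℝ, 0 < δ ∧ ∃ N₀ : ℝ, 1 ≤ N₀ ∧ ∃ K : ENNReal, K ≠ ⊤ ∧ ∀ N ≥ N₀, ∀ (T : ℝ) (u : ℝ → EC) (t : ℝ) (R : ENNReal),
    Blk T u 0 t R → Np 4 (volume.restrict (Icc 0 t)) (fun r => nL 4 (u r)) ≤ eR δ →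
    (∀ r ∈ Icc 0 t, energyE (op (sN η N) (u r)) ≤ 2) →
    Np 3 (volume.restrict (Icc 0 t)) (fun r => nG (18/5) (op (sN η N) (u r))) ≤ 8064 →
    Np 3 (volume.restrict (Icc 0 t)) (fun r => nG (18/5) (op (sN η N) (u r))) ≤ 4032 ∧
    ‖energyE (op (sN η N) (u t)) - energyE (op (sN η N) (u 0))‖ₑ ≤ K * eR N⁻¹ := by
  obtain ⟨Cs, hCs, sob⟩ := sobolev_sch 2 6 nmm nmm nmm
  obtain ⟨Cr, hCr, sob2⟩ := sobolev_sch (18/13) (18/7) nmm nmm nmm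
  obtain ⟨CD, hCD, hD⟩ := D_bound hη hs hs1
  obtain ⟨C4, hC4, hb4⟩ := sN_bound hη hs1 (p := 4) nmm
  set A := Cs * 6 with hA
  have hAt : A ≠ ⊤ := by finiteness
  clear_value A
  set Q := A ^ (1-2/3:ℝ) * C4 ^ (2/3:ℝ) with hQ
  have hQt : Q ≠ ⊤ := by
    have : A ^ (1-2/3:ℝ) ≠ ⊤ := rpow_ne_top_of_nonneg nmm hAt
    finiteness
  set Q9 := A ^ (1-4/9:ℝ) * C4 ^ (4/9:ℝ) with hQ9
  have hQ9t : Q9 ≠ ⊤ := by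
    have : A ^ (1-4/9:ℝ) ≠ ⊤ := rpow_ne_top_of_nonneg nmm hAt
    finiteness
  obtain ⟨δ, hδ, hδ1, hδL⟩ := small_tau (L := 2 * (1008 * Q^2)) (by finiteness)
  set L2 : ENNReal := 336 * (CD * 6 * 8064) with hL2
  have hL2t : L2 ≠ ⊤ := by finiteness
  refine ⟨δ, hδ, 1 + 4 * L2.toReal, by simp, CD * 6 * 4032^2 * (4032 + Cr * Q9 ^ (3:ℝ)), by finiteness,
    fun N hN T u t R h hL4 hE hX8 => ?_⟩
  have hN1 : 1 ≤ N := le_trans (by simp) hN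
  have hN0 : 0 < N := by linarith
  set n := eR N⁻¹ with hn
  have hnt : n ≠ ⊤ := by finiteness
  set m := sN η N with hm'
  have hm : RM m := sN_RM hη hN0
  have hD' : ∀ f, Sch f → nG (18/13) (Dm m f) ≤ CD * n * (nG (18/5) (op m f) ^ 2 * nG 2 (op m f)) := hD N hN0
  have hb4' : ∀ f, Sch f → nL 4 (op m f) ≤ C4 * nL 4 f := hb4 N hN0
  have e3 : 2 * (336 * (CD * 6 * n * 8064)) ≤ 1/2 := by
    calc _ = 2 * (L2 * n) := by rw [hL2]; ring
      _ = 2 * eR (L2.toReal * N⁻¹) := by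
          rw [hn, ENNReal.ofReal_mul ENNReal.toReal_nonneg, ENNReal.ofReal_toReal hL2t]
      _ ≤ 2 * eR (1/4) := by
          gcongr
          rw [← div_eq_mul_inv, div_le_iff₀ hN0]
          linarith [show 1 + 4 * L2.toReal ≤ N from hN]
      _ = eR (2 * (1/4)) := by rw [ENNReal.ofReal_mul nmm]; norm_num
      _ ≤ _ := by
          rw [show (2:ℝ) * (1/4) = 1/2 by norm_num, ENNReal.ofReal_div_of_pos nmm]; norm_num
  clear_value m n
  have hu := h.sol
  have hw := fun r => (hu.sch r).op hm.temp
  set μ := volume.restrict (Icc 0 t) with hμ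
  set σ := eR δ with hσ
  have hσ1 : σ ≤ 1 := by rw [hσ, ENNReal.ofReal_le_one]; exact hδ1
  have g2 : ∀ r ∈ Icc 0 t, nG 2 (op m (u r)) ≤ 6 := fun r hr => (nG2_le (hw r) (hE r hr)).trans (by
    rw [show (2:ℝ) * 2 = 2 ^ 2 by norm_num, Real.sqrt_sq nmm]; norm_num)
  have g6 : ∀ r ∈ Icc 0 t, nL 6 (op m (u r)) ≤ A := fun r hr => (sob _ (hw r)).trans (by
    rw [hA]; gcongr; exact g2 r hr)
  have g4 : Np 4 μ (fun r => nL 4 (op m (u r))) ≤ C4 * σ := by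
    refine (Np_mono (p := 4) (G := fun r => C4 * nL 4 (u r)) nmm fun r => hb4' _ (hu.sch r)).trans ?_
    rw [Np_const_mul nmm hC4]
    gcongr
  have P9 : Np 9 μ (fun r => nL (54/11) (op m (u r))) ≤ Q9 := by
    refine (mixed_interp hw hAt g6 g4 nmm (θ := 4/9) nmm nmm nmm nmm).trans ?_
    rw [hQ9]
    gcongr
    exact mul_le_of_le_one_right' hσ1
  have P6 : Np 6 μ (fun r => nL (9/2) (op m (u r))) ≤ Q * σ ^ (2/3:ℝ) := by
    refine (mixed_interp hw hAt g6 g4 nmm (θ := 2/3) nmm nmm nmm nmm).trans ?_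
    rw [hQ, mul_rpow_of_nonneg C4 _ nmm, mul_assoc]
  have mw : Measurable (fun q : ℝ × E3 => op m (u q.1) q.2) := (hu.op_meas hm).1
  have mc : Measurable (fun q : ℝ × E3 => op m (cub (u q.1)) q.2) := (hu.op_meas hm).2
  have md : Measurable (fun q : ℝ × E3 => Dm m (u q.1) q.2) := by
    exact mc.sub (cub_meas (v := fun r => op m (u r)) mw)
  have mX : Measurable (fun r => nG (18/5) (op m (u r))) := nG_meas mw hw _
  have mV : Measurable (fun r => nG (18/13) (Dm m (u r))) := nG_meas md (fun r => hm.Dm (hu.sch r)) _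
  have m9 : Measurable (fun r => nL (9/2) (op m (u r))) := measurable_nL_param (f := fun r => op m (u r)) mw _
  have m54 : Measurable (fun r => nL (54/11) (op m (u r))) := measurable_nL_param (f := fun r => op m (u r)) mw _
  set X := Np 3 μ (fun r => nG (18/5) (op m (u r))) with hX
  have hXt : X ≠ ⊤ := ne_top_of_le_ne_top nmm hX8
  have V1 : Np (3/2) μ (fun r => nG (18/13) (Dm m (u r))) ≤ CD * 6 * n * X^2 := by
    calc _ ≤ Np (3/2) μ (fun r => (CD * 6 * n) * nG (18/5) (op m (u r)) ^ (2:ℝ)) := by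
          refine Np_mono_ae nmm ((ae_restrict_iff' measurableSet_Icc).2 (evt fun r hr => ?_))
          refine (hD' _ (hu.sch r)).trans ?_
          rw [ENNReal.rpow_two]
          calc _ ≤ CD * n * (nG (18/5) (op m (u r)) ^ 2 * 6) := by
                gcongr; exact g2 r hr
            _ = _ := by ring
      _ = _ := by
          rw [Np_const_mul nmm (by finiteness), Np_pow_comp nmm nmm, ENNReal.rpow_two, hX]
          norm_num
  have W1 : Np (3/2) μ (fun r => nG (18/13) (cub (op m (u r)))) ≤ 3 * (Q * σ ^ (2/3:ℝ))^2 * X := by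
    calc _ ≤ Np (3/2) μ (fun r => 3 * (nL (9/2) (op m (u r)) ^ (2:ℝ) * nG (18/5) (op m (u r)))) := by
          refine Np_mono nmm fun r => (nG_cub_le (hw r)).trans (le_of_eq ?_)
          rw [ENNReal.rpow_two, mul_assoc]
      _ ≤ 3 * (Np 3 μ (fun r => nL (9/2) (op m (u r)) ^ (2:ℝ)) * X) := by
          rw [Np_const_mul nmm nmm]
          gcongr
          exact Np_mul_le (p := 3) (q := 3) nmm nmm nmm (m9.pow_const _).aemeasurable mX.aemeasurable
      _ ≤ _ := by
          rw [Np_pow_comp nmm nmm, ENNReal.rpow_two, mul_assoc]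
          norm_num
          gcongr
  have hX4 : X ≤ 4032 := by
    have : X ≤ 2 * 2016 := by
      refine absorb hXt ((grad_str h hm (t0 := 0) ⟨le_rfl, h.ab⟩).trans ?_)
      have e1 : Np (3/2) μ (fun r => nG (18/13) (op m (cub (u r)))) ≤ 3 * (Q * σ ^ (2/3:ℝ))^2 * X + CD * 6 * n * X^2 := by
        refine le_trans (Np_mono nmm fun r => nG_op_cub_le hm (hu.sch r)) ?_
        refine (Np_add_le nmm ?_ mV.aemeasurable).trans (add_le_add W1 V1)
        exact (nG_meas (v := fun r => cub (op m (u r))) (cub_meas (v := fun r => op m (u r)) mw) (fun r => (hw r).cub) _).aemeasurable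
      have q1 : (σ ^ (2/3:ℝ))^2 ≤ σ ^ (1/3:ℝ) := by
        rw [← ENNReal.rpow_two, ← ENNReal.rpow_mul]
        exact ENNReal.rpow_le_rpow_of_exponent_ge hσ1 nmm
      have q2 : 2 * (336 * (3 * (Q * σ ^ (2/3:ℝ))^2)) ≤ 1/2 := by
        refine le_trans ?_ hδL
        calc _ = 2 * (1008 * Q^2) * (σ ^ (2/3:ℝ))^2 := by ring
          _ ≤ _ := by gcongr
      have e4 : 336 * (3 * (Q * σ ^ (2/3:ℝ))^2) + 336 * (CD * 6 * n * 8064) ≤ 1/2 := by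
        rw [ENNReal.le_div_iff_mul_le (by simp) (by simp), mul_comm, mul_add]
        exact (add_le_add q2 e3).trans (by rw [ENNReal.add_halves])
      calc _ ≤ 336 * (6 + (3 * (Q * σ ^ (2/3:ℝ))^2 * X + CD * 6 * n * X^2)) := by
            gcongr
            exact g2 0 ⟨le_rfl, h.ab⟩
        _ = 2016 + (336 * (3 * (Q * σ ^ (2/3:ℝ))^2) + 336 * (CD * 6 * n * X)) * X := by ring
        _ ≤ 2016 + 1/2 * X := by
            gcongr
            exact le_trans (by gcongr) e4
    exact this.trans nmm
  refine ⟨hX4, (energy_le h hm ⟨le_rfl, h.ab⟩ ⟨h.ab, le_rfl⟩ h.ab).trans ?_⟩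
  calc _ ≤ ∫⁻ r in Icc 0 t, nG (18/13) (Dm m (u r)) * (nG (18/5) (op m (u r)) + Cr * nL (54/11) (op m (u r)) ^ (3:ℝ)) :=
        lintegral_mono fun r => incr_le hm (hu.sch r) sob2
    _ ≤ Np (3/2) μ (fun r => nG (18/13) (Dm m (u r))) *
          Np 3 μ (fun r => nG (18/5) (op m (u r)) + Cr * nL (54/11) (op m (u r)) ^ (3:ℝ)) := by
        have := Np_mul_le (μ := μ) (r := 1) (p := 3/2) (q := 3) nmm nmm nmm mV.aemeasurable
          (mX.add ((m54.pow_const (3:ℝ)).const_mul Cr)).aemeasurable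
        refine le_trans (le_of_eq ?_) this
        simp [Np]
        rfl
    _ ≤ (CD * 6 * n * 4032^2) * (4032 + Cr * Q9 ^ (3:ℝ)) := by
        refine mul_le_mul' (V1.trans (by gcongr)) ?_
        refine (Np_add_le nmm mX.aemeasurable ((m54.pow_const (3:ℝ)).const_mul Cr).aemeasurable).trans (add_le_add hX4 ?_)
        rw [Np_const_mul nmm hCr, Np_pow_comp nmm nmm]
        gcongr
        norm_num
        exact P9
    _ = _ := by ring

/-- The continuity argument in discrete form. -/
lemma boot {T L : ℝ} (hL : 0 < L) {e : ℝ → ℝ} {Y : ℝ → ENNReal} (he0 : e 0 ≤ 2) (hY0 : Y 0 ≤ 8064^3)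
    (he : ∀ a b, 0 ≤ a → a ≤ b → b ≤ T → |e b - e a| ≤ L * (b - a))
    (hY : ∀ a b, 0 ≤ a → a ≤ b → b ≤ T → Y b ≤ Y a + eR (L * (b - a)))
    (step : ∀ t ∈ Icc 0 T, (∀ r ∈ Icc 0 t, e r ≤ 2) → Y t ≤ 8064^3 → e t ≤ 3/2 ∧ Y t ≤ 4032^3) :
    ∀ t ∈ Icc 0 T, e t ≤ 2 ∧ Y t ≤ 8064^3 := by
  have key : ∀ n : ℕ, ∀ t ∈ Icc 0 T, t ≤ n * (1 / (2 * L)) → e t ≤ 2 ∧ Y t ≤ 8064^3 := by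
    intro n
    induction n with
    | zero =>
      intro t ht h
      have : t = 0 := le_antisymm (by simpa using h) ht.1
      rw [this]; exact ⟨he0, hY0⟩
    | succ n ih =>
      intro t ht h
      set r := max 0 (t - 1 / (2 * L)) with hr
      have hL2 : 0 < 1 / (2 * L) := by positivity
      have hrt : r ≤ t := max_le ht.1 (by linarith)
      have hr0 : 0 ≤ r := le_max_left _ _
      have hrn : r ≤ n * (1 / (2 * L)) := max_le psv (by push_cast at h; linarith)
      have hd : L * (t - r) ≤ 1 / 2 := by
        have : t - r ≤ 1 / (2 * L) := by linarith [le_max_right 0 (t - 1 / (2 * L))]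
        calc _ ≤ L * (1 / (2 * L)) := by gcongr
          _ = _ := by field_simp
      have hrT : r ∈ Icc 0 T := ⟨hr0, hrt.trans ht.2⟩
      obtain ⟨s1, s2⟩ := step r hrT (fun q hq => (ih q ⟨hq.1, hq.2.trans hrT.2⟩ (hq.2.trans hrn)).1) (ih r hrT hrn).2
      constructor
      · linarith [(abs_le.1 (he r t hr0 hrt ht.2)).2]
      · refine (hY r t hr0 hrt ht.2).trans ((add_le_add s2 (ofReal_le_ofReal (hd.trans (by norm_num : (1/2:ℝ) ≤ 1)))).trans ?_)
        norm_num
  intro t ht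
  obtain ⟨n, hn⟩ := exists_nat_ge (t / (1 / (2 * L)))
  exact key n t ht (by rwa [div_le_iff₀ psv] at hn)

lemma Blk.nL4 {T : ℝ} {u : ℝ → EC} {a b : ℝ} {R : ENNReal} (h : Blk T u a b R) :
    ∃ M : ENNReal, M ≠ ⊤ ∧ ∀ t ∈ Icc a b, nL 4 (u t) ≤ M := by
  obtain ⟨Cs, hCs, sob⟩ := sobolev_sch 2 6 nmm nmm nmm
  have hR := h.fin
  refine ⟨R + Cs * (3 * R), by finiteness, fun t ht => ?_⟩
  refine nL_interp_le (p := 2) (q := 6) nmm nmm nmm (h.sol.sch t).measurable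
    ((h.two t ht).trans le_self_add) ((sob _ (h.sol.sch t)).trans (le_trans ?_ le_add_self))
  gcongr
  calc _ ≤ ∑ j : Fin 3, R := Finset.sum_le_sum fun j _ => h.pd t ht j _ nmm nmm
    _ = _ := by simp

/-- Translating the space-time norm hypothesis. -/
lemma Blk.L4 {T : ℝ} {u : ℝ → EC} {R : ENNReal} (h : Blk T u 0 T R) {δ : ℝ}
    (hδ : (∫ t in (0:ℝ)..T, ∫ x : E3, ‖u t x‖^4) ^ ((1:ℝ)/4) ≤ δ) :
    Np 4 (volume.restrict (Icc 0 T)) (fun r => nL 4 (u r)) ≤ eR δ := by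
  obtain ⟨M, hM, hb⟩ := h.nL4
  have hu := h.sol
  have m4 : Measurable (fun r => nL 4 (u r)) := measurable_nL_param (f := u) hu.meas _
  have e1 : ∀ t, ∫ x : E3, ‖u t x‖^4 = (nL 4 (u t) ^ (4:ℝ)).toReal := by
    intro t
    rw [nL, Np_rpow nmm, integral_eq_lintegral_of_nonneg_ae (evt fun x => by positivity)
      (hu.sch t).quart_int.aestronglyMeasurable]
    congr 1
    refine lintegral_congr fun x => ?_
    rw [← ofReal_norm, ofReal_rpow_of_nonneg (norm_nonneg _) nmm]
    norm_num
  have e2 : ∀ t, nL 4 (u t) ≠ ⊤ := fun t => (hu.sch t).nL_ne_top nmm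
  simp only [e1] at hδ
  rw [intervalIntegral.integral_of_le h.ab, ← integral_Icc_eq_integral_Ioc, integral_toReal (m4.pow_const _).aemeasurable
    (evt fun t => by have := e2 t; finiteness), ← Np_rpow nmm, ENNReal.toReal_rpow,
    ← ENNReal.rpow_mul] at hδ
  norm_num at hδ
  exact (ENNReal.le_ofReal_iff_toReal_le (Np_fin nmm hM hb) (ENNReal.toReal_nonneg.trans hδ)).2 hδ

/-- Crude (non-uniform) Lipschitz bounds on the whole block. -/
lemma Blk.crude {s : ℝ} {η : ℝ → ℝ} (hη : IsCutoff s η) (hs : 1/2 < s) (hs1 : s < 1) {N : ℝ} (hN : 0 < N)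
    {T : ℝ} {u : ℝ → EC} {R : ENNReal} (h : Blk T u 0 T R) : ∃ L : ℝ, 0 < L ∧
    (∀ a b, 0 ≤ a → a ≤ b → b ≤ T → |energyE (op (sN η N) (u b)) - energyE (op (sN η N) (u a))| ≤ L * (b - a)) ∧
    (∀ a b, 0 ≤ a → a ≤ b → b ≤ T → ∫⁻ r in Icc 0 b, nG (18/5) (op (sN η N) (u r)) ^ (3:ℝ) ≤
      (∫⁻ r in Icc 0 a, nG (18/5) (op (sN η N) (u r)) ^ (3:ℝ)) + eR (L * (b - a))) := by
  obtain ⟨C, hC, hC1, hb⟩ := H2_bounds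
  obtain ⟨Cs, hCs, sob⟩ := sobolev_sch 2 6 nmm nmm nmm
  obtain ⟨Cr, hCr, sob2⟩ := sobolev_sch (18/13) (18/7) nmm nmm nmm
  obtain ⟨CD, hCD, hD⟩ := D_bound hη hs hs1
  set m := sN η N with hm'
  have hm : RM m := sN_RM hη hN
  have hu := h.sol
  have hw := fun r => (hu.sch r).op hm.temp
  have hR := h.fin
  have hH : ∀ r ∈ Icc 0 T, H2 (op m (u r)) ≤ R := fun r hr => (hm.op_H2 (hu.sch r)).trans (h.lam r hr)
  have hG : ∀ r ∈ Icc 0 T, ∀ p, 2 ≤ p → p ≤ 6 → nG p (op m (u r)) ≤ 3 * (C * R) := fun r hr p h1 h2 => by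
    calc _ ≤ ∑ j : Fin 3, C * R := Finset.sum_le_sum fun j _ => ((hb _ (hw r)).2.2.2 j p h1 h2).trans
          (by gcongr; exact hH r hr)
      _ = _ := by simp
  set S := 3 * (C * R) with hS
  have hSt : S ≠ ⊤ := by finiteness
  have h54 : ∀ r ∈ Icc 0 T, nL (54/11) (op m (u r)) ≤ S + Cs * S := fun r hr => by
    refine nL_interp_le (p := 2) (q := 6) nmm nmm nmm (hw r).measurable
      (((hb _ (hw r)).2.1).trans (le_trans ?_ le_self_add)) ((sob _ (hw r)).trans (le_trans ?_ le_add_self))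
    · calc C * H2 (op m (u r)) ≤ C * R := by gcongr; exact hH r hr
        _ ≤ S := le_mul_of_one_le_left' nmm
    · gcongr
      exact hG r hr 2 nmm nmm
  set n := eR N⁻¹ with hn
  have hnt : n ≠ ⊤ := by finiteness
  set M := CD * n * (S^2 * S) * (S + Cr * (S + Cs * S) ^ (3:ℝ)) + S ^ (3:ℝ) with hM
  have hMt : M ≠ ⊤ := by finiteness
  have pos : ∀ a b : ℝ, a ≤ b → M * eR (b - a) ≤ eR ((M.toReal + 1) * (b - a)) := fun a b hab => by
    rw [ENNReal.ofReal_mul psv]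
    gcongr
    rw [ENNReal.le_ofReal_iff_toReal_le hMt psv]
    linarith
  refine ⟨M.toReal + 1, by positivity, fun a b ha hab hbT => ?_, fun a b ha hab hbT => ?_⟩
  · have e1 := (energy_le h hm ⟨ha, hab.trans hbT⟩ ⟨ha.trans hab, hbT⟩ hab)
    have e2 : ‖energyE (op m (u b)) - energyE (op m (u a))‖ₑ ≤ M * eR (b - a) := by
      refine e1.trans ?_
      calc _ ≤ ∫⁻ r in Icc a b, M := by
            refine setLIntegral_mono' measurableSet_Icc fun r hr => (incr_le hm (hu.sch r) sob2).trans ?_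
            have hr' : r ∈ Icc 0 T := ⟨ha.trans hr.1, hr.2.trans hbT⟩
            refine le_trans (mul_le_mul' ((hD N hN _ (hu.sch r)).trans ?_) ?_) le_self_add
            · exact mul_le_mul' le_rfl (mul_le_mul' (pow_le_pow_left₀ bot_le (hG r hr' _ nmm nmm) 2)
                (hG r hr' _ nmm nmm))
            · gcongr
              · exact hG r hr' _ nmm nmm
              · exact h54 r hr'
        _ = _ := by simp
    have e3 := e2.trans (pos a b hab)
    rw [← ofReal_norm, ENNReal.ofReal_le_ofReal_iff (by have := sub_nonneg.2 hab; positivity)] at e3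
    simpa using e3
  · calc _ ≤ ∫⁻ r in Icc 0 a ∪ Icc a b, nG (18/5) (op m (u r)) ^ (3:ℝ) :=
          lintegral_mono_set (by rw [Set.Icc_union_Icc_eq_Icc ha hab])
      _ ≤ _ := lintegral_union_le _ _ _
      _ ≤ _ := by
          gcongr
          refine le_trans ?_ (pos a b hab)
          calc _ ≤ ∫⁻ r in Icc a b, M := by
                refine setLIntegral_mono' measurableSet_Icc fun r hr => ?_
                have hr' : r ∈ Icc 0 T := ⟨ha.trans hr.1, hr.2.trans hbT⟩
                refine le_trans ?_ le_add_self
                gcongr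
                exact hG r hr' _ nmm nmm
            _ = _ := by simp

/-- (Almost conservation law.) Fix `s ∈ (1/2, 1)`, a cutoff `η` for
`I_N` and `ε > 0`.  There exist `δ > 0`, `N₀ ≥ 1` and `C > 0` such that for every
`N ≥ N₀`, `T > 0` and every smooth decaying solution `φ` of the cubic defocusing NLS
on `[0,T] × ℝ³` with `‖φ‖_{L⁴_{x,t}([0,T]×ℝ³)} ≤ δ` and `E(I_N φ(0)) ≤ 1`, one has
`|E(I_N φ(t)) − E(I_N φ(0))| ≤ C N^{−1+ε}` for all `t ∈ [0,T]`. -/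
theorem almost_conservation_law
    (s : ℝ) (hs : 1/2 < s) (hs1 : s < 1) (η : ℝ → ℝ) (hη : IsCutoff s η)
    (ε : ℝ) (hε : 0 < ε) :
    ∃ δ > (0:ℝ), ∃ N₀ ≥ (1:ℝ), ∃ C > (0:ℝ), ∀ N ≥ N₀, ∀ T > (0:ℝ),
      ∀ φ : ℝ → E3 → ℂ, IsSolution 1 1 (fun z => z) T φ →
      (∫ t in (0:ℝ)..T, ∫ x : E3, ‖φ t x‖ ^ 4) ^ ((1:ℝ)/4) ≤ δ →
      energyE (Iop η N (φ 0)) ≤ 1 →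
      ∀ t ∈ Set.Icc (0:ℝ) T,
        |energyE (Iop η N (φ t)) - energyE (Iop η N (φ 0))| ≤ C * N ^ (-1 + ε) := by
  obtain ⟨δ, hδ, N₀, hN₀, K, hK, key⟩ := apriori hη hs hs1
  refine ⟨δ, hδ, N₀ + 2 * K.toReal, by have := K.toReal_nonneg; linarith, K.toReal + 1, by positivity,
    fun N hN T hT u hu hL4 hE0 t ht => ?_⟩
  have hK0 := K.toReal_nonneg
  have hN1 : 1 ≤ N := by linarith
  have hN0 : 0 < N := by linarith
  change |energyE (op (sN η N) (u t)) - energyE (op (sN η N) (u 0))| ≤ _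
  change energyE (op (sN η N) (u 0)) ≤ 1 at hE0
  obtain ⟨R, hB⟩ := Sol.blk hu hT.le
  have h4 := hB.L4 hL4
  obtain ⟨L, hL, l1, l2⟩ := hB.crude hη hs hs1 hN0
  have st : ∀ t ∈ Icc 0 T, (∀ r ∈ Icc 0 t, energyE (op (sN η N) (u r)) ≤ 2) →
      ∫⁻ r in Icc 0 t, nG (18/5) (op (sN η N) (u r)) ^ (3:ℝ) ≤ 8064^3 →
      |energyE (op (sN η N) (u t)) - energyE (op (sN η N) (u 0))| ≤ K.toReal * N⁻¹ ∧
      ∫⁻ r in Icc 0 t, nG (18/5) (op (sN η N) (u r)) ^ (3:ℝ) ≤ 4032^3 := by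
    intro t ht h1 h2
    obtain ⟨R', hB'⟩ := hB.sub ht.1 ht.2
    rw [← Np_rpow nmm] at h2 ⊢
    rw [show (3:ℝ) = ((3:ℕ):ℝ) by norm_num, ENNReal.rpow_natCast] at h2 ⊢
    rw [ENNReal.pow_le_pow_left_iff nmm] at h2 ⊢
    have h5 : Np 4 (volume.restrict (Icc 0 t)) (fun r => nL 4 (u r)) ≤ eR δ := by
      refine le_trans ?_ h4
      unfold Np
      gcongr
      exact ht.2
    obtain ⟨k1, k2⟩ := key N (by linarith) T u t R' hB' h5 h1 (by exact_mod_cast h2)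
    refine ⟨?_, by exact_mod_cast k1⟩
    rw [← ENNReal.ofReal_toReal hK, ← ENNReal.ofReal_mul hK0, ← ofReal_norm, ENNReal.ofReal_le_ofReal_iff psv] at k2
    simpa using k2
  have fin := boot hL (by linarith) (by simp) l1 l2 (fun t ht h1 h2 => by
    obtain ⟨k1, k2⟩ := st t ht h1 h2
    refine ⟨?_, k2⟩
    have : K.toReal * N⁻¹ ≤ 1/2 := by
      rw [← div_eq_mul_inv, div_le_iff₀ hN0]; linarith
    linarith [(abs_le.1 k1).2])
  refine (st t ht (fun r hr => (fin r ⟨hr.1, hr.2.trans ht.2⟩).1) (fin t ht).2).1.trans ?_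
  rw [← Real.rpow_neg_one]
  gcongr
  · linarith
  · linarith
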